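/- (Dimension of unitarily invariant valuations) Let n ≥ 1 and regard ℂⁿ as a 2n-dimensional real vector space with the Euclidean structure given by the real part of the standard hermitian inner product. For every 0 ≤ k ≤ 2n, the complex vector space Val_k^{U(n)} of continuous, translation invariant, complex-valued valuations on ℂⁿ that are homogeneous of degree k and invariant under the unitary group U(n) (μ(gK) = μ(K) for all g ∈ U(n)) has dimension min(⌊k/2⌋, ⌊(2n-k)/2⌋) + 1. -/

import Mathlib

open MeasureTheory Metric Set
open scoped Pointwise ENNReal

noncomputable section

/-- Complex `n`-space `ℂⁿ`, regarded as a real `2n`-dimensional vector space whose Euclidean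
structure is the real part of the standard hermitian inner product. -/
abbrev Cn (n : ℕ) := EuclideanSpace ℂ (Fin n)

/-- The linear action of a complex matrix on `ℂⁿ`. -/
def uAct {n : ℕ} (g : Matrix (Fin n) (Fin n) ℂ) : Cn n →ₗ[ℂ] Cn n :=
  Matrix.toEuclideanLin g

variable {V : Type*} [NormedAddCommGroup V] [NormedSpace ℝ V]

/-- `μ` is a (complex-valued) valuation: additivity on unions of convex bodies whose
union is again convex. -/
def IsValuationC (μ : ConvexBody V → ℂ) : Prop :=
  ∀ K L M N : ConvexBody V,
    (M : Set V) = (K : Set V) ∪ (L : Set V) → (N : Set V) = (K : Set V) ∩ (L : Set V) →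
      μ M + μ N = μ K + μ L

/-- `μ` is translation invariant. -/
def IsTranslationInvariantC (μ : ConvexBody V → ℂ) : Prop :=
  ∀ (x : V) (K L : ConvexBody V), (L : Set V) = x +ᵥ (K : Set V) → μ L = μ K

/-- `μ` is homogeneous of degree `k`. -/
def IsHomogeneousValC (k : ℕ) (μ : ConvexBody V → ℂ) : Prop :=
  ∀ (t : ℝ), 0 ≤ t → ∀ K L : ConvexBody V,
    (L : Set V) = t • (K : Set V) → μ L = (t : ℂ) ^ k * μ K

/-- `μ` is an even valuation. -/
def IsEvenValC (μ : ConvexBody V → ℂ) : Prop :=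
  ∀ K L : ConvexBody V, (L : Set V) = -(K : Set V) → μ L = μ K

/-- `μ` is invariant under the unitary group `U(n)`. -/
def IsUnitaryInvariant {n : ℕ} (μ : ConvexBody (Cn n) → ℂ) : Prop :=
  ∀ g ∈ Matrix.unitaryGroup (Fin n) ℂ, ∀ K L : ConvexBody (Cn n),
    (L : Set (Cn n)) = (uAct g) '' (K : Set (Cn n)) → μ L = μ K

/-- `μ` is invariant under the special unitary group `SU(n)`. -/
def IsSpecialUnitaryInvariant {n : ℕ} (μ : ConvexBody (Cn n) → ℂ) : Prop :=
  ∀ g ∈ Matrix.specialUnitaryGroup (Fin n) ℂ, ∀ K L : ConvexBody (Cn n),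
    (L : Set (Cn n)) = (uAct g) '' (K : Set (Cn n)) → μ L = μ K

/-- Membership in `Val_k^{U(n)}`. -/
def MemValUnk (n k : ℕ) (μ : ConvexBody (Cn n) → ℂ) : Prop :=
  IsValuationC μ ∧ Continuous μ ∧ IsTranslationInvariantC μ ∧
    IsHomogeneousValC k μ ∧ IsUnitaryInvariant μ

open MeasureTheory Metric Set
open scoped Pointwise ENNReal
set_option linter.all false
noncomputable section
namespace UV
open Filter Topology

section Basic

variable {V W : Type*} [NormedAddCommGroup V] [NormedSpace ℝ V]
  [NormedAddCommGroup W] [NormedSpace ℝ W]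

theorem exists_dist_le (K L : ConvexBody V) {x : V} (hx : x ∈ K) :
    ∃ y ∈ L, dist x y ≤ dist K L := by
  obtain ⟨y, hy, h⟩ := L.isCompact.exists_infDist_eq_dist L.nonempty x
  refine ⟨y, hy, ?_⟩
  rw [← h]
  exact Metric.infDist_le_hausdorffDist_of_mem hx ConvexBody.hausdorffEDist_ne_top

theorem dist_le_of {K L : ConvexBody V} {r : ℝ} (hr : 0 ≤ r)
    (h1 : ∀ x ∈ K, ∃ y ∈ L, dist x y ≤ r) (h2 : ∀ x ∈ L, ∃ y ∈ K, dist x y ≤ r) :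
    dist K L ≤ r :=
  Metric.hausdorffDist_le_of_mem_dist hr h1 h2

theorem mem_add {K L : ConvexBody V} {x : V} :
    x ∈ K + L ↔ ∃ y ∈ K, ∃ z ∈ L, y + z = x := Set.mem_add

theorem mem_smul {t : ℝ} {K : ConvexBody V} {x : V} :
    x ∈ t • K ↔ ∃ y ∈ K, t • y = x := Set.mem_smul_set

theorem dist_add_add_le (K A L B : ConvexBody V) :
    dist (K + A) (L + B) ≤ dist K L + dist A B := by
  apply dist_le_of (by positivity)
  · intro x hx
    obtain ⟨y, hy, z, hz, rfl⟩ := mem_add.1 hx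
    obtain ⟨y', hy', h1⟩ := exists_dist_le K L hy
    obtain ⟨z', hz', h2⟩ := exists_dist_le A B hz
    exact ⟨y' + z', mem_add.2 ⟨y', hy', z', hz', rfl⟩,
      (_root_.dist_add_add_le _ _ _ _).trans (add_le_add h1 h2)⟩
  · intro x hx
    obtain ⟨y, hy, z, hz, rfl⟩ := mem_add.1 hx
    obtain ⟨y', hy', h1⟩ := exists_dist_le L K hy
    obtain ⟨z', hz', h2⟩ := exists_dist_le B A hz
    rw [dist_comm K L, dist_comm A B]
    exact ⟨y' + z', mem_add.2 ⟨y', hy', z', hz', rfl⟩,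
      (_root_.dist_add_add_le _ _ _ _).trans (add_le_add h1 h2)⟩

instance : ContinuousAdd (ConvexBody V) := by
  constructor
  apply LipschitzWith.continuous (K := 2)
  apply LipschitzWith.of_dist_le_mul
  rintro ⟨K, A⟩ ⟨L, B⟩
  refine (dist_add_add_le K A L B).trans ?_
  rw [Prod.dist_eq]
  have h1 := le_max_left (dist K L) (dist A B)
  have h2 := le_max_right (dist K L) (dist A B)
  simp only [NNReal.coe_ofNat]
  linarith

/-- image of a body under a continuous linear map -/
def cmap (f : V →L[ℝ] W) (K : ConvexBody V) : ConvexBody W :=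
  ⟨f '' K, K.convex.linear_image (f : V →ₗ[ℝ] W), K.isCompact.image f.continuous, K.nonempty.image f⟩

theorem coe_cmap (f : V →L[ℝ] W) (K : ConvexBody V) : (cmap f K : Set W) = f '' K := rfl

theorem mem_cmap {f : V →L[ℝ] W} {K : ConvexBody V} {y : W} :
    y ∈ cmap f K ↔ ∃ x ∈ K, f x = y := Iff.rfl

theorem dist_cmap_le (f : V →L[ℝ] W) (K L : ConvexBody V) :
    dist (cmap f K) (cmap f L) ≤ ‖f‖ * dist K L := by
  apply dist_le_of (by positivity)
  · rintro _ ⟨x, hx, rfl⟩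
    obtain ⟨y, hy, h⟩ := exists_dist_le K L hx
    refine ⟨f y, ⟨y, hy, rfl⟩, (f.lipschitz.dist_le_mul _ _).trans ?_⟩
    simp only [coe_nnnorm]
    gcongr
  · rintro _ ⟨x, hx, rfl⟩
    obtain ⟨y, hy, h⟩ := exists_dist_le L K hx
    refine ⟨f y, ⟨y, hy, rfl⟩, (f.lipschitz.dist_le_mul _ _).trans ?_⟩
    rw [dist_comm K L]
    simp only [coe_nnnorm]
    gcongr

theorem continuous_cmap (f : V →L[ℝ] W) : Continuous (cmap f) := by
  apply LipschitzWith.continuous (K := ‖f‖₊)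
  exact LipschitzWith.of_dist_le_mul (dist_cmap_le f)

theorem cmap_add (f : V →L[ℝ] W) (K L : ConvexBody V) : cmap f (K + L) = cmap f K + cmap f L := by
  apply ConvexBody.ext
  exact Set.image_add f

theorem cmap_smul (f : V →L[ℝ] W) (t : ℝ) (K : ConvexBody V) : cmap f (t • K) = t • cmap f K := by
  apply ConvexBody.ext
  exact image_smul_set f t (K : Set V)

theorem cmap_zero (f : V →L[ℝ] W) : cmap f (0 : ConvexBody V) = 0 := by
  apply ConvexBody.ext
  rw [coe_cmap, ConvexBody.coe_zero, ConvexBody.coe_zero]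
  simp [← Set.singleton_zero]

theorem cmap_sum {ι : Type*} (f : V →L[ℝ] W) (s : Finset ι) (K : ι → ConvexBody V) :
    cmap f (∑ i ∈ s, K i) = ∑ i ∈ s, cmap f (K i) := by
  classical
  induction s using Finset.induction_on with
  | empty => simp [cmap_zero]
  | insert a s ha ih => rw [Finset.sum_insert ha, Finset.sum_insert ha, cmap_add, ih]

theorem cmap_cmap {X : Type*} [NormedAddCommGroup X] [NormedSpace ℝ X]
    (g : W →L[ℝ] X) (f : V →L[ℝ] W) (K : ConvexBody V) : cmap g (cmap f K) = cmap (g.comp f) K := by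
  apply ConvexBody.ext
  rw [coe_cmap, coe_cmap, coe_cmap, Set.image_image]
  rfl

theorem cmap_id (K : ConvexBody V) : cmap (ContinuousLinearMap.id ℝ V) K = K := by
  apply ConvexBody.ext
  simp [coe_cmap]

/-- one point body -/
def pt (x : V) : ConvexBody V := ⟨{x}, convex_singleton x, isCompact_singleton, Set.singleton_nonempty x⟩

theorem coe_pt (x : V) : (pt x : Set V) = {x} := rfl

theorem mem_pt {x y : V} : y ∈ pt x ↔ y = x := Iff.rfl

theorem pt_zero : pt (0 : V) = 0 := rfl

theorem pt_add (x y : V) : pt x + pt y = pt (x + y) := by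
  apply ConvexBody.ext
  simp [coe_pt]

theorem cmap_pt (f : V →L[ℝ] W) (x : V) : cmap f (pt x) = pt (f x) := by
  apply ConvexBody.ext
  simp [coe_pt, coe_cmap]

/-- the segment from zero to v -/
def seg (v : V) : ConvexBody V := 
  ⟨segment ℝ 0 v, convex_segment 0 v, by
    rw [segment_eq_image ℝ]
    exact isCompact_Icc.image (by fun_prop), ⟨0, left_mem_segment ℝ 0 v⟩⟩

theorem mem_seg {v x : V} : x ∈ seg v ↔ ∃ t : ℝ, 0 ≤ t ∧ t ≤ 1 ∧ t • v = x := by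
  change x ∈ segment ℝ 0 v ↔ _
  rw [segment_eq_image ℝ]
  simp [and_assoc]

theorem cmap_seg (f : V →L[ℝ] W) (v : V) : cmap f (seg v) = seg (f v) := by
  apply SetLike.ext
  intro x
  rw [mem_cmap, mem_seg]
  constructor
  · rintro ⟨y, hy, rfl⟩
    obtain ⟨t, h0, h1, rfl⟩ := mem_seg.1 hy
    exact ⟨t, h0, h1, by simp⟩
  · rintro ⟨t, h0, h1, rfl⟩
    exact ⟨t • v, mem_seg.2 ⟨t, h0, h1, rfl⟩, by simp⟩

theorem seg_zero : seg (0 : V) = 0 := by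
  apply SetLike.ext
  intro x
  rw [mem_seg, ← pt_zero, mem_pt]
  constructor
  · rintro ⟨t, -, -, rfl⟩; simp
  · rintro rfl; exact ⟨0, by simp⟩

theorem seg_smul {t : ℝ} (ht : 0 ≤ t) (v : V) : t • seg v = seg (t • v) := by
  apply SetLike.ext
  intro x
  rw [mem_smul, mem_seg]
  constructor
  · rintro ⟨y, hy, rfl⟩
    obtain ⟨s, h0, h1, rfl⟩ := mem_seg.1 hy
    exact ⟨s, h0, h1, by rw [smul_comm]⟩
  · rintro ⟨s, h0, h1, rfl⟩
    exact ⟨s • v, mem_seg.2 ⟨s, h0, h1, rfl⟩, by rw [smul_comm]⟩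

theorem seg_neg (v : V) : seg (-v) + pt v = seg v := by
  apply SetLike.ext
  intro x
  rw [mem_add, mem_seg]
  constructor
  · rintro ⟨y, hy, z, rfl, rfl⟩
    obtain ⟨s, h0, h1, rfl⟩ := mem_seg.1 hy
    exact ⟨1 - s, by linarith, by linarith, by module⟩
  · rintro ⟨s, h0, h1, rfl⟩
    exact ⟨(1 - s) • (-v), mem_seg.2 ⟨1 - s, by linarith, by linarith, rfl⟩, v, rfl, by module⟩

theorem dist_seg_le (v w : V) : dist (seg v) (seg w) ≤ ‖v - w‖ := by
  have key : ∀ v w : V, ∀ x ∈ seg v, ∃ y ∈ seg w, dist x y ≤ ‖v - w‖ := by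
    intro v w x hx
    obtain ⟨t, h0, h1, rfl⟩ := mem_seg.1 hx
    refine ⟨t • w, mem_seg.2 ⟨t, h0, h1, rfl⟩, ?_⟩
    rw [dist_eq_norm, ← smul_sub, norm_smul, Real.norm_of_nonneg h0]
    exact mul_le_of_le_one_left (norm_nonneg _) h1
  apply dist_le_of (norm_nonneg _) (key v w)
  rw [norm_sub_rev]
  exact key w v

theorem continuous_seg : Continuous (seg : V → ConvexBody V) := by
  apply LipschitzWith.continuous (K := 1)
  apply LipschitzWith.of_dist_le_mul
  intro v w
  simpa [dist_eq_norm] using dist_seg_le v w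

theorem continuous_pt : Continuous (pt : V → ConvexBody V) := by
  apply LipschitzWith.continuous (K := 1)
  apply LipschitzWith.of_dist_le_mul
  intro v w
  simp only [NNReal.coe_one, one_mul]
  apply dist_le_of dist_nonneg
  · rintro _ rfl
    exact ⟨w, rfl, le_rfl⟩
  · rintro _ rfl
    exact ⟨v, rfl, (dist_comm _ _).le⟩

theorem dist_smul_smul_le (s t : ℝ) (K : ConvexBody V) {C : ℝ} (hC : ∀ x ∈ K, ‖x‖ ≤ C) :
    dist (s • K) (t • K) ≤ |s - t| * C := by
  have hC0 : 0 ≤ C := by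
    obtain ⟨x, hx⟩ := K.nonempty
    exact (norm_nonneg _).trans (hC x hx)
  have key : ∀ s t : ℝ, ∀ x ∈ s • K, ∃ y ∈ t • K, dist x y ≤ |s - t| * C := by
    intro s t x hx
    obtain ⟨y, hy, rfl⟩ := mem_smul.1 hx
    refine ⟨t • y, mem_smul.2 ⟨y, hy, rfl⟩, ?_⟩
    rw [dist_eq_norm, ← sub_smul, norm_smul, Real.norm_eq_abs]
    gcongr
    exact hC y hy
  apply dist_le_of (by positivity) (key s t)
  rw [abs_sub_comm]
  exact key t s

theorem continuous_smul_left (K : ConvexBody V) : Continuous (fun t : ℝ => t • K) := by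
  obtain ⟨C, hC⟩ := K.isCompact.isBounded.exists_norm_le
  have hC0 : 0 ≤ C := by
    obtain ⟨x, hx⟩ := K.nonempty
    exact (norm_nonneg _).trans (hC x hx)
  apply LipschitzWith.continuous (K := ⟨C, hC0⟩)
  apply LipschitzWith.of_dist_le_mul
  intro s t
  have := dist_smul_smul_le s t K hC
  rw [mul_comm] at this
  exact this

theorem smul_eq_cmap (t : ℝ) (K : ConvexBody V) :
    t • K = cmap (t • ContinuousLinearMap.id ℝ V) K := by
  apply ConvexBody.ext
  simp [coe_cmap]

theorem zero_smul' (K : ConvexBody V) : (0 : ℝ) • K = 0 := by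
  apply ConvexBody.ext
  exact Set.zero_smul_set K.nonempty

theorem add_smul' {s t : ℝ} (hs : 0 ≤ s) (ht : 0 ≤ t) (K : ConvexBody V) :
    (s + t) • K = s • K + t • K := by
  apply ConvexBody.ext
  exact Convex.add_smul K.convex hs ht

theorem continuous_smul_right (t : ℝ) : Continuous (fun K : ConvexBody V => t • K) := by
  simp_rw [smul_eq_cmap]
  exact continuous_cmap _

theorem mem_neg {K : ConvexBody V} {x : V} : x ∈ (-1 : ℝ) • K ↔ -x ∈ K := by
  rw [mem_smul]
  constructor
  · rintro ⟨y, hy, rfl⟩; simpa using hy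
  · intro h; exact ⟨-x, h, by simp⟩

/-- crossing point: if the union of two closed convex sets is convex then any segment joining them
meets the intersection -/
theorem exists_cross {A B : Set V} (hA : IsClosed A) (hB : IsClosed B) (hAB : Convex ℝ (A ∪ B))
    {a b : V} (ha : a ∈ A) (hb : b ∈ B) : ∃ c ∈ segment ℝ a b, c ∈ A ∧ c ∈ B := by
  have h1 : segment ℝ a b ⊆ A ∪ B := hAB.segment_subset (Or.inl ha) (Or.inr hb)
  have h2 := (convex_segment (𝕜 := ℝ) a b).isPreconnected
  rw [isPreconnected_closed_iff] at h2
  obtain ⟨c, hc, hcA, hcB⟩ := h2 A B hA hB h1 ⟨a, left_mem_segment ℝ a b, ha⟩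
    ⟨b, right_mem_segment ℝ a b, hb⟩
  exact ⟨c, hc, hcA, hcB⟩

theorem add_union_inter (K A B M N : ConvexBody V) (hM : (M : Set V) = (A : Set V) ∪ (B : Set V))
    (hN : (N : Set V) = (A : Set V) ∩ B) :
    ((M + K : ConvexBody V) : Set V) = ((A + K : ConvexBody V) : Set V) ∪ (B + K : ConvexBody V) ∧
    ((N + K : ConvexBody V) : Set V) = ((A + K : ConvexBody V) : Set V) ∩ (B + K : ConvexBody V) := by
  simp only [ConvexBody.coe_add, hM, hN]
  refine ⟨Set.union_add, ?_⟩
  apply Set.Subset.antisymm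
  · exact Set.inter_add_subset
  · rintro x ⟨⟨a, ha, k, hk, rfl⟩, ⟨b, hb, l, hl, h⟩⟩
    obtain ⟨c, hc, hcA, hcB⟩ := exists_cross A.isClosed B.isClosed (hM ▸ M.convex) ha hb
    obtain ⟨s, t, hs, ht, hst, rfl⟩ := hc
    refine ⟨_, ⟨hcA, hcB⟩, s • k + t • l, K.convex hk hl hs ht hst, ?_⟩
    simp only at h ⊢
    have : s • (a + k) + t • (b + l) = a + k := by rw [h, ← add_smul, hst, one_smul]
    rw [← this]; module

theorem cmap_union_inter (f : V →L[ℝ] W) (A B M N : ConvexBody V) (hM : (M : Set V) = (A : Set V) ∪ (B : Set V))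
    (hN : (N : Set V) = (A : Set V) ∩ B) :
    (cmap f M : Set W) = (cmap f A : Set W) ∪ cmap f B ∧ (cmap f N : Set W) = (cmap f A : Set W) ∩ cmap f B := by
  simp only [coe_cmap, hM, hN]
  refine ⟨Set.image_union _ _ _, ?_⟩
  apply Set.Subset.antisymm
  · exact Set.image_inter_subset _ _ _
  · rintro x ⟨⟨a, ha, rfl⟩, ⟨b, hb, h⟩⟩
    obtain ⟨c, hc, hcA, hcB⟩ := exists_cross A.isClosed B.isClosed (hM ▸ M.convex) ha hb
    obtain ⟨s, t, hs, ht, hst, rfl⟩ := hc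
    refine ⟨_, ⟨hcA, hcB⟩, ?_⟩
    simp only [map_add, map_smul]
    rw [h, ← add_smul, hst, one_smul]

/-- continuous translation invariant valuation -/
structure IsVal (μ : ConvexBody V → ℂ) : Prop where
  val : IsValuationC μ
  cont : Continuous μ
  trans : ∀ x K, μ (K + pt x) = μ K

theorem isTranslationInvariantC_iff (μ : ConvexBody V → ℂ) :
    IsTranslationInvariantC μ ↔ ∀ x K, μ (K + pt x) = μ K := by
  constructor
  · intro h x K
    apply h x
    rw [ConvexBody.coe_add, coe_pt, Set.add_singleton]; simp only [add_comm _ x]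
    rfl
  · intro h x K L hL
    rw [← h x K]
    congr 1
    apply ConvexBody.ext
    rw [hL, ConvexBody.coe_add, coe_pt, Set.add_singleton]; simp only [add_comm _ x]
    rfl

theorem IsVal.comp_cmap {μ : ConvexBody W → ℂ} (h : IsVal μ) (f : V →L[ℝ] W) :
    IsVal (fun K => μ (cmap f K)) where
  val := by
    intro K L M N hM hN
    obtain ⟨h1, h2⟩ := cmap_union_inter f K L M N hM hN
    exact h.val _ _ _ _ h1 h2
  cont := h.cont.comp (continuous_cmap f)
  trans := by
    intro x K
    simp only [cmap_add, cmap_pt, h.trans]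

theorem IsVal.add_right {μ : ConvexBody V → ℂ} (h : IsVal μ) (A : ConvexBody V) :
    IsVal (fun K => μ (K + A)) where
  val := by
    intro K L M N hM hN
    obtain ⟨h1, h2⟩ := add_union_inter A K L M N hM hN
    exact h.val _ _ _ _ h1 h2
  cont := h.cont.comp (continuous_add_const A)
  trans := by
    intro x K
    simp only [add_right_comm, h.trans]

theorem IsVal.sub {μ ν : ConvexBody V → ℂ} (h : IsVal μ) (h' : IsVal ν) :
    IsVal (fun K => μ K - ν K) where
  val := by
    intro K L M N hM hN
    linear_combination h.val _ _ _ _ hM hN - h'.val _ _ _ _ hM hN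
  cont := h.cont.sub h'.cont
  trans := by
    intro x K
    simp only [h.trans, h'.trans]

theorem IsVal.add {μ ν : ConvexBody V → ℂ} (h : IsVal μ) (h' : IsVal ν) :
    IsVal (fun K => μ K + ν K) where
  val := by
    intro K L M N hM hN
    linear_combination h.val _ _ _ _ hM hN + h'.val _ _ _ _ hM hN
  cont := h.cont.add h'.cont
  trans := by
    intro x K
    simp only [h.trans, h'.trans]

theorem IsVal.const_mul {μ : ConvexBody V → ℂ} (h : IsVal μ) (c : ℂ) :
    IsVal (fun K => c * μ K) where
  val := by
    intro K L M N hM hN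
    linear_combination c * h.val _ _ _ _ hM hN
  cont := continuous_const.mul h.cont
  trans := by
    intro x K
    simp only [h.trans]

/-- homogeneity -/
def IsHom (k : ℕ) (μ : ConvexBody V → ℂ) : Prop := ∀ t : ℝ, 0 ≤ t → ∀ K, μ (t • K) = (t : ℂ) ^ k * μ K

theorem isHomogeneousValC_iff (k : ℕ) (μ : ConvexBody V → ℂ) : IsHomogeneousValC k μ ↔ IsHom k μ := by
  constructor
  · intro h t ht K
    exact h t ht K _ rfl
  · intro h t ht K L hL
    rw [← h t ht K]
    congr 1
    exact ConvexBody.ext hL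

/-- evenness -/
def IsEv (μ : ConvexBody V → ℂ) : Prop := ∀ K, μ ((-1 : ℝ) • K) = μ K

/-- homogeneity for positive factors is enough -/
theorem IsHom.of_pos {k : ℕ} {μ : ConvexBody V → ℂ} (hc : Continuous μ)
    (h : ∀ t : ℝ, 0 < t → ∀ K, μ (t • K) = (t : ℂ) ^ k * μ K) : IsHom k μ := by
  intro t ht K
  have h1 : Continuous fun t : ℝ => μ (t • K) := hc.comp (continuous_smul_left K)
  have h2 : Continuous fun t : ℝ => (t : ℂ) ^ k * μ K := by fun_prop
  have : EqOn (fun t : ℝ => μ (t • K)) (fun t : ℝ => (t : ℂ) ^ k * μ K) (closure (Ioi 0)) := by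
    apply EqOn.closure _ h1 h2
    intro t ht
    exact h t ht K
  rw [closure_Ioi] at this
  exact this ht

/-- continuous additive functions on the half line are linear -/
theorem linear_of_add {a : ℝ → ℂ} (hc : Continuous a)
    (h : ∀ s t, 0 ≤ s → 0 ≤ t → a (s + t) = a s + a t) {s : ℝ} (hs : 0 ≤ s) : a s = s * a 1 := by
  let g : ℝ →+ ℂ := AddMonoidHom.mk' (fun x => a (max x 0) - a (max (-x) 0)) (by
    intro x y
    have e : max x 0 + (max y 0 + max (-(x + y)) 0) = max (-x) 0 + (max (-y) 0 + max (x + y) 0) := by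
      rcases le_total x 0 with hx | hx <;> rcases le_total y 0 with hy | hy <;>
      rcases le_total (x + y) 0 with hxy | hxy <;> simp only [max_eq_left, max_eq_right, hx, hy, hxy, Left.neg_nonpos_iff, Left.nonneg_neg_iff, neg_nonneg, neg_nonpos] <;> linarith
    have e2 := congrArg a e
    rw [h _ _ (by positivity) (by positivity), h _ _ (by positivity) (by positivity),
      h _ _ (by positivity) (by positivity), h _ _ (by positivity) (by positivity)] at e2
    linear_combination -e2)
  have hg : Continuous g := by
    change Continuous (fun x => a (max x 0) - a (max (-x) 0))
    fun_prop
  have a0 : a 0 = 0 := by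
    have := h 0 0 le_rfl le_rfl
    simpa using this
  have h1 := (g.toRealLinearMap hg).map_smul s 1
  have e1 : ∀ x : ℝ, 0 ≤ x → g x = a x := by
    intro x hx
    change a (max x 0) - a (max (-x) 0) = a x
    simp [hx, a0]
  simp only [smul_eq_mul, mul_one, AddMonoidHom.coe_toRealLinearMap] at h1
  rw [e1 s hs, e1 1 zero_le_one] at h1
  rw [h1]; simp

/-- difference operator -/
def Dv (v : V) (μ : ConvexBody V → ℂ) : ConvexBody V → ℂ := fun K => μ (K + seg v) - μ K

theorem IsVal.Dv {μ : ConvexBody V → ℂ} (h : IsVal μ) (v : V) : IsVal (Dv v μ) :=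
  (h.add_right (seg v)).sub h

theorem seg_union {s t : ℝ} (hs : 0 ≤ s) (ht : 0 ≤ t) (v : V) :
    (seg ((s + t) • v) : Set V) = (seg (s • v) : Set V) ∪ ((seg (t • v) + pt (s • v) : ConvexBody V) : Set V) := by
  ext x
  simp only [SetLike.mem_coe, mem_union, mem_seg, mem_add, mem_pt]
  constructor
  · rintro ⟨r, h0, h1, rfl⟩
    rcases eq_or_lt_of_le hs with rfl | hs'
    · right
      exact ⟨r • t • v, ⟨r, h0, h1, rfl⟩, _, rfl, by simp⟩
    rcases eq_or_lt_of_le ht with rfl | ht'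
    · left
      exact ⟨r, h0, h1, by simp⟩
    rcases le_total (r * (s + t)) s with hr | hr
    · left
      exact ⟨r * (s + t) / s, by positivity, (div_le_one hs').2 hr, by
        simp only [smul_smul]; congr 1; field_simp⟩
    · right
      refine ⟨((r * (s + t) - s) / t) • t • v, ⟨(r * (s + t) - s) / t, div_nonneg (by linarith) ht,
        (div_le_one ht').2 (by nlinarith), rfl⟩, _, rfl, ?_⟩
      simp only [smul_smul, ← add_smul]; congr 1; field_simp; ring
  · rintro (⟨r, h0, h1, rfl⟩ | ⟨_, ⟨r, h0, h1, rfl⟩, _, rfl, rfl⟩)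
    · rcases eq_or_lt_of_le (add_nonneg hs ht) with h | h
      · have : s = 0 := by linarith
        exact ⟨0, le_rfl, zero_le_one, by simp [this]⟩
      · refine ⟨r * s / (s + t), by positivity, (div_le_one h).2 (by nlinarith), ?_⟩
        simp only [smul_smul]; congr 1; field_simp
    · rcases eq_or_lt_of_le (add_nonneg hs ht) with h | h
      · have : s = 0 := by linarith
        have : t = 0 := by linarith
        subst_vars
        exact ⟨0, le_rfl, zero_le_one, by simp⟩
      · refine ⟨(r * t + s) / (s + t), by positivity, (div_le_one h).2 (by nlinarith), ?_⟩
        simp only [smul_smul, ← add_smul]; congr 1; field_simp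

theorem seg_inter {s t : ℝ} (hs : 0 ≤ s) (ht : 0 ≤ t) (v : V) :
    ((pt (s • v) : ConvexBody V) : Set V) = (seg (s • v) : Set V) ∩ ((seg (t • v) + pt (s • v) : ConvexBody V) : Set V) := by
  ext x
  simp only [SetLike.mem_coe, mem_inter_iff, mem_seg, mem_add, mem_pt]
  constructor
  · rintro rfl
    exact ⟨⟨1, by simp⟩, ⟨0, ⟨0, by simp⟩, _, rfl, by simp⟩⟩
  · rintro ⟨⟨r, h0, h1, rfl⟩, ⟨_, ⟨q, q0, q1, rfl⟩, _, rfl, h⟩⟩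
    by_cases hv : v = 0
    · simp [hv]
    simp only [smul_smul, ← add_smul] at h ⊢
    have h' := smul_left_injective ℝ hv h
    have : r * s = s := by nlinarith [mul_nonneg q0 ht]
    rw [this]

theorem IsVal.Dv_smul {μ : ConvexBody V → ℂ} (h : IsVal μ) (v : V) {s : ℝ} (hs : 0 ≤ s)
    (K : ConvexBody V) : UV.Dv (s • v) μ K = s * UV.Dv v μ K := by
  have := linear_of_add (a := fun s => UV.Dv (s • v) μ K) (by
    unfold UV.Dv
    refine (h.cont.comp ?_).sub continuous_const
    exact continuous_const.add (continuous_seg.comp (by fun_prop))) (by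
    intro s t hs ht
    have := (h.add_right K).val _ _ _ _ (seg_union hs ht v) (seg_inter hs ht v)
    have e1 : μ (pt (s • v) + K) = μ K := by rw [add_comm, h.trans]
    have e2 : μ (seg (t • v) + pt (s • v) + K) = μ (K + seg (t • v)) := by
      rw [add_right_comm, h.trans, add_comm]
    simp only [e1, e2] at this
    simp only [UV.Dv, add_comm K] at this ⊢
    linear_combination this) hs
  simpa using this

theorem IsVal.Dv_neg {μ : ConvexBody V → ℂ} (h : IsVal μ) (v : V) : UV.Dv (-v) μ = UV.Dv v μ := by
  funext K
  unfold UV.Dv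
  rw [← seg_neg v, ← add_assoc, h.trans]

theorem smul_smul_inv {t : ℝ} (ht : t ≠ 0) (K : ConvexBody V) : t • (t⁻¹ • K) = K := by
  rw [smul_smul, mul_inv_cancel₀ ht, one_smul]

theorem IsHom.Dv {k : ℕ} {μ : ConvexBody V → ℂ} (h : IsVal μ) (hk : IsHom (k + 1) μ) (v : V) :
    IsHom k (Dv v μ) := by
  apply IsHom.of_pos (h.Dv v).cont
  intro t ht K
  have e : t • K + seg v = t • (K + seg (t⁻¹ • v)) := by
    rw [smul_add, seg_smul ht.le, smul_smul, mul_inv_cancel₀ ht.ne', one_smul]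
  have h1 := h.Dv_smul v (inv_nonneg.2 ht.le) K
  have h2 : UV.Dv v μ (t • K) = (t : ℂ) ^ (k + 1) * UV.Dv (t⁻¹ • v) μ K := by
    unfold UV.Dv
    rw [e, hk t ht.le, hk t ht.le]; ring
  rw [h2, h1]
  have : (t : ℂ) ≠ 0 := by exact_mod_cast ht.ne'
  push_cast
  field_simp
  ring

theorem IsEv.Dv {μ : ConvexBody V → ℂ} (h : IsVal μ) (he : IsEv μ) (v : V) : IsEv (Dv v μ) := by
  intro K
  unfold UV.Dv
  rw [he K]
  congr 1
  have : (-1 : ℝ) • K + seg v = (-1 : ℝ) • (K + seg v) + pt v := by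
    rw [smul_add, add_assoc]
    congr 1
    rw [smul_eq_cmap, cmap_seg]
    simpa using (seg_neg v).symm
  rw [this, h.trans, he]

theorem IsHom.zero_at {k : ℕ} {μ : ConvexBody V → ℂ} (hk : IsHom (k + 1) μ) : μ 0 = 0 := by
  have := hk 0 le_rfl 0
  simpa [zero_smul'] using this

theorem IsHom.zero_const {μ : ConvexBody V → ℂ} (hk : IsHom 0 μ) (K : ConvexBody V) : μ K = μ 0 := by
  have := hk 0 le_rfl K
  simpa [zero_smul'] using this.symm

/-- vanishing on sums of few segments -/
theorem IsHom.zono_zero {k : ℕ} : ∀ {μ : ConvexBody V → ℂ} (_ : IsVal μ) (_ : IsHom k μ) (l : List V),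
    l.length < k → μ (l.map seg).sum = 0 := by
  induction k with
  | zero => intro μ _ _ l hl; simp at hl
  | succ k ih =>
    intro μ h hk l
    induction l with
    | nil => intro _; simpa using hk.zero_at
    | cons v l ihl =>
      intro hl
      simp only [List.length_cons] at hl
      have h1 := ih (h.Dv v) (IsHom.Dv h hk v) l (by omega)
      have h2 := ihl (by omega)
      unfold UV.Dv at h1
      simp only [List.map_cons, List.sum_cons]
      rw [h2, sub_zero, add_comm] at h1
      exact h1

end Basic

end UV
end

noncomputable section
namespace UV
open Filter Topology

section Klain

variable {V W : Type*} [NormedAddCommGroup V] [NormedSpace ℝ V]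
  [NormedAddCommGroup W] [NormedSpace ℝ W]

/-- value on the parallelotope spanned by a family -/
def Fk {ι : Type*} [Fintype ι] (μ : ConvexBody V → ℂ) (v : ι → V) : ℂ := μ (∑ i, seg (v i))

theorem zono_zero {ι : Type*} {k : ℕ} {μ : ConvexBody V → ℂ} (h : IsVal μ) (hk : IsHom k μ)
    (s : Finset ι) (v : ι → V) (hs : s.card < k) : μ (∑ i ∈ s, seg (v i)) = 0 := by
  have := IsHom.zono_zero h hk (s.toList.map v) (by simpa using hs)
  rw [List.map_map, ] at this
  rw [← this]
  congr 1
  exact (Finset.sum_map_toList s (fun i => seg (v i))).symm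

def sqT : ConvexBody (ℝ × ℝ) := ⟨{p | 0 ≤ p.2 ∧ p.2 ≤ p.1 ∧ p.1 ≤ 1}, by
    rintro ⟨a, b⟩ ⟨h1, h2, h3⟩ ⟨c, d⟩ ⟨h4, h5, h6⟩ s t hs ht hst
    simp only at h1 h2 h3 h4 h5 h6
    refine ⟨?_, ?_, ?_⟩ <;> simp
    · positivity
    · nlinarith
    · nlinarith, by
    have : {p : ℝ × ℝ | 0 ≤ p.2 ∧ p.2 ≤ p.1 ∧ p.1 ≤ 1} = Icc 0 1 ∩ {p | p.2 ≤ p.1} := by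
      ext ⟨a, b⟩
      simp [Prod.le_def]
      constructor
      · rintro ⟨h1, h2, h3⟩; refine ⟨⟨⟨?_, ?_⟩, ?_, ?_⟩, ?_⟩ <;> linarith
      · rintro ⟨⟨⟨_, _⟩, _, _⟩, _⟩; refine ⟨?_, ?_, ?_⟩ <;> linarith
    rw [this]
    exact isCompact_Icc.inter_right (isClosed_le continuous_snd continuous_fst), ⟨0, by simp⟩⟩

def sqT' : ConvexBody (ℝ × ℝ) := ⟨{p | 0 ≤ p.1 ∧ p.1 ≤ p.2 ∧ p.2 ≤ 1}, by
    rintro ⟨a, b⟩ ⟨h1, h2, h3⟩ ⟨c, d⟩ ⟨h4, h5, h6⟩ s t hs ht hst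
    simp only at h1 h2 h3 h4 h5 h6
    refine ⟨?_, ?_, ?_⟩ <;> simp
    · positivity
    · nlinarith
    · nlinarith, by
    have : {p : ℝ × ℝ | 0 ≤ p.1 ∧ p.1 ≤ p.2 ∧ p.2 ≤ 1} = Icc 0 1 ∩ {p | p.1 ≤ p.2} := by
      ext ⟨a, b⟩
      simp [Prod.le_def]
      constructor
      · rintro ⟨h1, h2, h3⟩; refine ⟨⟨⟨?_, ?_⟩, ?_, ?_⟩, ?_⟩ <;> linarith
      · rintro ⟨⟨⟨_, _⟩, _, _⟩, _⟩; refine ⟨?_, ?_, ?_⟩ <;> linarith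
    rw [this]
    exact isCompact_Icc.inter_right (isClosed_le continuous_fst continuous_snd), ⟨0, by simp⟩⟩

theorem mem_sqT {p : ℝ × ℝ} : p ∈ sqT ↔ 0 ≤ p.2 ∧ p.2 ≤ p.1 ∧ p.1 ≤ 1 := Iff.rfl
theorem mem_sqT' {p : ℝ × ℝ} : p ∈ sqT' ↔ 0 ≤ p.1 ∧ p.1 ≤ p.2 ∧ p.2 ≤ 1 := Iff.rfl

theorem shear_plane {ψ : ConvexBody (ℝ × ℝ) → ℂ} (h : IsVal ψ) :
    ψ (seg (1, 0) + seg (0, 1)) + ψ (seg (1, 1)) = ψ (seg (1, 0) + seg (1, 1)) + ψ (seg (0, 1)) := by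
  have h1 := h.val sqT sqT' (seg (1, 0) + seg (0, 1)) (seg (1, 1)) (by
    ext ⟨a, b⟩
    simp only [SetLike.mem_coe, mem_union, mem_seg, mem_add, mem_sqT, mem_sqT']
    constructor
    · rintro ⟨_, ⟨t, h0, h1, rfl⟩, _, ⟨s, h2, h3, rfl⟩, h⟩
      simp at h
      obtain ⟨rfl, rfl⟩ := h
      rcases le_total t s with h | h
      · right; simp_all
      · left; simp_all
    · rintro (⟨h1, h2, h3⟩ | ⟨h1, h2, h3⟩)
      · exact ⟨a • (1, 0), ⟨a, by first | assumption | linarith | (simp at *; linarith), by first | assumption | linarith | (simp at *; linarith), rfl⟩, b • (0, 1), ⟨b, by first | assumption | linarith | (simp at *; linarith), by first | assumption | linarith | (simp at *; linarith), rfl⟩, by simp⟩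
      · exact ⟨a • (1, 0), ⟨a, by first | assumption | linarith | (simp at *; linarith), by first | assumption | linarith | (simp at *; linarith), rfl⟩, b • (0, 1), ⟨b, by first | assumption | linarith | (simp at *; linarith), by first | assumption | linarith | (simp at *; linarith), rfl⟩, by simp⟩) (by
    ext ⟨a, b⟩
    simp only [SetLike.mem_coe, mem_inter_iff, mem_seg, mem_add, mem_sqT, mem_sqT']
    constructor
    · rintro ⟨t, h0, h1, h⟩
      simp at h
      obtain ⟨rfl, rfl⟩ := h
      simp_all
    · rintro ⟨⟨h1, h2, h3⟩, h4, h5, h6⟩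
      exact ⟨a, h4, h3, by simp at *; linarith⟩)
  have h2 := h.val sqT (sqT' + pt (1, 0)) (seg (1, 0) + seg (1, 1)) (seg (0, 1) + pt (1, 0)) (by
    ext ⟨a, b⟩
    simp only [SetLike.mem_coe, mem_union, mem_seg, mem_add, mem_sqT, mem_sqT', mem_pt]
    constructor
    · rintro ⟨_, ⟨t, h0, h1, rfl⟩, _, ⟨s, h2, h3, rfl⟩, h⟩
      simp at h
      obtain ⟨rfl, rfl⟩ := h
      rcases le_total (t + s) 1 with h | h
      · left; simp_all
      · right; exact ⟨(t + s - 1, s), ⟨by simp; linarith, by simp; linarith, by simpa⟩, _, rfl, by simp⟩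
    · rintro (⟨h1, h2, h3⟩ | ⟨⟨c, d⟩, ⟨h1, h2, h3⟩, _, rfl, h⟩)
      · exact ⟨(a - b) • (1, 0), ⟨a - b, by first | assumption | linarith | (simp at *; linarith), by first | assumption | linarith | (simp at *; linarith), rfl⟩, b • (1, 1), ⟨b, by first | assumption | linarith | (simp at *; linarith), by first | assumption | linarith | (simp at *; linarith), rfl⟩, by simp⟩
      · simp at h
        obtain ⟨rfl, rfl⟩ := h
        exact ⟨(c + 1 - d) • (1, 0), ⟨c + 1 - d, by simp at *; linarith, by simp at *; linarith, rfl⟩, d • (1, 1), ⟨d, by simp at *; linarith, by simp at *; linarith, rfl⟩, by simp⟩) (by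
    ext ⟨a, b⟩
    simp only [SetLike.mem_coe, mem_inter_iff, mem_seg, mem_add, mem_sqT, mem_sqT', mem_pt]
    constructor
    · rintro ⟨_, ⟨t, h0, h1, rfl⟩, _, rfl, h⟩
      simp at h
      obtain ⟨rfl, rfl⟩ := h
      refine ⟨by simp_all, (0, t), by simp_all, _, rfl, by simp⟩
    · rintro ⟨⟨h1, h2, h3⟩, ⟨c, d⟩, ⟨h4, h5, h6⟩, _, rfl, h⟩
      simp at h h1 h2 h3 h4 h5 h6
      exact ⟨b • (0, 1), ⟨b, h1, by linarith, rfl⟩, _, rfl, by simp; linarith⟩)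
  rw [h.trans, h.trans] at h2
  rw [h1, ← h2]

theorem shear_gen {φ : ConvexBody V → ℂ} (h : IsVal φ) (v w : V) :
    φ (seg v + seg w) + φ (seg (v + w)) = φ (seg v + seg (v + w)) + φ (seg w) := by
  let ℓ : ℝ × ℝ →L[ℝ] V := (ContinuousLinearMap.fst ℝ ℝ ℝ).smulRight v +
    (ContinuousLinearMap.snd ℝ ℝ ℝ).smulRight w
  have := shear_plane (h.comp_cmap ℓ)
  simpa [cmap_add, cmap_seg, ℓ] using this

theorem IsVal.Dv_smul_abs {μ : ConvexBody V → ℂ} (h : IsVal μ) (v : V) (s : ℝ)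
    (K : ConvexBody V) : UV.Dv (s • v) μ K = |s| * UV.Dv v μ K := by
  rcases le_total 0 s with hs | hs
  · rw [h.Dv_smul v hs, abs_of_nonneg hs]
  · have := h.Dv_smul v (neg_nonneg.2 hs) K
    rw [abs_of_nonpos hs, ← this, neg_smul, h.Dv_neg]

section
variable {ι : Type*} [Fintype ι] [DecidableEq ι] {μ : ConvexBody V → ℂ} 

theorem Fk_split (v : ι → V) (i : ι) (x : V) : 
    Fk μ (Function.update v i x) = μ (∑ j ∈ Finset.univ.erase i, seg (v j) + seg x) := by
  unfold Fk
  rw [← Finset.sum_erase_add _ _ (Finset.mem_univ i)]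
  congr 2
  · apply Finset.sum_congr rfl
    intro j hj
    rw [Function.update_of_ne (Finset.ne_of_mem_erase hj)]
  · rw [Function.update_self]

theorem Fk_smul {k : ℕ} (h : IsVal μ) (hk : IsHom k μ) (hc : Fintype.card ι = k) 
    (v : ι → V) (i : ι) (c : ℝ) (x : V) :
    Fk μ (Function.update v i (c • x)) = |c| * Fk μ (Function.update v i x) := by
  rw [Fk_split, Fk_split]
  have h0 : μ (∑ j ∈ Finset.univ.erase i, seg (v j)) = 0 := by
    apply zono_zero h hk
    rw [Finset.card_erase_of_mem (Finset.mem_univ i), Finset.card_univ]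
    have : 0 < Fintype.card ι := Fintype.card_pos_iff.2 ⟨i⟩
    omega
  have := h.Dv_smul_abs x c (∑ j ∈ Finset.univ.erase i, seg (v j))
  unfold Dv at this
  rw [h0] at this
  simpa using this

theorem Fk_shear {k : ℕ} (h : IsVal μ) (hk : IsHom k μ) (hc : Fintype.card ι = k) 
    (v : ι → V) {i j : ι} (hij : i ≠ j) (c : ℝ) :
    Fk μ (Function.update v i (v i + c • v j)) = Fk μ v := by
  -- unit shear
  have key : ∀ v : ι → V, Fk μ (Function.update v i (v j + v i)) = Fk μ v := by
    intro v
    set R := ∑ l ∈ (Finset.univ.erase i).erase j, seg (v l) with hR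
    have hj : j ∈ Finset.univ.erase i := by simp [hij.symm]
    have e : ∑ l ∈ Finset.univ.erase i, seg (v l) = R + seg (v j) := by
      rw [hR, Finset.sum_erase_add _ _ hj]
    have hcard : ((Finset.univ.erase i).erase j).card + 2 = k := by
      rw [Finset.card_erase_of_mem hj, Finset.card_erase_of_mem (Finset.mem_univ i),
        Finset.card_univ]
      have : 1 < Fintype.card ι := Fintype.one_lt_card_iff.2 ⟨i, j, hij⟩
      omega
    have z : ∀ x, μ (seg x + R) = 0 := by
      intro x
      have := zono_zero h hk (Finset.univ.erase i) (Function.update v j x) (by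
        rw [Finset.card_erase_of_mem hj] at hcard; omega)
      rw [← Finset.sum_erase_add _ _ hj, Function.update_self] at this
      rw [← this, hR, add_comm]
      congr 2
      apply Finset.sum_congr rfl
      intro l hl
      rw [Function.update_of_ne (Finset.ne_of_mem_erase hl)]
    have s := shear_gen (h.add_right R) (v j) (v i)
    simp only [z, add_zero] at s
    conv_rhs => rw [← Function.update_eq_self i v]
    rw [Fk_split, Fk_split, e, add_comm R, add_right_comm, ← s, add_right_comm]
  by_cases hc0 : c = 0
  · simp [hc0]
  have k1 := key (Function.update v j (c • v j))
  have e1 : ∀ x, Function.update (Function.update v j (c • v j)) i x =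
      Function.update (Function.update v i x) j (c • v j) := by
    intro x; rw [Function.update_comm hij.symm]
  rw [Function.update_self, Function.update_of_ne hij, e1, Fk_smul h hk hc, Fk_smul h hk hc,
    Function.update_eq_self] at k1
  have : ((|c| : ℝ) : ℂ) ≠ 0 := by exact_mod_cast (abs_pos.2 hc0).ne'
  have k2 := mul_left_cancel₀ this k1
  rw [← k2, add_comm]
  congr 1
  rw [eq_comm]
  apply Function.update_eq_iff.2
  simp [hij.symm]

theorem Fk_diag {k : ℕ} (h : IsVal μ) (hk : IsHom k μ) (hc : Fintype.card ι = k) 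
    (v : ι → V) (D : ι → ℝ) (s : Finset ι) :
    Fk μ (fun i => if i ∈ s then D i • v i else v i) = (∏ i ∈ s, |D i| : ℝ) * Fk μ v := by
  induction s using Finset.induction_on with
  | empty => simp
  | insert a s ha ih =>
    rw [Finset.prod_insert ha]
    have : (fun i => if i ∈ insert a s then D i • v i else v i) =
        Function.update (fun i => if i ∈ s then D i • v i else v i) a (D a • v a) := by
      funext i
      by_cases hi : i = a
      · subst hi; simp
      · simp [hi]
    rw [this, Fk_smul h hk hc]
    have e : Function.update (fun i => if i ∈ s then D i • v i else v i) a (v a) =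
        (fun i => if i ∈ s then D i • v i else v i) := by
      funext i
      by_cases hi : i = a
      · subst hi; simp [ha]
      · simp [hi]
    rw [e, ih]
    push_cast; ring

theorem Fk_mul {k : ℕ} (h : IsVal μ) (hk : IsHom k μ) (hc : Fintype.card ι = k) 
    (M : Matrix ι ι ℝ) : ∀ (v : ι → V),
    Fk μ (fun i => ∑ j, M i j • v j) = (|M.det| : ℝ) * Fk μ v := by
  induction M using Matrix.diagonal_transvection_induction with
  | hdiag D hD =>
    intro v
    have := Fk_diag h hk hc v D Finset.univ
    simp only [Finset.mem_univ, if_true] at this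
    rw [Matrix.det_diagonal, Finset.abs_prod, ← this]
    congr 1
    funext i
    simp [Matrix.diagonal_apply]
  | htransvec t =>
    intro v
    rw [Matrix.TransvectionStruct.det]
    simp only [abs_one, Complex.ofReal_one, one_mul]
    rw [← Fk_shear h hk hc v t.hij t.c]
    congr 1
    funext i
    simp only [Matrix.TransvectionStruct.toMatrix, Matrix.transvection, Matrix.add_apply, add_smul,
      Finset.sum_add_distrib, Matrix.one_apply, ite_smul, one_smul, zero_smul, Finset.sum_ite_eq,
      Finset.mem_univ, if_true, Matrix.single_apply]
    by_cases hi : i = t.i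
    · subst hi; simp
    · rw [Function.update_of_ne hi]; simp [Ne.symm hi]
  | hmul A B hA hB =>
    intro v
    rw [Matrix.det_mul, abs_mul]
    have : (fun i => ∑ j, (A * B) i j • v j) = fun i => ∑ j, A i j • (∑ l, B j l • v l) := by
      funext i
      simp only [Matrix.mul_apply, Finset.sum_smul, Finset.smul_sum, smul_smul]
      rw [Finset.sum_comm]
    rw [this, hA, hB]
    push_cast; ring

/-- if every vector lies in the span of w, and F vanishes at w then it vanishes at v -/
theorem Fk_zero_of_span {k : ℕ} (h : IsVal μ) (hk : IsHom k μ) (hc : Fintype.card ι = k) 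
    (v w : ι → V) (hv : ∀ i, v i ∈ Submodule.span ℝ (range w)) (hw : Fk μ w = 0) : Fk μ v = 0 := by
  simp only [Submodule.mem_span_range_iff_exists_fun] at hv
  choose M hM using hv
  have := Fk_mul h hk hc M w
  rw [hw, mul_zero] at this
  rw [← this]
  congr 1
  funext i
  exact (hM i).symm

/-- F vanishes on dependent families -/
theorem Fk_zero_of_dep {k : ℕ} (h : IsVal μ) (hk : IsHom k μ) (hc : Fintype.card ι = k) 
    (v : ι → V) (hv : ¬ LinearIndependent ℝ v) : Fk μ v = 0 := by
  rw [Fintype.linearIndependent_iff] at hv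
  push Not at hv
  obtain ⟨g, hg, i, hi⟩ := hv
  have e : v i = ∑ j ∈ Finset.univ.erase i, (-(g i)⁻¹ * g j) • v j := by
    rw [← Finset.sum_erase_add _ _ (Finset.mem_univ i)] at hg
    have : g i • v i = - ∑ j ∈ Finset.univ.erase i, g j • v j := by
      rw [eq_neg_iff_add_eq_zero, add_comm]; exact hg
    have h2 : v i = (g i)⁻¹ • (g i • v i) := by rw [smul_smul, inv_mul_cancel₀ hi, one_smul]
    rw [h2, this, smul_neg, Finset.smul_sum, ← Finset.sum_neg_distrib]
    apply Finset.sum_congr rfl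
    intro j _
    rw [smul_smul]; simp
  apply Fk_zero_of_span h hk hc v (Function.update v i 0)
  · intro j
    have hne : ∀ j, j ≠ i → v j ∈ Submodule.span ℝ (range (Function.update v i 0)) := by
      intro j hj
      apply Submodule.subset_span
      exact ⟨j, by rw [Function.update_of_ne hj]⟩
    by_cases hj : j = i
    · subst hj
      rw [e]
      apply Submodule.sum_mem
      intro l hl
      exact Submodule.smul_mem _ _ (hne l (Finset.ne_of_mem_erase hl))
    · exact hne j hj
  · have := Fk_smul h hk hc v i 0 0
    simpa using this

end

end Klain

end UV
end

noncomputable section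
namespace UV
open Filter Topology

section Support

open scoped InnerProductSpace

variable {E G : Type*} [NormedAddCommGroup E] [InnerProductSpace ℝ E]
  [NormedAddCommGroup G] [InnerProductSpace ℝ G]

/-- support function -/
def supp (K : ConvexBody E) (x : E) : ℝ := sSup ((fun y => ⟪x, y⟫_ℝ) '' (K : Set E))

theorem bddAbove_supp (K : ConvexBody E) (x : E) : BddAbove ((fun y => ⟪x, y⟫_ℝ) '' (K : Set E)) :=
  (K.isCompact.image (by fun_prop)).bddAbove

theorem le_supp {K : ConvexBody E} {y : E} (hy : y ∈ K) (x : E) : ⟪x, y⟫_ℝ ≤ supp K x :=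
  le_csSup (bddAbove_supp K x) ⟨y, hy, rfl⟩

theorem exists_supp (K : ConvexBody E) (x : E) : ∃ y ∈ K, ⟪x, y⟫_ℝ = supp K x := by
  have := (K.isCompact.image (f := fun y => ⟪x, y⟫_ℝ) (by fun_prop)).sSup_mem (K.nonempty.image _)
  exact this

theorem supp_le {K : ConvexBody E} {x : E} {c : ℝ} (h : ∀ y ∈ K, ⟪x, y⟫_ℝ ≤ c) : supp K x ≤ c := by
  obtain ⟨y, hy, h'⟩ := exists_supp K x
  rw [← h']; exact h y hy

theorem supp_add (K L : ConvexBody E) (x : E) : supp (K + L) x = supp K x + supp L x := by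
  apply le_antisymm
  · apply supp_le
    intro y hy
    obtain ⟨a, ha, b, hb, rfl⟩ := mem_add.1 hy
    rw [inner_add_right]
    exact add_le_add (le_supp ha x) (le_supp hb x)
  · obtain ⟨a, ha, h1⟩ := exists_supp K x
    obtain ⟨b, hb, h2⟩ := exists_supp L x
    rw [← h1, ← h2, ← inner_add_right]
    exact le_supp (mem_add.2 ⟨a, ha, b, hb, rfl⟩) x

theorem supp_cmap [CompleteSpace E] [CompleteSpace G] (f : E →L[ℝ] G) (K : ConvexBody E) (x : G) :
    supp (cmap f K) x = supp K (ContinuousLinearMap.adjoint f x) := by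
  apply le_antisymm
  · apply supp_le
    rintro _ ⟨y, hy, rfl⟩
    rw [← ContinuousLinearMap.adjoint_inner_left]
    exact le_supp hy _
  · obtain ⟨a, ha, h1⟩ := exists_supp K (ContinuousLinearMap.adjoint f x)
    rw [← h1, ContinuousLinearMap.adjoint_inner_left]
    exact le_supp (K := cmap f K) (y := f a) ⟨a, ha, rfl⟩ x

theorem supp_smul (K : ConvexBody E) {t : ℝ} (ht : 0 ≤ t) (x : E) : supp (t • K) x = t * supp K x := by
  apply le_antisymm
  · apply supp_le
    intro y hy
    obtain ⟨a, ha, rfl⟩ := mem_smul.1 hy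
    rw [inner_smul_right]
    exact mul_le_mul_of_nonneg_left (le_supp ha x) ht
  · obtain ⟨a, ha, h1⟩ := exists_supp K x
    rw [← h1, ← inner_smul_right]
    exact le_supp (mem_smul.2 ⟨a, ha, rfl⟩) x

theorem supp_neg (K : ConvexBody E) (x : E) : supp ((-1 : ℝ) • K) x = supp K (-x) := by
  apply le_antisymm
  · apply supp_le
    intro y hy
    have := le_supp (mem_neg.1 hy) (-x)
    simpa using this
  · apply supp_le
    intro y hy
    have := le_supp (K := (-1 : ℝ) • K) (y := -y) (mem_neg.2 (by simpa using hy)) x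
    simpa using this

theorem supp_hom (K : ConvexBody E) {t : ℝ} (ht : 0 ≤ t) (x : E) : supp K (t • x) = t * supp K x := by
  apply le_antisymm
  · apply supp_le
    intro y hy
    rw [real_inner_smul_left]
    exact mul_le_mul_of_nonneg_left (le_supp hy x) ht
  · obtain ⟨a, ha, h1⟩ := exists_supp K x
    rw [← h1, ← real_inner_smul_left]
    exact le_supp ha _

theorem supp_subadd (K : ConvexBody E) (x y : E) : supp K (x + y) ≤ supp K x + supp K y := by
  apply supp_le
  intro z hz
  rw [inner_add_left]
  exact add_le_add (le_supp hz _) (le_supp hz _)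

theorem supp_pt (v x : E) : supp (pt v) x = ⟪x, v⟫_ℝ := by
  apply le_antisymm
  · apply supp_le
    rintro _ rfl; rfl
  · exact le_supp (mem_pt.2 rfl) x

theorem supp_zero (x : E) : supp (0 : ConvexBody E) x = 0 := by
  rw [← pt_zero, supp_pt, inner_zero_right]

theorem supp_seg (v x : E) : supp (seg v) x = max 0 ⟪x, v⟫_ℝ := by
  apply le_antisymm
  · apply supp_le
    intro y hy
    obtain ⟨t, h0, h1, rfl⟩ := mem_seg.1 hy
    rw [inner_smul_right]
    rcases le_total 0 ⟪x, v⟫_ℝ with h | h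
    · exact le_max_of_le_right (mul_le_of_le_one_left h h1)
    · exact le_max_of_le_left (mul_nonpos_of_nonneg_of_nonpos h0 h)
  · apply max_le
    · have := le_supp (K := seg v) (y := 0) (mem_seg.2 ⟨0, le_rfl, zero_le_one, by simp⟩) x
      simpa using this
    · exact le_supp (mem_seg.2 ⟨1, zero_le_one, le_rfl, by simp⟩) x

/-- symmetric segment -/
def sseg (v : E) : ConvexBody E := seg ((2 : ℝ) • v) + pt (-v)

theorem supp_sseg (v x : E) : supp (sseg v) x = |⟪x, v⟫_ℝ| := by
  rw [sseg, supp_add, supp_seg, supp_pt, inner_smul_right, inner_neg_right]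
  rcases le_total 0 ⟪x, v⟫_ℝ with h | h
  · rw [abs_of_nonneg h, max_eq_right (by positivity)]; ring
  · rw [abs_of_nonpos h, max_eq_left (by linarith)]; ring

theorem continuous_sseg : Continuous (sseg : E → ConvexBody E) := by
  unfold sseg
  exact (continuous_seg.comp (by fun_prop)).add (continuous_pt.comp (by fun_prop))

theorem exists_sep (L : ConvexBody E) (x : E) : 
    ∃ p ∈ L, supp L (x - p) = ⟪x - p, p⟫_ℝ := by
  obtain ⟨p, hp, h⟩ := exists_norm_eq_iInf_of_complete_convex L.nonempty L.isCompact.isComplete L.convex x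
  rw [norm_eq_iInf_iff_real_inner_le_zero L.convex hp] at h
  refine ⟨p, hp, le_antisymm (supp_le ?_) (le_supp hp _)⟩
  intro y hy
  have := h y hy
  rw [inner_sub_right] at this
  linarith

theorem near_of_supp {K L : ConvexBody E} {ε : ℝ} (h : ∀ u, ‖u‖ ≤ 1 → supp K u ≤ supp L u + ε)
    {x : E} (hx : x ∈ K) : ∃ y ∈ L, dist x y ≤ ε := by
  obtain ⟨p, hp, h1⟩ := exists_sep L x
  have hε : 0 ≤ ε := by
    have := h 0 (by simp)
    have e : ∀ K : ConvexBody E, supp K 0 = 0 := fun K => by simpa using supp_hom K le_rfl (0:E)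
    rw [e, e] at this; linarith
  refine ⟨p, hp, ?_⟩
  rw [dist_eq_norm]
  by_cases h0 : ‖x - p‖ = 0
  · rw [h0]; exact hε
  have hpos : 0 < ‖x - p‖ := lt_of_le_of_ne (norm_nonneg _) (Ne.symm h0)
  have h2 := h (‖x - p‖⁻¹ • (x - p)) (by rw [norm_smul, norm_inv, norm_norm, inv_mul_cancel₀ h0])
  rw [supp_hom K (by positivity), supp_hom L (by positivity), h1] at h2
  have h3 := le_supp hx (x - p)
  have h4 : ⟪x - p, x⟫_ℝ - ⟪x - p, p⟫_ℝ = ‖x - p‖ * ‖x - p‖ := by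
    rw [← inner_sub_right, real_inner_self_eq_norm_mul_norm]
  have h5 : ‖x - p‖⁻¹ * ⟪x - p, x⟫_ℝ ≤ ‖x - p‖⁻¹ * ⟪x - p, p⟫_ℝ + ε :=
    (mul_le_mul_of_nonneg_left h3 (by positivity)).trans h2
  have h6 : ‖x - p‖⁻¹ * (⟪x - p, x⟫_ℝ - ⟪x - p, p⟫_ℝ) = ‖x - p‖ := by
    rw [h4]; field_simp
  rw [← h6]; linarith

theorem dist_le_of_supp {K L : ConvexBody E} {ε : ℝ} (h : ∀ u, ‖u‖ ≤ 1 → |supp K u - supp L u| ≤ ε) :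
    dist K L ≤ ε := by
  have hε : 0 ≤ ε := (abs_nonneg _).trans (h 0 (by simp))
  apply dist_le_of hε
  · intro x hx
    apply near_of_supp _ hx
    intro u hu
    have := (abs_le.1 (h u hu)).2
    linarith
  · intro x hx
    apply near_of_supp _ hx
    intro u hu
    have := (abs_le.1 (h u hu)).1
    linarith

theorem supp_le_of_dist (K L : ConvexBody E) (u : E) : supp K u ≤ supp L u + dist K L * ‖u‖ := by
  apply supp_le
  intro x hx
  obtain ⟨y, hy, h⟩ := exists_dist_le K L hx
  have h1 : ⟪u, x⟫_ℝ = ⟪u, y⟫_ℝ + ⟪u, x - y⟫_ℝ := by rw [inner_sub_right]; ring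
  have h2 : ⟪u, x - y⟫_ℝ ≤ ‖u‖ * ‖x - y‖ := real_inner_le_norm _ _
  rw [dist_eq_norm] at h
  have h3 := le_supp hy u
  nlinarith [norm_nonneg u]

theorem abs_supp_sub_le (K L : ConvexBody E) (u : E) : |supp K u - supp L u| ≤ dist K L * ‖u‖ := by
  rw [abs_le]
  have h1 := supp_le_of_dist K L u
  have h2 := supp_le_of_dist L K u
  rw [dist_comm L K] at h2
  constructor <;> linarith

theorem ext_supp {K L : ConvexBody E} (h : ∀ u, supp K u = supp L u) : K = L := by
  apply eq_of_dist_eq_zero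
  apply le_antisymm _ dist_nonneg
  apply dist_le_of_supp
  intro u _
  rw [h]; simp

theorem mem_iff_supp {K : ConvexBody E} {x : E} : x ∈ K ↔ ∀ u, ⟪u, x⟫_ℝ ≤ supp K u := by
  constructor
  · intro h u; exact le_supp h u
  · intro h
    obtain ⟨y, hy, h'⟩ := near_of_supp (K := pt x) (L := K) (ε := 0) (by
      intro u _; rw [supp_pt, add_zero]; exact h u) (mem_pt.2 rfl)
    have : x = y := dist_le_zero.1 h'
    rwa [this]

theorem sseg_smul {t : ℝ} (ht : 0 ≤ t) (v : E) : t • sseg v = sseg (t • v) := by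
  apply ext_supp
  intro u
  rw [supp_smul _ ht, supp_sseg, supp_sseg, inner_smul_right, abs_mul, abs_of_nonneg ht]

theorem continuous_supp_left (u : E) : Continuous (fun K : ConvexBody E => supp K u) := by
  apply LipschitzWith.continuous (K := ‖u‖₊)
  apply LipschitzWith.of_dist_le_mul
  intro K L
  rw [Real.dist_eq, coe_nnnorm, mul_comm]
  exact abs_supp_sub_le K L u

theorem exists_bound (K : ConvexBody E) : ∃ C, 0 ≤ C ∧ ∀ x ∈ K, ‖x‖ ≤ C := by
  obtain ⟨C, hC⟩ := K.isCompact.isBounded.exists_norm_le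
  obtain ⟨x, hx⟩ := K.nonempty
  exact ⟨C, (norm_nonneg _).trans (hC x hx), hC⟩

theorem abs_supp_le {K : ConvexBody E} {C : ℝ} (hC : ∀ x ∈ K, ‖x‖ ≤ C) (u : E) : |supp K u| ≤ C * ‖u‖ := by
  obtain ⟨y, hy, h⟩ := exists_supp K u
  rw [← h, mul_comm]
  exact (abs_real_inner_le_norm u y).trans (mul_le_mul_of_nonneg_left (hC y hy) (norm_nonneg _))

theorem continuous_supp (K : ConvexBody E) : Continuous (supp K) := by
  obtain ⟨C, h0, hC⟩ := exists_bound K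
  apply LipschitzWith.continuous (K := ⟨C, h0⟩)
  apply LipschitzWith.of_dist_le_mul
  intro x y
  change |supp K x - supp K y| ≤ C * dist x y
  have h1 := supp_subadd K (x - y) y
  have h2 := supp_subadd K (y - x) x
  have h3 := (abs_le.1 (abs_supp_le hC (x - y))).2
  have h4 := (abs_le.1 (abs_supp_le hC (y - x))).2
  rw [sub_add_cancel] at h1 h2
  rw [norm_sub_rev] at h4
  rw [dist_eq_norm, abs_le]
  constructor <;> linarith

/-- sublinear functions are support functions -/
theorem exists_body [FiniteDimensional ℝ E] {h : E → ℝ} {C : ℝ}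
    (hadd : ∀ x y, h (x + y) ≤ h x + h y) (hom : ∀ t : ℝ, 0 < t → ∀ x, h (t • x) = t * h x)
    (hC : ∀ x, h x ≤ C * ‖x‖) : ∃ K : ConvexBody E, ∀ u, supp K u = h u := by
  have h0 : h 0 = 0 := by have := hom 2 two_pos 0; rw [smul_zero] at this; linarith
  let S : Set E := {x | ∀ u, ⟪u, x⟫_ℝ ≤ h u}
  have ex : ∀ u : E, ∃ x ∈ S, ⟪u, x⟫_ℝ = h u := by
    intro u
    by_cases hu : u = 0
    · subst hu
      obtain ⟨g, -, hg⟩ := exists_extension_of_le_sublinear (⟨⊥, 0⟩ : E →ₗ.[ℝ] ℝ) h hom hadd (by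
        rintro ⟨x, hx⟩
        have : x = 0 := by simpa using hx
        subst this
        simp [h0])
      refine ⟨(InnerProductSpace.toDual ℝ E).symm (LinearMap.toContinuousLinearMap g), ?_, by simp [h0]⟩
      intro u
      rw [real_inner_comm, InnerProductSpace.toDual_symm_apply]
      exact hg u
    · obtain ⟨g, h1, hg⟩ := exists_extension_of_le_sublinear (LinearPMap.mkSpanSingleton u (h u) hu) h hom hadd (by
        rintro ⟨x, hx⟩
        obtain ⟨c, rfl⟩ := Submodule.mem_span_singleton.1 hx
        rw [LinearPMap.mkSpanSingleton'_apply]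
        simp only [smul_eq_mul, RingHom.id_apply]
        rcases lt_trichotomy c 0 with hc | rfl | hc
        · have := hom (-c) (by linarith) (u)
          have h2 := hadd (c • u) (-c • u)
          rw [← add_smul, add_neg_cancel, zero_smul, h0, this] at h2
          linarith
        · simp [h0]
        · rw [hom c hc])
      refine ⟨(InnerProductSpace.toDual ℝ E).symm (LinearMap.toContinuousLinearMap g), ?_, ?_⟩
      · intro u
        rw [real_inner_comm, InnerProductSpace.toDual_symm_apply]
        exact hg u
      · rw [real_inner_comm, InnerProductSpace.toDual_symm_apply]
        have := h1 ⟨u, Submodule.mem_span_singleton_self u⟩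
        have e := LinearPMap.mkSpanSingleton_apply ℝ ℝ (σ := RingHom.id ℝ) hu (h u)
        exact this.trans e
  have hconv : Convex ℝ S := by
    intro x hx y hy s t hs ht hst u
    rw [inner_add_right, inner_smul_right, inner_smul_right]
    have : h u = s * h u + t * h u := by rw [← add_mul, hst, one_mul]
    rw [this]
    exact add_le_add (mul_le_mul_of_nonneg_left (hx u) hs) (mul_le_mul_of_nonneg_left (hy u) ht)
  have hcl : IsClosed S := by
    have : S = ⋂ u, {x | ⟪u, x⟫_ℝ ≤ h u} := by ext x; simp [S]
    rw [this]
    exact isClosed_iInter fun u => isClosed_le (by fun_prop) continuous_const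
  have hbd : Bornology.IsBounded S := by
    apply (isBounded_iff_forall_norm_le).2
    refine ⟨max C 0, fun x hx => ?_⟩
    have h1 := (hx x).trans (hC x)
    rw [real_inner_self_eq_norm_mul_norm] at h1
    by_cases h0 : ‖x‖ = 0
    · rw [h0]; exact le_max_right _ _
    · have : 0 < ‖x‖ := lt_of_le_of_ne (norm_nonneg _) (Ne.symm h0)
      exact le_max_of_le_left (le_of_mul_le_mul_right h1 this)
  let K : ConvexBody E := ⟨S, hconv, Metric.isCompact_of_isClosed_isBounded hcl hbd, by
    obtain ⟨x, hx, -⟩ := ex 0; exact ⟨x, hx⟩⟩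
  refine ⟨K, fun u => le_antisymm (supp_le fun y hy => hy u) ?_⟩
  obtain ⟨x, hx, h⟩ := ex u
  rw [← h]
  exact le_supp (K := K) hx u

end Support

end UV
end

noncomputable section
namespace UV
open Filter Topology

section LemmaJ

open scoped InnerProductSpace

variable {E : Type*} [NormedAddCommGroup E] [InnerProductSpace ℝ E] [FiniteDimensional ℝ E]

/-- support function restricted to the unit ball -/
def HB (K : ConvexBody E) : C(closedBall (0 : E) 1, ℝ) :=
  ⟨fun u => supp K u, (continuous_supp K).comp continuous_subtype_val⟩

instance : CompactSpace (closedBall (0 : E) 1) :=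
  isCompact_iff_compactSpace.1 (isCompact_closedBall 0 1)

theorem norm_HB_sub (K L : ConvexBody E) : dist (HB K) (HB L) = dist K L := by
  apply le_antisymm
  · rw [ContinuousMap.dist_le dist_nonneg]
    intro u
    have hu : ‖(u : E)‖ ≤ 1 := mem_closedBall_zero_iff.1 u.2
    rw [Real.dist_eq]
    refine (abs_supp_sub_le K L u).trans ?_
    exact mul_le_of_le_one_right dist_nonneg hu
  · apply dist_le_of_supp
    intro u hu
    have := ContinuousMap.dist_apply_le_dist (f := HB K) (g := HB L) ⟨u, by simpa using hu⟩
    rwa [Real.dist_eq] at this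

theorem continuous_HB : Continuous (HB : ConvexBody E → _) :=
  (Isometry.of_dist_eq norm_HB_sub).continuous

theorem exists_limit {K : ℕ → ConvexBody E} {f : C(closedBall (0 : E) 1, ℝ)}
    (h : Tendsto (fun n => HB (K n)) atTop (𝓝 f)) :
    ∃ L, HB L = f ∧ Tendsto K atTop (𝓝 L) := by
  have hx : ∀ x : E, ∃ c, Tendsto (fun n => supp (K n) x) atTop (𝓝 c) ∧ c ≤ ‖f‖ * ‖x‖ := by
    intro x
    by_cases h0 : x = 0
    · subst h0
      refine ⟨0, ?_, by simp⟩
      have : ∀ n, supp (K n) 0 = 0 := fun n => by simpa using supp_hom (K n) le_rfl (0:E)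
      simp [this]
    · have hn : ‖x‖ ≠ 0 := norm_ne_zero_iff.2 h0
      have hm : ‖x‖⁻¹ • x ∈ closedBall (0:E) 1 := by
        simp [norm_smul, inv_mul_cancel₀ hn]
      refine ⟨‖x‖ * f ⟨_, hm⟩, ?_, ?_⟩
      · have h1 : Tendsto (fun n => HB (K n) ⟨_, hm⟩) atTop (𝓝 (f ⟨_, hm⟩)) :=
          ((continuous_eval_const _).tendsto f).comp h
        have h2 := h1.const_mul ‖x‖
        refine h2.congr fun n => ?_
        change ‖x‖ * supp (K n) (‖x‖⁻¹ • x) = _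
        rw [supp_hom _ (by positivity), ← mul_assoc, mul_inv_cancel₀ hn, one_mul]
      · rw [mul_comm]
        exact mul_le_mul_of_nonneg_right ((le_abs_self _).trans (f.norm_coe_le_norm _)) (norm_nonneg _)
  choose h' h1 h2 using hx
  obtain ⟨L, hL⟩ := exists_body (h := h') (C := ‖f‖) (fun x y => le_of_tendsto_of_tendsto' (h1 _)
      ((h1 x).add (h1 y)) fun n => supp_subadd _ _ _) (fun t ht x =>
      tendsto_nhds_unique (h1 _) (((h1 x).const_mul t).congr fun n => (supp_hom _ ht.le _).symm)) h2
  have e : HB L = f := by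
    ext u
    refine tendsto_nhds_unique ((h1 u).trans ?_) (((continuous_eval_const u).tendsto f).comp h)
    change 𝓝 _ ≤ 𝓝 (supp L u)
    rw [hL]
  refine ⟨L, e, ?_⟩
  rw [tendsto_iff_dist_tendsto_zero] at h ⊢
  refine h.congr fun n => ?_
  rw [← e, norm_HB_sub]

theorem HB_add (K L : ConvexBody E) : HB (K + L) = HB K + HB L := by
  ext u; exact supp_add K L u
theorem HB_smul (K : ConvexBody E) {t : ℝ} (ht : 0 ≤ t) : HB (t • K) = t • HB K := by
  ext u; exact supp_smul K ht u

theorem supp_of_ball {K : ConvexBody E} {F : E → ℝ} (hF : ∀ t : ℝ, 0 ≤ t → ∀ x, F (t • x) = t * F x)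
    (h : ∀ u, ‖u‖ ≤ 1 → supp K u = F u) (x : E) : supp K x = F x := by
  by_cases h0 : x = 0
  · subst h0; exact h 0 (by simp)
  have hn : ‖x‖ ≠ 0 := norm_ne_zero_iff.2 h0
  have h1 := h (‖x‖⁻¹ • x) (by simp [norm_smul, inv_mul_cancel₀ hn])
  rw [supp_hom _ (by positivity), hF _ (by positivity)] at h1
  exact mul_left_cancel₀ (inv_ne_zero hn) h1

/-- integrals of bodies -/
theorem integral_body {C : Set (ConvexBody E)} (hC : IsClosed C) (h0 : (0 : ConvexBody E) ∈ C)
    (hadd : ∀ A ∈ C, ∀ B ∈ C, A + B ∈ C) (hsm : ∀ t : ℝ, 0 ≤ t → ∀ A ∈ C, t • A ∈ C)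
    {Φ : ConvexBody E → ℂ} (hΦ : Continuous Φ) (hΦa : ∀ A ∈ C, ∀ B ∈ C, Φ (A + B) = Φ A + Φ B)
    (hΦs : ∀ t : ℝ, 0 ≤ t → ∀ A ∈ C, Φ (t • A) = t * Φ A)
    {X : Type*} [TopologicalSpace X] [SecondCountableTopology X] [MeasurableSpace X]
    [OpensMeasurableSpace X] {ρ : Measure X} [IsFiniteMeasure ρ] {A : X → ConvexBody E}
    (hA : Continuous A) (hAC : ∀ x, A x ∈ C) {g : X → ℝ} (hg : Integrable g ρ)
    (hb : ∀ x u, |supp (A x) u| ≤ g x * ‖u‖) (hi : Integrable (fun x => Φ (A x)) ρ) :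
    ∃ Z ∈ C, (∀ u, supp Z u = ∫ x, supp (A x) u ∂ρ) ∧ Φ Z = ∫ x, Φ (A x) ∂ρ := by
  let S : Set (C(closedBall (0 : E) 1, ℝ) × ℂ) := (fun K => (HB K, Φ K)) '' C
  have hS : Convex ℝ S := by
    rintro _ ⟨K, hK, rfl⟩ _ ⟨L, hL, rfl⟩ s t hs ht _
    refine ⟨s • K + t • L, hadd _ (hsm s hs _ hK) _ (hsm t ht _ hL), ?_⟩
    ext1
    · simp [HB_add, HB_smul _ hs, HB_smul _ ht]
    · simp [hΦa _ (hsm s hs _ hK) _ (hsm t ht _ hL), hΦs s hs _ hK, hΦs t ht _ hL]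
  have hcl : IsClosed S := by
    apply IsSeqClosed.isClosed
    intro x p hx hp
    choose K hK hKx using hx
    have h1 : Tendsto (fun n => HB (K n)) atTop (𝓝 p.1) := by
      have := (continuous_fst.tendsto p).comp hp
      refine this.congr fun n => ?_
      simp [← hKx]
    obtain ⟨L, hL, hKL⟩ := exists_limit h1
    refine ⟨L, hC.mem_of_tendsto hKL (Eventually.of_forall hK), ?_⟩
    ext1
    · exact hL
    · refine tendsto_nhds_unique ((hΦ.tendsto L).comp hKL) ?_
      have := (continuous_snd.tendsto p).comp hp
      refine this.congr fun n => ?_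
      simp [← hKx]
  have hint1 : Integrable (fun x => HB (A x)) ρ := by
    refine hg.abs.mono' (continuous_HB.comp hA).aestronglyMeasurable (Eventually.of_forall fun x => ?_)
    rw [ContinuousMap.norm_le _ (abs_nonneg _)]
    intro u
    have hu : ‖(u : E)‖ ≤ 1 := mem_closedBall_zero_iff.1 u.2
    exact ((hb x u).trans (mul_le_mul_of_nonneg_right (le_abs_self _) (norm_nonneg _))).trans
      (mul_le_of_le_one_right (abs_nonneg _) hu)
  have hIntegr : Integrable (fun x => (HB (A x), Φ (A x))) ρ := hint1.prodMk hi
  have key : ∃ Z ∈ C, (HB Z, Φ Z) = ∫ x, (HB (A x), Φ (A x)) ∂ρ := by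
    by_cases hρ : ρ = 0
    · refine ⟨0, h0, ?_⟩
      have e : HB (0 : ConvexBody E) = 0 := by ext u; exact supp_zero _
      have e' : Φ 0 = 0 := by
        have := hΦs 0 le_rfl 0 h0
        simpa using this
      rw [hρ, integral_zero_measure, e, e']; rfl
    · haveI : NeZero ρ := ⟨hρ⟩
      have := hS.average_mem hcl (Eventually.of_forall fun x => ⟨A x, hAC x, rfl⟩) hIntegr
      obtain ⟨Z, hZ, h⟩ := this
      refine ⟨(ρ.real univ) • Z, hsm _ (by positivity) _ hZ, ?_⟩
      have h2 := congrArg (fun z => (ρ.real univ) • z) h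
      simp only [average_eq, Prod.smul_mk, smul_smul] at h2
      rw [mul_inv_cancel₀, one_smul] at h2
      · rw [← h2, HB_smul _ (by positivity), hΦs _ (by positivity) _ hZ]
        simp
      · exact (measureReal_ne_zero_iff (measure_ne_top ρ _)).2 (by simpa using hρ)
  obtain ⟨Z, hZ, h⟩ := key
  refine ⟨Z, hZ, ?_, ?_⟩
  · apply supp_of_ball
    · intro t ht x
      rw [← integral_const_mul]
      exact integral_congr_ae (Eventually.of_forall fun y => supp_hom _ ht _)
    · intro u hu
      have h1 := congrArg Prod.fst h
      rw [fst_integral hIntegr] at h1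
      have h2 := congrArg (fun F : C(closedBall (0 : E) 1, ℝ) => F ⟨u, by simpa using hu⟩) h1
      simp only at h2
      rw [ContinuousMap.integral_apply hint1] at h2
      exact h2
  · have h1 := congrArg Prod.snd h
    rw [snd_integral hIntegr] at h1
    exact h1

end LemmaJ

end UV
end

noncomputable section
namespace UV
open Filter Topology

section CosTransform

open scoped InnerProductSpace FourierTransform SchwartzMap ContDiff
open Real (cos)

def kern (s : ℝ) : ℝ := (1 - cos s) / s ^ 2

theorem kern_nonneg (s : ℝ) : 0 ≤ kern s :=
  div_nonneg (sub_nonneg.2 (Real.cos_le_one s)) (sq_nonneg s)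

theorem kern_meas : Measurable kern := by unfold kern; fun_prop

theorem kern_int : Integrable kern := by
  refine (integrable_inv_one_add_sq.const_mul (5/2)).mono' kern_meas.aestronglyMeasurable
    (Eventually.of_forall fun s => ?_)
  rw [Real.norm_of_nonneg (kern_nonneg s), kern]
  by_cases h : s = 0
  · subst h; norm_num
  have h2 : 0 < s ^ 2 := by positivity
  rw [← div_eq_mul_inv, div_le_div_iff₀ h2 (by positivity)]
  have h3 := Real.one_sub_sq_div_two_le_cos (x := s)
  have h4 := Real.neg_one_le_cos s
  nlinarith

def kC : ℝ := ∫ s in Ioi 0, kern s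

theorem kC_pos : 0 < kC := by
  unfold kC
  rw [integral_pos_iff_support_of_nonneg_ae (Eventually.of_forall kern_nonneg) kern_int.integrableOn]
  refine lt_of_lt_of_le ?_ (measure_mono (s := Ioo 0 1) ?_)
  · rw [Measure.restrict_apply measurableSet_Ioo, inter_eq_left.2 Ioo_subset_Ioi_self]; simp
  · intro s hs
    rw [Function.mem_support, kern]
    have : cos s < 1 := by
      have := Real.cos_lt_cos_of_nonneg_of_le_pi le_rfl (by linarith [hs.2, Real.pi_gt_three]) hs.1
      rwa [Real.cos_zero] at this
    have h1 := hs.1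
    have : 0 < 1 - cos s := by linarith
    positivity

theorem kern_scale (a s : ℝ) : (1 - cos (a * s)) / s ^ 2 = a ^ 2 * kern (|a| * s) := by
  by_cases h : a = 0
  · subst h; simp
  · rw [kern]
    have : cos (|a| * s) = cos (a * s) := by
      rcases abs_choice a with h | h <;> rw [h]
      rw [neg_mul, Real.cos_neg]
    rw [this, mul_pow, sq_abs, ← mul_div_assoc, mul_div_mul_left _ _ (by positivity)]

theorem kern_scale_int (a : ℝ) : IntegrableOn (fun s => (1 - cos (a * s)) / s ^ 2) (Ioi 0) := by
  simp_rw [kern_scale]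
  by_cases h : a = 0
  · subst h; simp
  · apply Integrable.const_mul
    have := (integrableOn_Ioi_comp_mul_left_iff kern 0 (abs_pos.2 h)).2 (by
      simpa using kern_int.integrableOn)
    exact this

theorem kern_scale_integral (a : ℝ) : ∫ s in Ioi 0, (1 - cos (a * s)) / s ^ 2 = kC * |a| := by
  simp_rw [kern_scale]
  by_cases h : a = 0
  · subst h; simp
  · rw [integral_const_mul, integral_comp_mul_left_Ioi kern 0 (abs_pos.2 h), mul_zero, kC, smul_eq_mul,
      ← sq_abs]
    have := abs_pos.2 h
    field_simp

variable {E : Type*} [NormedAddCommGroup E] [InnerProductSpace ℝ E] [FiniteDimensional ℝ E]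
  [MeasurableSpace E] [BorelSpace E]

/-- a smooth even real function with compact support is a cosine integral -/
theorem exists_cos_rep {Q : E → ℝ} (hQ : ContDiff ℝ ∞ Q) (hc : HasCompactSupport Q)
    (hev : ∀ x, Q (-x) = Q x) : ∃ r : E → ℝ, Continuous r ∧ Integrable r ∧
      Integrable (fun w => ‖w‖ * |r w|) ∧
      ∀ y, Q y = ∫ w, cos (2 * Real.pi * ⟪w, y⟫_ℝ) * r w := by
  have hc' : HasCompactSupport (fun x => (Q x : ℂ)) := hc.comp_left (g := fun x : ℝ => (x : ℂ)) (by simp)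
  have hQ' : ContDiff ℝ ∞ (fun x => (Q x : ℂ)) := Complex.ofRealCLM.contDiff.comp hQ
  let S : 𝓢(E, ℂ) := hc'.toSchwartzMap hQ'
  let q : 𝓢(E, ℂ) := 𝓕⁻ S
  have hqi : Integrable q := q.integrable
  have hS : ∀ y, (Q y : ℂ) = ∫ w, 𝐞 (-⟪w, y⟫_ℝ) • q w := by
    intro y
    have h1 : 𝓕 q = S := FourierTransform.fourier_fourierInv_eq S
    have h2 : 𝓕 (q : E → ℂ) y = S y := by rw [← SchwartzMap.fourier_coe, h1]
    rw [Real.fourier_eq] at h2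
    exact h2.symm
  refine ⟨fun w => (q w).re, Complex.continuous_re.comp q.continuous, hqi.re, ?_, ?_⟩
  · have := q.integrable_pow_mul volume 1
    refine this.mono' ?_ (Eventually.of_forall fun w => ?_)
    · exact (continuous_norm.mul (Complex.continuous_re.comp q.continuous).abs).aestronglyMeasurable
    · rw [pow_one, Real.norm_of_nonneg (by positivity)]
      exact mul_le_mul_of_nonneg_left (Complex.abs_re_le_norm _) (norm_nonneg _)
  · intro y
    have hexp : ∀ w, (𝐞 (-⟪w, y⟫_ℝ) • q w).re + (𝐞 (-⟪w, -y⟫_ℝ) • q w).re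
        = 2 * (cos (2 * Real.pi * ⟪w, y⟫_ℝ) * (q w).re) := by
      intro w
      simp only [Circle.smul_def, Real.fourierChar_apply, smul_eq_mul, Complex.mul_re, inner_neg_right, neg_neg]
      simp only [Complex.exp_ofReal_mul_I_re, Complex.exp_ofReal_mul_I_im, mul_neg, Real.cos_neg, Real.sin_neg]
      ring
    have hi : ∀ y : E, Integrable (fun w => 𝐞 (-⟪w, y⟫_ℝ) • q w) := by
      intro y
      refine hqi.norm.mono' ?_ (Eventually.of_forall fun w => ?_)
      · apply Continuous.aestronglyMeasurable
        have := Real.continuous_fourierChar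
        have := q.continuous
        fun_prop
      · simp
    have hre : ∀ y, Q y = ∫ w, (𝐞 (-⟪w, y⟫_ℝ) • q w).re := by
      intro y
      have := congrArg Complex.re (hS y)
      rw [Complex.ofReal_re] at this
      rw [this]
      exact (integral_re (hi y)).symm
    have h3 : 2 * Q y = 2 * ∫ w, cos (2 * Real.pi * ⟪w, y⟫_ℝ) * (q w).re := by
      rw [← integral_const_mul]
      simp_rw [← hexp]
      refine Eq.trans ?_ (integral_add (hi y).re (hi (-y)).re).symm
      rw [two_mul]
      congr 1
      · exact hre y
      · rw [← hev]; exact hre (-y)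
    linarith

theorem cos_rep_hom {Q : E → ℝ} {r : E → ℝ} (hr : Continuous r) (hri : Integrable r)
    (hrn : Integrable (fun w => ‖w‖ * |r w|))
    (hrep : ∀ y, Q y = ∫ w, cos (2 * Real.pi * ⟪w, y⟫_ℝ) * r w) (hQ0 : Q 0 = 0) (x : E) :
    ∫ s in Ioi (0:ℝ), Q (s • x) / s ^ 2 = - (kC * (2 * Real.pi) * ∫ w, |⟪x, w⟫_ℝ| * r w) := by
  have h0 : ∫ w, r w = 0 := by
    have := hrep 0
    simpa [hQ0] using this.symm
  have h1 : ∀ s : ℝ, Q (s • x) / s ^ 2 = 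
      - ∫ w, (1 - cos ((2 * Real.pi * ⟪w, x⟫_ℝ) * s)) / s ^ 2 * r w := by
    intro s
    have e : ∀ w, (1 - cos ((2 * Real.pi * ⟪w, x⟫_ℝ) * s)) / s ^ 2 * r w
      = (r w - cos (2 * Real.pi * ⟪w, s • x⟫_ℝ) * r w) / s ^ 2 := by
      intro w
      rw [inner_smul_right]
      have : 2 * Real.pi * ⟪w, x⟫_ℝ * s = 2 * Real.pi * (s * ⟪w, x⟫_ℝ) := by ring
      rw [this]; ring
    simp_rw [e]
    rw [integral_div, integral_sub hri, ← hrep, h0]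
    · ring
    · refine hri.norm.mono' ?_ (Eventually.of_forall fun w => ?_)
      · apply Continuous.aestronglyMeasurable; fun_prop
      · rw [norm_mul]
        exact mul_le_of_le_one_left (norm_nonneg _) (Real.abs_cos_le_one _)
  simp_rw [h1]
  rw [integral_neg, integral_integral_swap]
  · simp_rw [integral_mul_const, kern_scale_integral]
    rw [← integral_const_mul]
    congr 2
    ext w
    rw [abs_mul, abs_of_pos (by positivity), real_inner_comm]
    ring
  · rw [integrable_prod_iff']
    · simp only [Function.uncurry]
      refine ⟨Eventually.of_forall fun w => ?_, ?_⟩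
      · exact Integrable.mul_const (kern_scale_int (2 * Real.pi * ⟪w, x⟫_ℝ)) (r w)
      · have e : ∀ w, ∫ s in Ioi (0:ℝ), ‖(1 - cos ((2 * Real.pi * ⟪w, x⟫_ℝ) * s)) / s ^ 2 * r w‖
          = kC * |2 * Real.pi * ⟪w, x⟫_ℝ| * |r w| := by
          intro w
          rw [← kern_scale_integral, ← integral_mul_const]
          congr 1
          ext s
          rw [norm_mul, Real.norm_of_nonneg, Real.norm_eq_abs]
          exact div_nonneg (sub_nonneg.2 (Real.cos_le_one _)) (sq_nonneg s)
        simp_rw [e]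
        refine (hrn.const_mul (kC * (2 * Real.pi) * ‖x‖)).mono' ?_ (Eventually.of_forall fun w => ?_)
        · apply Continuous.aestronglyMeasurable; fun_prop
        · have := kC_pos
          have h5 := abs_real_inner_le_norm w x
          rw [Real.norm_of_nonneg (by positivity), abs_mul, abs_of_pos (a := 2 * Real.pi) (by positivity)]
          calc kC * (2 * Real.pi * |⟪w, x⟫_ℝ|) * |r w| ≤ kC * (2 * Real.pi * (‖w‖ * ‖x‖)) * |r w| := by gcongr
            _ = _ := by ring
    · apply Measurable.aestronglyMeasurable
      have := hr.measurable
      unfold Function.uncurry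
      fun_prop

end CosTransform

end UV
end

noncomputable section
namespace UV
open Filter Topology

section LemmaS

open scoped InnerProductSpace ContDiff NNReal
open Real (cos)

variable {E : Type*} [NormedAddCommGroup E] [InnerProductSpace ℝ E] [FiniteDimensional ℝ E]

/-- classes of bodies to which Lemma S applies -/
structure IsClass (N : Set (ConvexBody E)) : Prop where
  closed : IsClosed N
  add : ∀ A ∈ N, ∀ B ∈ N, A + B ∈ N
  smul : ∀ t : ℝ, 0 ≤ t → ∀ A ∈ N, t • A ∈ N
  seg : ∀ v, sseg v ∈ N
  cancel : ∀ A B, A + B ∈ N → B ∈ N → A ∈ N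

theorem sseg_zero : sseg (0 : E) = 0 := by
  apply ext_supp; intro u; rw [supp_sseg, supp_zero]; simp

theorem IsClass.zero {N : Set (ConvexBody E)} (hN : IsClass N) : (0 : ConvexBody E) ∈ N := by
  rw [← sseg_zero]; exact hN.seg 0

theorem IsClass.zonoid [MeasurableSpace E] [BorelSpace E] {N : Set (ConvexBody E)} (hN : IsClass N)
    {f : E → ℝ≥0} (hf : Measurable f) (h1 : Integrable (fun w => (f w : ℝ)))
    (h2 : Integrable (fun w => (f w : ℝ) * ‖w‖)) :
    ∃ Z ∈ N, ∀ u, supp Z u = ∫ w, (f w : ℝ) * |⟪u, w⟫_ℝ| := by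
  haveI : IsFiniteMeasure (volume.withDensity (fun w => (f w : ℝ≥0∞))) := by
    apply isFiniteMeasure_withDensity
    have := h1.hasFiniteIntegral
    rw [hasFiniteIntegral_iff_ofReal (Eventually.of_forall fun w => (f w).coe_nonneg)] at this
    simpa using this.ne
  obtain ⟨Z, hZ, h, -⟩ := integral_body (C := N) hN.closed hN.zero hN.add hN.smul
    (Φ := fun _ => 0) continuous_const (by simp) (by simp)
    (ρ := volume.withDensity (fun w => (f w : ℝ≥0∞)))
    (A := sseg) continuous_sseg hN.seg (g := fun w => ‖w‖)
    (by
      rw [integrable_withDensity_iff_integrable_smul hf]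
      exact h2)
    (by
      intro w u
      rw [supp_sseg, abs_abs, mul_comm]
      exact abs_real_inner_le_norm u w)
    (by simp)
  refine ⟨Z, hZ, fun u => ?_⟩
  rw [h, integral_withDensity_eq_integral_smul hf]
  simp_rw [supp_sseg]
  rfl

def chi : ContDiffBump (3/2 : ℝ) := ⟨1/4, 1/2, by norm_num, by norm_num⟩

theorem chi_supp {s : ℝ} (h : chi s ≠ 0) : 1 < s ∧ s < 2 := by
  have : s ∈ Function.support chi := h
  rw [ContDiffBump.support_eq, Real.ball_eq_Ioo] at this
  norm_num [chi] at this
  exact this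

def chg (s : ℝ) : ℝ := chi (s ^ 2) / s

theorem chg_int : IntegrableOn chg (Ioi 0) := by
  have hm : Measurable chg := by
    have := (chi.continuous).measurable
    unfold chg; fun_prop
  have : Integrable ((Icc (1/2:ℝ) 2).indicator (fun _ => (2:ℝ))) := by
    rw [integrable_indicator_iff measurableSet_Icc]
    exact integrableOn_const (by simp)
  refine this.integrableOn.mono' hm.aestronglyMeasurable ?_
  filter_upwards [ae_restrict_mem measurableSet_Ioi] with s hs
  have hs : 0 < s := hs
  by_cases h : chi (s ^ 2) = 0
  · rw [chg, h, zero_div, norm_zero]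
    exact indicator_nonneg (by simp) _
  · obtain ⟨h1, h2⟩ := chi_supp h
    have h3 : 1/2 < s := by nlinarith
    have h4 : s < 2 := by nlinarith
    rw [indicator_of_mem (show s ∈ Icc (1/2:ℝ) 2 from ⟨h3.le, h4.le⟩), chg, Real.norm_of_nonneg (div_nonneg chi.nonneg hs.le), div_le_iff₀ hs]
    have := chi.le_one (x := s ^ 2)
    linarith

def chC : ℝ := ∫ s in Ioi 0, chg s

theorem chC_pos : 0 < chC := by
  unfold chC
  have h0 : ∀ᵐ s ∂(volume.restrict (Ioi (0:ℝ))), 0 ≤ chg s := by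
    filter_upwards [ae_restrict_mem measurableSet_Ioi] with s hs
    exact div_nonneg chi.nonneg (le_of_lt hs)
  rw [integral_pos_iff_support_of_nonneg_ae h0 chg_int]
  refine lt_of_lt_of_le ?_ (measure_mono (s := Ioo 1.2 1.3) ?_)
  · rw [Measure.restrict_apply measurableSet_Ioo, inter_eq_left.2 
      (show Ioo (1.2:ℝ) 1.3 ⊆ Ioi 0 from fun x hx => lt_trans (by norm_num) hx.1)]
    norm_num
  · intro s hs
    have h1 := hs.1
    have h2 := hs.2
    rw [Function.mem_support, chg]
    have : 0 < chi (s ^ 2) := by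
      apply chi.pos_of_mem_ball
      rw [Real.ball_eq_Ioo]
      simp only [chi]
      constructor <;> nlinarith
    have : 0 < s := by linarith
    positivity

theorem chg_scale {a : ℝ} (ha : 0 < a) : ∫ s in Ioi (0:ℝ), chi (s ^ 2 * a ^ 2) / s = chC := by
  have : ∀ s, chi (s ^ 2 * a ^ 2) / s = a * chg (a * s) := by
    intro s
    rw [chg, mul_pow, mul_comm (s^2)]
    by_cases h : s = 0
    · subst h; simp
    · field_simp
  simp_rw [this]
  rw [integral_const_mul, integral_comp_mul_left_Ioi chg 0 ha, mul_zero, chC, smul_eq_mul, 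
    mul_inv_cancel_left₀ ha.ne']

theorem IsClass.smooth {N : Set (ConvexBody E)} (hN : IsClass N) {M : ConvexBody E}
    (hs : ∀ x : E, x ≠ 0 → ContDiffAt ℝ ∞ (supp M) x) (hev : ∀ x, supp M (-x) = supp M x) : M ∈ N := by
  borelize E
  let Q : E → ℝ := fun x => supp M x * chi (‖x‖ ^ 2)
  have hz : ∀ x : E, ‖x‖ < 1 → chi (‖x‖ ^ 2) = 0 := by
    intro x hx
    by_contra h
    have := (chi_supp h).1
    nlinarith [norm_nonneg x]
  have hQs : ContDiff ℝ ∞ Q := by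
    rw [contDiff_iff_contDiffAt]
    intro x
    by_cases hx : x = 0
    · subst hx
      have : Q =ᶠ[𝓝 0] fun _ => 0 := by
        filter_upwards [ball_mem_nhds (0:E) one_pos] with y hy
        simp only [Q]
        rw [hz y (by simpa using hy), mul_zero]
      exact contDiffAt_const.congr_of_eventuallyEq this
    · refine (hs x hx).mul ?_
      have h1 : ContDiff ℝ ∞ (fun x : E => ‖x‖ ^ 2) := contDiff_norm_sq ℝ
      have h2 : ContDiff ℝ ∞ (chi : ℝ → ℝ) := chi.contDiff
      exact (h2.comp h1).contDiffAt
  have hQc : HasCompactSupport Q := by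
    apply HasCompactSupport.intro (isCompact_closedBall (0:E) 2)
    intro x hx
    have hx : 2 < ‖x‖ := by simpa using hx
    have : chi (‖x‖ ^ 2) = 0 := by
      by_contra h
      have := (chi_supp h).2
      nlinarith [norm_nonneg x]
    simp [Q, this]
  have hQe : ∀ x, Q (-x) = Q x := by intro x; simp [Q, hev]
  obtain ⟨r, hr, hri, hrn, hrep⟩ := exists_cos_rep hQs hQc hQe
  have hQ0 : Q 0 = 0 := by simp only [Q]; rw [hz 0 (by simp), mul_zero]
  have key : ∀ x, chC * supp M x = -(kC * (2 * Real.pi) * ∫ w, |⟪x, w⟫_ℝ| * r w) := by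
    intro x
    rw [← cos_rep_hom hr hri hrn hrep hQ0 x]
    by_cases hx : x = 0
    · subst hx
      have : supp M 0 = 0 := by simpa using supp_hom M le_rfl (0:E)
      simp [this, hQ0]
    rw [← chg_scale (norm_pos_iff.2 hx), ← integral_mul_const]
    apply setIntegral_congr_fun measurableSet_Ioi
    intro s hs
    have hs : 0 < s := hs
    simp only [Q]
    rw [supp_hom _ hs.le, norm_smul, Real.norm_of_nonneg hs.le, mul_pow]
    field_simp
  have hr1 : ∀ w, r w = (r w).toNNReal - ((-r w).toNNReal : ℝ) := by
    intro w
    rw [Real.coe_toNNReal', Real.coe_toNNReal']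
    rcases le_total 0 (r w) with h | h
    · rw [max_eq_left h, max_eq_right (by linarith)]; ring
    · rw [max_eq_right h, max_eq_left (by linarith)]; ring
  have hb1 : ∀ w, ((r w).toNNReal : ℝ) ≤ |r w| := fun w => by
    rw [Real.coe_toNNReal']; exact max_le (le_abs_self _) (abs_nonneg _)
  have hb2 : ∀ w, ((-r w).toNNReal : ℝ) ≤ |r w| := fun w => by
    rw [Real.coe_toNNReal']; exact max_le (neg_le_abs _) (abs_nonneg _)
  have hm1 : Measurable (fun w => (r w).toNNReal) := hr.measurable.real_toNNReal
  have hm2 : Measurable (fun w => (-r w).toNNReal) := hr.measurable.neg.real_toNNReal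
  have ia : ∀ f : E → ℝ≥0, Measurable f → (∀ w, (f w : ℝ) ≤ |r w|) → Integrable (fun w => (f w : ℝ)) := by
    intro f hf h
    refine hri.abs.mono' hf.coe_nnreal_real.aestronglyMeasurable (Eventually.of_forall fun w => ?_)
    rw [Real.norm_of_nonneg (f w).coe_nonneg]; exact h w
  have ib : ∀ f : E → ℝ≥0, Measurable f → (∀ w, (f w : ℝ) ≤ |r w|) → Integrable (fun w => (f w : ℝ) * ‖w‖) := by
    intro f hf h
    refine hrn.mono' (hf.coe_nnreal_real.mul measurable_norm).aestronglyMeasurable (Eventually.of_forall fun w => ?_)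
    rw [Real.norm_of_nonneg (mul_nonneg (f w).coe_nonneg (norm_nonneg _)), mul_comm]
    exact mul_le_mul_of_nonneg_left (h w) (norm_nonneg _)
  have ic : ∀ f : E → ℝ≥0, Measurable f → (∀ w, (f w : ℝ) ≤ |r w|) → ∀ x : E,
      Integrable (fun w => (f w : ℝ) * |⟪x, w⟫_ℝ|) := by
    intro f hf h x
    refine ((ib f hf h).const_mul ‖x‖).mono' ?_ (Eventually.of_forall fun w => ?_)
    · have := hf.coe_nnreal_real
      apply Measurable.aestronglyMeasurable
      have h2 : Continuous (fun w : E => |⟪x, w⟫_ℝ|) := by fun_prop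
      exact this.mul h2.measurable
    · rw [Real.norm_of_nonneg (mul_nonneg (f w).coe_nonneg (abs_nonneg _))]
      have := mul_le_mul_of_nonneg_left (abs_real_inner_le_norm x w) (f w).coe_nonneg
      refine this.trans (le_of_eq ?_)
      ring
  obtain ⟨Z1, hZ1, hs1⟩ := hN.zonoid hm1 (ia _ hm1 hb1) (ib _ hm1 hb1)
  obtain ⟨Z2, hZ2, hs2⟩ := hN.zonoid hm2 (ia _ hm2 hb2) (ib _ hm2 hb2)
  have hk : 0 ≤ kC * (2 * Real.pi) := by have := kC_pos; positivity
  have e : chC • M + (kC * (2 * Real.pi)) • Z1 = (kC * (2 * Real.pi)) • Z2 := by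
    apply ext_supp
    intro u
    rw [supp_add, supp_smul _ chC_pos.le, supp_smul _ hk, supp_smul _ hk, key, hs1, hs2]
    have : ∫ w, |⟪u, w⟫_ℝ| * r w = (∫ w, ((r w).toNNReal : ℝ) * |⟪u, w⟫_ℝ|) - 
        ∫ w, ((-r w).toNNReal : ℝ) * |⟪u, w⟫_ℝ| := by
      rw [← integral_sub (ic _ hm1 hb1 u) (ic _ hm2 hb2 u)]
      congr 1
      ext w
      rw [← sub_mul, ← hr1, mul_comm]
    rw [this]; ring
  have h1 : chC • M ∈ N := hN.cancel _ _ (by rw [e]; exact hN.smul _ hk _ hZ2) (hN.smul _ hk _ hZ1)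
  have h2 := hN.smul chC⁻¹ (inv_nonneg.2 chC_pos.le) _ h1
  have : chC⁻¹ • chC • M = M := by
    apply ext_supp
    intro u
    rw [supp_smul _ (inv_nonneg.2 chC_pos.le), supp_smul _ chC_pos.le, inv_mul_cancel_left₀ chC_pos.ne']
  rwa [this] at h2

end LemmaS

end UV
end

noncomputable section
namespace UV
open Filter Topology

section LemmaS2

open scoped InnerProductSpace ContDiff NNReal

variable {E : Type*} [NormedAddCommGroup E] [InnerProductSpace ℝ E] [FiniteDimensional ℝ E]

/-- the `2p`-norm support function -/
def lph (T : Finset E) (p : ℕ) (x : E) : ℝ := (∑ v ∈ T, ⟪x, v⟫_ℝ ^ (2 * p)) ^ (1 / ((2 * p : ℕ) : ℝ))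

theorem lph_eq (T : Finset E) (p : ℕ) (x : E) :
    lph T p x = (∑ v ∈ T, |⟪x, v⟫_ℝ| ^ (((2 * p : ℕ) : ℝ))) ^ (1 / ((2 * p : ℕ) : ℝ)) := by
  simp_rw [Real.rpow_natCast, (even_two_mul p).pow_abs]; rfl

theorem lph_sub (T : Finset E) {p : ℕ} (hp : 1 ≤ p) (x y : E) : lph T p (x + y) ≤ lph T p x + lph T p y := by
  rw [lph_eq, lph_eq, lph_eq]
  simp_rw [inner_add_left]
  apply Real.Lp_add_le
  exact_mod_cast (by omega : 1 ≤ 2 * p)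

theorem lph_nonneg_sum (T : Finset E) (p : ℕ) (x : E) : 0 ≤ ∑ v ∈ T, ⟪x, v⟫_ℝ ^ (2 * p) :=
  Finset.sum_nonneg fun v _ => (even_two_mul p).pow_nonneg _

theorem pow_root {p : ℕ} (hp : 1 ≤ p) {a : ℝ} (ha : 0 ≤ a) : (a ^ (2 * p)) ^ (1 / ((2 * p : ℕ) : ℝ)) = a := by
  rw [one_div, Real.pow_rpow_inv_natCast ha (by omega)]

theorem lph_hom (T : Finset E) {p : ℕ} (hp : 1 ≤ p) (t : ℝ) (ht : 0 < t) (x : E) :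
    lph T p (t • x) = t * lph T p x := by
  unfold lph
  simp_rw [real_inner_smul_left, mul_pow]
  rw [← Finset.mul_sum, Real.mul_rpow (by positivity) (lph_nonneg_sum T p x), pow_root hp ht.le]

theorem le_lph {T : Finset E} {p : ℕ} (hp : 1 ≤ p) {v : E} (hv : v ∈ T) (x : E) : |⟪x, v⟫_ℝ| ≤ lph T p x := by
  rw [← pow_root hp (abs_nonneg ⟪x, v⟫_ℝ), (even_two_mul p).pow_abs]
  apply Real.rpow_le_rpow ((even_two_mul p).pow_nonneg _) _ (by positivity)
  exact Finset.single_le_sum (f := fun v => ⟪x, v⟫_ℝ ^ (2 * p)) (fun v _ => (even_two_mul p).pow_nonneg _) hv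

theorem lph_le {T : Finset E} {p : ℕ} (hp : 1 ≤ p) {x : E} {B : ℝ} (hB0 : 0 ≤ B) (hB : ∀ v ∈ T, |⟪x, v⟫_ℝ| ≤ B) :
    lph T p x ≤ (T.card : ℝ) ^ (1 / ((2 * p : ℕ) : ℝ)) * B := by
  rw [← pow_root hp hB0, ← Real.mul_rpow (by positivity) (by positivity)]
  apply Real.rpow_le_rpow (lph_nonneg_sum T p x) _ (by positivity)
  rw [← nsmul_eq_mul]
  apply Finset.sum_le_card_nsmul
  intro v hv
  rw [← (even_two_mul p).pow_abs]
  exact pow_le_pow_left₀ (abs_nonneg _) (hB v hv) _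

theorem lph_smooth {T : Finset E} {p : ℕ} (hp : 1 ≤ p) (hT : ∀ x : E, x ≠ 0 → ∃ v ∈ T, ⟪x, v⟫_ℝ ≠ 0) (x : E) (hx : x ≠ 0) :
    ContDiffAt ℝ ∞ (lph T p) x := by
  unfold lph
  apply ContDiffAt.rpow_const_of_ne
  · apply ContDiff.contDiffAt
    exact ContDiff.sum fun v _ => (contDiff_id.inner ℝ contDiff_const).pow _
  · obtain ⟨v, hv, h⟩ := hT x hx
    apply ne_of_gt
    apply Finset.sum_pos' (fun v _ => (even_two_mul p).pow_nonneg _) ⟨v, hv, ?_⟩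
    exact (even_two_mul p).pow_pos h

theorem IsClass.sym {N : Set (ConvexBody E)} (hN : IsClass N) {L : ConvexBody E}
    (hL : ∀ x, supp L (-x) = supp L x) : L ∈ N := by
  have hL0 : ∀ x, 0 ≤ supp L x := by
    intro x
    have h1 := supp_subadd L x (-x)
    have h2 : supp L 0 = 0 := by simpa using supp_hom L le_rfl (0:E)
    rw [add_neg_cancel, h2, hL] at h1
    linarith
  rw [← hN.closed.closure_eq, Metric.mem_closure_iff]
  intro δ hδ
  obtain ⟨C, hC0, hC⟩ := exists_bound L
  set ε := δ / 3 with hε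
  have hε0 : 0 < ε := by positivity
  obtain ⟨t, htL, htf, htc⟩ := L.isCompact.finite_cover_balls hε0
  classical
  let e := stdOrthonormalBasis ℝ E
  let T : Finset E := htf.toFinset ∪ Finset.univ.image (fun j => ε • e j)
  have hT1 : ∀ v ∈ T, ∀ u : E, ‖u‖ ≤ 1 → |⟪u, v⟫_ℝ| ≤ supp L u + ε := by
    intro v hv u hu
    rcases Finset.mem_union.1 hv with hv | hv
    · have hv : v ∈ L := htL (by simpa using hv)
      have h1 := le_supp hv u
      have h2 := le_supp hv (-u)
      rw [inner_neg_left, hL] at h2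
      rw [abs_le]
      constructor <;> linarith
    · obtain ⟨j, -, rfl⟩ := Finset.mem_image.1 hv
      rw [inner_smul_right, abs_mul, abs_of_pos hε0]
      have h1 := abs_real_inner_le_norm u (e j)
      rw [e.orthonormal.1, mul_one] at h1
      have := hL0 u
      nlinarith
  have hT2 : ∀ x : E, x ≠ 0 → ∃ v ∈ T, ⟪x, v⟫_ℝ ≠ 0 := by
    intro x hx
    by_contra! h
    apply hx
    apply e.repr.injective
    ext j
    rw [e.repr_apply_apply, map_zero, real_inner_comm]
    have := h (ε • e j) (Finset.mem_union_right _ (Finset.mem_image.2 ⟨j, Finset.mem_univ _, rfl⟩))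
    rw [inner_smul_right] at this
    simpa [hε0.ne'] using this
  have hlim : Tendsto (fun p : ℕ => ((T.card : ℝ) ^ (1 / ((2 * p : ℕ) : ℝ)) - 1) * (C + ε)) atTop (𝓝 0) := by
    by_cases hc : (T.card : ℝ) = 0
    · rw [hc]
      have : ∀ᶠ p : ℕ in atTop, ((0:ℝ) ^ (1 / ((2 * p : ℕ) : ℝ)) - 1) * (C + ε) = - (C + ε) := by
        filter_upwards [eventually_ge_atTop 1] with p hp
        rw [Real.zero_rpow (by positivity)]; ring
      -- impossible unless trivial; handled below
      have hT0 : T = ∅ := by simpa using hc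
      exfalso
      obtain ⟨y, hy⟩ := L.nonempty
      have := htc hy
      simp only [mem_iUnion] at this
      obtain ⟨v, hv, -⟩ := this
      have : v ∈ T := Finset.mem_union_left _ (by simpa using hv)
      rw [hT0] at this; simp at this
    · have h1 : Tendsto (fun p : ℕ => 1 / ((2 * p : ℕ) : ℝ)) atTop (𝓝 0) := by
        have h := tendsto_one_div_atTop_nhds_zero_nat (𝕜 := ℝ)
        exact h.comp (tendsto_id.const_mul_atTop' (by norm_num : 0 < 2))
      have h2 := ((Real.continuousAt_const_rpow (a := (T.card : ℝ)) hc).tendsto.comp h1)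
      have h3 := (h2.sub_const 1).mul_const (C + ε)
      simpa using h3
  obtain ⟨p, hp1, hp2⟩ := ((eventually_ge_atTop 1).and (hlim.eventually_lt_const hε0)).exists
  obtain ⟨M, hM⟩ := exists_body (h := lph T p) (C := (T.card : ℝ) ^ (1 / ((2 * p : ℕ) : ℝ)) * (C + ε)) (lph_sub T hp1) (lph_hom T hp1) (by
    intro x
    by_cases hx : x = 0
    · subst hx
      have := lph_hom T hp1 2 two_pos (0:E)
      rw [smul_zero] at this
      rw [norm_zero, mul_zero]
      linarith
    rw [mul_assoc]
    apply lph_le hp1 (by positivity)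
    intro v hv
    have hn : 0 < ‖x‖ := norm_pos_iff.2 hx
    have h1 := hT1 v hv (‖x‖⁻¹ • x) (by rw [norm_smul, norm_inv, norm_norm, inv_mul_cancel₀ hn.ne'])
    have h2 := (le_abs_self _).trans (abs_supp_le hC (‖x‖⁻¹ • x))
    rw [norm_smul, norm_inv, norm_norm, inv_mul_cancel₀ hn.ne', mul_one] at h2
    rw [real_inner_smul_left, abs_mul, abs_of_pos (inv_pos.2 hn)] at h1
    have h3 : ‖x‖⁻¹ * |⟪x, v⟫_ℝ| ≤ C + ε := by linarith
    rw [inv_mul_le_iff₀ hn] at h3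
    linarith)
  have hMf : supp M = lph T p := funext hM
  refine ⟨M, ?_, ?_⟩
  · apply hN.smooth
    · rw [hMf]; exact lph_smooth hp1 hT2
    · intro x
      rw [hMf, lph, lph]
      simp_rw [inner_neg_left, (even_two_mul p).neg_pow]
  · have : dist L M ≤ 2 * ε := by
      apply dist_le_of_supp
      intro u hu
      rw [hM, abs_le]
      have hsC := ((le_abs_self _).trans (abs_supp_le hC u)).trans (mul_le_of_le_one_right hC0 hu)
      have hs0 := hL0 u
      constructor
      · have h1 := lph_le (T := T) hp1 (x := u) (B := supp L u + ε) (by linarith [hL0 u]) (fun v hv => hT1 v hv u hu)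
        by_cases hcs : 1 ≤ (T.card : ℝ) ^ (1 / ((2 * p : ℕ) : ℝ))
        · have : ((T.card : ℝ) ^ (1 / ((2 * p : ℕ) : ℝ)) - 1) * (supp L u + ε) ≤ 
            ((T.card : ℝ) ^ (1 / ((2 * p : ℕ) : ℝ)) - 1) * (C + ε) := by
            apply mul_le_mul_of_nonneg_left _ (by linarith)
            linarith
          nlinarith
        · nlinarith
      · obtain ⟨y, hy, h⟩ := exists_supp L u
        have := htc hy
        simp only [mem_iUnion] at this
        obtain ⟨v, hv, hyv⟩ := this
        have hvT : v ∈ T := Finset.mem_union_left _ (by simpa using hv)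
        have h1 := (le_abs_self _).trans (le_lph hp1 hvT u)
        have h2 := (real_inner_le_norm u (y - v))
        rw [inner_sub_right] at h2
        rw [mem_ball, dist_eq_norm] at hyv
        have h3 : ‖u‖ * ‖y - v‖ ≤ 1 * ε := mul_le_mul hu hyv.le (norm_nonneg _) zero_le_one
        linarith
    linarith

end LemmaS2

end UV
end

noncomputable section
namespace UV
open Filter Topology

section Dissect

open scoped InnerProductSpace

variable {E : Type*} [NormedAddCommGroup E] [InnerProductSpace ℝ E] [FiniteDimensional ℝ E]

open scoped Classical in
/-- extension of a function on bodies to sets -/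
def ext (μ : ConvexBody E → ℂ) (S : Set E) : ℂ :=
  if h : Convex ℝ S ∧ IsCompact S ∧ S.Nonempty then μ ⟨S, h.1, h.2.1, h.2.2⟩ else 0

theorem ext_body (μ : ConvexBody E → ℂ) (K : ConvexBody E) : ext μ (K : Set E) = μ K := by
  rw [ext, dif_pos ⟨K.convex, K.isCompact, K.nonempty⟩]; rfl

theorem ext_empty (μ : ConvexBody E → ℂ) : ext μ ∅ = 0 := by
  rw [ext, dif_neg]; simp

structure Simple (μ : ConvexBody E → ℂ) : Prop where
  val : IsVal μ
  hyper : ∀ (K : ConvexBody E) (p : E) (W : Submodule ℝ E), W ≠ ⊤ → (∀ y ∈ K, y - p ∈ W) → μ K = 0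
  sym : ∀ L : ConvexBody E, (∀ x, supp L (-x) = supp L x) → μ L = 0
  ev : IsEv μ

theorem Simple.ext_hyper {μ : ConvexBody E → ℂ} (h : Simple μ) {S : Set E} {p : E} {W : Submodule ℝ E}
    (hW : W ≠ ⊤) (hS : ∀ y ∈ S, y - p ∈ W) : ext μ S = 0 := by
  rw [ext]
  split_ifs with hc
  · exact h.hyper _ p W hW hS
  · rfl

theorem Simple.ext_hyper' {μ : ConvexBody E → ℂ} (h : Simple μ) {S : Set E} {g : E →ᵃ[ℝ] ℝ} (hg : g.linear ≠ 0)
    (hS : ∀ y ∈ S, g y = 0) : ext μ S = 0 := by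
  rcases S.eq_empty_or_nonempty with rfl | ⟨p, hp⟩
  · exact ext_empty μ
  · apply h.ext_hyper (p := p) (W := LinearMap.ker g.linear)
    · intro h; exact hg (LinearMap.ker_eq_top.1 h)
    · intro y hy
      rw [LinearMap.mem_ker, ← vsub_eq_sub, AffineMap.linearMap_vsub, hS y hy, hS p hp]; simp

theorem convex_le (g : E →ᵃ[ℝ] ℝ) : Convex ℝ {y | g y ≤ 0} := (convex_Iic (0:ℝ)).affine_preimage g
theorem convex_ge (g : E →ᵃ[ℝ] ℝ) : Convex ℝ {y | 0 ≤ g y} := (convex_Ici (0:ℝ)).affine_preimage g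
theorem closed_le (g : E →ᵃ[ℝ] ℝ) : IsClosed {y | g y ≤ 0} :=
  isClosed_le g.continuous_of_finiteDimensional continuous_const
theorem closed_ge (g : E →ᵃ[ℝ] ℝ) : IsClosed {y | 0 ≤ g y} :=
  isClosed_le continuous_const g.continuous_of_finiteDimensional

theorem Simple.cut {μ : ConvexBody E → ℂ} (h : Simple μ) {S : Set E} (hc : Convex ℝ S) (hk : IsCompact S)
    (g : E →ᵃ[ℝ] ℝ) (hg : g.linear ≠ 0) : ext μ S = ext μ (S ∩ {y | g y ≤ 0}) + ext μ (S ∩ {y | 0 ≤ g y}) := by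
  rcases (S ∩ {y | g y ≤ 0}).eq_empty_or_nonempty with h1 | ⟨a, ha⟩
  · have : S ∩ {y | 0 ≤ g y} = S := by
      apply inter_eq_left.2
      intro y hy
      by_contra h2
      have : y ∈ S ∩ {y | g y ≤ 0} := ⟨hy, le_of_lt (not_le.1 (show ¬ (0 ≤ g y) from h2))⟩
      rw [h1] at this; exact this
    rw [this, h1, ext_empty, zero_add]
  rcases (S ∩ {y | 0 ≤ g y}).eq_empty_or_nonempty with h1 | ⟨b, hb⟩
  · have : S ∩ {y | g y ≤ 0} = S := by
      apply inter_eq_left.2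
      intro y hy
      by_contra h2
      have : y ∈ S ∩ {y | 0 ≤ g y} := ⟨hy, le_of_lt (not_le.1 (show ¬ (g y ≤ 0) from h2))⟩
      rw [h1] at this; exact this
    rw [this, h1, ext_empty, add_zero]
  let K : ConvexBody E := ⟨_, hc.inter (convex_le g), hk.inter_right (closed_le g), ⟨a, ha⟩⟩
  let L : ConvexBody E := ⟨_, hc.inter (convex_ge g), hk.inter_right (closed_ge g), ⟨b, hb⟩⟩
  have hU : S = (S ∩ {y | g y ≤ 0}) ∪ (S ∩ {y | 0 ≤ g y}) := by
    ext y
    constructor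
    · intro hy
      rcases le_total (g y) 0 with h | h
      · exact Or.inl ⟨hy, h⟩
      · exact Or.inr ⟨hy, h⟩
    · rintro (h | h) <;> exact h.1
  obtain ⟨c, -, hc1, hc2⟩ := exists_cross K.isCompact.isClosed L.isCompact.isClosed 
    (show Convex ℝ ((S ∩ {y | g y ≤ 0}) ∪ (S ∩ {y | 0 ≤ g y})) by rw [← hU]; exact hc) ha hb
  let M : ConvexBody E := ⟨S, hc, hk, ⟨a, ha.1⟩⟩
  let N : ConvexBody E := ⟨K ∩ L, K.convex.inter L.convex, K.isCompact.inter L.isCompact, ⟨c, hc1, hc2⟩⟩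
  have := h.val.val K L M N hU rfl
  have hN : μ N = 0 := by
    rw [← ext_body μ N]
    apply h.ext_hyper' hg
    intro y hy
    exact le_antisymm hy.1.2 hy.2.2
  rw [hN, add_zero] at this
  exact (ext_body μ M).trans (this.trans (congrArg₂ _ (ext_body μ K).symm (ext_body μ L).symm))

theorem Simple.ext_refl {μ : ConvexBody E → ℂ} (h : Simple μ) {S T : Set E} (q : E)
    (hT : ∀ y, y ∈ T ↔ q - y ∈ S) : ext μ T = ext μ S := by
  have hTS : T = (fun y => q - y) '' S := by
    ext y
    rw [hT]
    constructor
    · intro h; exact ⟨_, h, by simp⟩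
    · rintro ⟨z, hz, rfl⟩; simpa using hz
  by_cases hS : Convex ℝ S ∧ IsCompact S ∧ S.Nonempty
  · let K : ConvexBody E := ⟨S, hS.1, hS.2.1, hS.2.2⟩
    have e : ((-1 : ℝ) • K + pt q : ConvexBody E) = T := by
      ext y
      rw [hT]
      change y ∈ ((-1 : ℝ) • K + pt q : ConvexBody E) ↔ _
      rw [mem_add]
      constructor
      · rintro ⟨a, ha, b, hb, rfl⟩
        rw [mem_pt.1 hb]
        have : -a ∈ S := mem_neg.1 ha
        rwa [show q - (a + q) = -a by abel]
      · intro h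
        exact ⟨y - q, mem_neg.2 (show -(y - q) ∈ S by rwa [neg_sub]), q, mem_pt.2 rfl, by simp⟩
    rw [← e, ext_body, h.val.trans, h.ev]
    exact (ext_body μ K).symm
  · have hT' : ¬ (Convex ℝ T ∧ IsCompact T ∧ T.Nonempty) := by
      intro hT'
      apply hS
      have : S = (fun y => q - y) '' T := by
        rw [hTS, image_image]; simp
      rw [this]
      refine ⟨?_, hT'.2.1.image (by fun_prop), hT'.2.2.image _⟩
      have := hT'.1.affine_image (AffineMap.const ℝ E q - AffineMap.id ℝ E)
      exact this
    rw [ext, ext, dif_neg hS, dif_neg hT']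

theorem Simple.ext_sym {μ : ConvexBody E → ℂ} (h : Simple μ) {S : Set E} (p : E)
    (hS : ∀ y ∈ S, (2 : ℝ) • p - y ∈ S) : ext μ S = 0 := by
  rw [ext]
  split_ifs with hc
  · rw [← h.val.trans (-p)]
    apply h.sym
    intro x
    have aux : ∀ x, supp (⟨S, hc.1, hc.2.1, hc.2.2⟩ + pt (-p) : ConvexBody E) (-x) ≤ supp (⟨S, hc.1, hc.2.1, hc.2.2⟩ + pt (-p) : ConvexBody E) x := by
      intro x
      apply supp_le
      intro y hy
      obtain ⟨a, ha, b, hb, rfl⟩ := mem_add.1 hy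
      rw [mem_pt.1 hb]
      have ha' := hS a ha
      have := le_supp (K := (⟨S, hc.1, hc.2.1, hc.2.2⟩ + pt (-p) : ConvexBody E)) (y := ((2 : ℝ) • p - a) + (-p))
        (mem_add.2 ⟨_, ha', _, mem_pt.2 rfl, rfl⟩) x
      refine le_trans (le_of_eq ?_) this
      rw [inner_neg_left, ← inner_neg_right]
      congr 1
      rw [two_smul]; abel
    apply le_antisymm (aux x)
    simpa using aux (-x)
  · rfl

end Dissect

end UV
end

noncomputable section
namespace UV
open Filter Topology

section Simplex

open scoped InnerProductSpace

variable {E : Type*} [NormedAddCommGroup E] [InnerProductSpace ℝ E] [FiniteDimensional ℝ E]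

theorem coord_refl {ι : Type*} (b : AffineBasis ι ℝ E) (i : ι) (p y : E) :
    b.coord i ((2 : ℝ) • p - y) = 2 * b.coord i p - b.coord i y := by
  have h1 : (2 : ℝ) • p - y = AffineMap.lineMap y p (2 : ℝ) := by
    rw [AffineMap.lineMap_apply_module]; module
  rw [h1, AffineMap.apply_lineMap, AffineMap.lineMap_apply_module]
  simp; ring

theorem exists_coord {ι : Type*} [Fintype ι] (b : AffineBasis ι ℝ E) (w : ι → ℝ) (hw : ∑ i, w i = 1) :
    ∃ p, ∀ i, b.coord i p = w i :=
  ⟨Finset.univ.affineCombination ℝ b w, fun i => b.coord_apply_combination_of_mem (Finset.mem_univ i) hw⟩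

theorem coord_linear_ne {ι : Type*} (b : AffineBasis ι ℝ E) {i j : ι} (hij : i ≠ j) : (b.coord i).linear ≠ 0 := by
  intro h
  have := (b.coord i).linearMap_vsub (b i) (b j)
  rw [h, b.coord_apply_eq, b.coord_apply_ne hij] at this
  simp at this

theorem Simple.simplex {μ : ConvexBody E → ℂ} (h : Simple μ) {ι : Type*} [Fintype ι] (b : AffineBasis ι ℝ E) :
    ext μ (convexHull ℝ (range b)) = 0 := by
  classical
  obtain ⟨o⟩ := b.nonempty
  set P : Set E := {y | ∀ i, i ≠ o → 0 ≤ b.coord i y ∧ b.coord i y ≤ 1} with hP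
  have memP : ∀ y, y ∈ P ↔ ∀ i, i ≠ o → 0 ≤ b.coord i y ∧ b.coord i y ≤ 1 := fun y => Iff.rfl
  have hsum : ∀ y, ∑ i ∈ Finset.univ.erase o, b.coord i y = 1 - b.coord o y := by
    intro y
    rw [← b.sum_coord_apply_eq_one y, ← Finset.add_sum_erase _ _ (Finset.mem_univ o)]; ring
  have hcont : ∀ i, Continuous (b.coord i) := fun i => (b.coord i).continuous_of_finiteDimensional
  have hPP : P = ⋂ i, ⋂ (_ : i ≠ o), ((b.coord i) ⁻¹' (Icc 0 1)) := by
    ext y; simp [memP]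
  have hPc : Convex ℝ P := by
    rw [hPP]
    exact convex_iInter fun i => convex_iInter fun _ => (convex_Icc 0 1).affine_preimage _
  have hPcl : IsClosed P := by
    rw [hPP]
    exact isClosed_iInter fun i => isClosed_iInter fun _ => isClosed_Icc.preimage (hcont i)
  have hPk : IsCompact P := by
    have hK : IsCompact ((fun w : ι → ℝ => ∑ i, w i • b i) '' (Set.pi univ fun _ => Icc (-(Fintype.card ι : ℝ)) (Fintype.card ι + 1))) := by
      apply IsCompact.image
      · exact isCompact_univ_pi fun _ => isCompact_Icc
      · fun_prop
    apply hK.of_isClosed_subset hPcl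
    intro y hy
    refine ⟨fun i => b.coord i y, ?_, b.linear_combination_coord_eq_self y⟩
    intro i _
    have h0 : (0:ℝ) ≤ Fintype.card ι := by positivity
    by_cases hi : i = o
    · have h1 : 0 ≤ ∑ i ∈ Finset.univ.erase o, b.coord i y :=
        Finset.sum_nonneg fun j hj => ((memP y).1 hy j (Finset.ne_of_mem_erase hj)).1
      have h2 : ∑ i ∈ Finset.univ.erase o, b.coord i y ≤ ∑ i ∈ Finset.univ.erase o, (1:ℝ) :=
        Finset.sum_le_sum fun j hj => ((memP y).1 hy j (Finset.ne_of_mem_erase hj)).2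
      have h3 : ∑ i ∈ Finset.univ.erase o, (1:ℝ) ≤ Fintype.card ι := by
        rw [Finset.sum_const, nsmul_eq_mul, mul_one]
        exact_mod_cast Finset.card_le_univ _
      rw [hsum] at h1 h2
      subst hi
      constructor <;> linarith
    · have := (memP y).1 hy i hi
      constructor <;> linarith
  obtain ⟨p, hp⟩ := exists_coord b (fun i => if i = o then 1 - ∑ j ∈ Finset.univ.erase o, (1/2 : ℝ) else 1/2) (by
    rw [← Finset.add_sum_erase _ _ (Finset.mem_univ o), if_pos rfl]
    rw [Finset.sum_congr rfl (fun j hj => if_neg (Finset.ne_of_mem_erase hj))]; ring)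
  set d : ℝ := ((Finset.univ.erase o).card : ℝ) with hd
  have hpo : b.coord o p = 1 - d / 2 := by
    rw [hp, if_pos rfl, Finset.sum_const, nsmul_eq_mul]; ring
  have hpi : ∀ i, i ≠ o → b.coord i p = 1/2 := fun i hi => by rw [hp, if_neg hi]
  have hPs : ∀ y ∈ P, (2 : ℝ) • p - y ∈ P := by
    intro y hy i hi
    rw [coord_refl, hpi i hi]
    have := (memP y).1 hy i hi
    constructor <;> linarith
  have hD : convexHull ℝ (range b) = P ∩ {y | 0 ≤ b.coord o y} := by
    rw [b.convexHull_eq_nonneg_coord]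
    ext y
    constructor
    · intro hy
      refine ⟨fun i hi => ⟨hy i, ?_⟩, hy o⟩
      rw [← b.sum_coord_apply_eq_one y]
      exact Finset.single_le_sum (f := fun i => b.coord i y) (fun j _ => hy j) (Finset.mem_univ i)
    · rintro ⟨h1, h2⟩ i
      by_cases hi : i = o
      · rw [hi]; exact h2
      · exact (h1 i hi).1
  by_cases hd1 : (Finset.univ.erase o).card ≤ 1
  · have : P ∩ {y | 0 ≤ b.coord o y} = P := by
      apply inter_eq_left.2
      intro y hy
      have h2 : ∑ i ∈ Finset.univ.erase o, b.coord i y ≤ ∑ i ∈ Finset.univ.erase o, (1:ℝ) :=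
        Finset.sum_le_sum fun j hj => ((memP y).1 hy j (Finset.ne_of_mem_erase hj)).2
      rw [hsum, Finset.sum_const, nsmul_eq_mul, mul_one] at h2
      have : ((Finset.univ.erase o).card : ℝ) ≤ 1 := by exact_mod_cast hd1
      show 0 ≤ b.coord o y
      linarith
    rw [hD, this]
    exact h.ext_sym p hPs
  · push Not at hd1
    have hd2 : (2 : ℝ) ≤ d := by rw [hd]; exact_mod_cast hd1
    obtain ⟨j, hj⟩ : (Finset.univ.erase o).Nonempty := by rw [← Finset.card_pos]; omega
    have hne := coord_linear_ne b (Finset.ne_of_mem_erase hj).symm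
    have c1 := h.cut hPc hPk (b.coord o) hne
    let g : E →ᵃ[ℝ] ℝ := b.coord o + AffineMap.const ℝ E (d - 2)
    have hgv : ∀ y, g y = b.coord o y + (d - 2) := fun y => rfl
    have hg : g.linear ≠ 0 := by
      have : g.linear = (b.coord o).linear := by simp [g]
      rwa [this]
    have c2 := h.cut (hPc.inter (convex_le (b.coord o))) (hPk.inter_right (closed_le (b.coord o))) g hg
    rw [h.ext_sym p hPs, c2, ← hD] at c1
    have e1 : ext μ (P ∩ {y | b.coord o y ≤ 0} ∩ {y | g y ≤ 0}) = ext μ (convexHull ℝ (range b)) := by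
      rw [hD]
      apply h.ext_refl ((2 : ℝ) • p)
      intro y
      constructor
      · rintro ⟨⟨h1, h2⟩, h3⟩
        refine ⟨hPs y h1, ?_⟩
        change b.coord o y ≤ 0 at h2
        change g y ≤ 0 at h3
        rw [hgv] at h3
        show 0 ≤ b.coord o _
        rw [coord_refl, hpo]; linarith
      · rintro ⟨h1, h2⟩
        change 0 ≤ b.coord o _ at h2
        rw [coord_refl, hpo] at h2
        refine ⟨⟨by simpa using hPs _ h1, ?_⟩, ?_⟩
        · show b.coord o y ≤ 0
          linarith
        · show g y ≤ 0
          rw [hgv]; linarith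
    have e2 : ext μ (P ∩ {y | b.coord o y ≤ 0} ∩ {y | 0 ≤ g y}) = 0 := by
      apply h.ext_sym p
      rintro y ⟨⟨h1, h2⟩, h3⟩
      change b.coord o y ≤ 0 at h2
      change 0 ≤ g y at h3
      rw [hgv] at h3
      refine ⟨⟨hPs y h1, ?_⟩, ?_⟩
      · show b.coord o _ ≤ 0
        rw [coord_refl, hpo]; linarith
      · show 0 ≤ g _
        rw [hgv, coord_refl, hpo]; linarith
    rw [e1, e2] at c1
    have : ext μ (convexHull ℝ (range b)) + ext μ (convexHull ℝ (range b)) = 0 := by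
      rw [add_zero] at c1; exact c1.symm
    exact self_eq_neg.1 (eq_neg_of_add_eq_zero_left this)

theorem Simple.simplex' {μ : ConvexBody E → ℂ} (h : Simple μ) {ι : Type*} [Fintype ι] (x : ι → E)
    (hι : Fintype.card ι = Module.finrank ℝ E + 1) :
    (∃ b : AffineBasis ι ℝ E, ⇑b = x) ∨ ∃ (p : E) (W : Submodule ℝ E), W ≠ ⊤ ∧ ∀ y ∈ convexHull ℝ (range x), y - p ∈ W := by
  by_cases hx : AffineIndependent ℝ x
  · left
    exact ⟨⟨x, hx, hx.affineSpan_eq_top_iff_card_eq_finrank_add_one.2 hι⟩, rfl⟩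
  · right
    have : Nonempty ι := Fintype.card_pos_iff.1 (by omega)
    obtain ⟨i⟩ := this
    refine ⟨x i, vectorSpan ℝ (range x), ?_, ?_⟩
    · intro hW
      have hd : Module.finrank ℝ E ≠ 0 := by
        intro h0
        have : Subsingleton ι := Fintype.card_le_one_iff_subsingleton.1 (by omega)
        exact hx (affineIndependent_of_subsingleton ℝ x)
      obtain ⟨m, hm⟩ := Nat.exists_eq_succ_of_ne_zero hd
      have := (finrank_vectorSpan_le_iff_not_affineIndependent ℝ x (n := m) (by omega)).2 hx
      rw [hW, finrank_top] at this
      omega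
    · intro y hy
      have h1 := convexHull_subset_affineSpan (𝕜 := ℝ) (range x) hy
      rw [← direction_affineSpan, ← vsub_eq_sub]
      exact AffineSubspace.vsub_mem_direction h1 (mem_affineSpan ℝ (mem_range_self i))

end Simplex

end UV
end

noncomputable section
namespace UV
open Filter Topology

section Halfspaces

open scoped InnerProductSpace

variable {E : Type*} [NormedAddCommGroup E] [InnerProductSpace ℝ E] [FiniteDimensional ℝ E]

theorem conv_update {ι : Type*} [Fintype ι] [DecidableEq ι] (B : AffineBasis ι ℝ E) {a b : ι} (hab : a ≠ b) {θ : ℝ}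
    (h0 : 0 < θ) (h1 : θ < 1) :
    convexHull ℝ (range (Function.update B a ((1 - θ) • B a + θ • B b))) =
      convexHull ℝ (range B) ∩ {y | 0 ≤ ((1 - θ) • B.coord b - θ • B.coord a : E →ᵃ[ℝ] ℝ) y} := by
  have hgv : ∀ y, ((1 - θ) • B.coord b - θ • B.coord a : E →ᵃ[ℝ] ℝ) y = (1 - θ) * B.coord b y - θ * B.coord a y := fun y => rfl
  have hm : (1 - θ) • B a + θ • B b = AffineMap.lineMap (B a) (B b) θ := by
    rw [AffineMap.lineMap_apply_module]
  apply Subset.antisymm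
  · apply convexHull_min _ ((convex_convexHull ℝ _).inter (convex_ge _))
    rintro _ ⟨i, rfl⟩
    by_cases hi : i = a
    · subst hi
      rw [Function.update_self]
      constructor
      · exact (convex_convexHull ℝ _) (subset_convexHull _ _ (mem_range_self i)) (subset_convexHull _ _ (mem_range_self b)) (by linarith) h0.le (by ring)
      · rw [mem_ofPred_eq]
        rw [hgv, hm, AffineMap.apply_lineMap, AffineMap.apply_lineMap, B.coord_apply_eq, B.coord_apply_eq,
          B.coord_apply_ne hab, B.coord_apply_ne hab.symm, AffineMap.lineMap_apply_module, AffineMap.lineMap_apply_module]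
        simp; linarith
    · rw [Function.update_of_ne hi]
      refine ⟨subset_convexHull _ _ (mem_range_self i), ?_⟩
      rw [mem_ofPred_eq]
      rw [hgv, B.coord_apply, B.coord_apply, if_neg (Ne.symm hi)]
      split_ifs <;> linarith
  · rintro y ⟨hy, hg⟩
    rw [mem_ofPred_eq] at hg
    rw [hgv] at hg
    rw [B.convexHull_eq_nonneg_coord] at hy
    change ∀ i, 0 ≤ B.coord i y at hy
    have h2 : 0 < 1 - θ := by linarith
    set s := B.coord a y / (1 - θ) with hs
    have hs' : s * (1 - θ) = B.coord a y := by rw [hs]; field_simp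
    have hs0 : 0 ≤ s := div_nonneg (hy a) h2.le
    have hyy := B.linear_combination_coord_eq_self y
    have hsum := B.sum_coord_apply_eq_one y
    set x' := Function.update B a ((1 - θ) • B a + θ • B b) with hx'
    set w : ι → ℝ := fun i => B.coord i y + (if i = a then s * θ else 0) - (if i = b then s * θ else 0) with hw
    have hx'' : ∀ i, x' i = B i + (if i = a then θ • (B b - B a) else 0) := by
      intro i
      by_cases hi : i = a
      · subst hi; rw [hx', Function.update_self, if_pos rfl]; module
      · rw [hx', Function.update_of_ne hi, if_neg hi, add_zero]
    have hyw : y = ∑ i, w i • x' i := by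
      have h3 : ∀ i, w i • x' i = B.coord i y • B i + (if i = a then (s * θ) • B i else 0) - (if i = b then (s * θ) • B i else 0)
          + (if i = a then (w i * θ) • (B b - B a) else 0) := by
        intro i
        rw [hx'']
        simp only [hw]
        split_ifs <;> module
      rw [Finset.sum_congr rfl (fun i _ => h3 i), Finset.sum_add_distrib, Finset.sum_sub_distrib, Finset.sum_add_distrib, hyy]
      rw [Finset.sum_ite_eq', Finset.sum_ite_eq', Finset.sum_ite_eq']
      simp only [Finset.mem_univ, if_true, hw, if_neg hab]
      have : (B.coord a y + s * θ - 0) * θ = s * θ := by rw [← hs']; ring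
      rw [this]; module
    rw [hyw]
    apply (convex_convexHull ℝ (range x')).sum_mem
    · intro i _
      simp only [hw]
      by_cases hi : i = a
      · subst hi
        rw [if_pos rfl, if_neg hab]
        have := hy i; have := mul_nonneg hs0 h0.le
        linarith
      · by_cases hi' : i = b
        · subst hi'
          rw [if_neg hi, if_pos rfl]
          rw [← hs'] at hg
          have : 0 ≤ (1 - θ) * (B.coord i y - s * θ) := by linarith
          have := nonneg_of_mul_nonneg_right this h2
          linarith
        · rw [if_neg hi, if_neg hi']; have := hy i; linarith
    · simp only [hw]
      rw [Finset.sum_sub_distrib, Finset.sum_add_distrib, hsum, Finset.sum_ite_eq', Finset.sum_ite_eq']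
      simp
    · intro i _
      exact subset_convexHull _ _ (mem_range_self i)

/-- polyhedron cut out by a list of half spaces -/
def poly (l : List ((E →ₗ[ℝ] ℝ) × ℝ)) : Set E := {y | ∀ q ∈ l, q.1 y ≤ q.2}

theorem poly_convex (l : List ((E →ₗ[ℝ] ℝ) × ℝ)) : Convex ℝ (poly l) := by
  have : poly l = ⋂ q ∈ l, {y | q.1 y ≤ q.2} := by ext y; simp [poly]
  rw [this]
  exact convex_iInter₂ fun q _ => convex_halfSpace_le q.1.isLinear q.2

theorem poly_closed (l : List ((E →ₗ[ℝ] ℝ) × ℝ)) : IsClosed (poly l) := by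
  have : poly l = ⋂ q ∈ l, {y | q.1 y ≤ q.2} := by ext y; simp [poly]
  rw [this]
  exact isClosed_biInter fun q _ => isClosed_le q.1.continuous_of_finiteDimensional continuous_const

theorem poly_cons (f : E →ₗ[ℝ] ℝ) (c : ℝ) (l : List ((E →ₗ[ℝ] ℝ) × ℝ)) (y : E) :
    y ∈ poly ((f, c) :: l) ↔ f y ≤ c ∧ y ∈ poly l := by
  show (∀ q ∈ (f, c) :: l, q.1 y ≤ q.2) ↔ f y ≤ c ∧ (∀ q ∈ l, q.1 y ≤ q.2)
  simp

theorem Simple.poly {μ : ConvexBody E → ℂ} (h : Simple μ) {ι : Type*} [Fintype ι]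
    (hι : Fintype.card ι = Module.finrank ℝ E + 1) (l : List ((E →ₗ[ℝ] ℝ) × ℝ)) :
    ∀ x : ι → E, ext μ (convexHull ℝ (range x) ∩ UV.poly l) = 0 := by
  classical
  induction l with
  | nil =>
    intro x
    have : UV.poly ([] : List ((E →ₗ[ℝ] ℝ) × ℝ)) = univ := by ext; simp [UV.poly]
    rw [this, inter_univ]
    rcases h.simplex' x hι with ⟨b, rfl⟩ | ⟨p, W, hW, hy⟩
    · exact h.simplex b
    · exact h.ext_hyper hW hy
  | cons q l ih =>
    obtain ⟨f, c⟩ := q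
    have key : ∀ N : ℕ, ∀ x : ι → E, (Finset.univ.filter fun i => f (x i) ≠ c).card ≤ N →
        ext μ (convexHull ℝ (range x) ∩ UV.poly ((f, c) :: l)) = 0 := by
      intro N
      induction N with
      | zero =>
        intro x hx
        have hx' : ∀ i, f (x i) = c := by
          intro i
          by_contra hi
          have : i ∈ Finset.univ.filter fun i => f (x i) ≠ c := by simp [hi]
          have := Finset.card_pos.2 ⟨i, this⟩
          omega
        have : convexHull ℝ (range x) ∩ UV.poly ((f, c) :: l) = convexHull ℝ (range x) ∩ UV.poly l := by
          ext y
          constructor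
          · rintro ⟨h1, h2⟩; exact ⟨h1, ((poly_cons f c l y).1 h2).2⟩
          · rintro ⟨h1, h2⟩
            refine ⟨h1, (poly_cons f c l y).2 ⟨?_, h2⟩⟩
            have := convexHull_min (t := {y | f y ≤ c}) (by rintro _ ⟨i, rfl⟩; exact (hx' i).le) (convex_halfSpace_le f.isLinear c) h1
            exact this
        rw [this]; exact ih x
      | succ N ihN =>
        intro x hx
        rcases h.simplex' x hι with ⟨B, hB⟩ | ⟨p, W, hW, hy⟩
        swap
        · exact h.ext_hyper hW (fun y hy' => hy y hy'.1)
        by_cases hle : ∀ i, f (x i) ≤ c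
        · have : convexHull ℝ (range x) ∩ UV.poly ((f, c) :: l) = convexHull ℝ (range x) ∩ UV.poly l := by
            ext y
            constructor
            · rintro ⟨h1, h2⟩; exact ⟨h1, ((poly_cons f c l y).1 h2).2⟩
            · rintro ⟨h1, h2⟩
              refine ⟨h1, (poly_cons f c l y).2 ⟨?_, h2⟩⟩
              have := convexHull_min (t := {y | f y ≤ c}) (by rintro _ ⟨i, rfl⟩; exact hle i) (convex_halfSpace_le f.isLinear c) h1
              exact this
          rw [this]; exact ih x
        push Not at hle
        obtain ⟨b, hb⟩ := hle
        by_cases hge : ∀ i, c ≤ f (x i)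
        · rcases (convexHull ℝ (range x) ∩ UV.poly ((f, c) :: l)).eq_empty_or_nonempty with h1 | ⟨p, hp⟩
          · rw [h1, ext_empty]
          have hf : ∀ y ∈ convexHull ℝ (range x) ∩ UV.poly ((f, c) :: l), f y = c := by
            rintro y ⟨h1, h2⟩
            apply le_antisymm ((poly_cons f c l y).1 h2).1
            have := convexHull_min (t := {y | c ≤ f y}) (by rintro _ ⟨i, rfl⟩; exact hge i) (convex_halfSpace_ge f.isLinear c) h1
            exact this
          apply h.ext_hyper (p := p) (W := LinearMap.ker f)
          · intro h0
            have h0 := LinearMap.ker_eq_top.1 h0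
            have h3 := hf p hp
            rw [h0] at h3 hb
            simp at h3 hb
            linarith
          · intro y hy
            rw [LinearMap.mem_ker, map_sub, hf y hy, hf p hp, sub_self]
        push Not at hge
        obtain ⟨a, ha⟩ := hge
        have hab : a ≠ b := by rintro rfl; linarith
        set θ := (c - f (x a)) / (f (x b) - f (x a)) with hθ
        have hpos : 0 < f (x b) - f (x a) := by linarith
        have h0 : 0 < θ := div_pos (by linarith) hpos
        have h1 : θ < 1 := by rw [hθ, div_lt_one hpos]; linarith
        have hθ' : θ * (f (x b) - f (x a)) = c - f (x a) := by rw [hθ]; field_simp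
        set m := (1 - θ) • x a + θ • x b with hm
        have hfm : f m = c := by rw [hm]; simp; linarith
        have hsmall : ∀ e, f (x e) ≠ c → (Finset.univ.filter fun i => f (Function.update x e m i) ≠ c).card ≤ N := by
          intro e he
          have : (Finset.univ.filter fun i => f (Function.update x e m i) ≠ c) ⊆ (Finset.univ.filter fun i => f (x i) ≠ c).erase e := by
            intro i hi
            simp only [Finset.mem_filter, Finset.mem_univ, true_and, Finset.mem_erase] at hi ⊢
            by_cases hie : i = e
            · subst hie; rw [Function.update_self] at hi; exact absurd hfm hi
            · rw [Function.update_of_ne hie] at hi; exact ⟨hie, hi⟩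
          have h2 := Finset.card_le_card this
          rw [Finset.card_erase_of_mem (by simp [he])] at h2
          omega
        set g : E →ᵃ[ℝ] ℝ := (1 - θ) • B.coord b - θ • B.coord a with hg
        have hgv : ∀ y, g y = (1 - θ) * B.coord b y - θ * B.coord a y := fun y => rfl
        have hgl : g.linear ≠ 0 := by
          intro hz
          have h3 := g.linearMap_vsub (B b) (B a)
          rw [hz, hgv, hgv, B.coord_apply_eq, B.coord_apply_eq, B.coord_apply_ne hab, B.coord_apply_ne hab.symm] at h3
          simp at h3
        have u1 := conv_update B hab h0 h1
        have u2 := conv_update B hab.symm (θ := 1 - θ) (by linarith) (by linarith)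
        rw [hB] at u1 u2
        have hm2 : (1 - (1 - θ)) • x b + (1 - θ) • x a = m := by rw [hm]; module
        rw [hm2] at u2
        rw [← hm] at u1
        have hcx : IsCompact (convexHull ℝ (range x)) := (Set.finite_range x).isCompact_convexHull (𝕜 := ℝ)
        have hcut := h.cut ((convex_convexHull ℝ (range x)).inter (poly_convex ((f, c) :: l)))
          (hcx.inter_right (poly_closed ((f, c) :: l))) g hgl
        rw [hcut]
        have e1 : convexHull ℝ (range x) ∩ UV.poly ((f, c) :: l) ∩ {y | 0 ≤ g y} =
            convexHull ℝ (range (Function.update x a m)) ∩ UV.poly ((f, c) :: l) := by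
          rw [u1]; ext y; constructor
          · rintro ⟨⟨h1, h2⟩, h3⟩; exact ⟨⟨h1, h3⟩, h2⟩
          · rintro ⟨⟨h1, h2⟩, h3⟩; exact ⟨⟨h1, h3⟩, h2⟩
        have e2 : convexHull ℝ (range x) ∩ UV.poly ((f, c) :: l) ∩ {y | g y ≤ 0} =
            convexHull ℝ (range (Function.update x b m)) ∩ UV.poly ((f, c) :: l) := by
          have : ∀ y, ((1 - (1 - θ)) • B.coord a - (1 - θ) • B.coord b : E →ᵃ[ℝ] ℝ) y = - g y := by
            intro y
            show (1 - (1 - θ)) * B.coord a y - (1 - θ) * B.coord b y = _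
            rw [hgv]; ring
          rw [u2]; ext y; constructor
          · rintro ⟨⟨h1, h2⟩, h3⟩
            refine ⟨⟨h1, ?_⟩, h2⟩
            rw [mem_ofPred_eq]
            rw [this]; change g y ≤ 0 at h3; linarith
          · rintro ⟨⟨h1, h2⟩, h3⟩
            refine ⟨⟨h1, h3⟩, ?_⟩
            rw [mem_ofPred_eq] at h2
            rw [this] at h2; show g y ≤ 0; linarith
        rw [e1, e2, ihN _ (hsmall a ha.ne), ihN _ (hsmall b hb.ne'), add_zero]
    intro x
    exact key _ x le_rfl

end Halfspaces

end UV
end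

noncomputable section
namespace UV
open Filter Topology

universe uE

section Klain

open scoped InnerProductSpace

theorem IsHom.comp_cmap {V W : Type*} [NormedAddCommGroup V] [NormedSpace ℝ V] [NormedAddCommGroup W] [NormedSpace ℝ W]
    {k : ℕ} {μ : ConvexBody W → ℂ} (hk : IsHom k μ) (f : V →L[ℝ] W) : IsHom k (fun K => μ (cmap f K)) := by
  intro t ht A
  show μ (cmap f (t • A)) = _
  rw [cmap_smul, hk t ht]

theorem IsEv.comp_cmap {V W : Type*} [NormedAddCommGroup V] [NormedSpace ℝ V] [NormedAddCommGroup W] [NormedSpace ℝ W]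
    {μ : ConvexBody W → ℂ} (he : IsEv μ) (f : V →L[ℝ] W) : IsEv (fun K => μ (cmap f K)) := by
  intro A
  show μ (cmap f ((-1 : ℝ) • A)) = _
  rw [cmap_smul, he]

theorem Fk_comp_cmap {V W : Type*} [NormedAddCommGroup V] [NormedSpace ℝ V] [NormedAddCommGroup W] [NormedSpace ℝ W]
    {ι : Type*} [Fintype ι] (μ : ConvexBody W → ℂ) (f : V →L[ℝ] W) (v : ι → V) :
    Fk (fun K => μ (cmap f K)) v = Fk μ (fun i => f (v i)) := by
  unfold Fk
  show μ (cmap f _) = _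
  rw [cmap_sum]
  simp [cmap_seg]

theorem exists_big_simplex {E : Type*} [NormedAddCommGroup E] [InnerProductSpace ℝ E] [FiniteDimensional ℝ E]
    (K : ConvexBody E) : ∃ x : Fin (Module.finrank ℝ E + 1) → E, (K : Set E) ⊆ convexHull ℝ (range x) := by
  obtain ⟨B⟩ := AffineBasis.exists_affineBasis_of_finiteDimensional (ι := Fin (Module.finrank ℝ E + 1)) (k := ℝ) (P := E) (by simp)
  have h1 := B.centroid_mem_interior_convexHull
  set c := Finset.univ.centroid ℝ B with hc
  rw [mem_interior_iff_mem_nhds, Metric.mem_nhds_iff] at h1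
  obtain ⟨r, hr, hb⟩ := h1
  obtain ⟨R, hR, hK⟩ := exists_bound K
  set s := (R + 1) / r with hs
  have hs0 : 0 < s := by positivity
  refine ⟨fun i => s • (B i - c), ?_⟩
  have h2 : convexHull ℝ (range (fun i => s • (B i - c))) = (fun y => s • (y - c)) '' convexHull ℝ (range B) := by
    have e : range (fun i => s • (B i - c)) = (s • (AffineMap.id ℝ E - AffineMap.const ℝ E c)) '' range B := by
      rw [← range_comp]; rfl
    rw [e, ← AffineMap.image_convexHull]; rfl
  rw [h2]
  intro y hy
  refine ⟨c + s⁻¹ • y, hb ?_, ?_⟩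
  · rw [mem_ball, dist_eq_norm, add_sub_cancel_left, norm_smul, norm_inv, Real.norm_of_nonneg hs0.le]
    have := hK y hy
    rw [hs, inv_div, div_mul_eq_mul_div, div_lt_iff₀ (by positivity)]
    nlinarith
  · simp [smul_smul, hs0.ne']

theorem Simple.zero {E : Type*} [NormedAddCommGroup E] [InnerProductSpace ℝ E] [FiniteDimensional ℝ E]
    {μ : ConvexBody E → ℂ} (h : Simple μ) (K : ConvexBody E) : μ K = 0 := by
  classical
  obtain ⟨x, hx⟩ := exists_big_simplex K
  have hΔ : IsCompact (convexHull ℝ (range x)) := (Set.finite_range x).isCompact_convexHull (𝕜 := ℝ)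
  have key : ∀ ε > 0, ∃ P : ConvexBody E, dist P K ≤ ε ∧ μ P = 0 := by
    intro ε hε
    have hc : IsCompact (convexHull ℝ (range x) \ thickening ε (K : Set E)) := hΔ.diff isOpen_thickening
    obtain ⟨t, ht⟩ := hc.elim_finite_subcover (fun u : E => {y | supp K u < ⟪u, y⟫_ℝ}) (fun u => isOpen_lt (by fun_prop) (by fun_prop)) (by
      rintro y ⟨hy, hy2⟩
      have hyK : y ∉ K := fun h => hy2 (self_subset_thickening hε _ h)
      rw [mem_iff_supp] at hyK
      push Not at hyK
      obtain ⟨u, hu⟩ := hyK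
      exact mem_iUnion.2 ⟨u, hu⟩)
    let l : List ((E →ₗ[ℝ] ℝ) × ℝ) := t.toList.map fun u => (innerₗ E u, supp K u)
    have hl : ∀ y, y ∈ UV.poly l ↔ ∀ u ∈ t, ⟪u, y⟫_ℝ ≤ supp K u := by
      intro y
      show (∀ q ∈ l, q.1 y ≤ q.2) ↔ _
      simp [l]
    have hKP : ∀ y ∈ K, y ∈ convexHull ℝ (range x) ∩ UV.poly l := by
      intro y hy
      exact ⟨hx hy, (hl y).2 fun u _ => le_supp hy u⟩
    let P : ConvexBody E := ⟨convexHull ℝ (range x) ∩ UV.poly l, (convex_convexHull ℝ _).inter (poly_convex l),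
      hΔ.inter_right (poly_closed l), K.nonempty.mono hKP⟩
    refine ⟨P, ?_, ?_⟩
    · apply dist_le_of hε.le
      · intro y hy
        have hy1 : y ∈ convexHull ℝ (range x) := hy.1
        have hy2 := (hl y).1 hy.2
        have : y ∈ thickening ε (K : Set E) := by
          by_contra hn
          have := ht ⟨hy1, hn⟩
          simp only [mem_iUnion] at this
          obtain ⟨u, hu, hu2⟩ := this
          exact absurd (hy2 u hu) (not_le.2 hu2)
        obtain ⟨z, hz, hd⟩ := mem_thickening_iff.1 this
        exact ⟨z, hz, hd.le⟩
      · intro y hy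
        exact ⟨y, hKP y hy, by simp [hε.le]⟩
    · rw [← ext_body μ P]
      exact h.poly (by simp) l x
  have hcl : K ∈ closure {P : ConvexBody E | μ P = 0} := by
    rw [Metric.mem_closure_iff]
    intro ε hε
    obtain ⟨P, h1, h2⟩ := key (ε / 2) (by positivity)
    exact ⟨P, h2, by rw [dist_comm]; linarith⟩
  have : IsClosed {P : ConvexBody E | μ P = 0} := isClosed_eq h.val.cont continuous_const
  rw [this.closure_eq] at hcl
  exact hcl

theorem class_inv {E : Type*} [NormedAddCommGroup E] [InnerProductSpace ℝ E] [FiniteDimensional ℝ E]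
    {μ : ConvexBody E → ℂ} {k : ℕ} (h : IsVal μ) (hk : IsHom k μ) (hD : ∀ v K, Dv v μ K = 0) :
    IsClass {A : ConvexBody E | ∀ K, μ (K + A) = μ K} where
  closed := by
    have : {A : ConvexBody E | ∀ K, μ (K + A) = μ K} = ⋂ K, {A | μ (K + A) = μ K} := by ext; simp
    rw [this]
    exact isClosed_iInter fun K => isClosed_eq (h.cont.comp (by fun_prop)) continuous_const
  add := by
    intro A hA B hB K
    rw [← add_assoc, hB (K + A), hA K]
  smul := by
    intro t ht A hA K
    rcases ht.eq_or_lt with rfl | ht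
    · rw [zero_smul', add_zero]
    · have e : K + t • A = t • (t⁻¹ • K + A) := by rw [smul_add, smul_smul_inv ht.ne']
      rw [e, hk t ht.le, hA, ← hk t ht.le, smul_smul_inv ht.ne']
  seg := by
    intro v K
    rw [sseg, ← add_assoc, h.trans]
    exact sub_eq_zero.1 (hD _ K)
  cancel := by
    intro A B hAB hB K
    rw [← hAB K, ← add_assoc, hB (K + A)]

theorem Fk_cons {E : Type*} [NormedAddCommGroup E] [NormedSpace ℝ E]
    {μ : ConvexBody E → ℂ} {k : ℕ} (h : IsVal μ) (hk : IsHom (k + 1) μ) (v : E) (w : Fin k → E) :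
    Fk (Dv v μ) w = Fk μ (Fin.cons v w : Fin (k + 1) → E) := by
  unfold Fk Dv
  rw [zono_zero h hk Finset.univ w (by simp), sub_zero, Fin.sum_univ_succ]
  simp [add_comm]

theorem klain (k : ℕ) : ∀ (E : Type uE) [NormedAddCommGroup E] [InnerProductSpace ℝ E] [FiniteDimensional ℝ E]
    (μ : ConvexBody E → ℂ), IsVal μ → IsHom k μ → IsEv μ → (∀ v : Fin k → E, Fk μ v = 0) → ∀ K, μ K = 0 := by
  induction k with
  | zero =>
    intro E _ _ _ μ h hk he hF K
    rw [hk.zero_const K]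
    have := hF Fin.elim0
    simpa [Fk] using this
  | succ k ih =>
    have key : ∀ d : ℕ, ∀ (E : Type uE) [NormedAddCommGroup E] [InnerProductSpace ℝ E] [FiniteDimensional ℝ E]
        (μ : ConvexBody E → ℂ), Module.finrank ℝ E < d → IsVal μ → IsHom (k + 1) μ → IsEv μ → (∀ v : Fin (k + 1) → E, Fk μ v = 0) → ∀ K, μ K = 0 := by
      intro d
      induction d with
      | zero => intro E _ _ _ μ hd; omega
      | succ d ihd =>
        intro E _ _ _ μ hd h hk he hF
        have hD : ∀ v K, Dv v μ K = 0 := by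
          intro v
          apply ih E (Dv v μ) (h.Dv v) (hk.Dv h v) (he.Dv h v)
          intro w
          rw [Fk_cons h hk]; exact hF _
        have hcl := class_inv h hk hD
        have hsimple : Simple μ := by
          refine ⟨h, ?_, ?_, he⟩
          · intro K p W hW hK
            have hfr : Module.finrank ℝ W < d := by
              have := Submodule.finrank_lt hW
              omega
            have := ihd W (fun A => μ (cmap W.subtypeL A)) hfr (h.comp_cmap _)
              (hk.comp_cmap _) (he.comp_cmap _) (fun v => by rw [Fk_comp_cmap]; exact hF _)
            let K' : ConvexBody W := ⟨(fun w : W => (w : E) + p) ⁻¹' K, ?_, ?_, ?_⟩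
            · have e : K = cmap W.subtypeL K' + pt p := by
                apply ConvexBody.ext
                ext y
                change y ∈ K ↔ y ∈ cmap W.subtypeL K' + pt p
                rw [mem_add]
                constructor
                · intro hy
                  refine ⟨y - p, mem_cmap.2 ⟨⟨y - p, hK y hy⟩, ?_, rfl⟩, p, mem_pt.2 rfl, by simp⟩
                  show (y - p) + p ∈ K
                  simpa using hy
                · rintro ⟨z, hz, q, hq, rfl⟩
                  obtain ⟨w, hw, rfl⟩ := mem_cmap.1 hz
                  rw [mem_pt.1 hq]
                  exact hw
              rw [e, h.trans]
              exact this K'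
            · exact K.convex.affine_preimage (W.subtype.toAffineMap + AffineMap.const ℝ W p)
            · have hce : Topology.IsClosedEmbedding (fun w : W => (w : E) + p) :=
                (Homeomorph.addRight p).isClosedEmbedding.comp (W.closed_of_finiteDimensional.isClosedEmbedding_subtypeVal)
              exact hce.isCompact_preimage K.isCompact
            · obtain ⟨y, hy⟩ := K.nonempty
              exact ⟨⟨y - p, hK y hy⟩, show (y - p) + p ∈ K by simpa using hy⟩
          · intro L hL
            have := hcl.sym hL 0
            rw [zero_add] at this
            rw [this, hk.zero_at]
        exact hsimple.zero
    intro E _ _ _ μ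
    exact key _ E μ (Nat.lt_succ_self _)

end Klain

end UV
end

noncomputable section
namespace UV
open Filter Topology

section SymBodies

open scoped InnerProductSpace

variable {E : Type*} [NormedAddCommGroup E] [InnerProductSpace ℝ E] [FiniteDimensional ℝ E]

/-- centrally symmetric bodies -/
def IsSym (L : ConvexBody E) : Prop := ∀ x, supp L (-x) = supp L x

theorem IsSym.add {A B : ConvexBody E} (hA : IsSym A) (hB : IsSym B) : IsSym (A + B) := by
  intro x; rw [supp_add, supp_add, hA, hB]

theorem IsSym.smul {A : ConvexBody E} (hA : IsSym A) {t : ℝ} (ht : 0 ≤ t) : IsSym (t • A) := by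
  intro x; rw [supp_smul _ ht, supp_smul _ ht, hA]

theorem IsSym.sseg (v : E) : IsSym (sseg v) := by
  intro x; rw [supp_sseg, supp_sseg, inner_neg_left, abs_neg]

theorem IsSym.zero : IsSym (0 : ConvexBody E) := by
  intro x; rw [supp_zero, supp_zero]

theorem IsSym.cancel {A B : ConvexBody E} (hAB : IsSym (A + B)) (hB : IsSym B) : IsSym A := by
  intro x
  have := hAB x
  rw [supp_add, supp_add, hB] at this
  linarith

theorem IsSym.isClosed : IsClosed {A : ConvexBody E | IsSym A} := by
  have : {A : ConvexBody E | IsSym A} = ⋂ x, {A | supp A (-x) = supp A x} := by ext; simp [IsSym]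
  rw [this]
  exact isClosed_iInter fun x => isClosed_eq (continuous_supp_left _) (continuous_supp_left _)

theorem IsSym.neg {A : ConvexBody E} (hA : IsSym A) : (-1 : ℝ) • A = A := by
  apply ext_supp; intro u; rw [supp_neg, hA]

theorem IsSym.cmap {G : Type*} [NormedAddCommGroup G] [InnerProductSpace ℝ G] [FiniteDimensional ℝ G]
    {A : ConvexBody E} (hA : IsSym A) (f : E →L[ℝ] G) : IsSym (cmap f A) := by
  intro x; rw [supp_cmap, supp_cmap, map_neg, hA]

theorem IsSym.of_mem {A : ConvexBody E} (h : ∀ x ∈ A, -x ∈ A) : IsSym A := by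
  have aux : ∀ x, supp A (-x) ≤ supp A x := by
    intro x
    apply supp_le
    intro y hy
    rw [inner_neg_left, ← inner_neg_right]
    exact le_supp (h y hy) x
  intro x
  apply le_antisymm (aux x)
  simpa using aux (-x)

theorem IsVal.sseg_Dv {μ : ConvexBody E → ℂ} (h : IsVal μ) (v : E) (K : ConvexBody E) :
    μ (K + UV.sseg v) = μ K + UV.Dv ((2 : ℝ) • v) μ K := by
  rw [UV.sseg, ← add_assoc, h.trans, UV.Dv]; ring

/-- degree one: additivity -/
theorem add_of_deg_one {L : ConvexBody E → ℂ} (h : IsVal L) (hk : IsHom 1 L) {A : ConvexBody E} (hA : IsSym A)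
    (K : ConvexBody E) : L (K + A) = L K + L A := by
  have hN : IsClass {A : ConvexBody E | ∀ K, L (K + A) = L K + L A} := by
    refine ⟨?_, ?_, ?_, ?_, ?_⟩
    · have : {A : ConvexBody E | ∀ K, L (K + A) = L K + L A} = ⋂ K, {A | L (K + A) = L K + L A} := by ext; simp
      rw [this]
      exact isClosed_iInter fun K => isClosed_eq (h.cont.comp (by fun_prop)) (continuous_const.add h.cont)
    · intro A hA B hB K
      rw [← add_assoc, hB (K + A), hA K, hB A]; ring
    · intro t ht A hA K
      rcases ht.eq_or_lt with rfl | ht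
      · rw [zero_smul', add_zero, hk.zero_at, add_zero]
      · have e : K + t • A = t • (t⁻¹ • K + A) := by rw [smul_add, smul_smul_inv ht.ne']
        have e2 : L K = L (t • (t⁻¹ • K)) := by rw [smul_smul_inv ht.ne']
        rw [e, e2, hk t ht.le, hk t ht.le, hk t ht.le, hA]; ring
    · intro v K
      have h1 := h.sseg_Dv v K
      have h2 := h.sseg_Dv v 0
      rw [hk.zero_at, zero_add, zero_add] at h2
      rw [h1, h2, (IsHom.Dv h hk _).zero_const K]
    · intro A B hAB hB K
      have h1 := hAB K
      rw [← add_assoc, hB (K + A), hB A] at h1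
      have : L (K + A) + L B = L K + L A + L B := by rw [h1]; ring
      exact add_right_cancel this
  exact hN.sym hA K

/-- the mixed functional -/
def bet (ν : ConvexBody E → ℂ) (A K : ConvexBody E) : ℂ := ν (A + K) - ν A - ν K

theorem bet_sseg {ν : ConvexBody E → ℂ} (h : IsVal ν) (hk : IsHom 2 ν) (v : E) (K : ConvexBody E) :
    bet ν (sseg v) K = Dv ((2 : ℝ) • v) ν K := by
  have h1 := h.sseg_Dv v K
  have h2 : ν (sseg v) = 0 := by
    have h3 := h.sseg_Dv v 0
    have h4 := IsHom.Dv h hk ((2 : ℝ) • v)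
    rw [h4.zero_at, hk.zero_at] at h3
    simpa using h3
  rw [bet, add_comm, h1, h2]; ring

theorem bet_add {ν : ConvexBody E → ℂ} (h : IsVal ν) (hk : IsHom 2 ν) {A B K : ConvexBody E} (hA : IsSym A) (hB : IsSym B)
    (hK : IsSym K) : bet ν (A + B) K = bet ν A K + bet ν B K := by
  have hN : IsClass {A : ConvexBody E | IsSym A ∧ ∀ B K, IsSym B → IsSym K → bet ν (A + B) K = bet ν A K + bet ν B K} := by
    refine ⟨?_, ?_, ?_, ?_, ?_⟩
    · have : {A : ConvexBody E | IsSym A ∧ ∀ B K, IsSym B → IsSym K → bet ν (A + B) K = bet ν A K + bet ν B K} =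
        {A : ConvexBody E | IsSym A} ∩ ⋂ B, ⋂ K, ⋂ (_ : IsSym B), ⋂ (_ : IsSym K), {A | bet ν (A + B) K = bet ν A K + bet ν B K} := by ext; simp
      rw [this]
      refine IsSym.isClosed.inter (isClosed_iInter fun B => isClosed_iInter fun K => isClosed_iInter fun _ => isClosed_iInter fun _ => ?_)
      have hc := h.cont
      unfold bet
      exact isClosed_eq (by fun_prop) (by fun_prop)
    · rintro A ⟨sA, hA⟩ B ⟨sB, hB⟩
      refine ⟨sA.add sB, fun C K hC hK => ?_⟩
      rw [add_assoc, hA _ K (sB.add hC) hK, hB C K hC hK, hA B K sB hK]; ring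
    · rintro t ht A ⟨sA, hA⟩
      refine ⟨sA.smul ht, fun B K hB hK => ?_⟩
      rcases ht.eq_or_lt with rfl | ht
      · rw [zero_smul', zero_add]
        simp [bet, hk.zero_at]
      · have hsc : ∀ A K, bet ν (t • A) (t • K) = (t : ℂ) ^ 2 * bet ν A K := by
          intro A K
          unfold bet
          rw [← smul_add, hk t ht.le, hk t ht.le, hk t ht.le]; ring
        have e : t • A + B = t • (A + t⁻¹ • B) := by rw [smul_add, smul_smul_inv ht.ne']
        have := hA (t⁻¹ • B) (t⁻¹ • K) (hB.smul (by positivity)) (hK.smul (by positivity))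
        have h2 : bet ν B K = bet ν (t • (t⁻¹ • B)) (t • (t⁻¹ • K)) := by rw [smul_smul_inv ht.ne', smul_smul_inv ht.ne']
        rw [h2]
        have h3 : ∀ X, bet ν X K = bet ν X (t • (t⁻¹ • K)) := by intro X; rw [smul_smul_inv ht.ne']
        rw [e, h3, h3 (t • A), hsc, hsc, hsc, this]; ring
    · intro v
      refine ⟨IsSym.sseg v, fun B K hB hK => ?_⟩
      rw [bet_sseg h hk]
      have h1 := h.sseg_Dv v (B + K)
      have h2 := h.sseg_Dv v B
      have h3 := add_of_deg_one (h.Dv _) (IsHom.Dv h hk ((2 : ℝ) • v)) hK B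
      unfold bet
      rw [show sseg v + B + K = B + K + sseg v by rw [add_comm, add_assoc, add_comm _ B, ← add_assoc, add_comm K, add_assoc, add_comm K], add_comm (sseg v), h1, h2, h3]; ring
    · rintro A B ⟨sAB, hAB⟩ ⟨sB, hB⟩
      have sA := sAB.cancel sB
      refine ⟨sA, fun C K hC hK => ?_⟩
      have h1 := hAB C K hC hK
      have h2 := hB (A + C) K (sA.add hC) hK
      have h3 := hB A K sA hK
      have e : A + B + C = B + (A + C) := by rw [add_comm A B, add_assoc]
      rw [e, h2, add_comm A B, h3] at h1
      linear_combination h1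
  exact (hN.sym hA).2 B K hB hK

theorem bet_smul {ν : ConvexBody E → ℂ} (h : IsVal ν) (hk : IsHom 2 ν) {A K : ConvexBody E} (hA : IsSym A)
    (hK : IsSym K) {t : ℝ} (ht : 0 ≤ t) : bet ν (t • A) K = t * bet ν A K := by
  have hc := h.cont
  have h1 := linear_of_add (a := fun t => bet ν (t • A) K) (by
    unfold bet
    have := continuous_smul_left A
    fun_prop) (by
    intro s t hs ht
    show bet ν ((s + t) • A) K = _
    rw [add_smul' hs ht, bet_add h hk (hA.smul hs) (hA.smul ht) hK]) ht
  simpa using h1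

end SymBodies

end UV
end

noncomputable section
namespace UV
open Filter Topology
open scoped InnerProductSpace Quaternion

/-- quaternions -/
abbrev HH := Quaternion ℝ
/-- three space -/
abbrev E3 := EuclideanSpace ℝ (Fin 3)

/-- quaternion from coordinates -/
def qm (a b c d : ℝ) : HH := ⟨a, b, c, d⟩
@[simp] theorem qm_re (a b c d : ℝ) : (qm a b c d).re = a := rfl
@[simp] theorem qm_imI (a b c d : ℝ) : (qm a b c d).imI = b := rfl
@[simp] theorem qm_imJ (a b c d : ℝ) : (qm a b c d).imJ = c := rfl
@[simp] theorem qm_imK (a b c d : ℝ) : (qm a b c d).imK = d := rfl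

/-- imaginary embedding -/
def qe : E3 →L[ℝ] HH :=
  LinearMap.toContinuousLinearMap
    { toFun := fun a => qm 0 (a 0) (a 1) (a 2)
      map_add' := by intro a b; ext <;> simp
      map_smul' := by intro t a; ext <;> simp }

/-- imaginary part -/
def qim : HH →L[ℝ] E3 :=
  LinearMap.toContinuousLinearMap
    { toFun := fun x => !₂[x.imI, x.imJ, x.imK]
      map_add' := by intro a b; ext i; fin_cases i <;> simp
      map_smul' := by intro t a; ext i; fin_cases i <;> simp }

@[simp] theorem qe_re (a : E3) : (qe a).re = 0 := rfl
@[simp] theorem qe_imI (a : E3) : (qe a).imI = a 0 := rfl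
@[simp] theorem qe_imJ (a : E3) : (qe a).imJ = a 1 := rfl
@[simp] theorem qe_imK (a : E3) : (qe a).imK = a 2 := rfl
@[simp] theorem qim_0 (x : HH) : qim x 0 = x.imI := rfl
@[simp] theorem qim_1 (x : HH) : qim x 1 = x.imJ := rfl
@[simp] theorem qim_2 (x : HH) : qim x 2 = x.imK := rfl

theorem inner_E3 (a b : E3) : ⟪a, b⟫_ℝ = a 0 * b 0 + a 1 * b 1 + a 2 * b 2 := by
  simp [PiLp.inner_apply, Fin.sum_univ_three]; ring

theorem inner_HH (x y : HH) : ⟪x, y⟫_ℝ = x.re * y.re + x.imI * y.imI + x.imJ * y.imJ + x.imK * y.imK := by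
  rw [Quaternion.inner_def]; simp

theorem inner_HH' (x y : HH) : ⟪x, y⟫_ℝ = x.re * y.re + ⟪qim x, qim y⟫_ℝ := by
  rw [inner_HH, inner_E3]; simp only [qim_0, qim_1, qim_2]; ring

theorem qim_qe (a : E3) : qim (qe a) = a := by ext i; fin_cases i <;> rfl

theorem qe_qim (x : HH) : qe (qim x) + x.re • (1 : HH) = x := by ext <;> simp

theorem inner_qe_left (a : E3) (x : HH) : ⟪qe a, x⟫_ℝ = ⟪a, qim x⟫_ℝ := by
  rw [inner_HH', qim_qe]; simp

theorem inner_qe_right (a : E3) (x : HH) : ⟪x, qe a⟫_ℝ = ⟪qim x, a⟫_ℝ := by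
  rw [inner_HH', qim_qe]; simp

theorem norm_qe (a : E3) : ‖qe a‖ = ‖a‖ := by
  rw [← sq_eq_sq₀ (norm_nonneg _) (norm_nonneg _), ← real_inner_self_eq_norm_sq, ← real_inner_self_eq_norm_sq,
    inner_qe_left, qim_qe]

theorem normSq_HH (x : HH) : ‖x‖ ^ 2 = x.re ^ 2 + ‖qim x‖ ^ 2 := by
  rw [← real_inner_self_eq_norm_sq, ← real_inner_self_eq_norm_sq, inner_HH']; ring

theorem adj_qim : ContinuousLinearMap.adjoint qim = qe := by
  symm; rw [ContinuousLinearMap.eq_adjoint_iff]; intro x y; exact inner_qe_left _ _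

theorem adj_qe : ContinuousLinearMap.adjoint qe = qim := by
  symm; rw [ContinuousLinearMap.eq_adjoint_iff]; intro x y; exact (inner_qe_right _ _).symm

/-- left multiplication -/
def ml (g : HH) : HH →L[ℝ] HH := ContinuousLinearMap.mul ℝ HH g
/-- right multiplication -/
def mr (r : HH) : HH →L[ℝ] HH := (ContinuousLinearMap.mul ℝ HH).flip r

@[simp] theorem ml_apply (g x : HH) : ml g x = g * x := rfl
@[simp] theorem mr_apply (g x : HH) : mr g x = x * g := rfl

theorem adj_ml (g : HH) : ContinuousLinearMap.adjoint (ml g) = ml (star g) := by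
  symm; rw [ContinuousLinearMap.eq_adjoint_iff]; intro x y
  rw [inner_HH, inner_HH]; simp; ring

theorem adj_mr (g : HH) : ContinuousLinearMap.adjoint (mr g) = mr (star g) := by
  symm; rw [ContinuousLinearMap.eq_adjoint_iff]; intro x y
  rw [inner_HH, inner_HH]; simp; ring

theorem star_mul_self' (x : HH) : star x * x = (‖x‖ ^ 2) • (1 : HH) := by
  rw [Quaternion.star_mul_self, Quaternion.normSq_eq_norm_mul_self]; ext <;> simp <;> ring

/-- the invariance hypotheses -/
structure QV (ν : ConvexBody HH → ℂ) : Prop where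
  v : IsVal ν
  h : IsHom 2 ν
  l : ∀ g : HH, ‖g‖ = 1 → ∀ K, ν (cmap (ml g) K) = ν K
  r : ∀ r : HH, ‖r‖ = 1 → r.imJ = 0 → r.imK = 0 → ∀ K, ν (cmap (mr r) K) = ν K

theorem QV.e {ν} (q : QV ν) : IsEv ν := by
  intro K
  rw [← q.l (-1) (by simp) K, smul_eq_cmap]
  congr 2
  ext1 x; simp

theorem QV.Dv_eq {ν} (q : QV ν) (x : HH) (K : ConvexBody HH) :
    Dv x ν K = Dv 1 ν (cmap (ml (star x)) K) := by
  by_cases hx : x = 0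
  · subst hx
    have e : cmap (ml (star 0)) K = 0 := by
      apply ext_supp; intro u; rw [supp_cmap, adj_ml, supp_zero]; simp [supp_smul]
      have := supp_hom K (le_refl (0 : ℝ)) 0
      simpa using this
    rw [e, (IsHom.Dv q.v q.h 1).zero_at]
    unfold Dv
    rw [seg_zero, add_zero, sub_self]
  · have hn : 0 < ‖x‖ := norm_pos_iff.2 hx
    set g : HH := ‖x‖⁻¹ • star x with hg
    have hg1 : ‖g‖ = 1 := by rw [hg, norm_smul, Quaternion.norm_star]; simp [hn.ne']
    have hgx : g * x = ‖x‖ • (1 : HH) := by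
      rw [hg, smul_mul_assoc, star_mul_self', smul_smul]; congr 1; field_simp
    have e : cmap (ml (star x)) K = ‖x‖ • cmap (ml g) K := by
      rw [smul_eq_cmap, cmap_cmap]; congr 1; ext1 y; simp [hg, hn.ne']
    rw [e, IsHom.Dv q.v q.h 1 _ hn.le, pow_one, ← q.v.Dv_smul _ hn.le, ← hgx]
    unfold Dv
    rw [← ml_apply, ← cmap_seg, ← cmap_add, q.l g hg1, q.l g hg1]

theorem QV.conj {ν} (q : QV ν) {r : HH} (hr : ‖r‖ = 1) (h1 : r.imJ = 0) (h2 : r.imK = 0) (K : ConvexBody HH) :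
    Dv 1 ν (cmap ((mr r).comp (ml (star r))) K) = Dv 1 ν K := by
  have hs : ‖star r‖ = 1 := by rw [Quaternion.norm_star, hr]
  have key : ∀ K, ν (cmap ((mr r).comp (ml (star r))) K) = ν K := by
    intro K
    rw [← cmap_cmap, q.r r hr h1 h2, q.l _ hs]
  have e : ((mr r).comp (ml (star r))) 1 = 1 := by
    simp [star_mul_self', hr]
  unfold Dv
  conv_lhs => rw [← e]
  rw [← cmap_seg, ← cmap_add, key, key]

theorem QV.proj {ν} (q : QV ν) (K : ConvexBody HH) : Dv 1 ν K = Dv 1 ν (cmap (qe.comp qim) K) := by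
  have hL := q.v.Dv 1
  have hh := IsHom.Dv q.v q.h 1
  have he := IsEv.Dv q.v q.e 1
  refine sub_eq_zero.1 (klain 1 HH (fun K => Dv 1 ν K - Dv 1 ν (cmap (qe.comp qim) K)) (hL.sub (hL.comp_cmap _)) ?_ ?_ ?_ K)
  · intro t ht K
    show Dv 1 ν (t • K) - Dv 1 ν (cmap (qe.comp qim) (t • K)) = _
    rw [cmap_smul, hh t ht, hh t ht]; ring
  · intro K
    show Dv 1 ν ((-1 : ℝ) • K) - Dv 1 ν (cmap (qe.comp qim) ((-1 : ℝ) • K)) = _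
    rw [cmap_smul, he, he]
  · intro v
    have h1 := Fk_cons q.v q.h 1 v
    have h2 := Fk_cons q.v q.h 1 (fun i => qe (qim (v i)))
    have h3 := Fk_shear q.v q.h (by simp) (Fin.cons 1 (fun i => qe (qim (v i))) : Fin 2 → HH) (i := 1) (j := 0) (by simp) (v 0).re
    have h4 : Function.update (Fin.cons 1 (fun i => qe (qim (v i))) : Fin 2 → HH) 1
      ((Fin.cons 1 (fun i => qe (qim (v i))) : Fin 2 → HH) 1 + (v 0).re • (Fin.cons 1 (fun i => qe (qim (v i))) : Fin 2 → HH) 0) = (Fin.cons 1 v : Fin 2 → HH) := by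
      ext1 i
      fin_cases i
      · simp
      · have := qe_qim (v 0)
        show Function.update (Fin.cons 1 (fun i => qe (qim (v i))) : Fin 2 → HH) 1 _ 1 = v 0
        rw [Function.update_self]; exact this
    rw [h4] at h3
    have h5 : Fk (fun K => Dv 1 ν (cmap (qe.comp qim) K)) v = Fk (Dv 1 ν) (fun i => qe (qim (v i))) := Fk_comp_cmap _ _ _
    have h6 : Fk (fun K => Dv 1 ν K - Dv 1 ν (cmap (qe.comp qim) K)) v = Fk (Dv 1 ν) v - Fk (fun K => Dv 1 ν (cmap (qe.comp qim) K)) v := rfl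
    rw [h6, h5, h1, h2, h3, sub_self]

/-- the degree one functional on three-space -/
def LI (ν : ConvexBody HH → ℂ) (K : ConvexBody E3) : ℂ := Dv 1 ν (cmap qe K)

theorem QV.LI_eq {ν} (q : QV ν) (K : ConvexBody HH) : Dv 1 ν K = LI ν (cmap qim K) := by
  rw [q.proj, LI, cmap_cmap]

theorem QV.LIv {ν} (q : QV ν) : IsVal (LI ν) := (q.v.Dv 1).comp_cmap _
theorem QV.LIh {ν} (q : QV ν) : IsHom 1 (LI ν) := (IsHom.Dv q.v q.h 1).comp_cmap _

theorem exists_rot {p p' : E3} (h0 : p 0 = p' 0) (hn : ‖p‖ = ‖p'‖) :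
    ∃ r : HH, ‖r‖ = 1 ∧ r.imJ = 0 ∧ r.imK = 0 ∧ star r * qe p * r = qe p' := by
  have h1 : p 1 ^ 2 + p 2 ^ 2 = p' 1 ^ 2 + p' 2 ^ 2 := by
    have : ‖p‖ ^ 2 = ‖p'‖ ^ 2 := by rw [hn]
    rw [← real_inner_self_eq_norm_sq, ← real_inner_self_eq_norm_sq, inner_E3, inner_E3, h0] at this
    linarith
  by_cases hw : p 1 ^ 2 + p 2 ^ 2 = 0
  · have a1 : p 1 = 0 := by nlinarith [sq_nonneg (p 1), sq_nonneg (p 2)]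
    have a2 : p 2 = 0 := by nlinarith [sq_nonneg (p 1), sq_nonneg (p 2)]
    have a3 : p' 1 = 0 := by nlinarith [sq_nonneg (p' 1), sq_nonneg (p' 2)]
    have a4 : p' 2 = 0 := by nlinarith [sq_nonneg (p' 1), sq_nonneg (p' 2)]
    refine ⟨1, by simp, by simp, by simp, ?_⟩
    ext <;> simp [*]
  · let w : ℂ := ⟨p 1, - p 2⟩
    let w' : ℂ := ⟨p' 1, - p' 2⟩
    have hw0 : w ≠ 0 := by
      intro h
      have h2 : p 1 = 0 := by simpa using congrArg Complex.re h
      have h3 : p 2 = 0 := by simpa [w] using congrArg Complex.im h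
      exact hw (by rw [h2, h3]; simp)
    obtain ⟨z, hz⟩ := IsAlgClosed.exists_pow_nat_eq (w' / w) (n := 2) (by norm_num)
    have hN : Complex.normSq w = Complex.normSq w' := by simp [Complex.normSq_apply, w, w']; nlinarith
    have hz1 : Complex.normSq z = 1 := by
      have h4 : Complex.normSq z ^ 2 = 1 := by
        rw [← map_pow, hz, map_div₀, hN, div_self]
        rw [← hN]; simpa using hw0
      have := Complex.normSq_nonneg z
      nlinarith
    have hzz : w * z ^ 2 = w' := by rw [hz]; field_simp
    rw [Complex.normSq_apply] at hz1
    have e1 : p 1 * (z.re * z.re - z.im * z.im) + p 2 * (2 * z.re * z.im) = p' 1 := by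
      have := congrArg Complex.re hzz
      simp [pow_two, w, w'] at this
      linarith
    have e2 : p 1 * (2 * z.re * z.im) - p 2 * (z.re * z.re - z.im * z.im) = - p' 2 := by
      have := congrArg Complex.im hzz
      simp [pow_two, w, w'] at this
      linarith
    refine ⟨qm z.re z.im 0 0, ?_, rfl, rfl, ?_⟩
    · rw [← sq_eq_sq₀ (norm_nonneg _) zero_le_one, ← real_inner_self_eq_norm_sq, inner_HH]
      simp; linarith
    · ext
      · simp; ring
      · simp; rw [← h0]; linear_combination (p 0) * hz1
      · simp; linear_combination e1
      · simp; linear_combination - e2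

end UV
end

noncomputable section
namespace UV
open Filter Topology
open scoped InnerProductSpace Quaternion

section SymInt
variable {E : Type*} [NormedAddCommGroup E] [InnerProductSpace ℝ E] [FiniteDimensional ℝ E]

theorem integ_cpt {X : Type*} [MetricSpace X] [SecondCountableTopology X] [MeasurableSpace X]
    [BorelSpace X] {ρ : Measure X} [IsFiniteMeasure ρ] {S : Set X} (hS : IsCompact S) (hρ : ∀ᵐ x ∂ρ, x ∈ S)
    {G : Type*} [NormedAddCommGroup G] {f : X → G} (hf : Continuous f) : Integrable f ρ := by
  have h1 : ρ.restrict S = ρ := Measure.restrict_eq_self_of_ae_mem hρ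
  have h2 := hf.continuousOn.integrableOn_compact (μ := ρ) hS
  rwa [IntegrableOn, h1] at h2

theorem sym_integral {X : Type*} [MetricSpace X] [SecondCountableTopology X] [MeasurableSpace X]
    [BorelSpace X] {ρ : Measure X} [IsFiniteMeasure ρ] {S : Set X} (hS : IsCompact S) (hρ : ∀ᵐ x ∂ρ, x ∈ S)
    {A : X → ConvexBody E} (hA : Continuous A) (hsym : ∀ x, IsSym (A x)) :
    ∃ Z, IsSym Z ∧ (∀ u, supp Z u = ∫ x, supp (A x) u ∂ρ) ∧
      ∀ Φ : ConvexBody E → ℂ, Continuous Φ → (∀ A B, IsSym A → IsSym B → Φ (A + B) = Φ A + Φ B) →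
        (∀ t : ℝ, 0 ≤ t → ∀ A, IsSym A → Φ (t • A) = t * Φ A) → Φ Z = ∫ x, Φ (A x) ∂ρ := by
  have key : ∀ Φ : ConvexBody E → ℂ, Continuous Φ → (∀ A B, IsSym A → IsSym B → Φ (A + B) = Φ A + Φ B) →
        (∀ t : ℝ, 0 ≤ t → ∀ A, IsSym A → Φ (t • A) = t * Φ A) → 
      ∃ Z ∈ {A : ConvexBody E | IsSym A}, (∀ u, supp Z u = ∫ x, supp (A x) u ∂ρ) ∧ Φ Z = ∫ x, Φ (A x) ∂ρ := by
    intro Φ h1 h2 h3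
    refine integral_body IsSym.isClosed IsSym.zero (fun A hA B hB => IsSym.add hA hB) (fun t ht A hA => IsSym.smul hA ht)
      h1 (fun A hA B hB => h2 A B hA hB) h3 hA hsym (g := fun x => dist (A x) 0) (integ_cpt hS hρ (by fun_prop)) ?_ (integ_cpt hS hρ (h1.comp hA))
    intro x u
    have := abs_supp_sub_le (A x) 0 u
    rwa [supp_zero, sub_zero] at this
  obtain ⟨Z, hZ, hs, -⟩ := key (fun _ => 0) continuous_const (by simp) (by simp)
  refine ⟨Z, hZ, hs, fun Φ h1 h2 h3 => ?_⟩
  obtain ⟨Z', hZ', hs', h'⟩ := key Φ h1 h2 h3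
  rw [← h']
  congr 1
  apply ext_supp; intro u; rw [hs, hs']

end SymInt

/-- Lebesgue measure on [-1,1] -/
def tau : Measure ℝ := volume.restrict (Icc (-1) 1)

instance : IsFiniteMeasure tau := by unfold tau; infer_instance

theorem tau_ae : ∀ᵐ t ∂tau, t ∈ Icc (-1 : ℝ) 1 := ae_restrict_mem measurableSet_Icc

theorem integral_tau {G : Type*} [NormedAddCommGroup G] [NormedSpace ℝ G] (f : ℝ → G) :
    ∫ t, f t ∂tau = ∫ t in (-1 : ℝ)..1, f t := by
  rw [tau, integral_Icc_eq_integral_Ioc, intervalIntegral.integral_of_le (by norm_num)]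

theorem integ_tau {G : Type*} [NormedAddCommGroup G] {f : ℝ → G} (hf : Continuous f) : Integrable f tau :=
  integ_cpt isCompact_Icc tau_ae hf

/-- the profile -/
def phi (s c : ℝ) : ℝ := ∫ t, |c + t * s| ∂tau

theorem phi_neg (s c : ℝ) : phi (-s) c = phi s c := by
  unfold phi
  rw [integral_tau, integral_tau]
  have := intervalIntegral.integral_comp_neg (a := -1) (b := 1) (fun t => |c + t * s|)
  rw [neg_neg] at this
  rw [← this]
  congr 1; ext t; congr 1; ring

theorem phi_zero (c : ℝ) : phi 0 c = 2 * |c| := by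
  unfold phi
  rw [integral_tau]; simp only [mul_zero, add_zero, intervalIntegral.integral_const, smul_eq_mul]; ring

theorem int_aux (s c a b : ℝ) : ∫ t in a..b, (c + t * s) = c * (b - a) + s * ((b ^ 2 - a ^ 2) / 2) := by
  rw [intervalIntegral.integral_add (by simp) (by apply Continuous.intervalIntegrable; fun_prop), intervalIntegral.integral_mul_const, integral_id]
  simp; ring

theorem phi_one {c : ℝ} (hc : |c| ≤ 1) : phi 1 c = 1 + c ^ 2 := by
  rw [abs_le] at hc
  unfold phi
  rw [integral_tau, ← intervalIntegral.integral_add_adjacent_intervals (b := -c) (by apply Continuous.intervalIntegrable; fun_prop) (by apply Continuous.intervalIntegrable; fun_prop)]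
  have h1 : ∫ t in (-1 : ℝ)..(-c), |c + t * 1| = ∫ t in (-1 : ℝ)..(-c), (-c + t * (-1)) := by
    apply intervalIntegral.integral_congr
    intro t ht
    rw [uIcc_of_le (by linarith)] at ht
    show |c + t * 1| = -c + t * (-1)
    rw [abs_of_nonpos (by linarith [ht.2])]; ring
  have h2 : ∫ t in (-c)..1, |c + t * 1| = ∫ t in (-c)..1, (c + t * 1) := by
    apply intervalIntegral.integral_congr
    intro t ht
    rw [uIcc_of_le (by linarith)] at ht
    exact abs_of_nonneg (by linarith [ht.1])
  rw [h1, h2, int_aux, int_aux]; ring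

theorem phi_ge {a : ℝ} (s c : ℝ) (ha : |a| ≤ 2) : c * a + |s| * (1 - a ^ 2 / 4) ≤ phi s c := by
  have key : ∀ s : ℝ, c * a + s * (1 - a ^ 2 / 4) ≤ phi s c := by
    intro s
    rw [abs_le] at ha
    unfold phi
    rw [integral_tau, ← intervalIntegral.integral_add_adjacent_intervals (b := -(a/2)) (by apply Continuous.intervalIntegrable; fun_prop) (by apply Continuous.intervalIntegrable; fun_prop)]
    have h1 : ∫ t in (-1 : ℝ)..(-(a/2)), (-c + t * (-s)) ≤ ∫ t in (-1 : ℝ)..(-(a/2)), |c + t * s| := by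
      apply intervalIntegral.integral_mono_on (by linarith) (by apply Continuous.intervalIntegrable; fun_prop) (by apply Continuous.intervalIntegrable; fun_prop)
      intro t _
      have := neg_abs_le (c + t * s); linarith
    have h2 : ∫ t in (-(a/2))..1, (c + t * s) ≤ ∫ t in (-(a/2))..1, |c + t * s| := by
      apply intervalIntegral.integral_mono_on (by linarith) (by apply Continuous.intervalIntegrable; fun_prop) (by apply Continuous.intervalIntegrable; fun_prop)
      intro t _
      exact le_abs_self _
    rw [int_aux] at h1 h2
    linarith
  rcases le_total 0 s with h | h
  · rw [abs_of_nonneg h]; exact key s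
  · rw [abs_of_nonpos h, ← phi_neg]; exact key (-s)

theorem inner_real_add (p : E3) (t : ℝ) (u : HH) : ⟪u, qe p + t • (1 : HH)⟫_ℝ = ⟪p, qim u⟫_ℝ + t * u.re := by
  rw [inner_add_right, inner_smul_right, inner_qe_right, real_inner_comm]
  congr 2
  rw [inner_HH]; simp

theorem QV.bet_Dv {ν} (q : QV ν) (x : HH) (K : ConvexBody HH) :
    bet ν (sseg x) K = 2 * Dv 1 ν (cmap (ml (star x)) K) := by
  rw [bet_sseg q.v q.h, q.v.Dv_smul _ (by norm_num), q.Dv_eq]; simp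

theorem exists_zb (p : E3) : ∃ Z : ConvexBody HH, IsSym Z ∧ (∀ u, supp Z u = phi u.re ⟪p, qim u⟫_ℝ) ∧
    ∀ ν, QV ν → ∀ K, IsSym K → bet ν Z K = 2 * ∫ t, Dv 1 ν (cmap (ml (star (qe p + t • (1 : HH)))) K) ∂tau := by
  obtain ⟨Z, h1, h2, h3⟩ := sym_integral (ρ := tau) isCompact_Icc tau_ae
    (A := fun t => sseg (qe p + t • (1 : HH))) (continuous_sseg.comp (by fun_prop)) (fun _ => IsSym.sseg _)
  refine ⟨Z, h1, ?_, ?_⟩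
  · intro u
    rw [h2]
    unfold phi
    congr 1; ext t; rw [supp_sseg, inner_real_add]
  · intro ν q K hK
    have hc := q.v.cont
    rw [h3 (fun A => bet ν A K) (by unfold bet; fun_prop) (fun A B hA hB => bet_add q.v q.h hA hB hK)
      (fun t ht A hA => bet_smul q.v q.h hA hK ht), ← integral_const_mul]
    congr 1; ext t; rw [q.bet_Dv]

/-- the building block bodies -/
def zb (p : E3) : ConvexBody HH := (exists_zb p).choose

theorem zb_sym (p : E3) : IsSym (zb p) := (exists_zb p).choose_spec.1
theorem supp_zb (p : E3) (u : HH) : supp (zb p) u = phi u.re ⟪p, qim u⟫_ℝ := (exists_zb p).choose_spec.2.1 u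
theorem bet_zb {ν} (q : QV ν) (p : E3) {K : ConvexBody HH} (hK : IsSym K) :
    bet ν (zb p) K = 2 * ∫ t, Dv 1 ν (cmap (ml (star (qe p + t • (1 : HH)))) K) ∂tau := (exists_zb p).choose_spec.2.2 ν q K hK

/-- standard basis -/
def e3 (j : Fin 3) : E3 := EuclideanSpace.single j 1

theorem inner_e3 (R : E3 ≃ₗᵢ[ℝ] E3) (j : Fin 3) (v : E3) : ⟪R (e3 j), v⟫_ℝ = R.symm v j := by
  rw [← R.symm.inner_map_map, R.symm_apply_apply]
  rw [inner_E3]; fin_cases j <;> simp [e3]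

/-- the frame body -/
def zR (R : E3 ≃ₗᵢ[ℝ] E3) : ConvexBody HH := zb (R (e3 0)) + zb (R (e3 1)) + zb (R (e3 2))

theorem zR_sym (R) : IsSym (zR R) := ((zb_sym _).add (zb_sym _)).add (zb_sym _)

theorem supp_zR (R) (u : HH) : supp (zR R) u = phi u.re (R.symm (qim u) 0) + phi u.re (R.symm (qim u) 1) + phi u.re (R.symm (qim u) 2) := by
  rw [zR, supp_add, supp_add, supp_zb, supp_zb, supp_zb, inner_e3, inner_e3, inner_e3]

theorem norm_E3 (a : E3) : ‖a‖ ^ 2 = a 0 ^ 2 + a 1 ^ 2 + a 2 ^ 2 := by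
  rw [← real_inner_self_eq_norm_sq, inner_E3]; ring

theorem mem_zR (R : E3 ≃ₗᵢ[ℝ] E3) (x : HH) :
    x ∈ zR R ↔ (∀ j, |R.symm (qim x) j| ≤ 2) ∧ |x.re| ≤ 3 - ‖qim x‖ ^ 2 / 4 := by
  have hsq : ‖qim x‖ ^ 2 = R.symm (qim x) 0 ^ 2 + R.symm (qim x) 1 ^ 2 + R.symm (qim x) 2 ^ 2 := by
    rw [← R.symm.norm_map, norm_E3]
  have hin : ∀ u : HH, ⟪u, x⟫_ℝ = u.re * x.re + (R.symm (qim u) 0 * R.symm (qim x) 0 + R.symm (qim u) 1 * R.symm (qim x) 1 + R.symm (qim u) 2 * R.symm (qim x) 2) := by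
    intro u
    rw [inner_HH', ← R.symm.inner_map_map, inner_E3]
  rw [mem_iff_supp]
  constructor
  · intro h
    have h1 : ∀ j, |R.symm (qim x) j| ≤ 2 := by
      have aux : ∀ j, ∀ s : ℝ, |s| = 1 → s * R.symm (qim x) j ≤ 2 := by
        intro j s hs
        have h2 := h (qe (s • R (e3 j)))
        rw [hin, supp_zR, qim_qe] at h2
        simp only [qe_re, phi_zero, zero_mul, zero_add, map_smul, LinearIsometryEquiv.symm_apply_apply] at h2
        fin_cases j <;> simp [e3, hs, phi_zero] at h2 ⊢ <;> linarith
      intro j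
      rw [abs_le]
      have := aux j 1 (by simp)
      have := aux j (-1) (by simp)
      constructor <;> linarith
    refine ⟨h1, ?_⟩
    have aux : ∀ s : ℝ, s = 1 ∨ s = -1 → s * x.re ≤ 3 - ‖qim x‖ ^ 2 / 4 := by
      intro s hs
      have hp : ∀ c, phi s c = phi 1 c := by
        intro c; rcases hs with rfl | rfl
        · rfl
        · exact phi_neg 1 c
      have h2 := h (qe ((1/2 : ℝ) • qim x) + s • (1 : HH))
      have e1 : qim (qe ((1/2 : ℝ) • qim x) + s • (1 : HH)) = (1/2 : ℝ) • qim x := by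
        rw [map_add, qim_qe]
        ext i; fin_cases i <;> simp
      have e2 : (qe ((1/2 : ℝ) • qim x) + s • (1 : HH)).re = s := by simp
      rw [hin, supp_zR, e1, e2, hp, hp, hp, map_smul] at h2
      have hb : ∀ j, |((1/2 : ℝ) • R.symm (qim x)) j| ≤ 1 := by
        intro j
        have := h1 j
        simp [abs_mul]; linarith
      rw [phi_one (hb _), phi_one (hb _), phi_one (hb _)] at h2
      simp at h2
      rw [hsq]; linarith
    rw [abs_le]
    have := aux 1 (by simp)
    have := aux (-1) (by simp)
    constructor <;> linarith
  · rintro ⟨h1, h2⟩ u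
    rw [hin, supp_zR]
    have a0 := phi_ge u.re (R.symm (qim u) 0) (h1 0)
    have a1 := phi_ge u.re (R.symm (qim u) 1) (h1 1)
    have a2 := phi_ge u.re (R.symm (qim u) 2) (h1 2)
    have h3 : u.re * x.re ≤ |u.re| * (3 - ‖qim x‖ ^ 2 / 4) := by
      calc u.re * x.re ≤ |u.re * x.re| := le_abs_self _
        _ = |u.re| * |x.re| := abs_mul _ _
        _ ≤ _ := by gcongr
    rw [hsq] at h3
    nlinarith

end UV
end

noncomputable section
namespace UV
open Filter Topology
open scoped InnerProductSpace Quaternion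

theorem smul_add_body {V : Type*} [NormedAddCommGroup V] [NormedSpace ℝ V] (t : ℝ) (K L : ConvexBody V) :
    t • (K + L) = t • K + t • L := smul_add _ _ _

/-- real part as a functional -/
def reL : HH →L[ℝ] ℝ := innerSL ℝ (1 : HH)
theorem reL_apply (x : HH) : reL x = x.re := by
  show ⟪(1 : HH), x⟫_ℝ = x.re
  rw [inner_HH]; simp

open Classical in
/-- horizontal slabs of bodies -/
def slab (K : ConvexBody HH) (I : Set ℝ) : ConvexBody HH :=
  if h : Convex ℝ I ∧ IsClosed I ∧ ((K : Set HH) ∩ reL ⁻¹' I).Nonempty then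
    ⟨(K : Set HH) ∩ reL ⁻¹' I, K.convex.inter (h.1.linear_preimage (reL : HH →ₗ[ℝ] ℝ)),
      K.isCompact.inter_right (h.2.1.preimage reL.continuous), h.2.2⟩
  else K

theorem mem_slab {K : ConvexBody HH} {I : Set ℝ} (h1 : Convex ℝ I) (h2 : IsClosed I) {y : HH} (hy : y ∈ K) (hy' : y.re ∈ I)
    (x : HH) : x ∈ slab K I ↔ x ∈ K ∧ x.re ∈ I := by
  have h : Convex ℝ I ∧ IsClosed I ∧ ((K : Set HH) ∩ reL ⁻¹' I).Nonempty :=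
    ⟨h1, h2, y, hy, by rw [mem_preimage, reL_apply]; exact hy'⟩
  rw [slab, dif_pos h]
  show x ∈ (K : Set HH) ∩ reL ⁻¹' I ↔ _
  rw [mem_inter_iff, mem_preimage, reL_apply]; rfl

theorem slab_val {ν : ConvexBody HH → ℂ} (h : IsVal ν) {K K1 K2 K3 : ConvexBody HH} {I J : Set ℝ} 
    (h1 : ∀ x, x ∈ K1 ↔ x ∈ K ∧ x.re ∈ I) (h2 : ∀ x, x ∈ K2 ↔ x ∈ K ∧ x.re ∈ J)
    (h3 : ∀ x, x ∈ K3 ↔ x ∈ K ∧ x.re ∈ I ∩ J) (hIJ : ∀ x ∈ K, x.re ∈ I ∪ J) :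
    ν K + ν K3 = ν K1 + ν K2 := by
  apply h.val
  · ext x
    have := hIJ x
    have := h1 x
    have := h2 x
    simp only [mem_union, SetLike.mem_coe] at *
    tauto
  · ext x
    have := h1 x
    have := h2 x
    have := h3 x
    simp only [mem_inter_iff, SetLike.mem_coe] at *
    tauto

/-- unit ball -/
def B1 : ConvexBody HH := ⟨closedBall 0 1, convex_closedBall _ _, isCompact_closedBall _ _, ⟨0, by simp⟩⟩

theorem mem_B1 (x : HH) : x ∈ B1 ↔ ‖x‖ ^ 2 ≤ 1 := by
  show x ∈ closedBall (0 : HH) 1 ↔ _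
  rw [mem_closedBall_zero_iff, sq_le_one_iff₀ (norm_nonneg _)]

theorem mem_B1' (x : HH) : x ∈ B1 ↔ x.re ^ 2 + ‖qim x‖ ^ 2 ≤ 1 := by
  rw [mem_B1, normSq_HH]

theorem B1_sym : IsSym B1 := IsSym.of_mem fun x hx => by rw [mem_B1, norm_neg]; rwa [mem_B1] at hx

/-- the truncated ball -/
def Keps (ε : ℝ) : ConvexBody HH := slab B1 (Icc (-(1 - ε)) (1 - ε))

theorem pt_B1 {s : ℝ} (h : |s| ≤ 1) : qm s 0 0 0 ∈ B1 := by
  rw [mem_B1', norm_E3]; simpa using h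

theorem mem_Keps {ε : ℝ} (h : ε ≤ 1) (x : HH) : x ∈ Keps ε ↔ x ∈ B1 ∧ x.re ∈ Icc (-(1 - ε)) (1 - ε) :=
  mem_slab (convex_Icc _ _) isClosed_Icc (pt_B1 (s := 0) (by simp)) (by simp [h]) x

theorem Keps_sym {ε : ℝ} (h : ε ≤ 1) : IsSym (Keps ε) := IsSym.of_mem fun x hx => by
  rw [mem_Keps h] at hx ⊢
  refine ⟨?_, ?_⟩
  · rw [mem_B1, norm_neg, ← mem_B1]; exact hx.1
  · simp only [Quaternion.re_neg, mem_Icc] at *; constructor <;> linarith [hx.2.1, hx.2.2]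

theorem coord_le (a : E3) (j : Fin 3) : |a j| ≤ ‖a‖ := by
  have := norm_E3 a
  apply abs_le_of_sq_le_sq _ (norm_nonneg _)
  fin_cases j <;> simp <;> nlinarith [sq_nonneg (a 0), sq_nonneg (a 1), sq_nonneg (a 2)]

theorem zR_high {R R' : E3 ≃ₗᵢ[ℝ] E3} {z : HH} (hz : z ∈ zR R) (h : 2 ≤ z.re) : z ∈ zR R' := by
  rw [mem_zR] at hz ⊢
  refine ⟨fun j => ?_, hz.2⟩
  have h1 := (le_abs_self _).trans hz.2
  have h2 : ‖qim z‖ ≤ 2 := by nlinarith [norm_nonneg (qim z)]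
  refine (coord_le _ j).trans ?_
  rwa [R'.symm.norm_map]

theorem qim_qm (s a b c : ℝ) : qim (qm s a b c) = !₂[a, b, c] := rfl

set_option maxHeartbeats 1000000 in
/-- the key geometric step -/
theorem geom_low {R : E3 ≃ₗᵢ[ℝ] E3} {ε : ℝ} (h0 : 0 < ε) (h1 : ε ≤ 1 / 20) {b z : HH} (hb : b ∈ B1) (hbr : 1 - ε ≤ b.re)
    (hz : z ∈ zR R) (hx : (b + z).re ≤ 3) :
    ∃ b' z' : HH, b' ∈ B1 ∧ b'.re = 1 - ε ∧ z' ∈ zR R ∧ b' + z' = b + z := by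
  rw [mem_B1'] at hb
  rw [mem_zR] at hz
  obtain ⟨hz1, hz2⟩ := hz
  have hz3 := abs_le.1 hz2
  set δ := b.re - (1 - ε) with hδ
  have hδ0 : 0 ≤ δ := by linarith
  have hy1 : b.re ≤ 1 := by nlinarith [sq_nonneg ‖qim b‖]
  have hδε : δ ≤ ε := by linarith
  simp only [Quaternion.re_add] at hx
  set a := qim z with ha
  have e1 : ∀ (c : E3) (s : ℝ), (qe c + s • (1 : HH)).re = s := by intro c s; simp
  have e2 : ∀ (c : E3) (s : ℝ), qim (qe c + s • (1 : HH)) = c := by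
    intro c s; rw [map_add, qim_qe]; ext i; fin_cases i <;> simp
  by_cases hc : z.re + δ ≤ 3 - ‖a‖ ^ 2 / 4
  · refine ⟨qe (qim b) + (1 - ε) • (1 : HH), qe a + (z.re + δ) • (1 : HH), ?_, e1 _ _, ?_, ?_⟩
    · rw [mem_B1', e1, e2]; nlinarith
    · rw [mem_zR, e1, e2]
      exact ⟨hz1, abs_le.2 ⟨by linarith, hc⟩⟩
    · conv_rhs => rw [← qe_qim b, ← qe_qim z]
      rw [← ha]
      have : b.re = (1 - ε) + δ := by rw [hδ]; ring
      rw [this]; module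
  · push Not at hc
    have hna := norm_nonneg a
    have ha1 : 1 + δ ≤ ‖a‖ := by nlinarith
    have hapos : 0 < ‖a‖ := by linarith
    set s := 2 * δ / ‖a‖ with hs
    have hs0 : 0 ≤ s := by positivity
    have hs1 : s ≤ 1 := by rw [hs, div_le_one hapos]; nlinarith
    have hsa : s * ‖a‖ = 2 * δ := by rw [hs]; field_simp
    have hna' : ‖(1 - s) • a‖ = ‖a‖ - 2 * δ := by
      rw [norm_smul, Real.norm_eq_abs, abs_of_nonneg (by linarith), sub_mul, hsa, one_mul]
    have hnb : ‖qim b + s • a‖ ≤ ‖qim b‖ + 2 * δ := by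
      refine (norm_add_le _ _).trans ?_
      rw [norm_smul, Real.norm_eq_abs, abs_of_nonneg hs0, hsa]
    refine ⟨qe (qim b + s • a) + (1 - ε) • (1 : HH), qe ((1 - s) • a) + (z.re + δ) • (1 : HH), ?_, e1 _ _, ?_, ?_⟩
    · rw [mem_B1', e1, e2]
      have hr := norm_nonneg (qim b)
      have hr2 : ‖qim b‖ ^ 2 ≤ 1 - b.re ^ 2 := by linarith
      have hr3 : ‖qim b‖ ≤ 2 / 5 := by nlinarith
      have h5 : ‖qim b + s • a‖ ^ 2 ≤ (‖qim b‖ + 2 * δ) ^ 2 := by gcongr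
      have hbr' : b.re = (1 - ε) + δ := by rw [hδ]; ring
      rw [hbr'] at hr2
      have h6 : δ * (4 * ‖qim b‖ + 3 * δ - 2 * (1 - ε)) ≤ 0 := by
        apply mul_nonpos_of_nonneg_of_nonpos hδ0; linarith
      nlinarith
    · rw [mem_zR, e1, e2, hna']
      refine ⟨fun j => ?_, ?_⟩
      · rw [map_smul]
        have := hz1 j
        simp only [PiLp.smul_apply, smul_eq_mul, abs_mul]
        rw [abs_of_nonneg (by linarith : 0 ≤ 1 - s)]
        nlinarith [abs_nonneg (R.symm a j)]
      · have h7 : δ * (1 + δ) ≤ δ * ‖a‖ := by gcongr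
        have h8 : (‖a‖ - 2 * δ) ^ 2 / 4 = ‖a‖ ^ 2 / 4 - (δ * ‖a‖ - δ ^ 2) := by ring
        have h9 : δ + δ ^ 2 ≤ δ * ‖a‖ := by linarith
        have h10 : 0 ≤ δ ^ 2 := by positivity
        rw [h8, abs_le]; constructor <;> linarith [hz3.1, hz3.2]
    · conv_rhs => rw [← qe_qim b, ← qe_qim z]
      rw [← ha]
      have : b.re = (1 - ε) + δ := by rw [hδ]; ring
      rw [this, map_add, map_smul, map_smul]; module

theorem cap_diff {ν} (q : QV ν) {ε : ℝ} (h0 : 0 < ε) (h1 : ε ≤ 1 / 20) (R R' : E3 ≃ₗᵢ[ℝ] E3) {C D : ConvexBody HH}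
    (hC : ∀ x, x ∈ C ↔ x ∈ B1 ∧ x.re ∈ Ici (1 - ε)) (hD : ∀ x, x ∈ D ↔ x ∈ B1 ∧ x.re ∈ ({1 - ε} : Set ℝ)) :
    ν (C + zR R) - ν (D + zR R) = ν (C + zR R') - ν (D + zR R') := by
  have hDC : ∀ x ∈ D, x ∈ C := by
    intro x hx; rw [hD] at hx; rw [hC]; exact ⟨hx.1, le_of_eq hx.2.symm⟩
  have hd : qm (1 - ε) 0 0 0 ∈ D := by
    rw [hD]; exact ⟨pt_B1 (by rw [abs_le]; constructor <;> linarith), rfl⟩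
  have hzz : ∀ R, qm (2 + ε) 0 0 0 ∈ zR R := by
    intro R
    have e : qim (qm (2 + ε) 0 0 0) = 0 := by rw [qim_qm]; ext i; fin_cases i <;> rfl
    rw [mem_zR, e]
    simp only [map_zero, qm_re, norm_zero]
    refine ⟨by simp, ?_⟩
    rw [abs_le]; constructor <;> linarith
  have hpt : ∀ R, qm 3 0 0 0 ∈ D + zR R := by
    intro R
    rw [mem_add]
    refine ⟨_, hd, _, hzz R, ?_⟩
    ext <;> simp; ring
  have hpt' : ∀ R, qm 3 0 0 0 ∈ C + zR R := by
    intro R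
    have := hpt R
    rw [mem_add] at this ⊢
    obtain ⟨y, hy, z, hz, e⟩ := this
    exact ⟨y, hDC y hy, z, hz, e⟩
  -- cutting
  have cut : ∀ X : ConvexBody HH, qm 3 0 0 0 ∈ X → ν X + ν (slab X {3}) = ν (slab X (Iic 3)) + ν (slab X (Ici 3)) := by
    intro X hX
    refine slab_val q.v (I := Iic 3) (J := Ici 3) (mem_slab (convex_Iic _) isClosed_Iic hX (by simp)) (mem_slab (convex_Ici _) isClosed_Ici hX (by simp))
      ?_ (fun x _ => by rw [mem_union]; simp only [mem_Iic, mem_Ici]; first | exact le_total x.re _ | exact le_total _ x.re)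
    intro x
    rw [mem_slab (convex_singleton 3) isClosed_singleton hX (by simp)]
    rw [mem_inter_iff, mem_Iic, mem_Ici, mem_singleton_iff]
    constructor
    · rintro ⟨a, b⟩; exact ⟨a, b.le, b.ge⟩
    · rintro ⟨a, b, c⟩; exact ⟨a, le_antisymm b c⟩
  have low : ∀ R, ∀ x : HH, x.re ≤ 3 → (x ∈ C + zR R ↔ x ∈ D + zR R) := by
    intro R x hx
    rw [mem_add, mem_add]
    constructor
    · rintro ⟨b, hb, z, hz, rfl⟩
      rw [hC] at hb
      obtain ⟨b', z', g1, g2, g3, g4⟩ := geom_low h0 h1 hb.1 hb.2 hz hx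
      exact ⟨b', (hD _).2 ⟨g1, g2⟩, z', g3, g4⟩
    · rintro ⟨b, hb, z, hz, rfl⟩
      exact ⟨b, hDC b hb, z, hz, rfl⟩
  have l1 : ∀ R, slab (C + zR R) (Iic 3) = slab (D + zR R) (Iic 3) := by
    intro R
    apply SetLike.ext; intro x
    rw [mem_slab (convex_Iic _) isClosed_Iic (hpt R) (by simp), mem_slab (convex_Iic _) isClosed_Iic (hpt' R) (by simp)]
    exact and_congr_left fun h => low R x h
  have l2 : ∀ R, slab (C + zR R) {3} = slab (D + zR R) {3} := by
    intro R
    apply SetLike.ext; intro x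
    rw [mem_slab (convex_singleton _) isClosed_singleton (hpt R) (by simp), mem_slab (convex_singleton _) isClosed_singleton (hpt' R) (by simp)]
    exact and_congr_left fun h => low R x (le_of_eq h)
  have high : ∀ R R' : E3 ≃ₗᵢ[ℝ] E3, ∀ X : ConvexBody HH, (∀ x ∈ X, x ∈ B1) → ∀ x : HH, 3 ≤ x.re → x ∈ X + zR R → x ∈ X + zR R' := by
    intro R R' X hX x hx h
    rw [mem_add] at h ⊢
    obtain ⟨b, hb, z, hz, rfl⟩ := h
    refine ⟨b, hb, z, zR_high hz ?_, rfl⟩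
    have h2 := hX b hb
    rw [mem_B1'] at h2
    have h3 : b.re ≤ 1 := by nlinarith [sq_nonneg ‖qim b‖]
    simp only [Quaternion.re_add] at hx
    linarith
  have l3 : ∀ X : ConvexBody HH, (∀ x ∈ X, x ∈ B1) → (∀ R, qm 3 0 0 0 ∈ X + zR R) → slab (X + zR R) (Ici 3) = slab (X + zR R') (Ici 3) := by
    intro X hX hp
    apply SetLike.ext; intro x
    rw [mem_slab (convex_Ici _) isClosed_Ici (hp R) (by simp), mem_slab (convex_Ici _) isClosed_Ici (hp R') (by simp)]
    exact and_congr_left fun h => ⟨high R R' X hX x h, high R' R X hX x h⟩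
  have c1 := cut _ (hpt R)
  have c2 := cut _ (hpt' R)
  have c3 := cut _ (hpt R')
  have c4 := cut _ (hpt' R')
  rw [l1, l2] at c2 c4
  rw [← l3 D (fun x hx => ((hD x).1 hx).1) hpt] at c3
  rw [← l3 C (fun x hx => ((hC x).1 hx).1) hpt'] at c4
  linear_combination c2 - c1 - c4 + c3

theorem locality {ν} (q : QV ν) {ε : ℝ} (h0 : 0 < ε) (h1 : ε ≤ 1 / 20) (R R' : E3 ≃ₗᵢ[ℝ] E3) :
    bet ν (zR R) B1 - bet ν (zR R) (Keps ε) = bet ν (zR R') B1 - bet ν (zR R') (Keps ε) := by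
  have hp : qm (1 - ε) 0 0 0 ∈ B1 := pt_B1 (by rw [abs_le]; constructor <;> linarith)
  have hm : qm (-(1 - ε)) 0 0 0 ∈ B1 := pt_B1 (by rw [abs_le]; constructor <;> linarith)
  have mC := mem_slab (convex_Ici (1 - ε)) isClosed_Ici hp (by simp)
  have mD := mem_slab (convex_singleton (1 - ε)) isClosed_singleton hp (by simp)
  have mI := mem_slab (convex_Iic (1 - ε)) isClosed_Iic hp (by simp)
  have mC' := mem_slab (convex_Iic (-(1 - ε))) isClosed_Iic hm (by simp)
  have mD' := mem_slab (convex_singleton (-(1 - ε))) isClosed_singleton hm (by simp)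
  have mK := mem_Keps (ε := ε) (by linarith)
  have negB : ∀ x : HH, -x ∈ B1 ↔ x ∈ B1 := by intro x; rw [mem_B1, mem_B1, norm_neg]
  have neg1 : slab B1 (Iic (-(1 - ε))) = (-1 : ℝ) • slab B1 (Ici (1 - ε)) := by
    apply SetLike.ext; intro x
    rw [mem_neg, mC, mC', negB]
    simp only [mem_Iic, mem_Ici, Quaternion.re_neg]
    exact and_congr_right fun _ => ⟨fun h => by linarith, fun h => by linarith⟩
  have neg2 : slab B1 {-(1 - ε)} = (-1 : ℝ) • slab B1 {1 - ε} := by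
    apply SetLike.ext; intro x
    rw [mem_neg, mD, mD', negB]
    simp only [mem_singleton_iff, Quaternion.re_neg]
    exact and_congr_right fun _ => ⟨fun h => by linarith, fun h => by linarith⟩
  have main : ∀ R, ν (B1 + zR R) - ν (Keps ε + zR R) = 2 * (ν (slab B1 (Ici (1 - ε)) + zR R) - ν (slab B1 {1 - ε} + zR R)) := by
    intro R
    have hv := q.v.add_right (zR R)
    have s1 := slab_val hv (I := Ici (1 - ε)) (J := Iic (1 - ε)) mC mI (K3 := slab B1 {1 - ε}) (by
      intro x
      rw [mD, mem_inter_iff, mem_Iic, mem_Ici, mem_singleton_iff]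
      exact and_congr_right fun _ => ⟨fun h => ⟨h.ge, h.le⟩, fun h => le_antisymm h.2 h.1⟩) (fun x _ => by rw [mem_union]; simp only [mem_Iic, mem_Ici]; first | exact le_total x.re _ | exact le_total _ x.re)
    have s2 := slab_val hv (K := slab B1 (Iic (1 - ε))) (K1 := slab B1 (Iic (-(1 - ε)))) (K2 := Keps ε) (K3 := slab B1 {-(1 - ε)})
      (I := Iic (-(1 - ε))) (J := Ici (-(1 - ε))) (by
        intro x
        rw [mC', mI]
        simp only [mem_Iic]
        refine ⟨fun h => ⟨⟨h.1, by linarith [h.2]⟩, h.2⟩, fun h => ⟨h.1.1, h.2⟩⟩) (by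
        intro x
        rw [mK, mI]
        simp only [mem_Iic, mem_Ici, mem_Icc]; tauto) (by
        intro x
        rw [mD', mI]
        simp only [mem_Iic, mem_Ici, mem_singleton_iff, mem_inter_iff]
        refine ⟨fun h => ⟨⟨h.1, by linarith [h.2]⟩, h.2.le, h.2.ge⟩, fun h => ⟨h.1.1, le_antisymm h.2.1 h.2.2⟩⟩) (fun x _ => by rw [mem_union]; simp only [mem_Iic, mem_Ici]; first | exact le_total x.re _ | exact le_total _ x.re)
    have ev : ∀ X : ConvexBody HH, ν ((-1 : ℝ) • X + zR R) = ν (X + zR R) := by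
      intro X
      have e : (-1 : ℝ) • (X + zR R) = (-1 : ℝ) • X + zR R := by
        rw [smul_add_body, (zR_sym R).neg]
      rw [← e, q.e]
    simp only [neg1, neg2, ev] at s1 s2
    linear_combination s1 + s2
  have := cap_diff q h0 h1 R R' mC mD
  have m1 := main R
  have m2 := main R'
  unfold bet
  rw [add_comm (zR R), add_comm (zR R), add_comm (zR R'), add_comm (zR R')]
  linear_combination m1 - m2 + 2 * this

end UV
end

noncomputable section
namespace UV
open Filter Topology
open scoped InnerProductSpace Quaternion

theorem continuous_cmap_left {V W : Type*} [NormedAddCommGroup V] [NormedSpace ℝ V] [NormedAddCommGroup W] [NormedSpace ℝ W] 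
    (K : ConvexBody V) : Continuous (fun f : V →L[ℝ] W => cmap f K) := by
  obtain ⟨C, hC⟩ := K.isCompact.isBounded.exists_norm_le
  obtain ⟨x0, hx0⟩ := K.nonempty
  have hC0 : 0 ≤ C := (norm_nonneg _).trans (hC x0 hx0)
  apply LipschitzWith.continuous (K := ⟨C, hC0⟩)
  apply LipschitzWith.of_dist_le_mul
  have aux : ∀ f g : V →L[ℝ] W, ∀ y ∈ K, dist (f y) (g y) ≤ C * dist f g := by
    intro f g y hy
    rw [dist_eq_norm, dist_eq_norm, ← sub_apply, mul_comm]
    exact ((f - g).le_opNorm y).trans (mul_le_mul_of_nonneg_left (hC y hy) (norm_nonneg _))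
  intro f g
  apply dist_le_of (by positivity)
  · rintro _ ⟨y, hy, rfl⟩
    exact ⟨g y, ⟨y, hy, rfl⟩, aux f g y hy⟩
  · rintro _ ⟨y, hy, rfl⟩
    exact ⟨f y, ⟨y, hy, rfl⟩, by rw [dist_comm f g]; exact aux g f y hy⟩

theorem continuous_ml : Continuous ml := (ContinuousLinearMap.mul ℝ HH).continuous

/-- integrated mixed functional -/
def Xi (ν : ConvexBody HH → ℂ) (K : ConvexBody HH) (p : E3) : ℂ :=
  ∫ t, Dv 1 ν (cmap (ml (star (qe p + t • (1 : HH)))) K) ∂tau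

theorem QV.cont_L {ν} (q : QV ν) (K : ConvexBody HH) : Continuous (fun x : HH => Dv 1 ν (cmap (ml (star x)) K)) :=
  (q.v.Dv 1).cont.comp ((continuous_cmap_left K).comp (continuous_ml.comp continuous_star))

theorem QV.cont_Xi {ν} (q : QV ν) (K : ConvexBody HH) : Continuous (Xi ν K) := by
  unfold Xi tau
  apply continuous_parametric_integral_of_continuous _ isCompact_Icc
  exact (q.cont_L K).comp (by fun_prop : Continuous fun z : E3 × ℝ => qe z.1 + z.2 • (1 : HH))

theorem QV.Xi_neg {ν} (q : QV ν) (K : ConvexBody HH) (p : E3) : Xi ν K (-p) = Xi ν K p := by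
  unfold Xi
  rw [integral_tau, integral_tau]
  have := intervalIntegral.integral_comp_neg (a := -1) (b := 1) (fun t => Dv 1 ν (cmap (ml (star (qe p + t • (1 : HH)))) K))
  rw [neg_neg] at this
  rw [← this]
  congr 1; ext t
  rw [← IsEv.Dv q.v q.e 1, smul_eq_cmap, cmap_cmap]
  congr 2
  ext1 x
  have : star (qe (-p) + t • (1 : HH)) = -star (qe p + (-t) • (1:HH)) := by
    rw [map_neg, ← star_neg]; congr 1; rw [neg_add, neg_smul, neg_neg]
  simp only [ContinuousLinearMap.comp_apply, ml_apply, this]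
  simp
  rw [← neg_mul, neg_add, neg_neg, add_comm]

theorem star_mul_cancel {r : HH} (hr : ‖r‖ = 1) : r * star r = 1 := by
  rw [Quaternion.self_mul_star, Quaternion.normSq_eq_norm_mul_self, hr]; simp

theorem QV.Xi_rot {ν} (q : QV ν) {K : ConvexBody HH}
    (hK : ∀ r : HH, ‖r‖ = 1 → cmap ((mr r).comp (ml (star r))) K = K) {p p' : E3} (h0 : p 0 = p' 0) (hn : ‖p‖ = ‖p'‖) :
    Xi ν K p = Xi ν K p' := by
  obtain ⟨r, h1, h2, h3, h4⟩ := exists_rot h0 hn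
  have hr := star_mul_cancel h1
  have hr' : star r * r = 1 := by rw [star_mul_self', h1]; simp
  unfold Xi
  congr 1; ext t
  rw [← q.conj h1 h2 h3, cmap_cmap]
  conv_rhs => rw [← hK r h1, cmap_cmap]
  congr 2
  ext1 x
  have e : qe p' + t • (1 : HH) = star r * (qe p + t • (1 : HH)) * r := by
    rw [mul_add, add_mul, h4, mul_smul_comm, mul_one, smul_mul_assoc, hr']
  rw [e]
  simp only [ContinuousLinearMap.comp_apply, ml_apply, mr_apply, star_mul, star_star]
  set s := star (qe p + t • (1 : HH))
  calc star r * (s * x) * r = star r * s * (1 : HH) * x * r := by simp [mul_assoc]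
    _ = star r * s * (r * star r) * x * r := by rw [hr]
    _ = _ := by simp only [mul_assoc]

theorem conj_norm {r : HH} (hr : ‖r‖ = 1) (x : HH) : ‖star r * x * r‖ = ‖x‖ := by
  rw [norm_mul, norm_mul, Quaternion.norm_star, hr]; ring

theorem conj_re {r : HH} (hr : ‖r‖ = 1) (x : HH) : (star r * x * r).re = x.re := by
  have h : r.re ^ 2 + r.imI ^ 2 + r.imJ ^ 2 + r.imK ^ 2 = 1 := by
    have : ‖r‖ ^ 2 = 1 := by rw [hr]; simp
    rw [← real_inner_self_eq_norm_sq, inner_HH] at this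
    linarith
  simp; linear_combination x.re * h

theorem conj_body {K : ConvexBody HH} (P : ℝ → ℝ → Prop) (hK : ∀ x, x ∈ K ↔ P ‖x‖ x.re) (r : HH) (hr : ‖r‖ = 1) :
    cmap ((mr r).comp (ml (star r))) K = K := by
  have hs : ‖star r‖ = 1 := by rw [Quaternion.norm_star, hr]
  have h1 := star_mul_cancel hr
  have h2 := star_mul_cancel hs
  rw [star_star] at h2
  apply SetLike.ext; intro x
  rw [mem_cmap]
  constructor
  · rintro ⟨y, hy, rfl⟩
    rw [hK] at hy ⊢
    simp only [ContinuousLinearMap.comp_apply, ml_apply, mr_apply]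
    rwa [conj_norm hr, conj_re hr]
  · intro hx
    refine ⟨star (star r) * x * star r, ?_, ?_⟩
    · rw [hK] at hx ⊢
      rwa [conj_norm hs, conj_re hs]
    · simp only [ContinuousLinearMap.comp_apply, ml_apply, mr_apply, star_star]
      calc star r * (r * x * star r) * r = (star r * r) * x * (star r * r) := by simp only [mul_assoc]
        _ = x := by rw [h2]; simp

theorem conj_B1 (r : HH) (hr : ‖r‖ = 1) : cmap ((mr r).comp (ml (star r))) B1 = B1 :=
  conj_body (fun n _ => n ^ 2 ≤ 1) mem_B1 r hr
theorem conj_Keps {ε : ℝ} (h : ε ≤ 1) (r : HH) (hr : ‖r‖ = 1) : cmap ((mr r).comp (ml (star r))) (Keps ε) = Keps ε :=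
  conj_body (fun n s => n ^ 2 ≤ 1 ∧ s ∈ Icc (-(1 - ε)) (1 - ε)) (fun x => by rw [mem_Keps h, mem_B1]) r hr

theorem exists_isom {v w : E3} (h : ‖v‖ = ‖w‖) : ∃ R : E3 ≃ₗᵢ[ℝ] E3, R v = w ∧ R w = v := by
  refine ⟨(ℝ ∙ (v - w))ᗮ.reflection, Submodule.reflection_sub h, ?_⟩
  have := congrArg (ℝ ∙ (v - w))ᗮ.reflection (Submodule.reflection_sub h)
  rw [Submodule.reflection_reflection] at this
  exact this.symm

theorem affine_of {a : ℝ → ℂ} (hc : Continuous a) (h : ∀ x y, 0 ≤ x → 0 ≤ y → x + y ≤ 1 → a (x + y) = a x + a y) {x : ℝ} (h0 : 0 ≤ x) (h1 : x ≤ 1) :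
    a x = x * a 1 := by
  have a0 : a 0 = 0 := by have := h 0 0 le_rfl le_rfl (by simp); simpa using this
  have s1 : ∀ n : ℕ, 0 < n → ∀ k : ℕ, k ≤ n → a (k / n) = k * a (1 / n) := by
    intro n hn k
    have hn' : (0 : ℝ) < n := by exact_mod_cast hn
    induction k with
    | zero => intro _; simp [a0]
    | succ k ih =>
      intro hk
      have hk' : (k : ℝ) + 1 ≤ n := by exact_mod_cast hk
      have := h (k / n) (1 / n) (by positivity) (by positivity) (by rw [← add_div, div_le_one hn']; exact hk')
      rw [← add_div] at this
      push_cast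
      rw [this, ih (by omega)]; ring
  have s2 : ∀ n : ℕ, 0 < n → ∀ k : ℕ, k ≤ n → a (k / n) = ((k / n : ℝ) : ℂ) * a 1 := by
    intro n hn k hk
    have hn' : (n : ℂ) ≠ 0 := by exact_mod_cast hn.ne'
    have hn2 : (n : ℝ) ≠ 0 := by exact_mod_cast hn.ne'
    have e := s1 n hn n le_rfl
    rw [div_self hn2] at e
    rw [s1 n hn k hk, e]; push_cast; field_simp
  have t1 : Tendsto (fun n : ℕ => ((⌊x * n⌋₊ : ℕ) : ℝ) / (n : ℝ)) atTop (𝓝 x) :=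
    (tendsto_nat_floor_mul_div_atTop h0).comp tendsto_natCast_atTop_atTop
  have t2 := (hc.tendsto x).comp t1
  have t3 : Tendsto (fun n : ℕ => ((((⌊x * n⌋₊ : ℕ) : ℝ) / (n : ℝ) : ℝ) : ℂ) * a 1) atTop (𝓝 (x * a 1)) :=
    ((Complex.continuous_ofReal.tendsto x).comp t1).mul_const _
  refine tendsto_nhds_unique (t2.congr' ?_) t3
  filter_upwards [eventually_gt_atTop 0] with n hn
  refine s2 n hn _ ?_
  have hn' : (0 : ℝ) < n := by exact_mod_cast hn
  exact Nat.floor_le_of_le (by nlinarith)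

/-- the local difference is affine in the squared first coordinate -/
theorem Xi_affine {ν} (q : QV ν) {ε : ℝ} (h0 : 0 < ε) (h1 : ε ≤ 1 / 20) :
    ∃ α β : ℂ, ∀ p : E3, ‖p‖ = 1 → Xi ν B1 p - Xi ν (Keps ε) p = α + β * (p 0 : ℂ) ^ 2 := by
  set X : E3 → ℂ := fun p => Xi ν B1 p - Xi ν (Keps ε) p with hX
  have hε : ε ≤ 1 := by linarith
  have hXc : Continuous X := (q.cont_Xi _).sub (q.cont_Xi _)
  have hXn : ∀ p, X (-p) = X p := fun p => by simp only [hX]; rw [q.Xi_neg, q.Xi_neg]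
  have hXr : ∀ p p' : E3, p 0 = p' 0 → ‖p‖ = ‖p'‖ → X p = X p' := fun p p' a b => by
    simp only [hX]; rw [q.Xi_rot conj_B1 a b, q.Xi_rot (conj_Keps hε) a b]
  have hsum : ∀ R R' : E3 ≃ₗᵢ[ℝ] E3, X (R (e3 0)) + X (R (e3 1)) + X (R (e3 2)) = X (R' (e3 0)) + X (R' (e3 1)) + X (R' (e3 2)) := by
    intro R R'
    have hl := locality q h0 h1 R R'
    have hb : ∀ (R : E3 ≃ₗᵢ[ℝ] E3) (K : ConvexBody HH), IsSym K → bet ν (zR R) K = 2 * (Xi ν K (R (e3 0)) + Xi ν K (R (e3 1)) + Xi ν K (R (e3 2))) := by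
      intro R K hK
      rw [zR, bet_add q.v q.h ((zb_sym _).add (zb_sym _)) (zb_sym _) hK, bet_add q.v q.h (zb_sym _) (zb_sym _) hK, bet_zb q _ hK, bet_zb q _ hK, bet_zb q _ hK]
      unfold Xi; ring
    rw [hb _ _ B1_sym, hb _ _ B1_sym, hb _ _ (Keps_sym hε), hb _ _ (Keps_sym hε)] at hl
    simp only [hX]
    linear_combination hl / 2
  let m : ℝ → E3 := fun x => !₂[√x, √(1 - x), 0]
  have hm : ∀ x, 0 ≤ x → x ≤ 1 → ‖m x‖ = 1 := by
    intro x hx hx1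
    have : ‖m x‖ ^ 2 = 1 := by
      rw [norm_E3]
      simp [m, Real.sq_sqrt hx, Real.sq_sqrt (sub_nonneg.2 hx1)]
    nlinarith [norm_nonneg (m x)]
  let G : ℝ → ℂ := fun x => X (m x)
  have hG : ∀ p : E3, ‖p‖ = 1 → X p = G (p 0 ^ 2) := by
    intro p hp
    have hp2 := norm_E3 p
    rw [hp] at hp2
    have hp3 : p 0 ^ 2 ≤ 1 := by nlinarith [sq_nonneg (p 1), sq_nonneg (p 2)]
    have h2 := hm (p 0 ^ 2) (sq_nonneg _) hp3
    have e0 : m (p 0 ^ 2) 0 = |p 0| := by simp [m, Real.sqrt_sq_eq_abs]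
    rcases le_total 0 (p 0) with h | h
    · exact hXr _ _ (by rw [e0, abs_of_nonneg h]) (by rw [h2, hp])
    · rw [← hXn p]
      refine hXr _ _ (by rw [e0, abs_of_nonpos h]; simp) (by rw [h2, norm_neg, hp])
  have hmc : Continuous m := by
    have : Continuous (fun x : ℝ => ![√x, √(1 - x), 0]) := by
      apply continuous_pi; intro i; fin_cases i <;> simp <;> fun_prop
    exact (PiLp.continuous_toLp 2 _).comp this
  have hGc : Continuous G := hXc.comp hmc
  have trip : ∀ x y z : ℝ, 0 ≤ x → 0 ≤ y → 0 ≤ z → x + y + z = 1 → 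
      G x + G y + G z = X (e3 0) + X (e3 1) + X (e3 2) := by
    intro x y z hx hy hz hs
    have hv : ‖(!₂[√x, √y, √z] : E3)‖ = 1 := by
      have : ‖(!₂[√x, √y, √z] : E3)‖ ^ 2 = 1 := by
        rw [norm_E3]; simp [Real.sq_sqrt hx, Real.sq_sqrt hy, Real.sq_sqrt hz, hs]
      nlinarith [norm_nonneg (!₂[√x, √y, √z] : E3)]
    have he : ‖e3 0‖ = 1 := by simp [e3]
    have hej : ∀ j, ‖e3 j‖ = 1 := by intro j; simp [e3]
    obtain ⟨R, hR1, hR2⟩ := exists_isom (hv.trans he.symm)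
    have key := hsum R (LinearIsometryEquiv.refl ℝ E3)
    have hc : ∀ j, (R (e3 j)) 0 = (!₂[√x, √y, √z] : E3) j := by
      intro j
      have h5 : R (e3 j) 0 = ⟪R (e3 j), e3 0⟫_ℝ := by rw [inner_E3]; simp [e3]
      rw [h5, inner_e3, ← hR1, R.symm_apply_apply]
    rw [hG _ (by rw [R.norm_map, hej]), hG (R (e3 1)) (by rw [R.norm_map, hej]), hG (R (e3 2)) (by rw [R.norm_map, hej]), hc, hc, hc] at key
    simpa [Real.sq_sqrt hx, Real.sq_sqrt hy, Real.sq_sqrt hz] using key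
  have hadd : ∀ x y, 0 ≤ x → 0 ≤ y → x + y ≤ 1 → (G (x + y) - G 0) = (G x - G 0) + (G y - G 0) := by
    intro x y hx hy hxy
    have t1 := trip x y (1 - x - y) hx hy (by linarith) (by ring)
    have t2 := trip (x + y) 0 (1 - x - y) (by linarith) le_rfl (by linarith) (by ring)
    linear_combination t2 - t1
  refine ⟨G 0, G 1 - G 0, fun p hp => ?_⟩
  have hp2 := norm_E3 p
  rw [hp] at hp2
  have hp3 : p 0 ^ 2 ≤ 1 := by nlinarith [sq_nonneg (p 1), sq_nonneg (p 2)]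
  have h6 := affine_of (a := fun x => G x - G 0) (hGc.sub continuous_const) hadd (sq_nonneg (p 0)) hp3
  have h7 := hG p hp
  simp only [hX] at h7
  rw [h7]
  push_cast at h6
  linear_combination h6

end UV
end

noncomputable section
namespace UV
open Filter Topology
open scoped InnerProductSpace

/-- support functions of rotationally symmetric bodies -/
theorem supp_le_rot {K : ConvexBody HH} (P : ℝ → ℝ → Prop) (hK : ∀ x, x ∈ K ↔ P ‖x‖ x.re) {x x' : HH}
    (h0 : x.re = x'.re) (h1 : ‖x‖ = ‖x'‖) : supp K x ≤ supp K x' := by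
  have h2 : ‖qim x‖ = ‖qim x'‖ := by
    have a := normSq_HH x
    have b := normSq_HH x'
    rw [h1, h0] at a
    have : ‖qim x‖ ^ 2 = ‖qim x'‖ ^ 2 := by linarith
    rwa [sq_eq_sq₀ (norm_nonneg _) (norm_nonneg _)] at this
  obtain ⟨R, hR, -⟩ := exists_isom h2
  apply supp_le
  intro y hy
  have e1 : (qe (R (qim y)) + y.re • (1 : HH)).re = y.re := by rw [Quaternion.re_add]; simp; exact mul_one _
  have e2 : qim (qe (R (qim y)) + y.re • (1 : HH)) = R (qim y) := by
    rw [map_add, qim_qe]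
    have : qim (y.re • (1 : HH)) = 0 := by ext i; fin_cases i <;> simp <;> right <;> rfl
    rw [this, add_zero]
  have : qe (R (qim y)) + y.re • (1 : HH) ∈ K := by
    rw [hK] at hy ⊢
    rw [e1]
    convert hy using 1
    rw [← sq_eq_sq₀ (norm_nonneg _) (norm_nonneg _), normSq_HH, normSq_HH, e1, e2, R.norm_map]
  refine le_trans (le_of_eq ?_) (le_supp this x')
  rw [inner_HH', inner_HH', e1, e2, ← hR, R.inner_map_map, h0]

theorem supp_rot {K : ConvexBody HH} (P : ℝ → ℝ → Prop) (hK : ∀ x, x ∈ K ↔ P ‖x‖ x.re) {x x' : HH}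
    (h0 : x.re = x'.re) (h1 : ‖x‖ = ‖x'‖) : supp K x = supp K x' :=
  le_antisymm (supp_le_rot P hK h0 h1) (supp_le_rot P hK h0.symm h1.symm)

/-- normalized rotation-invariant measure on the sphere -/
def sig : Measure E3 := Measure.map (fun p : E3 => ‖p‖⁻¹ • p) (volume.restrict (ball 0 1))

theorem nrm_meas : Measurable (fun p : E3 => ‖p‖⁻¹ • p) := by fun_prop

instance : IsFiniteMeasure sig := by
  unfold sig
  have : IsFiniteMeasure ((volume : Measure E3).restrict (ball 0 1)) := ⟨by simp [measure_ball_lt_top]⟩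
  infer_instance

theorem sig_ae : ∀ᵐ p ∂sig, ‖p‖ = 1 := by
  unfold sig
  rw [ae_map_iff nrm_meas.aemeasurable (measurableSet_eq_fun measurable_norm measurable_const)]
  apply ae_restrict_of_ae
  have : ∀ᵐ p : E3, p ≠ 0 := by
    rw [ae_iff]; simp
  filter_upwards [this] with p hp
  rw [norm_smul, norm_inv, norm_norm, inv_mul_cancel₀ (norm_ne_zero_iff.2 hp)]

theorem sig_ae' : ∀ᵐ p ∂sig, p ∈ closedBall (0 : E3) 1 := by
  filter_upwards [sig_ae] with p hp
  simp [hp]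

theorem integ_sig {G : Type*} [NormedAddCommGroup G] {f : E3 → G} (hf : Continuous f) : Integrable f sig :=
  integ_cpt (isCompact_closedBall _ _) sig_ae' hf

theorem sig_map (R : E3 ≃ₗᵢ[ℝ] E3) : Measure.map R sig = sig := by
  unfold sig
  rw [Measure.map_map R.continuous.measurable nrm_meas]
  have : (R ∘ fun p : E3 => ‖p‖⁻¹ • p) = (fun p : E3 => ‖p‖⁻¹ • p) ∘ R := by
    ext1 p; simp
  rw [this, ← Measure.map_map nrm_meas R.continuous.measurable]
  congr 1
  have hm := R.measurePreserving
  have := hm.restrict_preimage (s := ball (0 : E3) 1) measurableSet_ball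
  have h2 : R ⁻¹' ball (0 : E3) 1 = ball 0 1 := by ext x; simp
  rw [h2] at this
  exact this.map_eq

theorem integral_sig {G : Type*} [NormedAddCommGroup G] [NormedSpace ℝ G] (R : E3 ≃ₗᵢ[ℝ] E3) (f : E3 → G) :
    ∫ p, f (R p) ∂sig = ∫ p, f p ∂sig := by
  conv_rhs => rw [← sig_map R]
  exact (R.toHomeomorph.toMeasurableEquiv.measurableEmbedding.integral_map f).symm

theorem integral_sig_pos {f : E3 → ℝ} (hf : Continuous f) (h0 : ∀ p, 0 ≤ f p) {q : E3} (hq : ‖q‖ = 1) (h1 : 0 < f q) :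
    0 < ∫ p, f p ∂sig := by
  rw [integral_pos_iff_support_of_nonneg h0 (integ_sig hf)]
  unfold sig
  have hsup : Function.support f = f ⁻¹' {0}ᶜ := rfl
  rw [hsup, Measure.map_apply nrm_meas (hf.measurable (measurableSet_singleton 0).compl : MeasurableSet (f ⁻¹' {0}ᶜ))]
  rw [Measure.restrict_apply' measurableSet_ball]
  have ho : IsOpen ({p : E3 | p ≠ 0 ∧ f (‖p‖⁻¹ • p) ≠ 0} ∩ ball (0:E3) 1) := by
    apply IsOpen.inter _ isOpen_ball
    have hc : ContinuousOn (fun p : E3 => f (‖p‖⁻¹ • p)) {p | p ≠ 0} := by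
      apply hf.comp_continuousOn
      have h3 : ContinuousOn (fun p : E3 => ‖p‖⁻¹) {p | p ≠ 0} := by
        apply ContinuousOn.inv₀ continuous_norm.continuousOn
        intro x hx; exact norm_ne_zero_iff.2 hx
      exact h3.smul continuousOn_id
    exact hc.isOpen_inter_preimage isOpen_ne (isOpen_compl_singleton (x := (0:ℝ)))
  have hne : ({p : E3 | p ≠ 0 ∧ f (‖p‖⁻¹ • p) ≠ 0} ∩ ball (0:E3) 1).Nonempty := by
    refine ⟨(1/2 : ℝ) • q, ⟨?_, ?_⟩, ?_⟩
    · intro h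
      have := congrArg norm h
      rw [norm_smul, hq] at this; norm_num at this
    · rw [norm_smul, hq, smul_smul]; norm_num; exact h1.ne'
    · rw [mem_ball_zero_iff, norm_smul, hq]; norm_num
  refine lt_of_lt_of_le (ho.measure_pos volume hne) (measure_mono ?_)
  rintro p ⟨⟨_, h⟩, h'⟩
  exact ⟨h, h'⟩

/-- the quadratic moment -/
theorem moment_aff : ∃ a b : ℝ, ∀ q : E3, ‖q‖ = 1 → ∫ p, |⟪p, q⟫_ℝ| * (p 0) ^ 2 ∂sig = a + b * (q 0) ^ 2 := by
  set A := ∫ p : E3, |p 0| * (p 0) ^ 2 ∂sig with hA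
  set B := ∫ p : E3, |p 0| * (p 1) ^ 2 ∂sig with hB
  refine ⟨B, A - B, ?_⟩
  have key : ∀ q q' : E3, ‖q‖ = ‖q'‖ → q 0 = q' 0 → ∫ p : E3, |p 0| * ⟪p, q⟫_ℝ ^ 2 ∂sig = ∫ p : E3, |p 0| * ⟪p, q'⟫_ℝ ^ 2 ∂sig := by
    intro q q' hn h0
    set R := (ℝ ∙ (q - q'))ᗮ.reflection with hR
    have h1 : R q = q' := Submodule.reflection_sub hn
    have h2 : R (e3 0) = e3 0 := by
      apply Submodule.reflection_mem_subspace_eq_self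
      rw [Submodule.mem_orthogonal_singleton_iff_inner_right]
      simp [e3, EuclideanSpace.inner_single_right, h0]
    rw [← integral_sig R (fun p => |p 0| * ⟪p, q'⟫_ℝ ^ 2)]
    congr 1; ext1 p
    have h3 : (R p) 0 = p 0 := by
      have e : ∀ p : E3, p 0 = ⟪p, e3 0⟫_ℝ := fun p => by simp [e3, EuclideanSpace.inner_single_right]
      rw [e (R p), e p]
      nth_rewrite 1 [← h2]
      rw [R.inner_map_map]
    rw [h3, ← h1, R.inner_map_map]
  intro q hq
  have he0 : ‖e3 0‖ = 1 := by simp [e3]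
  obtain ⟨R, hR, hR'⟩ := exists_isom (hq.trans he0.symm)
  have step1 : ∫ p, |⟪p, q⟫_ℝ| * (p 0) ^ 2 ∂sig = ∫ p : E3, |p 0| * ⟪p, q⟫_ℝ ^ 2 ∂sig := by
    rw [← integral_sig R]
    congr 1; ext1 p
    have e : ∀ p : E3, p 0 = ⟪p, e3 0⟫_ℝ := fun p => by simp [e3, EuclideanSpace.inner_single_right]
    have a1 : ⟪R p, q⟫_ℝ = p 0 := by rw [← hR', R.inner_map_map, e]
    have a2 : (R p) 0 = ⟪p, q⟫_ℝ := by rw [e, ← hR, R.inner_map_map]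
    rw [a1, a2]
  rw [step1]
  set s := Real.sqrt (1 - q 0 ^ 2) with hs
  have hq2 := norm_E3 q
  rw [hq] at hq2
  have hs2 : s ^ 2 = 1 - q 0 ^ 2 := Real.sq_sqrt (by nlinarith [sq_nonneg (q 1), sq_nonneg (q 2)])
  have n1 : ∀ y : ℝ, y ^ 2 = 1 - q 0 ^ 2 → ‖q‖ = ‖(!₂[q 0, y, 0] : E3)‖ := by
    intro y hy
    rw [← sq_eq_sq₀ (norm_nonneg _) (norm_nonneg _), hq, norm_E3]
    simp; linarith
  have k1 := key q !₂[q 0, s, 0] (n1 s hs2) (by simp)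
  have k2 := key q !₂[q 0, -s, 0] (n1 (-s) (by rw [neg_sq, hs2])) (by simp)
  have k3 : 2 * ∫ p : E3, |p 0| * ⟪p, q⟫_ℝ ^ 2 ∂sig = 2 * (q 0 ^ 2 * A + s ^ 2 * B) := by
    rw [two_mul]
    conv_lhs => rw [k1]
    nth_rewrite 2 [← k1]
    rw [k2, hA, hB, ← integral_const_mul, ← integral_const_mul, ← integral_add, ← integral_add, ← integral_const_mul]
    · congr 1; ext1 p
      rw [inner_E3, inner_E3]; simp; ring
    all_goals exact integ_sig (by fun_prop)
  have : ∫ p : E3, |p 0| * ⟪p, q⟫_ℝ ^ 2 ∂sig = q 0 ^ 2 * A + s ^ 2 * B := by linarith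
  rw [this, hs2]; ring
end UV
end

noncomputable section
namespace UV
open Filter Topology
open scoped InnerProductSpace

theorem qmul_re (p u : E3) (t : ℝ) : ((qe p + t • (1 : HH)) * qe u).re = -⟪p, u⟫_ℝ := by
  rw [inner_E3, add_mul, smul_mul_assoc, one_mul, Quaternion.re_add, Quaternion.re_smul]
  simp; ring

theorem qadd_norm (p : E3) (t : ℝ) : ‖qe p + t • (1 : HH)‖ ^ 2 = ‖p‖ ^ 2 + t ^ 2 := by
  rw [norm_add_sq_real, norm_qe, norm_smul, inner_smul_right, inner_qe_left]
  have : qim 1 = 0 := by ext i; fin_cases i <;> rfl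
  rw [this]; simp

theorem supp_B1 (x : HH) : supp B1 x = ‖x‖ := by
  apply le_antisymm
  · apply supp_le; intro y hy
    rw [mem_B1, sq_le_one_iff₀ (norm_nonneg _)] at hy
    refine (real_inner_le_norm _ _).trans ?_
    nlinarith [norm_nonneg x]
  · by_cases hx : x = 0
    · subst hx; have := le_supp (K := B1) (y := 0) (by rw [mem_B1]; simp) 0
      simpa using this
    have hx' := norm_ne_zero_iff.2 hx
    have h := le_supp (K := B1) (y := ‖x‖⁻¹ • x) (by
      rw [mem_B1, norm_smul, norm_inv, norm_norm, inv_mul_cancel₀ hx']; simp) x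
    rwa [inner_smul_right, real_inner_self_eq_norm_sq, pow_two, ← mul_assoc, inv_mul_cancel₀ hx', one_mul] at h

/-- the difference kernel -/
def Psi (ε : ℝ) (w u : E3) : ℝ := ∫ t, (supp B1 ((qe w + t • (1 : HH)) * qe u) - supp (Keps ε) ((qe w + t • (1 : HH)) * qe u)) ∂tau

theorem Psi_inv {ε : ℝ} (h : ε ≤ 1) {p p' u u' : E3} (h1 : ⟪p, u⟫_ℝ = ⟪p', u'⟫_ℝ) (h2 : ‖p‖ = ‖p'‖) (h3 : ‖u‖ = ‖u'‖) :
    Psi ε p u = Psi ε p' u' := by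
  unfold Psi
  congr 1; ext1 t
  have a : ((qe p + t • (1 : HH)) * qe u).re = ((qe p' + t • (1 : HH)) * qe u').re := by
    rw [qmul_re, qmul_re, h1]
  have b : ‖(qe p + t • (1 : HH)) * qe u‖ = ‖(qe p' + t • (1 : HH)) * qe u'‖ := by
    rw [norm_mul, norm_mul, norm_qe, norm_qe, h3]
    congr 1
    rw [← sq_eq_sq₀ (norm_nonneg _) (norm_nonneg _), qadd_norm, qadd_norm, h2]
  rw [supp_B1, supp_B1, b, supp_rot (fun n s => n ^ 2 ≤ 1 ∧ s ∈ Icc (-(1 - ε)) (1 - ε)) (fun x => by rw [mem_Keps h, mem_B1]) a b]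

theorem Psi_cont (ε : ℝ) (u : E3) : Continuous (fun w => Psi ε w u) := by
  unfold Psi tau
  apply continuous_parametric_integral_of_continuous _ isCompact_Icc
  have : Continuous fun z : E3 × ℝ => (qe z.1 + z.2 • (1 : HH)) * qe u := by fun_prop
  exact ((continuous_supp _).comp this).sub ((continuous_supp _).comp this)

theorem supp_Keps_le {ε : ℝ} (h : ε ≤ 1) (x : HH) : supp (Keps ε) x ≤ supp B1 x :=
  supp_le fun y hy => le_supp ((mem_Keps h y).1 hy).1 x

theorem Psi_nonneg {ε : ℝ} (h : ε ≤ 1) (w u : E3) : 0 ≤ Psi ε w u :=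
  integral_nonneg fun t => sub_nonneg.2 (supp_Keps_le h _)

theorem Psi_zero {ε : ℝ} (h : ε ≤ 1) {w u : E3} (hw : ‖w‖ = 1) (hu : ‖u‖ = 1) (hc : |⟪w, u⟫_ℝ| ≤ 1 - ε) : Psi ε w u = 0 := by
  unfold Psi
  rw [← integral_zero ℝ ℝ (μ := tau)]
  congr 1; ext1 t
  set x := (qe w + t • (1 : HH)) * qe u with hx
  have h1 : 1 ≤ ‖x‖ := by
    rw [hx, norm_mul, norm_qe, hu, mul_one]
    have := qadd_norm w t
    rw [hw] at this
    by_contra! hh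
    nlinarith [norm_nonneg (qe w + t • (1 : HH)), sq_nonneg t]
  rw [sub_eq_zero]
  refine le_antisymm ?_ (supp_Keps_le h _)
  have hx' : ‖x‖ ≠ 0 := by linarith
  have hm : ‖x‖⁻¹ • x ∈ Keps ε := by
    rw [mem_Keps h]
    refine ⟨by rw [mem_B1, norm_smul, norm_inv, norm_norm, inv_mul_cancel₀ hx']; simp, ?_⟩
    rw [mem_Icc, ← abs_le, Quaternion.re_smul, hx, qmul_re, ← hx, smul_eq_mul, abs_mul, abs_neg, abs_inv, abs_norm]
    have : ‖x‖⁻¹ ≤ 1 := inv_le_one_of_one_le₀ h1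
    nlinarith [abs_nonneg ⟪w, u⟫_ℝ]
  have h2 := le_supp hm x
  rw [inner_smul_right, real_inner_self_eq_norm_sq, pow_two, ← mul_assoc, inv_mul_cancel₀ hx', one_mul] at h2
  rwa [supp_B1]

theorem Psi_pos {ε : ℝ} (h0 : 0 < ε) (h : ε ≤ 1) {q : E3} (hq : ‖q‖ = 1) : 0 < Psi ε q q := by
  unfold Psi
  rw [integral_tau]
  have : Continuous fun t : ℝ => (qe q + t • (1 : HH)) * qe q := by fun_prop
  apply intervalIntegral.integral_pos (by norm_num) (((continuous_supp _).comp this).sub ((continuous_supp _).comp this)).continuousOn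
  · intro t _; exact sub_nonneg.2 (supp_Keps_le h _)
  · refine ⟨0, by simp, ?_⟩
    have e : (qe q + (0:ℝ) • (1 : HH)) * qe q = -1 := by
      rw [zero_smul, add_zero]
      have h1 : star (qe q) = - qe q := by ext <;> simp
      have h2 := star_mul_self' (qe q)
      rw [h1, norm_qe, hq] at h2
      rw [← neg_inj, ← neg_mul, h2]; simp
    show 0 < supp B1 ((qe q + (0:ℝ) • (1 : HH)) * qe q) - supp (Keps ε) ((qe q + (0:ℝ) • (1 : HH)) * qe q)
    rw [e, supp_B1, norm_neg, norm_one, sub_pos]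
    refine lt_of_le_of_lt (supp_le (c := 1 - ε) ?_) (by linarith)
    intro y hy
    rw [mem_Keps h] at hy
    have : ⟪(-1 : HH), y⟫_ℝ = - y.re := by
      have e1 : (1 : HH).re = 1 := rfl
      have e2 : (1 : HH).imI = 0 := rfl
      have e3 : (1 : HH).imJ = 0 := rfl
      have e4 : (1 : HH).imK = 0 := rfl
      rw [inner_neg_left, inner_HH, e1, e2, e3, e4]; ring
    rw [this]; linarith [hy.2.1]

theorem ext_supp_unit {K L : ConvexBody E3} (h : ∀ u : E3, ‖u‖ = 1 → supp K u = supp L u) : K = L := by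
  apply ext_supp
  intro u
  by_cases hu : u = 0
  · subst hu
    have := supp_hom K le_rfl (0:E3)
    have h2 := supp_hom L le_rfl (0:E3)
    rw [smul_zero, zero_mul] at this h2
    rw [this, h2]
  have hu' := norm_ne_zero_iff.2 hu
  have := h (‖u‖⁻¹ • u) (by rw [norm_smul, norm_inv, norm_norm, inv_mul_cancel₀ hu'])
  rw [supp_hom _ (by positivity), supp_hom _ (by positivity)] at this
  exact mul_left_cancel₀ (inv_ne_zero hu') this

theorem LI_add {ν} (q : QV ν) (A B : ConvexBody E3) (hA : IsSym A) (hB : IsSym B) : LI ν (A + B) = LI ν A + LI ν B :=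
  add_of_deg_one q.LIv q.LIh hB A

theorem LI_smul {ν} (q : QV ν) (t : ℝ) (ht : 0 ≤ t) (A : ConvexBody E3) : LI ν (t • A) = t * LI ν A := by
  have := q.LIh t ht A
  simpa using this

/-- the average body -/
theorem exists_Mb {ν} (q : QV ν) {K : ConvexBody HH} (hK : IsSym K) (x : E3) : ∃ M : ConvexBody E3, IsSym M ∧
    (∀ u, supp M u = ∫ p, |⟪p, x⟫_ℝ| * ∫ t, supp K ((qe p + t • (1 : HH)) * qe u) ∂tau ∂sig) ∧
    LI ν M = ∫ p, ((|⟪p, x⟫_ℝ| : ℝ) : ℂ) * Xi ν K p ∂sig := by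
  set A : E3 × ℝ → ConvexBody E3 := fun z => |⟪z.1, x⟫_ℝ| • cmap qim (cmap (ml (star (qe z.1 + z.2 • (1 : HH)))) K) with hA
  have hAc : Continuous A := by
    have h1 : ∀ z, A z = cmap (|⟪z.1, x⟫_ℝ| • qim.comp (ml (star (qe z.1 + z.2 • (1 : HH))))) K := by
      intro z
      rw [hA]; beta_reduce
      rw [cmap_cmap, smul_eq_cmap, cmap_cmap]
      congr 1
    rw [funext h1]
    refine (continuous_cmap_left K).comp ?_
    have h2 : Continuous fun z : E3 × ℝ => ml (star (qe z.1 + z.2 • (1 : HH))) := continuous_ml.comp (by fun_prop)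
    have h3 : Continuous fun z : E3 × ℝ => |⟪z.1, x⟫_ℝ| := by fun_prop
    exact h3.smul (continuous_const.clm_comp h2)
  have hS : ∀ z, IsSym (A z) := fun z => ((hK.cmap _).cmap _).smul (abs_nonneg _)
  have hae : ∀ᵐ z ∂(sig.prod tau), z ∈ closedBall (0 : E3) 1 ×ˢ Icc (-1 : ℝ) 1 := by
    filter_upwards [Measure.quasiMeasurePreserving_fst.ae sig_ae', Measure.quasiMeasurePreserving_snd.ae tau_ae] with z a b
    exact ⟨a, b⟩
  have hcpt := (isCompact_closedBall (0 : E3) 1).prod (isCompact_Icc (a := (-1 : ℝ)) (b := 1))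
  obtain ⟨M, h1, h2, h3⟩ := sym_integral hcpt hae hAc hS
  refine ⟨M, h1, fun u => ?_, ?_⟩
  · rw [h2, integral_prod (fun z => supp (A z) u) (integ_cpt hcpt hae ((continuous_supp_left u).comp hAc))]
    congr 1; ext1 p
    rw [← integral_const_mul]
    congr 1; ext1 t
    rw [hA]
    show supp (|⟪p, x⟫_ℝ| • _) u = _
    rw [supp_smul _ (abs_nonneg _), supp_cmap, supp_cmap, adj_qim, adj_ml, star_star, ml_apply]
  · rw [h3 (LI ν) q.LIv.cont (LI_add q) (fun t ht A _ => LI_smul q t ht A), integral_prod (fun z => LI ν (A z)) (integ_cpt hcpt hae (q.LIv.cont.comp hAc))]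
    congr 1; ext1 p
    unfold Xi
    rw [← integral_const_mul]
    congr 1; ext1 t
    rw [hA]
    show LI ν (|⟪p, x⟫_ℝ| • _) = _
    rw [LI_smul q _ (abs_nonneg _), q.LI_eq]

theorem exists_Y {ν} (q : QV ν) {ε : ℝ} (h : ε ≤ 1) (x : E3) : ∃ M : ConvexBody E3, IsSym M ∧
    (∀ u, supp M u = ∫ w, Psi ε w x * |⟪w, u⟫_ℝ| ∂sig) ∧
    LI ν M = ∫ w, (Psi ε w x : ℂ) * LI ν (sseg w) ∂sig := by
  have hAc : Continuous fun w => Psi ε w x • sseg w := by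
    have : ∀ w, Psi ε w x • sseg w = sseg (Psi ε w x • w) := fun w => sseg_smul (Psi_nonneg h _ _) w
    rw [funext this]
    exact continuous_sseg.comp ((Psi_cont ε x).smul continuous_id)
  obtain ⟨M, h1, h2, h3⟩ := sym_integral (isCompact_closedBall _ _) sig_ae' hAc (fun w => (IsSym.sseg w).smul (Psi_nonneg h w x))
  refine ⟨M, h1, fun u => ?_, ?_⟩
  · rw [h2]
    congr 1; ext1 w
    rw [supp_smul _ (Psi_nonneg h _ _), supp_sseg, real_inner_comm]
  · rw [h3 (LI ν) q.LIv.cont (LI_add q) (fun t ht A _ => LI_smul q t ht A)]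
    congr 1; ext1 w
    rw [LI_smul q _ (Psi_nonneg h _ _)]

/-- the smoothed Klain function is affine -/
theorem smooth_affine {ν} (q : QV ν) {ε : ℝ} (h0 : 0 < ε) (h1 : ε ≤ 1 / 20) :
    ∃ α β : ℂ, ∀ x : E3, ‖x‖ = 1 → ∫ w, (Psi ε w x : ℂ) * LI ν (sseg w) ∂sig = α + β * (x 0 : ℂ) ^ 2 := by
  have hε : ε ≤ 1 := by linarith
  obtain ⟨α, β, hX⟩ := Xi_affine q h0 h1
  obtain ⟨a, b, hab⟩ := moment_aff
  have he0 : ‖e3 0‖ = 1 := by simp [e3]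
  refine ⟨α * ((∫ p : E3, |⟪p, e3 0⟫_ℝ| ∂sig : ℝ) : ℂ) + β * a, β * b, fun x hx => ?_⟩
  obtain ⟨M, s1, u1, l1⟩ := exists_Mb q B1_sym x
  obtain ⟨M', s2, u2, l2⟩ := exists_Mb q (Keps_sym hε) x
  obtain ⟨Y, s3, u3, l3⟩ := exists_Y q hε x
  have cK : ∀ (K : ConvexBody HH) (u : E3), Continuous fun p : E3 => ∫ t, supp K ((qe p + t • (1 : HH)) * qe u) ∂tau := by
    intro K u
    unfold tau
    apply continuous_parametric_integral_of_continuous _ isCompact_Icc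
    have : Continuous fun z : E3 × ℝ => (qe z.1 + z.2 • (1 : HH)) * qe u := by fun_prop
    exact (continuous_supp _).comp this
  have key : M = M' + Y := by
    apply ext_supp_unit
    intro u hu
    rw [supp_add, u1, u2, u3, ← sub_eq_iff_eq_add', ← integral_sub]
    · obtain ⟨R, hR, hR'⟩ := exists_isom (hu.trans hx.symm)
      rw [← integral_sig R]
      congr 1; ext1 p
      rw [← mul_sub, mul_comm]
      have e1 : ⟪R p, x⟫_ℝ = ⟪p, u⟫_ℝ := by rw [← hR, R.inner_map_map]
      rw [e1, ← Psi_inv hε (p := R p) (u := u) (by rw [← hR', R.inner_map_map]) (R.norm_map p) (hu.trans hx.symm)]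
      congr 1
      unfold Psi
      have : Continuous fun t : ℝ => (qe (R p) + t • (1 : HH)) * qe u := by fun_prop
      exact (integral_sub (integ_tau ((continuous_supp _).comp this)) (integ_tau ((continuous_supp _).comp this))).symm
    · exact integ_sig (Continuous.mul (by fun_prop) (cK _ u))
    · exact integ_sig (Continuous.mul (by fun_prop) (cK _ u))
  have key2 : LI ν M = LI ν M' + LI ν Y := by rw [key, LI_add q _ _ s2 s3]
  rw [l1, l2, l3, ← sub_eq_iff_eq_add', ← integral_sub] at key2
  · rw [← key2]
    have e : ∫ p : E3, |⟪p, e3 0⟫_ℝ| ∂sig = ∫ p : E3, |⟪p, x⟫_ℝ| ∂sig := by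
      obtain ⟨R, hR, hR'⟩ := exists_isom (hx.trans he0.symm)
      rw [← integral_sig R]
      congr 1; ext1 p
      rw [← hR, R.inner_map_map]
    have e2 : ∫ p : E3, (((|⟪p, x⟫_ℝ| : ℝ) : ℂ) * Xi ν B1 p - ((|⟪p, x⟫_ℝ| : ℝ) : ℂ) * Xi ν (Keps ε) p) ∂sig
        = ∫ p : E3, (α * ((|⟪p, x⟫_ℝ| : ℝ) : ℂ) + β * ((|⟪p, x⟫_ℝ| * (p 0) ^ 2 : ℝ) : ℂ)) ∂sig := by
      apply integral_congr_ae
      filter_upwards [sig_ae] with p hp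
      rw [← mul_sub, hX p hp]; push_cast; ring
    rw [e2, integral_add, integral_const_mul, integral_const_mul, integral_complex_ofReal, integral_complex_ofReal, hab x hx, e]
    · push_cast; ring
    · exact integ_sig (by fun_prop)
    · exact integ_sig (by fun_prop)
  · exact integ_sig (Continuous.mul (by fun_prop) (q.cont_Xi _))
  · exact integ_sig (Continuous.mul (by fun_prop) (q.cont_Xi _))

theorem mass_pos {ε : ℝ} (h0 : 0 < ε) (h : ε ≤ 1) : ∃ m : ℝ, 0 < m ∧ ∀ x : E3, ‖x‖ = 1 → ∫ w, Psi ε w x ∂sig = m := by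
  have he0 : ‖e3 0‖ = 1 := by simp [e3]
  refine ⟨∫ w, Psi ε w (e3 0) ∂sig, integral_sig_pos (Psi_cont _ _) (fun p => Psi_nonneg h _ _) he0 (Psi_pos h0 h he0), ?_⟩
  intro x hx
  obtain ⟨R, hR, hR'⟩ := exists_isom (hx.trans he0.symm)
  rw [← integral_sig R]
  congr 1; ext1 p
  exact Psi_inv h (by rw [← hR', R.inner_map_map]) (R.norm_map p) (hx.trans he0.symm)

theorem sseg_neg' {E : Type*} [NormedAddCommGroup E] [InnerProductSpace ℝ E] [FiniteDimensional ℝ E] (v : E) : sseg (-v) = sseg v := by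
  apply ext_supp; intro u; rw [supp_sseg, supp_sseg, inner_neg_right, abs_neg]

theorem approx {ν} (q : QV ν) {x : E3} (hx : ‖x‖ = 1) {η : ℝ} (hη : 0 < η) :
    ∃ δ > 0, ∀ ε, 0 < ε → ε ≤ δ → ε ≤ 1 → 
      ‖(∫ w, (Psi ε w x : ℂ) * LI ν (sseg w) ∂sig) - ((∫ w, Psi ε w x ∂sig : ℝ) : ℂ) * LI ν (sseg x)‖ ≤ η * ∫ w, Psi ε w x ∂sig := by
  have hc : Continuous fun w : E3 => LI ν (sseg w) := q.LIv.cont.comp continuous_sseg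
  obtain ⟨δ, h1, h2⟩ := Metric.continuous_iff.1 hc x η hη
  refine ⟨δ ^ 2 / 4, by positivity, fun ε h0 hε hε1 => ?_⟩
  rw [← integral_complex_ofReal, ← integral_mul_const, ← integral_sub, ← integral_const_mul]
  · apply norm_integral_le_of_norm_le (integ_sig (continuous_const.mul (Psi_cont _ _)))
    filter_upwards [sig_ae] with w hw
    rw [← mul_sub, norm_mul, Complex.norm_real, Real.norm_of_nonneg (Psi_nonneg hε1 _ _), mul_comm]
    by_cases hz : |⟪w, x⟫_ℝ| ≤ 1 - ε
    · rw [Psi_zero hε1 hw hx hz]; simp; exact mul_nonneg hη.le (Psi_nonneg hε1 _ _)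
    · apply mul_le_mul_of_nonneg_right _ (Psi_nonneg hε1 _ _)
      have near : ∀ w : E3, ‖w‖ = 1 → 1 - ε < ⟪w, x⟫_ℝ → dist w x < δ := by
        intro w hw h
        rw [dist_eq_norm]
        have := norm_sub_sq_real w x
        rw [hw, hx] at this
        apply lt_of_pow_lt_pow_left₀ 2 h1.le
        nlinarith
      push Not at hz
      rcases lt_abs.1 hz with h | h
      · have := h2 w (near w hw h)
        rw [dist_eq_norm] at this; exact this.le
      · have := h2 (-w) (near (-w) (by rwa [norm_neg]) (by rwa [inner_neg_left]))
        rw [dist_eq_norm, sseg_neg'] at this; exact this.le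
  · exact integ_sig (Continuous.mul (Complex.continuous_ofReal.comp (Psi_cont _ _)) hc)
  · exact integ_sig (Continuous.mul (Complex.continuous_ofReal.comp (Psi_cont _ _)) continuous_const)

/-- the main result of Part C -/
theorem QV.main {ν} (q : QV ν) {x : E3} (hx : ‖x‖ = 1) :
    LI ν (sseg x) = (x 0 : ℂ) ^ 2 * LI ν (sseg (e3 0)) + (1 - (x 0 : ℂ) ^ 2) * LI ν (sseg (e3 1)) := by
  have he0 : ‖e3 0‖ = 1 := by simp [e3]
  have he1 : ‖e3 1‖ = 1 := by simp [e3]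
  have hx0 : (x 0) ^ 2 ≤ 1 := by
    have := norm_E3 x
    rw [hx] at this
    nlinarith [sq_nonneg (x 1), sq_nonneg (x 2)]
  have main : ∀ η : ℝ, 0 < η → ‖LI ν (sseg x) - ((x 0 : ℂ) ^ 2 * LI ν (sseg (e3 0)) + (1 - (x 0 : ℂ) ^ 2) * LI ν (sseg (e3 1)))‖ ≤ 3 * η := by
    intro η hη
    obtain ⟨d1, p1, a1⟩ := approx q hx hη
    obtain ⟨d2, p2, a2⟩ := approx q he0 hη
    obtain ⟨d3, p3, a3⟩ := approx q he1 hη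
    obtain ⟨ε, h0, e1, e2, e3', e4⟩ : ∃ ε : ℝ, 0 < ε ∧ ε ≤ d1 ∧ ε ≤ d2 ∧ ε ≤ d3 ∧ ε ≤ 1 / 20 :=
      ⟨min (min d1 d2) (min d3 (1/20)), by positivity, by simp, by simp, by simp, by simp⟩
    have e5 : ε ≤ 1 := by linarith
    obtain ⟨m, hm, hmx⟩ := mass_pos h0 e5
    obtain ⟨α, β, hab⟩ := smooth_affine q h0 e4
    have b1 := a1 ε h0 e1 e5
    have b2 := a2 ε h0 e2 e5
    have b3 := a3 ε h0 e3' e5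
    rw [hab x hx, hmx x hx] at b1
    rw [hab _ he0, hmx _ he0] at b2
    rw [hab _ he1, hmx _ he1] at b3
    have z0 : e3 0 0 = 1 := by simp [e3]
    have z1 : e3 1 0 = 0 := by simp [e3]
    rw [z0] at b2
    rw [z1] at b3
    set f0 := LI ν (sseg (e3 0))
    set f1 := LI ν (sseg (e3 1))
    set fx := LI ν (sseg x)
    have id1 : (m : ℂ) * (fx - ((x 0 : ℂ) ^ 2 * f0 + (1 - (x 0 : ℂ) ^ 2) * f1)) =
      -(α + β * (x 0 : ℂ) ^ 2 - m * fx) + (((x 0) ^ 2 : ℝ) : ℂ) * (α + β * ((1:ℝ) : ℂ) ^ 2 - m * f0) + ((1 - (x 0) ^ 2 : ℝ) : ℂ) * (α + β * ((0:ℝ) : ℂ) ^ 2 - m * f1) := by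
      push_cast; ring
    have hle : m * ‖fx - ((x 0 : ℂ) ^ 2 * f0 + (1 - (x 0 : ℂ) ^ 2) * f1)‖ ≤ m * (3 * η) := by
      have := congrArg norm id1
      rw [norm_mul, Complex.norm_real, Real.norm_of_nonneg hm.le] at this
      rw [this]
      refine (norm_add₃_le).trans ?_
      rw [norm_neg, norm_mul, norm_mul, Complex.norm_real, Complex.norm_real, Real.norm_of_nonneg (sq_nonneg _), Real.norm_of_nonneg (by linarith)]
      have t2 : x 0 ^ 2 * ‖α + β * ((1:ℝ) : ℂ) ^ 2 - m * f0‖ ≤ 1 * (η * m) := mul_le_mul hx0 b2 (norm_nonneg _) (by norm_num)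
      have t3 : (1 - x 0 ^ 2) * ‖α + β * ((0:ℝ) : ℂ) ^ 2 - m * f1‖ ≤ 1 * (η * m) := mul_le_mul (by nlinarith [sq_nonneg (x 0)]) b3 (norm_nonneg _) (by norm_num)
      linarith
    exact le_of_mul_le_mul_left hle hm
  rw [← sub_eq_zero, ← norm_eq_zero]
  apply le_antisymm _ (norm_nonneg _)
  apply le_of_forall_pos_le_add
  intro η hη
  have := main (η / 3) (by positivity)
  linarith

theorem LI_sseg {ν} (q : QV ν) (x : E3) : LI ν (sseg x) = 2 * Dv 1 ν (seg (qe x)) := by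
  rw [sseg, q.LIv.trans, ← seg_smul (by norm_num), LI_smul q _ (by norm_num), LI, cmap_seg]; simp

theorem QV.main' {ν} (q : QV ν) {x : E3} (hx : ‖x‖ = 1) :
    Dv 1 ν (seg (qe x)) = (x 0 : ℂ) ^ 2 * Dv 1 ν (seg (qe (e3 0))) + (1 - (x 0 : ℂ) ^ 2) * Dv 1 ν (seg (qe (e3 1))) := by
  have := q.main hx
  rw [LI_sseg q, LI_sseg q, LI_sseg q] at this
  linear_combination this / 2
end UV
end

noncomputable section
namespace UV
open Filter Topology
open scoped InnerProductSpace ComplexConjugate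

section Lists
variable {V : Type*} [NormedAddCommGroup V] [NormedSpace ℝ V]

/-- iterated difference operator along a list of vectors -/
def Dl (l : List V) (μ : ConvexBody V → ℂ) : ConvexBody V → ℂ := l.foldr (fun v ν => Dv v ν) μ

theorem Dl_nil (μ : ConvexBody V → ℂ) : Dl [] μ = μ := rfl
theorem Dl_cons (v : V) (l : List V) (μ : ConvexBody V → ℂ) : Dl (v :: l) μ = Dv v (Dl l μ) := rfl
theorem Dl_append (l l' : List V) (μ : ConvexBody V → ℂ) : Dl (l ++ l') μ = Dl l (Dl l' μ) := by
  unfold Dl; rw [List.foldr_append]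

theorem IsVal.Dl {μ : ConvexBody V → ℂ} (h : IsVal μ) (l : List V) : IsVal (Dl l μ) := by
  induction l with
  | nil => exact h
  | cons v l ih => exact ih.Dv v

theorem IsHom.Dl {μ : ConvexBody V → ℂ} (h : IsVal μ) (l : List V) {k m : ℕ} (hk : IsHom k μ) (hm : m + l.length = k) : IsHom m (Dl l μ) := by
  induction l generalizing m with
  | nil => simp at hm; subst hm; exact hk
  | cons v l ih => exact IsHom.Dv (h.Dl l) (ih (m := m + 1) (by simp at hm; omega)) v

theorem Dv_comm (v w : V) (μ : ConvexBody V → ℂ) : Dv v (Dv w μ) = Dv w (Dv v μ) := by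
  funext K
  unfold Dv
  rw [add_right_comm]; ring

theorem Dl_perm {l l' : List V} (h : l.Perm l') (μ : ConvexBody V → ℂ) : Dl l μ = Dl l' μ := by
  induction h with
  | nil => rfl
  | cons v _ ih => rw [Dl_cons, Dl_cons, ih]
  | swap v w l => rw [Dl_cons, Dl_cons, Dl_cons, Dl_cons, Dv_comm]
  | trans _ _ h1 h2 => rw [h1, h2]

theorem Dl_inv {μ : ConvexBody V → ℂ} (g : V →L[ℝ] V) (hg : ∀ K, μ (cmap g K) = μ K) (l : List V) (hl : ∀ v ∈ l, g v = v) (K : ConvexBody V) :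
    Dl l μ (cmap g K) = Dl l μ K := by
  induction l generalizing K with
  | nil => exact hg K
  | cons v l ih =>
    rw [Dl_cons]
    unfold Dv
    have ih' := ih (fun w hw => hl w (List.mem_cons_of_mem _ hw))
    have hv : seg v = cmap g (seg v) := by rw [cmap_seg, hl v List.mem_cons_self]
    conv_lhs => rw [hv, ← cmap_add, ih', ih']

theorem Fk_ofFn {m : ℕ} : ∀ {μ : ConvexBody V → ℂ} (h : IsVal μ) (hk : IsHom m μ) (v : Fin m → V), Fk μ v = Dl (List.ofFn v) μ 0 := by
  induction m with
  | zero => intro μ h hk v; simp [Fk, Dl]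
  | succ m ih =>
    intro μ h hk v
    have e : v = Fin.cons (v 0) (Fin.tail v) := (Fin.cons_self_tail v).symm
    conv_lhs => rw [e]
    rw [← Fk_cons h hk, ih (h.Dv _) (IsHom.Dv h hk _), List.ofFn_succ]
    have : Dv (v 0) μ = Dl [v 0] μ := rfl
    rw [this, ← Dl_append]
    exact congrFun (Dl_perm (by exact List.perm_append_singleton _ _) μ) 0

theorem Dl_eq_sum {m : ℕ} {μ : ConvexBody V → ℂ} (h : IsVal μ) (hk : IsHom m μ) (l : List V) (hl : l.length = m) :
    Dl l μ 0 = μ (l.map seg).sum := by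
  subst hl
  rw [← List.ofFn_get l, ← Fk_ofFn h (by simpa using hk), Fk]
  simp [List.sum_ofFn]
end Lists

section Cplx
variable {V : Type*} [NormedAddCommGroup V] [InnerProductSpace ℂ V] [FiniteDimensional ℂ V]

/-- the underlying real continuous linear map -/
def rl (g : V ≃ₗᵢ[ℂ] V) : V →L[ℝ] V := ((g.toContinuousLinearEquiv : V ≃L[ℂ] V) : V →L[ℂ] V).restrictScalars ℝ

@[simp] theorem rl_apply (g : V ≃ₗᵢ[ℂ] V) (x : V) : rl g x = g x := rfl

theorem norm_comb {a a' : V} (ha : ‖a‖ = 1) (ha' : ‖a'‖ = 1) (h : ⟪a, a'⟫_ℂ = 0) (x y : ℂ) :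
    ‖x • a + y • a'‖ ^ 2 = ‖x‖ ^ 2 + ‖y‖ ^ 2 := by
  rw [norm_add_sq (𝕜 := ℂ), inner_smul_left, inner_smul_right, h, norm_smul, norm_smul, ha, ha']; simp

theorem ext2 {a a' : V} (ha : ‖a‖ = 1) (ha' : ‖a'‖ = 1) (h : ⟪a, a'⟫_ℂ = 0) {p q p' q' : ℂ}
    (h1 : p * conj p + q * conj q = 1) (h2 : p' * conj p' + q' * conj q' = 1) (h3 : conj p * p' + conj q * q' = 0) :
    ∃ G : V ≃ₗᵢ[ℂ] V, G a = p • a + q • a' ∧ G a' = p' • a + q' • a' ∧ ∀ y, ⟪a, y⟫_ℂ = 0 → ⟪a', y⟫_ℂ = 0 → G y = y := by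
  have haa : ⟪a, a⟫_ℂ = 1 := by rw [inner_self_eq_norm_sq_to_K, ha]; simp
  have haa' : ⟪a', a'⟫_ℂ = 1 := by rw [inner_self_eq_norm_sq_to_K, ha']; simp
  have h' : ⟪a', a⟫_ℂ = 0 := by rw [← inner_conj_symm, h]; simp
  set f : V →ₗ[ℂ] V := LinearMap.id + (innerₛₗ ℂ a).smulRight (p • a + q • a' - a) + (innerₛₗ ℂ a').smulRight (p' • a + q' • a' - a') with hf
  have hfa : ∀ y, f y = y + ⟪a, y⟫_ℂ • (p • a + q • a' - a) + ⟪a', y⟫_ℂ • (p' • a + q' • a' - a') := fun y => rfl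
  have hn : ∀ y, ‖f y‖ = ‖y‖ := by
    intro y
    set α := ⟪a, y⟫_ℂ with hα
    set β := ⟪a', y⟫_ℂ with hβ
    set r := y - (α • a + β • a') with hr
    have r1 : ⟪r, a⟫_ℂ = 0 := by
      rw [← inner_conj_symm, hr, inner_sub_right, inner_add_right, inner_smul_right, inner_smul_right, haa, h, ← hα]; simp
    have r2 : ⟪r, a'⟫_ℂ = 0 := by
      rw [← inner_conj_symm, hr, inner_sub_right, inner_add_right, inner_smul_right, inner_smul_right, haa', h', ← hβ]; simp
    have pyth : ∀ x z : ℂ, ‖r + (x • a + z • a')‖ ^ 2 = ‖r‖ ^ 2 + (‖x‖ ^ 2 + ‖z‖ ^ 2) := by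
      intro x z
      rw [norm_add_sq (𝕜 := ℂ), inner_add_right, inner_smul_right, inner_smul_right, r1, r2, norm_comb ha ha' h]; simp
    have e1 : y = r + (α • a + β • a') := by rw [hr]; abel
    have e2 : f y = r + ((p * α + p' * β) • a + (q * α + q' * β) • a') := by
      rw [hfa, ← hα, ← hβ, hr]; module
    rw [← sq_eq_sq₀ (norm_nonneg _) (norm_nonneg _), e2, pyth]
    have e3 := pyth α β
    rw [← e1] at e3
    rw [e3]
    congr 1
    rw [← Complex.ofReal_inj]
    push_cast
    rw [← Complex.mul_conj', ← Complex.mul_conj', ← Complex.mul_conj', ← Complex.mul_conj']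
    have h3' : p * conj p' + q * conj q' = 0 := by
      have := congrArg conj h3
      simpa using this
    simp only [map_add, map_mul]
    linear_combination α * conj α * h1 + β * conj β * h2 + β * conj α * h3 + α * conj β * h3'
  refine ⟨LinearIsometry.toLinearIsometryEquiv ⟨f, hn⟩ rfl, ?_, ?_, ?_⟩
  · show f a = _
    rw [hfa, haa, h']; simp
  · show f a' = _
    rw [hfa, haa', h]; simp
  · intro y y1 y2
    show f y = _
    rw [hfa, y1, y2]; simp

/-- embedding of the quaternions -/
def TT (a a' : V) : HH →L[ℝ] V := LinearMap.toContinuousLinearMap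
  { toFun := fun x => ((x.re : ℂ) + x.imI * Complex.I) • a + ((x.imJ : ℂ) - x.imK * Complex.I) • a'
    map_add' := by intro x y; simp; module
    map_smul' := by
      intro r x
      rw [RingHom.id_apply, ← Complex.coe_smul]
      simp
      module }

theorem TT_apply (a a' : V) (x : HH) : TT a a' x = ((x.re : ℂ) + x.imI * Complex.I) • a + ((x.imJ : ℂ) - x.imK * Complex.I) • a' := rfl

theorem planeC {η : ConvexBody V → ℂ} (hv : IsVal η) (hk : IsHom 2 η) {a a' : V} (ha : ‖a‖ = 1) (ha' : ‖a'‖ = 1) (h : ⟪a, a'⟫_ℂ = 0)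
    (hinv : ∀ G : V ≃ₗᵢ[ℂ] V, (∀ y, ⟪a, y⟫_ℂ = 0 → ⟪a', y⟫_ℂ = 0 → G y = y) → ∀ K, η (cmap (rl G) K) = η K) {c s : ℝ} (hcs : c ^ 2 + s ^ 2 = 1) :
    Dl [a, (c : ℂ) • Complex.I • a + (s : ℂ) • a'] η 0 = (c : ℂ) ^ 2 * Dl [a, Complex.I • a] η 0 + (s : ℂ) ^ 2 * Dl [a, a'] η 0 := by
  have q : QV (fun K => η (cmap (TT a a') K)) := by
    refine ⟨hv.comp_cmap _, hk.comp_cmap _, ?_, ?_⟩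
    · intro g hg K
      have hg2 : g.re ^ 2 + g.imI ^ 2 + g.imJ ^ 2 + g.imK ^ 2 = 1 := by
        have : ‖g‖ ^ 2 = 1 := by rw [hg]; simp
        rw [← real_inner_self_eq_norm_sq, inner_HH] at this
        linarith
      have hg3 : (g.re : ℂ) ^ 2 + g.imI ^ 2 + g.imJ ^ 2 + g.imK ^ 2 = 1 := by exact_mod_cast hg2
      obtain ⟨G, G1, G2, G3⟩ := ext2 ha ha' h (p := g.re + g.imI * Complex.I) (q := g.imJ - g.imK * Complex.I)
        (p' := -(g.imJ + g.imK * Complex.I)) (q' := g.re - g.imI * Complex.I)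
        (by simp; linear_combination hg3 - (g.imI ^ 2 + g.imK ^ 2) * Complex.I_sq)
        (by simp; linear_combination hg3 - (g.imI ^ 2 + g.imK ^ 2) * Complex.I_sq)
        (by simp; ring)
      show η _ = η _
      rw [← hinv G G3 (cmap (TT a a') K), cmap_cmap, cmap_cmap]
      congr 2
      ext1 x
      simp only [ContinuousLinearMap.comp_apply, ml_apply, rl_apply, TT_apply, map_add, map_smul, G1, G2]
      simp only [Quaternion.re_mul, Quaternion.imI_mul, Quaternion.imJ_mul, Quaternion.imK_mul]
      push_cast
      match_scalars
      · linear_combination (-(x.imI : ℂ) * g.imI - x.imK * g.imK) * Complex.I_sq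
      · linear_combination ((x.imI : ℂ) * g.imK - x.imK * g.imI) * Complex.I_sq
    · intro r hr r1 r2 K
      have hg2 : r.re ^ 2 + r.imI ^ 2 = 1 := by
        have : ‖r‖ ^ 2 = 1 := by rw [hr]; simp
        rw [← real_inner_self_eq_norm_sq, inner_HH, r1, r2] at this
        linarith
      have hg3 : (r.re : ℂ) ^ 2 + r.imI ^ 2 = 1 := by exact_mod_cast hg2
      obtain ⟨G, G1, G2, G3⟩ := ext2 ha ha' h (p := r.re + r.imI * Complex.I) (q := 0)
        (p' := 0) (q' := r.re + r.imI * Complex.I)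
        (by simp; linear_combination hg3 - (r.imI ^ 2) * Complex.I_sq)
        (by simp; linear_combination hg3 - (r.imI ^ 2) * Complex.I_sq)
        (by simp)
      show η _ = η _
      rw [← hinv G G3 (cmap (TT a a') K), cmap_cmap, cmap_cmap]
      congr 2
      ext1 x
      simp only [ContinuousLinearMap.comp_apply, mr_apply, rl_apply, TT_apply, map_add, map_smul, G1, G2]
      simp only [Quaternion.re_mul, Quaternion.imI_mul, Quaternion.imJ_mul, Quaternion.imK_mul, r1, r2]
      push_cast
      match_scalars
      · linear_combination (-(x.imI : ℂ) * r.imI) * Complex.I_sq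
      · linear_combination ((x.imK : ℂ) * r.imI) * Complex.I_sq
  have key : ∀ x : E3, Dv 1 (fun K => η (cmap (TT a a') K)) (seg (qe x)) = Dl [a, TT a a' (qe x)] η 0 := by
    intro x
    have e1 : TT a a' 1 = a := by
      rw [TT_apply]
      have e1 : (1 : HH).re = 1 := rfl
      have e2 : (1 : HH).imI = 0 := rfl
      have e3 : (1 : HH).imJ = 0 := rfl
      have e4 : (1 : HH).imK = 0 := rfl
      rw [e1, e2, e3, e4]; simp
    have z1 := IsHom.zono_zero hv hk [TT a a' (qe x)] (by simp)
    have z2 := IsHom.zono_zero hv hk [a] (by simp)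
    have z3 := IsHom.zono_zero hv hk [] (by simp)
    simp at z1 z2 z3
    unfold Dv
    simp only [Dl_cons, Dl_nil, Dv]
    rw [cmap_add, cmap_seg, cmap_seg, e1, z1]
    simp [z1, z2, z3, add_comm]
  have hx : ‖(!₂[c, s, 0] : E3)‖ = 1 := by
    rw [← sq_eq_sq₀ (norm_nonneg _) (by norm_num), norm_E3]; simp; linarith
  have m := q.main' hx
  rw [key, key, key] at m
  have t1 : TT a a' (qe !₂[c, s, 0]) = (c : ℂ) • Complex.I • a + (s : ℂ) • a' := by
    rw [TT_apply]; simp [smul_smul]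
  have t2 : TT a a' (qe (e3 0)) = Complex.I • a := by
    rw [TT_apply]; simp [e3]
  have t3 : TT a a' (qe (e3 1)) = a' := by
    rw [TT_apply]; simp [e3]
  rw [t1, t2, t3] at m
  have hcs' : (s : ℂ) ^ 2 = 1 - c ^ 2 := by
    have : s ^ 2 = 1 - c ^ 2 := by linarith
    exact_mod_cast this
  rw [m, hcs']; simp
end Cplx
end UV
end

noncomputable section
namespace UV
open Filter Topology
open scoped InnerProductSpace ComplexConjugate

theorem skew_step {E : Type*} [NormedAddCommGroup E] [InnerProductSpace ℝ E] [FiniteDimensional ℝ E] [Nontrivial E]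
    (A : E →ₗ[ℝ] E) (hA : ∀ x y, ⟪A x, y⟫_ℝ = -⟪x, A y⟫_ℝ) :
    ∃ a : E, ‖a‖ = 1 ∧ (A a = 0 ∨ ∃ b : E, ∃ c : ℝ, 0 < c ∧ ‖b‖ = 1 ∧ ⟪a, b⟫_ℝ = 0 ∧ A a = c • b ∧ A b = (-c) • a) := by
  have hs : (A ∘ₗ A).IsSymmetric := by
    intro x y
    simp only [LinearMap.comp_apply]
    rw [hA, hA]; simp
  obtain ⟨v, hv⟩ := (hs.hasEigenvalue_iSup_of_finiteDimensional).exists_hasEigenvector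
  set lam : ℝ := (⨆ x : { x : E // x ≠ 0 }, RCLike.re ⟪(A ∘ₗ A) ↑x, ↑x⟫_ℝ / ‖(x : E)‖ ^ 2)
  have h1 : A (A v) = lam • v := hv.apply_eq_smul
  have hv0 : v ≠ 0 := hv.2
  have hn : ‖v‖ ≠ 0 := norm_ne_zero_iff.2 hv0
  set a := ‖v‖⁻¹ • v with ha
  have ha1 : ‖a‖ = 1 := by rw [ha, norm_smul]; simp [hn]
  have h2 : A (A a) = lam • a := by rw [ha, map_smul, map_smul, h1, smul_comm]
  refine ⟨a, ha1, ?_⟩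
  by_cases h0 : A a = 0
  · exact Or.inl h0
  right
  have hc : ‖A a‖ ≠ 0 := norm_ne_zero_iff.2 h0
  have hl : lam = -‖A a‖ ^ 2 := by
    have := hA (A a) a
    rw [h2, inner_smul_left, real_inner_self_eq_norm_sq, real_inner_self_eq_norm_sq, ha1] at this
    simpa using this
  have h3 : ⟪a, A a⟫_ℝ = 0 := by
    have := hA a a
    rw [real_inner_comm] at this
    linarith
  refine ⟨‖A a‖⁻¹ • A a, ‖A a‖, by positivity, by rw [norm_smul]; simp [hc], by rw [inner_smul_right, h3, mul_zero], ?_, ?_⟩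
  · rw [smul_smul, mul_inv_cancel₀ hc, one_smul]
  · rw [map_smul, h2, hl, smul_smul]; congr 1; field_simp

section Cplx
variable {V : Type*} [NormedAddCommGroup V] [InnerProductSpace ℂ V] [FiniteDimensional ℂ V]

attribute [local instance] InnerProductSpace.complexToReal

theorem rinner (x y : V) : ⟪x, y⟫_ℝ = (⟪x, y⟫_ℂ).re := rfl

theorem rinner_I (x y : V) : ⟪Complex.I • x, y⟫_ℝ = (⟪x, y⟫_ℂ).im := by
  rw [rinner, inner_smul_left]; simp

theorem cinner_zero {x y : V} (h1 : ⟪x, y⟫_ℝ = 0) (h2 : ⟪Complex.I • x, y⟫_ℝ = 0) : ⟪x, y⟫_ℂ = 0 := by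
  rw [rinner_I] at h2
  rw [rinner] at h1
  exact Complex.ext h1 h2

theorem decomp (E : Submodule ℝ V) (m : ℕ) (hE : Module.finrank ℝ E = m + 1) :
    (∃ a ∈ E, ‖a‖ = 1 ∧ ∃ F ≤ E, Module.finrank ℝ F = m ∧ E ≤ Submodule.span ℝ {a} ⊔ F ∧ ∀ y ∈ F, ⟪a, y⟫_ℂ = 0) ∨
    (∃ a ∈ E, ∃ b ∈ E, ‖a‖ = 1 ∧ ‖b‖ = 1 ∧ (⟪a, b⟫_ℂ).re = 0 ∧ 0 ≤ (⟪a, b⟫_ℂ).im ∧ ∃ F ≤ E, Module.finrank ℝ F + 1 = m ∧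
      E ≤ Submodule.span ℝ {a, b} ⊔ F ∧ ∀ y ∈ F, ⟪a, y⟫_ℂ = 0 ∧ ⟪b, y⟫_ℂ = 0) := by
  haveI : Nontrivial E := Module.nontrivial_of_finrank_pos (R := ℝ) (by omega)
  set J : V →ₗ[ℝ] V := { toFun := fun x => Complex.I • x, map_add' := fun x y => smul_add _ _ _, map_smul' := fun r x => smul_comm _ _ _ } with hJ
  set A : E →ₗ[ℝ] E := (E.orthogonalProjectionOnto : V →ₗ[ℝ] E) ∘ₗ J ∘ₗ E.subtype with hA
  have hAi : ∀ x y : E, ⟪A x, y⟫_ℝ = ⟪Complex.I • (x : V), (y : V)⟫_ℝ := by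
    intro x y
    have := Submodule.inner_orthogonalProjectionOnto_eq_of_mem_left y (Complex.I • (x : V))
    rw [real_inner_comm, real_inner_comm (y : V) (Complex.I • (x : V)), ← this]; rfl
  have hsk : ∀ x y : E, ⟪A x, y⟫_ℝ = -⟪x, A y⟫_ℝ := by
    intro x y
    rw [real_inner_comm (A y) x, hAi, hAi, rinner_I, rinner_I, ← inner_conj_symm, Complex.conj_im]
  obtain ⟨a, ha, h0 | ⟨b, c, hc, hb, hab, h1, h2⟩⟩ := skew_step A hsk
  · left
    have hle : Submodule.span ℝ {(a : V)} ≤ E := by rw [Submodule.span_singleton_le_iff_mem]; exact a.2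
    have ha0 : (a : V) ≠ 0 := by intro h; have : ‖(a : V)‖ = 1 := ha; rw [h] at this; simp at this
    refine ⟨a, a.2, ha, (Submodule.span ℝ {(a : V)})ᗮ ⊓ E, inf_le_right, ?_, ?_, ?_⟩
    · have := Submodule.finrank_add_inf_finrank_orthogonal hle
      rw [finrank_span_singleton ha0, hE] at this; omega
    · rw [Submodule.sup_orthogonal_inf_of_hasOrthogonalProjection hle]
    · intro y hy
      refine cinner_zero (Submodule.mem_orthogonal_singleton_iff_inner_right.1 hy.1) ?_
      have := hAi a ⟨y, hy.2⟩
      rw [h0, inner_zero_left] at this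
      exact this.symm
  · right
    have hle : Submodule.span ℝ {(a : V), (b : V)} ≤ E := by
      rw [Submodule.span_le]; rintro x (rfl | rfl); exacts [a.2, b.2]
    have hab' : ⟪(a : V), (b : V)⟫_ℝ = 0 := hab
    have hli : LinearIndependent ℝ ![(a : V), (b : V)] := by
      have : Orthonormal ℝ ![(a : V), (b : V)] := by
        constructor
        · intro i; fin_cases i; exacts [ha, hb]
        · intro i j hij; fin_cases i <;> fin_cases j <;> simp at hij ⊢
          · exact hab'
          · rw [real_inner_comm]; exact hab'
      exact this.linearIndependent
    have hf : Module.finrank ℝ (Submodule.span ℝ {(a : V), (b : V)}) = 2 := by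
      have := finrank_span_eq_card hli
      have e : range ![(a : V), (b : V)] = {(a : V), (b : V)} := by
        ext x; simp [Fin.exists_fin_two, eq_comm, or_comm]
      rw [e] at this; simpa using this
    refine ⟨a, a.2, b, b.2, ha, hb, hab', ?_, (Submodule.span ℝ {(a : V), (b : V)})ᗮ ⊓ E, inf_le_right, ?_, ?_, ?_⟩
    · rw [← rinner_I, ← hAi, h1, inner_smul_left, real_inner_self_eq_norm_sq]; simp; positivity
    · have := Submodule.finrank_add_inf_finrank_orthogonal hle
      rw [hf, hE] at this; omega
    · rw [Submodule.sup_orthogonal_inf_of_hasOrthogonalProjection hle]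
    · intro y hy
      have ya : ⟪(a : V), y⟫_ℝ = 0 := (Submodule.mem_orthogonal _ _).1 hy.1 _ (Submodule.subset_span (by simp))
      have yb : ⟪(b : V), y⟫_ℝ = 0 := (Submodule.mem_orthogonal _ _).1 hy.1 _ (Submodule.subset_span (by simp))
      constructor
      · refine cinner_zero ya ?_
        have := hAi a ⟨y, hy.2⟩
        rw [h1, inner_smul_left] at this
        rw [← this]
        have : ⟪b, (⟨y, hy.2⟩ : E)⟫_ℝ = 0 := yb
        rw [this, mul_zero]
      · refine cinner_zero yb ?_
        have := hAi b ⟨y, hy.2⟩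
        rw [h2, inner_smul_left] at this
        rw [← this]
        have : ⟪a, (⟨y, hy.2⟩ : E)⟫_ℝ = 0 := ya
        rw [this, mul_zero]

/-- hermitian orthonormal lists -/
def ON (l : List V) : Prop := (∀ x ∈ l, ‖x‖ = 1) ∧ l.Pairwise (fun x y => ⟪x, y⟫_ℂ = 0)

theorem ON.perm {l l' : List V} (h : l.Perm l') (hl : ON l) : ON l' := by
  refine ⟨fun x hx => hl.1 x (h.mem_iff.2 hx), ?_⟩
  refine (h.pairwise_iff ?_).1 hl.2
  intro x y hxy
  rw [← inner_conj_symm, hxy]; simp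

theorem ON.cons {l : List V} {a : V} (hl : ON l) (ha : ‖a‖ = 1) (h : ∀ x ∈ l, ⟪a, x⟫_ℂ = 0) : ON (a :: l) := by
  refine ⟨?_, List.pairwise_cons.2 ⟨h, hl.2⟩⟩
  intro x hx
  rcases List.mem_cons.1 hx with rfl | hx
  exacts [ha, hl.1 x hx]

/-- the list of vectors of a configuration -/
def cf (zs rs : List V) : List V := zs ++ (zs.map (fun x => Complex.I • x) ++ rs)

theorem cf_length (zs rs : List V) : (cf zs rs).length = 2 * zs.length + rs.length := by
  simp [cf]; omega

theorem cf_cons_left (a : V) (zs rs : List V) : (cf (a :: zs) rs).Perm (a :: (Complex.I • a) :: cf zs rs) := by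
  unfold cf
  simp only [List.map_cons, List.cons_append]
  exact List.Perm.cons _ List.perm_middle

theorem cf_cons_right (a : V) (zs rs : List V) : (cf zs (a :: rs)).Perm (a :: cf zs rs) := by
  unfold cf
  rw [← List.append_assoc, ← List.append_assoc]
  exact List.perm_middle

theorem cf_fix (G : V ≃ₗᵢ[ℂ] V) (zs rs : List V) (h : ∀ x ∈ zs ++ rs, G x = x) : ∀ x ∈ cf zs rs, rl G x = x := by
  intro x hx
  simp only [cf, List.mem_append, List.mem_map] at hx
  rw [rl_apply]
  rcases hx with hx | ⟨y, hy, rfl⟩ | hx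
  · exact h x (by simp [hx])
  · rw [map_smul, h y (by simp [hy])]
  · exact h x (by simp [hx])

theorem upper_ind {μ : ConvexBody V → ℂ} {k : ℕ} (hv : IsVal μ) (hk : IsHom k μ) (hinv : ∀ g : V ≃ₗᵢ[ℂ] V, ∀ K, μ (cmap (rl g) K) = μ K)
    (H : ∀ zs rs : List V, ON (zs ++ rs) → 2 * zs.length + rs.length = k → Dl (cf zs rs) μ 0 = 0) (m : ℕ) :
    ∀ zs rs : List V, ON (zs ++ rs) → 2 * zs.length + rs.length + m = k → ∀ E : Submodule ℝ V, Module.finrank ℝ E = m →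
      (∀ x ∈ zs ++ rs, ∀ y ∈ E, ⟪x, y⟫_ℂ = 0) → ∀ v : Fin m → V, (∀ i, v i ∈ E) → Fk (Dl (cf zs rs) μ) v = 0 := by
  induction m using Nat.strong_induction_on with
  | _ m ih =>
  intro zs rs hon hlen E hE hort v hvE
  have hhom : ∀ (j : ℕ) (l : List V), j + l.length = k → IsHom j (Dl l μ) := fun j l hj => IsHom.Dl hv l hk hj
  have hη : IsHom m (Dl (cf zs rs) μ) := hhom m _ (by rw [cf_length]; omega)
  have hort' : ∀ x ∈ zs ++ rs, ∀ y ∈ E, ⟪y, x⟫_ℂ = 0 := by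
    intro x hx y hy; rw [← inner_conj_symm, hort x hx y hy]; simp
  obtain _ | m := m
  · have := H zs rs hon (by omega)
    rw [Fk]; simpa using this
  rcases decomp E m hE with ⟨a, haE, ha, F, hF, hFm, hEF, hFa⟩ | ⟨a, haE, b, hbE, ha, hb, hre, him, F, hF, hFm, hEF, hFa⟩
  · obtain ⟨w, hw⟩ : ∃ w : Fin m → V, Submodule.span ℝ (range w) = F := by
      let B := Module.finBasisOfFinrankEq ℝ F hFm
      refine ⟨fun i => B i, ?_⟩
      have := congrArg (Submodule.map F.subtype) B.span_eq
      rw [Submodule.map_span, ← range_comp] at this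
      simp at this; exact this
    refine Fk_zero_of_span (hv.Dl _) hη (by simp) v (Fin.cons a w) ?_ ?_
    · intro i
      rw [Fin.range_cons, ← union_singleton, Submodule.span_union, hw, sup_comm]
      exact hEF (hvE i)
    · rw [← Fk_cons (hv.Dl _) hη, ← Dl_cons, ← Dl_perm (cf_cons_right a zs rs)]
      have hp : (zs ++ a :: rs).Perm (a :: (zs ++ rs)) := List.perm_middle
      refine ih m (by omega) zs (a :: rs) (ON.perm hp.symm (hon.cons ha fun x hx => hort' x hx a haE)) (by simp; omega) F hFm ?_ w ?_
      · intro x hx y hy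
        rcases List.mem_cons.1 (hp.mem_iff.1 hx) with rfl | hx
        · exact hFa y hy
        · exact hort x hx y (hF hy)
      · intro i; rw [← hw]; exact Submodule.subset_span ⟨i, rfl⟩
  · obtain ⟨m, rfl⟩ : ∃ m', m = m' + 1 := ⟨m - 1, by omega⟩
    have hFm : Module.finrank ℝ F = m := by omega
    obtain ⟨w, hw⟩ : ∃ w : Fin m → V, Submodule.span ℝ (range w) = F := by
      let B := Module.finBasisOfFinrankEq ℝ F hFm
      refine ⟨fun i => B i, ?_⟩
      have := congrArg (Submodule.map F.subtype) B.span_eq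
      rw [Submodule.map_span, ← range_comp] at this
      simp at this; exact this
    have hwF : ∀ i, w i ∈ F := by intro i; rw [← hw]; exact Submodule.subset_span ⟨i, rfl⟩
    refine Fk_zero_of_span (hv.Dl _) hη (by simp) v (Fin.cons a (Fin.cons b w)) ?_ ?_
    · intro i
      rw [Fin.range_cons, Fin.range_cons, insert_eq, insert_eq b, ← union_assoc, ← insert_eq, Submodule.span_union, hw]
      exact hEF (hvE i)
    set η := Dl (List.ofFn w ++ cf zs rs) μ with hηdef
    have hη2 : IsHom 2 η := hhom 2 _ (by rw [List.length_append, List.length_ofFn, cf_length]; omega)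
    have hηv : IsVal η := hv.Dl _
    have conv : ∀ (x y : V) (l : List V), l.Perm (x :: y :: cf zs rs) → Dl [x, y] η 0 = Fk (Dl l μ) w := by
      intro x y l hl
      rw [hηdef, Fk_ofFn (hv.Dl _) (hhom m _ (by rw [hl.length_eq]; simp [cf_length]; omega)), ← Dl_append, ← Dl_append]
      refine congrFun (Dl_perm ?_ μ) 0
      have h1 : (List.ofFn w ++ l).Perm (List.ofFn w ++ ([x, y] ++ cf zs rs)) := List.Perm.append_left _ hl
      refine List.Perm.trans ?_ h1.symm
      rw [← List.append_assoc, ← List.append_assoc]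
      exact List.Perm.append_right _ List.perm_append_comm
    have hwhole : Fk (Dl (cf zs rs) μ) (Fin.cons a (Fin.cons b w) : Fin (m + 2) → V) = Dl [a, b] η 0 := by
      rw [← Fk_cons (hv.Dl _) hη, ← Fk_cons ((hv.Dl _).Dv _) (IsHom.Dv (hv.Dl _) hη _), conv a b (b :: a :: cf zs rs) (List.Perm.swap _ _ _)]
      rfl
    -- the complex line case
    have hz : Dl [a, Complex.I • a] η 0 = 0 := by
      rw [conv _ _ _ (cf_cons_left a zs rs)]
      refine ih m (by omega) (a :: zs) rs (hon.cons ha fun x hx => hort' x hx a haE) (by simp; omega) F hFm ?_ w hwF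
      intro x hx y hy
      rcases List.mem_cons.1 hx with rfl | hx
      · exact (hFa y hy).1
      · exact hort x hx y (hF hy)
    rw [hwhole]
    set c := (⟪a, b⟫_ℂ).im with hc
    have hab : ⟪a, b⟫_ℂ = c * Complex.I := by
      apply Complex.ext <;> simp [hre, hc]
    set r := b - (c : ℂ) • Complex.I • a with hr
    have haa : ⟪a, a⟫_ℂ = 1 := by rw [inner_self_eq_norm_sq_to_K, ha]; simp
    have har : ⟪a, r⟫_ℂ = 0 := by
      rw [hr, inner_sub_right, inner_smul_right, inner_smul_right, hab, haa]; ring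
    have hbr : b = (c : ℂ) • Complex.I • a + r := by rw [hr]; abel
    have hnb : c ^ 2 + ‖r‖ ^ 2 = 1 := by
      have : ‖b‖ ^ 2 = 1 := by rw [hb]; simp
      rw [hbr, norm_add_sq (𝕜 := ℂ), smul_smul, inner_smul_left, har, norm_smul, ha] at this
      simpa using this
    by_cases hr0 : ‖r‖ = 0
    · have hc1 : c = 1 := by rw [hr0] at hnb; nlinarith
      have : b = Complex.I • a := by rw [hbr, norm_eq_zero.1 hr0, hc1]; simp
      rw [this, hz]
    set a' := ((‖r‖⁻¹ : ℝ) : ℂ) • r with ha'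
    have hna' : ‖a'‖ = 1 := by rw [ha', norm_smul]; simp [hr0]
    have haa' : ⟪a, a'⟫_ℂ = 0 := by rw [ha', inner_smul_right, har, mul_zero]
    have hra : r = (‖r‖ : ℂ) • a' := by
      rw [ha', smul_smul, ← Complex.ofReal_mul, mul_inv_cancel₀ hr0]; simp
    have ha'y : ∀ y, ⟪a, y⟫_ℂ = 0 → ⟪b, y⟫_ℂ = 0 → ⟪a', y⟫_ℂ = 0 := by
      intro y h1 h2
      rw [ha', inner_smul_left, hr, inner_sub_left, smul_smul, inner_smul_left, h1, h2]; simp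
    have ha'x : ∀ x ∈ zs ++ rs, ⟪a', x⟫_ℂ = 0 := fun x hx => ha'y x (hort' x hx a haE) (hort' x hx b hbE)
    have hpl := planeC hηv hη2 ha hna' haa' (by
      intro G hG K
      refine Dl_inv (rl G) (hinv G) _ ?_ K
      intro x hx
      rcases List.mem_append.1 hx with hx | hx
      · obtain ⟨i, rfl⟩ := (List.mem_ofFn' w x).1 hx
        exact hG _ (hFa _ (hwF i)).1 (ha'y _ (hFa _ (hwF i)).1 (hFa _ (hwF i)).2)
      · exact cf_fix G zs rs (fun x hx => hG x (hort' x hx a haE) (ha'x x hx)) x hx) hnb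
    rw [← hra, ← hbr, hz] at hpl
    rw [hpl]
    have hl : (cf zs (a :: a' :: rs)).Perm (a :: a' :: cf zs rs) := (cf_cons_right a zs _).trans ((cf_cons_right a' zs rs).cons a)
    rw [conv _ _ _ hl]
    have hp : (zs ++ a :: a' :: rs).Perm (a :: a' :: (zs ++ rs)) := List.perm_middle.trans (List.perm_middle.cons a)
    rw [ih m (by omega) zs (a :: a' :: rs) (ON.perm hp.symm ((hon.cons hna' ha'x).cons ha ?_)) (by simp; omega) F hFm ?_ w hwF]
    · simp
    · intro x hx
      rcases List.mem_cons.1 hx with rfl | hx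
      · exact haa'
      · exact hort' x hx a haE
    · intro x hx y hy
      have hx' := hp.mem_iff.1 hx
      simp only [List.mem_cons] at hx'
      rcases hx' with rfl | rfl | hx
      · exact (hFa y hy).1
      · exact ha'y y (hFa y hy).1 (hFa y hy).2
      · exact hort x hx y (hF hy)

theorem upper {μ : ConvexBody V → ℂ} {k : ℕ} (hv : IsVal μ) (hk : IsHom k μ) (hinv : ∀ g : V ≃ₗᵢ[ℂ] V, ∀ K, μ (cmap (rl g) K) = μ K)
    (H : ∀ zs rs : List V, ON (zs ++ rs) → 2 * zs.length + rs.length = k → Dl (cf zs rs) μ 0 = 0) (K : ConvexBody V) : μ K = 0 := by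
  refine klain k V μ hv hk ?_ ?_ K
  · intro K
    have := hinv (LinearIsometryEquiv.neg ℂ) K
    rw [smul_eq_cmap, ← this]
    congr 2
    ext1 x
    simp
  · intro v
    by_cases hli : LinearIndependent ℝ v
    · have := upper_ind hv hk hinv H k [] [] (by simp [ON]) (by simp) (Submodule.span ℝ (range v)) (by rw [finrank_span_eq_card hli]; simp)
        (by simp) v (fun i => Submodule.subset_span ⟨i, rfl⟩)
      exact this
    · exact Fk_zero_of_dep hv hk (by simp) v hli
end Cplx
end UV
end

noncomputable section
namespace UV
open Filter Topology
open scoped InnerProductSpace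

section DlMore
variable {V : Type*} [NormedAddCommGroup V] [NormedSpace ℝ V]

theorem Dl_pair {η : ConvexBody V → ℂ} (h : IsVal η) (hk : IsHom 2 η) (x y : V) : Dl [x, y] η 0 = Fk η ![x, y] := by
  rw [Fk_ofFn h hk]; rfl

theorem Dl_shear2 {η : ConvexBody V → ℂ} (h : IsVal η) (hk : IsHom 2 η) (x y : V) (c : ℝ) :
    Dl [x + c • y, y] η 0 = Dl [x, y] η 0 := by
  rw [Dl_pair h hk, Dl_pair h hk, ← Fk_shear h hk (by simp) ![x, y] (i := 0) (j := 1) (by decide) c]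
  congr 1
  funext i; fin_cases i <;> simp

theorem Dl_smul2 {η : ConvexBody V → ℂ} (h : IsVal η) (hk : IsHom 2 η) (x y : V) (c : ℝ) :
    Dl [c • x, y] η 0 = |c| * Dl [x, y] η 0 := by
  have := Fk_smul h hk (by simp) ![x, y] 0 c x
  rw [Dl_pair h hk, Dl_pair h hk]
  convert this using 2
  · funext i; fin_cases i <;> simp
  · congr 1; funext i; fin_cases i <;> simp

theorem Dl_shear {μ : ConvexBody V → ℂ} (h : IsVal μ) (l : List V) (hk : IsHom (l.length + 1) μ) {w : V}
    (hw : w ∈ Submodule.span ℝ {a | a ∈ l}) : ∀ x, Dl ((x + w) :: l) μ 0 = Dl (x :: l) μ 0 := by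
  have : ∀ (c : ℝ) x, Dl ((x + c • w) :: l) μ 0 = Dl (x :: l) μ 0 := by
    induction hw using Submodule.span_induction with
    | mem a ha =>
      intro c x
      classical
      have hp : l.Perm (a :: l.erase a) := List.perm_cons_erase ha
      have hlen : l.length = (l.erase a).length + 1 := by rw [hp.length_eq]; simp
      have key : ∀ y, Dl (y :: l) μ 0 = Dl [y, a] (Dl (l.erase a) μ) 0 := by
        intro y
        rw [Dl_perm (hp.cons y) μ]; rfl
      rw [key, key]
      exact Dl_shear2 (h.Dl _) (IsHom.Dl h (l.erase a) hk (by omega)) x a c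
    | zero => intro c x; simp
    | add y z _ _ hy hz => intro c x; rw [smul_add, ← add_assoc, hz, hy]
    | smul a y _ hy => intro c x; rw [smul_smul, hy]
  intro x
  simpa using this 1 x

theorem Dl_span_zero {μ : ConvexBody V → ℂ} (h : IsVal μ) (l : List V) (hk : IsHom (l.length + 1) μ) {w : V}
    (hw : w ∈ Submodule.span ℝ {a | a ∈ l}) : Dl (w :: l) μ 0 = 0 := by
  have := Dl_shear h l hk hw 0
  rw [zero_add] at this
  rw [this, Dl_cons, Dv, seg_zero, add_zero, sub_self]

theorem Dl_dep_zero {μ : ConvexBody V → ℂ} (h : IsVal μ) (l : List V) (hk : IsHom l.length μ) 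
    (hw : ¬ LinearIndependent ℝ l.get) : Dl l μ 0 = 0 := by
  have e : l = List.ofFn l.get := (List.ofFn_get l).symm
  rw [e, ← Fk_ofFn h hk]
  exact Fk_zero_of_dep h hk (by simp) _ hw
end DlMore

section Vol
variable {E : Type*} [NormedAddCommGroup E] [InnerProductSpace ℝ E] [FiniteDimensional ℝ E] [MeasurableSpace E] [BorelSpace E]

/-- Haar volume -/
def vlr (K : ConvexBody E) : ℝ := ((Measure.addHaar : Measure E) (K : Set E)).toReal

/-- complex valued Haar volume -/
def vl (K : ConvexBody E) : ℂ := (vlr K : ℂ)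

theorem mem_of_ball {K L : ConvexBody E} {x : E} {ρ : ℝ} (hρ : closedBall x ρ ⊆ (K : Set E)) (hd : dist K L < ρ) : x ∈ L := by
  obtain ⟨p, hp, h1⟩ := exists_sep L x
  by_contra hx
  have hw : x - p ≠ 0 := by intro h; rw [sub_eq_zero.1 h] at hx; exact hx hp
  set w := x - p with hwd
  have hn : 0 < ‖w‖ := norm_pos_iff.2 hw
  have hρ0 : 0 ≤ ρ := dist_nonneg.trans hd.le
  have hm : x + (ρ * ‖w‖⁻¹) • w ∈ K := by
    apply hρ
    rw [mem_closedBall, dist_eq_norm, add_sub_cancel_left, norm_smul, norm_mul, norm_inv, norm_norm, mul_assoc, inv_mul_cancel₀ hn.ne', mul_one,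
      Real.norm_of_nonneg hρ0]
  obtain ⟨y, hy, hyd⟩ := exists_dist_le K L hm
  have h2 := le_supp hy w
  rw [h1] at h2
  have h3 : ⟪w, x + (ρ * ‖w‖⁻¹) • w - y⟫_ℝ ≤ ‖w‖ * dist K L := by
    refine (real_inner_le_norm _ _).trans ?_
    gcongr
    rwa [← dist_eq_norm]
  rw [inner_sub_right, inner_add_right, inner_smul_right, real_inner_self_eq_norm_sq] at h3
  have h4 : ⟪w, x⟫_ℝ - ⟪w, p⟫_ℝ = ‖w‖ ^ 2 := by rw [← inner_sub_right, ← hwd, real_inner_self_eq_norm_sq]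
  have h5 : ρ * ‖w‖⁻¹ * ‖w‖ ^ 2 = ρ * ‖w‖ := by field_simp
  rw [h5] at h3
  nlinarith

theorem continuous_vlr : Continuous (vlr : ConvexBody E → ℝ) := by
  rw [continuous_iff_continuousAt]
  intro K
  unfold ContinuousAt vlr
  refine (ENNReal.tendsto_toReal K.isCompact.measure_ne_top).comp ?_
  have hB : ∀ᶠ L : ConvexBody E in 𝓝 K, (L : Set E) ⊆ cthickening 1 (K : Set E) := by
    filter_upwards [Metric.ball_mem_nhds K one_pos] with L hL x hx
    obtain ⟨y, hy, hd⟩ := exists_dist_le L K hx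
    exact mem_cthickening_of_dist_le x y 1 _ hy (hd.trans (le_of_lt hL))
  refine tendsto_measure_of_ae_tendsto_indicator (As := fun L : ConvexBody E => (L : Set E)) (𝓝 K) K.isClosed.measurableSet (fun L => L.isClosed.measurableSet)
    (B := cthickening 1 (K : Set E)) isClosed_cthickening.measurableSet (K.isCompact.cthickening).measure_ne_top hB ?_
  have hf : ∀ᵐ x ∂(Measure.addHaar : Measure E), x ∉ frontier (K : Set E) := measure_eq_zero_iff_ae_notMem.1 (K.convex.addHaar_frontier _)
  filter_upwards [hf] with x hx
  by_cases hxK : x ∈ (K : Set E)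
  · have hi : x ∈ interior (K : Set E) := by
      by_contra h
      exact hx ⟨subset_closure hxK, h⟩
    obtain ⟨ρ, hρ, hb⟩ := Metric.nhds_basis_closedBall.mem_iff.1 (mem_interior_iff_mem_nhds.1 hi)
    filter_upwards [Metric.ball_mem_nhds K hρ] with L hL
    exact iff_of_true (mem_of_ball hb (by rw [dist_comm]; exact hL)) hxK
  · have hi : (K : Set E)ᶜ ∈ 𝓝 x := K.isClosed.isOpen_compl.mem_nhds hxK
    obtain ⟨ρ, hρ, hb⟩ := Metric.nhds_basis_closedBall.mem_iff.1 hi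
    filter_upwards [Metric.ball_mem_nhds K hρ] with L hL
    refine iff_of_false ?_ hxK
    intro hxL
    obtain ⟨y, hy, hd⟩ := exists_dist_le L K hxL
    exact hb (mem_closedBall.2 (by rw [dist_comm]; exact hd.trans (le_of_lt hL))) hy

theorem vlr_nonneg (K : ConvexBody E) : 0 ≤ vlr K := ENNReal.toReal_nonneg

theorem vlr_cmap (f : E →L[ℝ] E) (K : ConvexBody E) : vlr (cmap f K) = |LinearMap.det (f : E →ₗ[ℝ] E)| * vlr K := by
  unfold vlr
  have := Measure.addHaar_image_linearMap (Measure.addHaar : Measure E) (f : E →ₗ[ℝ] E) (K : Set E)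
  rw [coe_cmap]
  have e : f '' (K : Set E) = (f : E →ₗ[ℝ] E) '' (K : Set E) := rfl
  rw [e, this, ENNReal.toReal_mul, ENNReal.toReal_ofReal (abs_nonneg _)]

theorem vl_isVal : IsVal (vl : ConvexBody E → ℂ) := by
  refine ⟨?_, Complex.continuous_ofReal.comp continuous_vlr, ?_⟩
  · intro K L M N hM hN
    unfold vl vlr
    rw [hM, hN]
    have := measure_union_add_inter (μ := (Measure.addHaar : Measure E)) (K : Set E) L.isClosed.measurableSet
    have h2 := congrArg ENNReal.toReal this
    rw [ENNReal.toReal_add, ENNReal.toReal_add] at h2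
    · exact_mod_cast h2
    · exact K.isCompact.measure_ne_top
    · exact L.isCompact.measure_ne_top
    · rw [← hM]; exact M.isCompact.measure_ne_top
    · rw [← hN]; exact N.isCompact.measure_ne_top
  · intro x K
    unfold vl vlr
    congr 2
    have : ((K + pt x : ConvexBody E) : Set E) = (fun y => y + x) '' (K : Set E) := by
      rw [ConvexBody.coe_add]
      show (K : Set E) + {x} = _
      rw [add_singleton]
    rw [this, image_add_right, measure_preimage_add_right]

theorem vl_isHom : IsHom (Module.finrank ℝ E) (vl : ConvexBody E → ℂ) := by
  intro t ht K
  unfold vl vlr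
  rw [ConvexBody.coe_smul, Measure.addHaar_smul_of_nonneg _ ht, ENNReal.toReal_mul, ENNReal.toReal_ofReal (by positivity)]
  push_cast; rfl

theorem vl_isom (f : E ≃ₗᵢ[ℝ] E) (K : ConvexBody E) : vl (cmap (f.toContinuousLinearEquiv : E →L[ℝ] E) K) = vl K := by
  unfold vl
  rw [vlr_cmap]
  have : |LinearMap.det ((f.toContinuousLinearEquiv : E →L[ℝ] E) : E →ₗ[ℝ] E)| = 1 := by
    have h := Measure.addHaar_image_linearMap (Measure.addHaar : Measure E) ((f.toContinuousLinearEquiv : E →L[ℝ] E) : E →ₗ[ℝ] E) (closedBall 0 1)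
    have e : ((f.toContinuousLinearEquiv : E →L[ℝ] E) : E →ₗ[ℝ] E) '' closedBall 0 1 = closedBall 0 1 := by
      have := f.image_closedBall 0 1
      rw [map_zero] at this
      exact this
    rw [e] at h
    have h0 : (Measure.addHaar : Measure E) (closedBall 0 1) ≠ 0 := (measure_closedBall_pos _ _ one_pos).ne'
    have h1 : (Measure.addHaar : Measure E) (closedBall 0 1) ≠ ⊤ := (isCompact_closedBall _ _).measure_ne_top
    have h2 := congrArg ENNReal.toReal h
    rw [ENNReal.toReal_mul, ENNReal.toReal_ofReal (abs_nonneg _)] at h2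
    have h3 := ENNReal.toReal_pos h0 h1
    exact mul_right_cancel₀ h3.ne' (by rw [← h2, one_mul])
  rw [this, one_mul]

theorem vl_bound {K : ConvexBody E} {R : ℝ} (hR : 0 ≤ R) (h : ∀ x ∈ K, ‖x‖ ≤ R) :
    vlr K ≤ R ^ (Module.finrank ℝ E) * ((Measure.addHaar : Measure E) (closedBall 0 1)).toReal := by
  have : (K : Set E) ⊆ closedBall 0 R := fun x hx => by simpa using h x hx
  unfold vlr
  rw [← ENNReal.toReal_ofReal (show 0 ≤ R ^ (Module.finrank ℝ E) by positivity), ← ENNReal.toReal_mul]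
  refine ENNReal.toReal_mono (ENNReal.mul_ne_top (by simp) (isCompact_closedBall _ _).measure_ne_top) ?_
  refine (measure_mono this).trans ?_
  rw [Measure.addHaar_closedBall' _ _ hR]

theorem vlr_pos (v : Module.Basis (Fin (Module.finrank ℝ E)) ℝ E) : 0 < vlr (∑ i, seg (v i)) := by
  unfold vlr
  refine ENNReal.toReal_pos ?_ (ConvexBody.isCompact _).measure_ne_top
  have h : ((∑ i, seg (v i) : ConvexBody E) : Set E) = v.parallelepiped := by
    rw [Module.Basis.coe_parallelepiped, parallelepiped_eq_sum_segment]
    have : ∀ s : Finset (Fin (Module.finrank ℝ E)), ((∑ i ∈ s, seg (v i) : ConvexBody E) : Set E) = ∑ i ∈ s, segment ℝ 0 (v i) := by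
      intro s
      induction s using Finset.cons_induction with
      | empty => simp
      | cons a s ha ih => rw [Finset.sum_cons, Finset.sum_cons, ConvexBody.coe_add, ih]; rfl
    exact this _
  rw [h]
  exact (Measure.measure_pos_of_nonempty_interior _ v.parallelepiped.interior_nonempty).ne'
end Vol
end UV
end

noncomputable section
namespace UV
open Filter Topology
open scoped InnerProductSpace
open ProbabilityTheory

section Dens
variable {d : ℕ}

/-- normalizing constant -/
def gZ (d : ℕ) : ℝ := ∫ x : EuclideanSpace ℝ (Fin d), Real.exp (-(1/2) * ‖x‖ ^ 2)

theorem gZ_int (d : ℕ) : Integrable (fun x : EuclideanSpace ℝ (Fin d) => Real.exp (-(1/2) * ‖x‖ ^ 2)) := by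
  have h := (GaussianFourier.integrable_cexp_neg_mul_sq_norm_add (V := EuclideanSpace ℝ (Fin d)) (b := 1/2) (by norm_num) 0 0).re
  refine h.congr (ae_of_all _ fun x => ?_)
  show RCLike.re (Complex.exp (-(1/2) * (‖x‖ : ℂ) ^ 2 + 0 * _)) = _
  have e : (-(1/2) * (‖x‖ : ℂ) ^ 2 + 0 * ((⟪(0 : EuclideanSpace ℝ (Fin d)), x⟫_ℝ : ℝ) : ℂ)) = ((-(1/2) * ‖x‖ ^ 2 : ℝ) : ℂ) := by push_cast; ring
  rw [e, ← Complex.ofReal_exp]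
  exact Complex.ofReal_re _

theorem gZ_eq : gZ d = (Real.pi / (1/2)) ^ ((Module.finrank ℝ (EuclideanSpace ℝ (Fin d)) : ℝ) / 2) := by
  unfold gZ
  rw [GaussianFourier.integral_rexp_neg_mul_sq_norm (by norm_num)]

theorem gZ_pos : 0 < gZ d := by
  rw [gZ_eq]; have := Real.pi_pos; positivity

/-- Gaussian density -/
def gd (x : EuclideanSpace ℝ (Fin d)) : ℝ := (gZ d)⁻¹ * Real.exp (-(1/2) * ‖x‖ ^ 2)

theorem gd_pos (x : EuclideanSpace ℝ (Fin d)) : 0 < gd x := mul_pos (inv_pos.2 gZ_pos) (Real.exp_pos _)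

theorem gd_cont : Continuous (gd (d := d)) := by unfold gd; fun_prop

theorem gauss_dens : stdGaussian (EuclideanSpace ℝ (Fin d)) = volume.withDensity (fun x => ENNReal.ofReal (gd x)) := by
  have hIntegr : Integrable (gd (d := d)) := (gZ_int d).const_mul _
  haveI : IsFiniteMeasure (volume.withDensity (fun x : EuclideanSpace ℝ (Fin d) => ENNReal.ofReal (gd x))) :=
    isFiniteMeasure_withDensity_ofReal hIntegr.2
  apply Measure.ext_of_charFun
  ext t
  rw [charFun_stdGaussian, charFun_apply, integral_withDensity_eq_integral_toReal_smul (by have := gd_cont (d := d); fun_prop) (by simp)]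
  have e : ∀ x : EuclideanSpace ℝ (Fin d), (ENNReal.ofReal (gd x)).toReal • Complex.exp (⟪x, t⟫_ℝ * Complex.I) =
      ((gZ d)⁻¹ : ℂ) * Complex.exp (-(1/2 : ℂ) * (‖x‖ : ℂ) ^ 2 + Complex.I * ⟪t, x⟫_ℝ) := by
    intro x
    rw [ENNReal.toReal_ofReal (gd_pos x).le, Complex.exp_add, gd, Complex.real_smul, real_inner_comm, mul_comm Complex.I]
    push_cast; ring
  simp_rw [e]
  rw [integral_const_mul, GaussianFourier.integral_cexp_neg_mul_sq_norm_add (by norm_num), gZ_eq, ← mul_assoc]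
  have e2 : ((((Real.pi / (1/2)) ^ ((Module.finrank ℝ (EuclideanSpace ℝ (Fin d)) : ℝ) / 2) : ℝ) : ℂ))  = ((Real.pi : ℂ) / (1/2)) ^ ((Module.finrank ℝ (EuclideanSpace ℝ (Fin d)) : ℂ) / 2) := by
    rw [Complex.ofReal_cpow (by have := Real.pi_pos; positivity)]
    push_cast; rfl
  rw [← e2, inv_mul_cancel₀, one_mul]
  · congr 1
    rw [Complex.I_sq]; ring
  · have := gZ_pos (d := d); rw [gZ_eq] at this
    exact_mod_cast this.ne'

/-- radial moments -/
def gJ (a : ℝ) : ℝ := ∫ y in Ioi (0:ℝ), y ^ a * Real.exp (-(1/2) * y ^ (2:ℝ))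

theorem gJ_eq {a : ℝ} (ha : -1 < a) : gJ a = (1/2) ^ (-(a + 1) / 2) * (1 / 2) * Real.Gamma ((a + 1) / 2) := 
  integral_rpow_mul_exp_neg_mul_rpow (by norm_num) ha (by norm_num)

theorem gJ_pos {a : ℝ} (ha : -1 < a) : 0 < gJ a := by
  rw [gJ_eq ha]
  have := Real.Gamma_pos_of_pos (show 0 < (a+1)/2 by linarith)
  positivity

theorem gJ_rec {a : ℝ} (ha : -1 < a) : gJ (a + 2) = (a + 1) * gJ a := by
  rw [gJ_eq ha, gJ_eq (by linarith)]
  rw [show (a + 2 + 1) / 2 = (a + 1) / 2 + 1 by ring, Real.Gamma_add_one (by linarith), show -(a + 2 + 1) / 2 = -(a+1)/2 + (-1) by ring,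
    Real.rpow_add (by norm_num), Real.rpow_neg_one]
  ring

theorem gauss_moment' (hd : 1 ≤ d) (p : ℕ) : ∫ x, ‖x‖ ^ p ∂(stdGaussian (EuclideanSpace ℝ (Fin d))) = gJ ((d:ℝ) - 1 + p) / gJ ((d:ℝ) - 1) := by
  haveI : Nontrivial (EuclideanSpace ℝ (Fin d)) := by
    haveI : Nonempty (Fin d) := ⟨⟨0, hd⟩⟩
    infer_instance
  have key : ∀ q : ℕ, ∫ x : EuclideanSpace ℝ (Fin d), ‖x‖ ^ q * Real.exp (-(1/2) * ‖x‖^2) = 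
      d • (volume.real (ball (0 : EuclideanSpace ℝ (Fin d)) 1)) • gJ ((d:ℝ) - 1 + q) := by
    intro q
    have := integral_fun_norm_addHaar (volume : Measure (EuclideanSpace ℝ (Fin d))) (fun r : ℝ => r ^ q * Real.exp (-(1/2) * r^2))
    rw [this]
    simp only [finrank_euclideanSpace, Fintype.card_fin]
    congr 2
    unfold gJ
    refine setIntegral_congr_fun measurableSet_Ioi fun y hy => ?_
    have hy : 0 < y := hy
    show y ^ (d - 1) • (y ^ q * _) = _
    rw [smul_eq_mul, ← mul_assoc, ← pow_add, ← Real.rpow_natCast, ← Real.rpow_natCast y 2]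
    push_cast [Nat.cast_sub hd]
    rfl
  rw [gauss_dens, integral_withDensity_eq_integral_toReal_smul (by have := gd_cont (d := d); fun_prop) (by simp)]
  have e : ∀ x : EuclideanSpace ℝ (Fin d), (ENNReal.ofReal (gd x)).toReal • ‖x‖ ^ p = (gZ d)⁻¹ * (‖x‖ ^ p * Real.exp (-(1/2) * ‖x‖^2)) := by
    intro x
    rw [ENNReal.toReal_ofReal (gd_pos x).le, gd, smul_eq_mul]; ring
  simp_rw [e]
  rw [integral_const_mul, key]
  have h0 := key 0
  simp only [pow_zero, one_mul, Nat.cast_zero, add_zero] at h0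
  have h1 : gZ d = _ := h0
  have h2 := gZ_pos (d := d)
  rw [h1] at h2 ⊢
  have h3 := gJ_pos (a := (d:ℝ) - 1) (by have : (1:ℝ) ≤ d := by exact_mod_cast hd
                                         linarith)
  simp only [nsmul_eq_mul, smul_eq_mul] at h2 ⊢
  have h4 : (d:ℝ) ≠ 0 := by positivity
  have h5 : volume.real (ball (0 : EuclideanSpace ℝ (Fin d)) 1) ≠ 0 := by
    intro h; rw [h] at h2; simp at h2
  field_simp
end Dens

section Gen
variable {E : Type*} [NormedAddCommGroup E] [InnerProductSpace ℝ E] [FiniteDimensional ℝ E] [MeasurableSpace E] [BorelSpace E]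

theorem gauss_repr : (stdGaussian E).map (stdOrthonormalBasis ℝ E).repr = stdGaussian (EuclideanSpace ℝ (Fin (Module.finrank ℝ E))) :=
  stdGaussian_map _

theorem gauss_moment (hd : 1 ≤ Module.finrank ℝ E) (p : ℕ) : ∫ x, ‖x‖ ^ p ∂(stdGaussian E) = 
    gJ ((Module.finrank ℝ E :ℝ) - 1 + p) / gJ ((Module.finrank ℝ E :ℝ) - 1) := by
  rw [← gauss_moment' hd, ← gauss_repr (E := E), integral_map]
  · simp
  · exact (LinearIsometryEquiv.continuous _).measurable.aemeasurable
  · fun_prop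

theorem gauss_pow_int (p : ℕ) : Integrable (fun x : E => ‖x‖ ^ p) (stdGaussian E) := by
  have := (IsGaussian.memLp_id (stdGaussian E) (p : ℝ≥0∞) (by simp)).integrable_norm_pow'
  simpa using this

theorem gauss_lint (p : ℕ) : ∫⁻ x, ENNReal.ofReal (‖x‖ ^ p) ∂(stdGaussian E) = ENNReal.ofReal (∫ x, ‖x‖ ^ p ∂(stdGaussian E)) := 
  (ofReal_integral_eq_lintegral_ofReal (gauss_pow_int p) (ae_of_all _ fun x => by positivity)).symm

theorem gauss_sq (hd : 1 ≤ Module.finrank ℝ E) : ∫⁻ x, ENNReal.ofReal (‖x‖ ^ 2) ∂(stdGaussian E) = (Module.finrank ℝ E : ℝ≥0∞) := by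
  have h1 : (1:ℝ) ≤ Module.finrank ℝ E := by exact_mod_cast hd
  rw [gauss_lint, gauss_moment hd]
  push_cast
  rw [gJ_rec (by linarith), mul_div_assoc, div_self (gJ_pos (by linarith)).ne']
  simp

theorem gauss_one_mul {F : Type*} [NormedAddCommGroup F] [InnerProductSpace ℝ F] [FiniteDimensional ℝ F] [MeasurableSpace F] [BorelSpace F]
    (hd : 1 ≤ Module.finrank ℝ F) (hE : Module.finrank ℝ E = Module.finrank ℝ F + 1) :
    (∫⁻ x, ENNReal.ofReal ‖x‖ ∂(stdGaussian E)) * (∫⁻ x, ENNReal.ofReal ‖x‖ ∂(stdGaussian F)) = (Module.finrank ℝ F : ℝ≥0∞) := by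
  have h1 : (1:ℝ) ≤ Module.finrank ℝ F := by exact_mod_cast hd
  have a := gauss_lint (E := E) 1
  have b := gauss_lint (E := F) 1
  rw [gauss_moment (by omega)] at a
  rw [gauss_moment (by omega)] at b
  simp only [pow_one] at a b
  rw [a, b, ← ENNReal.ofReal_mul (div_nonneg (gJ_pos (by push_cast [hE]; linarith)).le (gJ_pos (by push_cast [hE]; linarith)).le), hE]
  push_cast
  rw [show (Module.finrank ℝ F : ℝ) + 1 - 1 + 1 = (Module.finrank ℝ F : ℝ) - 1 + 2 by ring, gJ_rec (by linarith),
    show (Module.finrank ℝ F : ℝ) + 1 - 1  = (Module.finrank ℝ F : ℝ) - 1 + 1 by ring]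
  have p1 := gJ_pos (a := (Module.finrank ℝ F : ℝ) - 1) (by linarith)
  have p2 := gJ_pos (a := (Module.finrank ℝ F : ℝ) - 1 + 1) (by linarith)
  have : ((Module.finrank ℝ F : ℝ) - 1 + 1) * gJ ((Module.finrank ℝ F : ℝ) - 1) / gJ ((Module.finrank ℝ F : ℝ) - 1 + 1) *
      (gJ ((Module.finrank ℝ F : ℝ) - 1 + 1) / gJ ((Module.finrank ℝ F : ℝ) - 1)) = Module.finrank ℝ F := by
    field_simp; ring
  rw [this]; simp

instance gauss_open : (stdGaussian E).IsOpenPosMeasure := by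
  have h : (stdGaussian (EuclideanSpace ℝ (Fin (Module.finrank ℝ E)))).IsOpenPosMeasure := by
    rw [gauss_dens]
    refine Measure.AbsolutelyContinuous.isOpenPosMeasure (μ := volume) (withDensity_absolutelyContinuous' (by have := gd_cont (d := Module.finrank ℝ E); fun_prop) (ae_of_all _ fun x => ?_))
    simpa using gd_pos x
  have e := stdGaussian_map (stdOrthonormalBasis ℝ E).repr.symm
  have e2 : stdGaussian E = (stdGaussian (EuclideanSpace ℝ (Fin (Module.finrank ℝ E)))).map (stdOrthonormalBasis ℝ E).repr.symm := e.symm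
  rw [e2]
  exact Continuous.isOpenPosMeasure_map (LinearIsometryEquiv.continuous _) (LinearIsometryEquiv.surjective _)

theorem gauss_proj (T : Submodule ℝ E) : (stdGaussian E).map (T.orthogonalProjectionOnto) = stdGaussian T := by
  apply Measure.ext_of_charFun
  ext t
  rw [charFun_stdGaussian, charFun_apply, integral_map (by fun_prop) (by fun_prop)]
  have h := charFun_stdGaussian (t : E)
  rw [charFun_apply] at h
  rw [Submodule.coe_norm, ← h]
  congr 1
  funext x
  rw [Submodule.inner_orthogonalProjectionOnto_eq_of_mem_right]

theorem gauss_proj_lint (T : Submodule ℝ E) (p : ℕ) : ∫⁻ x, ENNReal.ofReal (‖T.orthogonalProjectionOnto x‖ ^ p) ∂(stdGaussian E) = ∫⁻ x, ENNReal.ofReal (‖x‖ ^ p) ∂(stdGaussian T) := by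
  rw [← gauss_proj T, lintegral_map (by fun_prop) (by fun_prop)]

/-- product Gaussian -/
abbrev gP (ι : Type*) [Fintype ι] (E : Type*) [NormedAddCommGroup E] [InnerProductSpace ℝ E] [FiniteDimensional ℝ E] [MeasurableSpace E] [BorelSpace E] : Measure (ι → E) :=
  Measure.pi (fun _ => stdGaussian E)

theorem gP_sel {ι κ : Type*} [Fintype ι] [Fintype κ] (σ : κ → ι) (hσ : Function.Injective σ) :
    (gP ι E).map (fun ω => ω ∘ σ) = gP κ E := by
  symm
  refine Measure.pi_eq fun s hs => ?_
  rw [Measure.map_apply (by fun_prop) (MeasurableSet.univ_pi hs)]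
  have e : (fun ω : ι → E => ω ∘ σ) ⁻¹' (univ.pi s) = univ.pi (Function.extend σ s (fun _ => univ)) := by
    ext ω
    simp only [mem_preimage, mem_univ_pi]
    constructor
    · intro h i
      by_cases hi : ∃ j, σ j = i
      · obtain ⟨j, rfl⟩ := hi
        rw [hσ.extend_apply]; exact h j
      · rw [Function.extend_apply' _ _ _ hi]; trivial
    · intro h j
      have := h (σ j)
      rwa [hσ.extend_apply] at this
  rw [e, Measure.pi_pi]
  symm
  refine Fintype.prod_of_injective σ hσ _ _ ?_ ?_
  · intro i hi
    rw [Function.extend_apply' _ _ _ (by simpa using hi)]; simp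
  · intro j; rw [hσ.extend_apply]

theorem gP_isom {ι : Type*} [Fintype ι] (f : E ≃ₗᵢ[ℝ] E) : (gP ι E).map (fun ω i => f (ω i)) = gP ι E := by
  unfold gP
  have := Measure.pi_map_pi (μ := fun _ : ι => stdGaussian E) (f := fun _ : ι => (f : E → E)) (fun _ => f.continuous.measurable.aemeasurable)
  rw [this]
  congr 1; funext i; exact stdGaussian_map f
end Gen
end UV
end

noncomputable section
namespace UV
open Filter Topology
open scoped InnerProductSpace
open ProbabilityTheory

section Hd
variable {E : Type*} [NormedAddCommGroup E] [InnerProductSpace ℝ E] [FiniteDimensional ℝ E] [MeasurableSpace E] [BorelSpace E]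

/-- volume of the parallelotope spanned by a list -/
def hd (l : List E) : ℝ := vlr (l.map seg).sum

theorem hd_nonneg (l : List E) : 0 ≤ hd l := vlr_nonneg _

theorem Dl_vl {l : List E} (hl : l.length = Module.finrank ℝ E) : Dl l vl 0 = (hd l : ℂ) :=
  Dl_eq_sum vl_isVal vl_isHom l hl

theorem hd_perm {l l' : List E} (h : l.Perm l') : hd l = hd l' := by
  unfold hd; rw [(h.map seg).sum_eq]

theorem hd_shear {l : List E} (hl : l.length + 1 = Module.finrank ℝ E) {w : E} (hw : w ∈ Submodule.span ℝ {a | a ∈ l}) (x : E) :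
    hd ((x + w) :: l) = hd (x :: l) := by
  have := Dl_shear vl_isVal l (by rw [hl]; exact vl_isHom) hw x
  rw [Dl_vl (by simpa using hl), Dl_vl (by simpa using hl)] at this
  exact_mod_cast this

theorem hd_smul {l : List E} {x y : E} (hl : l.length + 2 = Module.finrank ℝ E) (c : ℝ) :
    hd ((c • x) :: y :: l) = |c| * hd (x :: y :: l) := by
  have h : ∀ z, Dl (z :: y :: l) vl 0 = Dl [z, y] (Dl l vl) 0 := fun z => rfl
  have := Dl_smul2 (vl_isVal.Dl l) (IsHom.Dl vl_isVal l vl_isHom (by omega)) x y c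
  rw [← h, ← h, Dl_vl (by simpa using hl), Dl_vl (by simpa using hl)] at this
  exact_mod_cast this

theorem hd_isom (f : E ≃ₗᵢ[ℝ] E) (l : List E) : hd (l.map f) = hd l := by
  have h := vl_isom f (l.map seg).sum
  have e : cmap (f.toContinuousLinearEquiv : E →L[ℝ] E) (l.map seg).sum = ((l.map f).map seg).sum := by
    induction l with
    | nil => simp [cmap_zero]
    | cons a l ih => 
      have h2 := vl_isom f (l.map seg).sum
      simp only [List.map_cons, List.sum_cons]
      rw [cmap_add, ih h2, cmap_seg]; rfl
  rw [e] at h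
  unfold vl at h
  exact_mod_cast h

theorem hd_dep {l : List E} (hl : l.length = Module.finrank ℝ E) (h : ¬ LinearIndependent ℝ l.get) : hd l = 0 := by
  have := Dl_dep_zero vl_isVal l (by rw [hl]; exact vl_isHom) h
  rw [Dl_vl hl] at this
  exact_mod_cast this

theorem hd_cont {X : Type*} [TopologicalSpace X] (fs : List (X → E)) (h : ∀ f ∈ fs, Continuous f) : Continuous (fun x => hd (fs.map (fun f => f x))) := by
  unfold hd
  refine continuous_vlr.comp ?_
  induction fs with
  | nil => exact continuous_const
  | cons f fs ih =>
    simp only [List.map_cons, List.sum_cons]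
    exact (continuous_seg.comp (h f List.mem_cons_self)).add (ih fun g hg => h g (List.mem_cons_of_mem _ hg))

theorem norm_of_mem_sum (l : List E) : ∀ x ∈ (l.map seg).sum, ‖x‖ ≤ (l.map (fun a => ‖a‖)).sum := by
  induction l with
  | nil => 
    intro x hx
    have : x ∈ ((0 : ConvexBody E) : Set E) := hx
    rw [ConvexBody.coe_zero] at this
    simp [Set.mem_zero.1 this]
  | cons a l ih =>
    intro x hx
    simp only [List.map_cons, List.sum_cons] at hx ⊢
    obtain ⟨y, hy, z, hz, rfl⟩ := mem_add.1 hx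
    obtain ⟨t, ht, ht1, rfl⟩ := mem_seg.1 hy
    refine (norm_add_le _ _).trans (add_le_add ?_ (ih z hz))
    rw [norm_smul, Real.norm_eq_abs, abs_of_nonneg ht]
    exact mul_le_of_le_one_left (norm_nonneg _) ht1

/-- volume of unit ball -/
def vB (E : Type*) [NormedAddCommGroup E] [InnerProductSpace ℝ E] [FiniteDimensional ℝ E] [MeasurableSpace E] [BorelSpace E] : ℝ := 
  ((Measure.addHaar : Measure E) (closedBall 0 1)).toReal

theorem vB_nonneg : 0 ≤ vB E := ENNReal.toReal_nonneg

theorem hd_bound (l : List E) : hd l ≤ (l.map (fun a => ‖a‖)).sum ^ (Module.finrank ℝ E) * vB E :=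
  vl_bound (List.sum_nonneg (by simp)) (norm_of_mem_sum l)

theorem hd_pos {l : List E} (hl : l.length = Module.finrank ℝ E) (h : LinearIndependent ℝ l.get) : 0 < hd l := by
  have hne : l.length = Fintype.card (Fin (Module.finrank ℝ E)) := by simpa using hl
  let v : Fin (Module.finrank ℝ E) → E := fun i => l.get (Fin.cast hl.symm i)
  have hv : LinearIndependent ℝ v := h.comp _ (Fin.cast_injective _)
  rcases Nat.eq_zero_or_pos (Module.finrank ℝ E) with h0 | h0
  · have hp := vlr_pos (Module.finBasis ℝ E)
    have e1 : l = [] := List.length_eq_zero_iff.1 (by omega)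
    subst e1
    unfold hd
    haveI : IsEmpty (Fin (Module.finrank ℝ E)) := by rw [h0]; infer_instance
    rw [Finset.univ_eq_empty] at hp
    simpa using hp
  · haveI : Nonempty (Fin (Module.finrank ℝ E)) := ⟨⟨0, h0⟩⟩
    let b := basisOfLinearIndependentOfCardEqFinrank hv (by simp)
    have := vlr_pos b
    have e2 : l = List.ofFn v := by
      apply List.ext_get (by simp [hl])
      intro i h1 h2
      simp [v]
    have e3 : (l.map seg).sum = ∑ i, seg (b i) := by
      conv_lhs => rw [e2]
      rw [List.map_ofFn, List.sum_ofFn]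
      simp [b]
    unfold hd
    rwa [e3]

/-- partial Gaussian average -/
def gB (c : List E) (e : ℕ) (x y : E) : ℝ≥0∞ := ∫⁻ g : Fin e → E, ENNReal.ofReal (hd (x :: y :: (c ++ List.ofFn g))) ∂(gP (Fin e) E)

variable {c : List E} {e : ℕ}

theorem gB_symm (x y : E) : gB c e x y = gB c e y x := by
  unfold gB
  congr 1; funext g; rw [hd_perm (List.Perm.swap _ _ _)]

theorem gB_shear (hN : e + 2 + c.length = Module.finrank ℝ E) {x y w : E} (hw : w ∈ Submodule.span ℝ {a | a ∈ y :: c}) : gB c e (x + w) y = gB c e x y := by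
  unfold gB
  congr 1; funext g; congr 1
  refine hd_shear (by simp; omega) (Submodule.span_mono ?_ hw) x
  intro a ha
  rw [mem_ofPred_eq] at ha ⊢
  simp only [List.mem_cons, List.mem_append] at ha ⊢
  tauto

theorem gB_smul (hN : e + 2 + c.length = Module.finrank ℝ E) (x y : E) (a : ℝ) : gB c e (a • x) y = ENNReal.ofReal |a| * gB c e x y := by
  unfold gB
  rw [← lintegral_const_mul' _ _ (by simp)]
  congr 1; funext g
  rw [hd_smul (by simp; omega), ENNReal.ofReal_mul (abs_nonneg _)]

theorem hd_meas {X : Type*} [TopologicalSpace X] [MeasurableSpace X] [OpensMeasurableSpace X] (fs : List (X → E)) (h : ∀ f ∈ fs, Continuous f) :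
    Measurable (fun x => ENNReal.ofReal (hd (fs.map (fun f => f x)))) :=
  (hd_cont fs h).measurable.ennreal_ofReal

theorem gB_isom (f : E ≃ₗᵢ[ℝ] E) (hf : ∀ a ∈ c, f a = a) (x y : E) : gB c e (f x) (f y) = gB c e x y := by
  unfold gB
  conv_lhs => rw [← gP_isom (ι := Fin e) f]
  rw [lintegral_map]
  · congr 1; funext g; congr 1
    rw [← hd_isom f (x :: y :: (c ++ List.ofFn g))]
    congr 1
    simp only [List.map_cons, List.map_append, List.map_ofFn]
    rw [List.map_congr_left (g := id) (by simpa using hf)]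
    simp; rfl
  · have h := hd_meas (X := Fin e → E) (((f x) :: (f y) :: c).map (fun a (_ : Fin e → E) => a) ++ List.ofFn (fun i (g : Fin e → E) => g i)) (by
      intro F hF
      rw [List.mem_append] at hF
      rcases hF with hF | hF
      · obtain ⟨a, _, rfl⟩ := List.mem_map.1 hF; exact continuous_const
      · rw [List.mem_ofFn] at hF; obtain ⟨i, rfl⟩ := hF; exact continuous_apply i)
    convert! h using 4 with g
    simp [Function.comp_def, List.map_ofFn]
  · exact measurable_pi_lambda _ fun i => f.continuous.measurable.comp (measurable_pi_apply i)

theorem gB_const (U : Submodule ℝ E) (hU : U = Submodule.span ℝ {a | a ∈ c}) {x y x' y' : E} (hx : x ∈ Uᗮ) (hy : y ∈ Uᗮ) (hx' : x' ∈ Uᗮ) (hy' : y' ∈ Uᗮ)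
    (nx : ‖x‖ = 1) (ny : ‖y‖ = 1) (nx' : ‖x'‖ = 1) (ny' : ‖y'‖ = 1) (h : ⟪x, y⟫_ℝ = 0) (h' : ⟪x', y'⟫_ℝ = 0) :
    gB c e x y = gB c e x' y' := by
  have fixr : ∀ v w a : E, ⟪v - w, a⟫_ℝ = 0 → (Submodule.span ℝ {v - w})ᗮ.reflection a = a := by
    intro v w a ha
    apply Submodule.reflection_mem_subspace_eq_self
    rw [Submodule.mem_orthogonal_singleton_iff_inner_right]; exact ha
  have cU : ∀ a ∈ c, a ∈ U := fun a ha => by rw [hU]; exact Submodule.subset_span ha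
  have oU : ∀ v ∈ Uᗮ, ∀ a ∈ c, ⟪v, a⟫_ℝ = 0 := fun v hv a ha => Submodule.inner_left_of_mem_orthogonal (cU a ha) hv
  set R := (Submodule.span ℝ {x - x'})ᗮ.reflection with hR
  have r1 : R x = x' := Submodule.reflection_sub (by rw [nx, nx'])
  have r2 : ∀ a ∈ c, R a = a := fun a ha => fixr _ _ _ (by rw [inner_sub_left, oU x hx a ha, oU x' hx' a ha, sub_zero])
  rw [← gB_isom R r2, r1]
  set y1 := R y with hy1
  have i1 : ⟪x', y1⟫_ℝ = 0 := by rw [← r1, hy1, LinearIsometryEquiv.inner_map_map, h]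
  have i2 : ∀ a ∈ c, ⟪y1, a⟫_ℝ = 0 := fun a ha => by
    rw [← r2 a ha, hy1, LinearIsometryEquiv.inner_map_map, oU y hy a ha]
  have n1 : ‖y1‖ = 1 := by rw [hy1, LinearIsometryEquiv.norm_map, ny]
  set Q := (Submodule.span ℝ {y1 - y'})ᗮ.reflection with hQ
  have q1 : Q y1 = y' := Submodule.reflection_sub (by rw [n1, ny'])
  have q2 : ∀ a ∈ c, Q a = a := fun a ha => fixr _ _ _ (by rw [inner_sub_left, i2 a ha, oU y' hy' a ha, sub_zero])
  have q3 : Q x' = x' := fixr _ _ _ (by rw [inner_sub_left, real_inner_comm, i1, real_inner_comm, h', sub_zero])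
  rw [← gB_isom Q q2, q1, q3]
end Hd
end UV
end

noncomputable section
namespace UV
open Filter Topology
open scoped InnerProductSpace
open ProbabilityTheory

section Ratio
variable {E : Type*} [NormedAddCommGroup E] [InnerProductSpace ℝ E] [FiniteDimensional ℝ E] [MeasurableSpace E] [BorelSpace E]
variable {c : List E} {e : ℕ}

/-- mean norm -/
def gM (d : ℕ) : ℝ≥0∞ := ENNReal.ofReal (gJ ((d:ℝ) - 1 + 1) / gJ ((d:ℝ) - 1))

theorem gauss_one {F : Type*} [NormedAddCommGroup F] [InnerProductSpace ℝ F] [FiniteDimensional ℝ F] [MeasurableSpace F] [BorelSpace F] {d : ℕ} (hd : 1 ≤ d) (hF : Module.finrank ℝ F = d) :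
    ∫⁻ x, ENNReal.ofReal ‖x‖ ∂(stdGaussian F) = gM d := by
  subst hF
  have b := gauss_lint (E := F) 1
  rw [gauss_moment hd] at b
  simp only [pow_one] at b
  rw [b, gM]; simp

theorem gM_mul {d : ℕ} (hd : 1 ≤ d) : gM (d + 1) * gM d = d := by
  rw [← gauss_one (F := EuclideanSpace ℝ (Fin (d+1))) (by omega) (by simp), ← gauss_one (F := EuclideanSpace ℝ (Fin d)) (by omega) (by simp),
    gauss_one_mul (by simpa using hd) (by simp)]
  simp

theorem sub_proj_mem (U : Submodule ℝ E) (x : E) : x - (Uᗮ.orthogonalProjectionOnto x : E) ∈ U := by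
  have := Submodule.sub_starProjection_mem_orthogonal (K := Uᗮ) x
  rwa [Submodule.orthogonal_orthogonal] at this

/-- normalisation -/
theorem gB_unit (hN : e + 2 + c.length = Module.finrank ℝ E) (U : Submodule ℝ E) (hU : U = Submodule.span ℝ {a | a ∈ c}) {q : ℝ≥0∞}
    (hq : ∀ x ∈ Uᗮ, ∀ y ∈ Uᗮ, ‖x‖ = 1 → ‖y‖ = 1 → ⟪x, y⟫_ℝ = 0 → gB c e x y = q) {x y : E} (hx : x ∈ Uᗮ) (hy : y ∈ Uᗮ) (h : ⟪x, y⟫_ℝ = 0) :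
    gB c e x y = ENNReal.ofReal (‖x‖ * ‖y‖) * q := by
  have z0 : ∀ y, gB c e 0 y = 0 := fun y => by
    have := gB_smul hN 0 y 0
    simpa using this
  by_cases x0 : x = 0
  · subst x0; rw [z0]; simp
  by_cases y0 : y = 0
  · subst y0; rw [gB_symm, z0]; simp
  have nx := norm_pos_iff.2 x0
  have ny := norm_pos_iff.2 y0
  have ex : x = ‖x‖ • (‖x‖⁻¹ • x) := by rw [smul_smul, mul_inv_cancel₀ nx.ne', one_smul]
  have ey : y = ‖y‖ • (‖y‖⁻¹ • y) := by rw [smul_smul, mul_inv_cancel₀ ny.ne', one_smul]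
  conv_lhs => rw [ex, ey]
  rw [gB_smul hN, gB_symm, gB_smul hN, gB_symm, hq _ (Submodule.smul_mem _ _ hx) _ (Submodule.smul_mem _ _ hy), abs_norm, abs_norm, ← mul_assoc,
    ENNReal.ofReal_mul nx.le]
  · rw [norm_smul, norm_inv, norm_norm, inv_mul_cancel₀ nx.ne']
  · rw [norm_smul, norm_inv, norm_norm, inv_mul_cancel₀ ny.ne']
  · rw [inner_smul_left, inner_smul_right, h]; simp

theorem ratio (hN : e + 2 + c.length = Module.finrank ℝ E) (U : Submodule ℝ E) (hU : U = Submodule.span ℝ {a | a ∈ c})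
    (hfin : Module.finrank ℝ U = c.length) (J : E →ₗ[ℝ] E) (hJn : ∀ x, ‖J x‖ = ‖x‖) (hJo : ∀ x, ⟪x, J x⟫_ℝ = 0) (hJU : ∀ x ∈ U, J x ∈ U)
    (hJS : ∀ x ∈ Uᗮ, J x ∈ Uᗮ) :
    ((e + 1 : ℕ) : ℝ≥0∞) * ∫⁻ z, gB c e z (J z) ∂(stdGaussian E) = ((e + 2 : ℕ) : ℝ≥0∞) * ∫⁻ x, ∫⁻ y, gB c e x y ∂(stdGaussian E) ∂(stdGaussian E) := by
  have hS : Module.finrank ℝ Uᗮ = e + 2 := by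
    have := U.finrank_add_finrank_orthogonal
    omega
  obtain ⟨q, hq⟩ : ∃ q, ∀ x ∈ Uᗮ, ∀ y ∈ Uᗮ, ‖x‖ = 1 → ‖y‖ = 1 → ⟪x, y⟫_ℝ = 0 → gB c e x y = q := by
    by_cases h : ∃ x ∈ Uᗮ, ∃ y ∈ Uᗮ, ‖x‖ = 1 ∧ ‖y‖ = 1 ∧ ⟪x, y⟫_ℝ = 0
    · obtain ⟨x, hx, y, hy, nx, ny, o⟩ := h
      exact ⟨gB c e x y, fun x' hx' y' hy' nx' ny' o' => gB_const U hU hx' hy' hx hy nx' ny' nx ny o' o⟩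
    · push Not at h
      exact ⟨0, fun x hx y hy nx ny o => absurd o (h x hx y hy nx ny)⟩
  have shU : ∀ x y w, w ∈ U → gB c e (x + w) y = gB c e x y := by
    intro x y w hw
    refine gB_shear hN (Submodule.span_mono ?_ (hU ▸ hw))
    intro a ha; rw [mem_ofPred_eq] at ha ⊢; exact List.mem_cons_of_mem _ ha
  set P : E → E := fun x => (Uᗮ.orthogonalProjectionOnto x : E) with hP
  have PS : ∀ x, P x ∈ Uᗮ := fun x => Submodule.coe_mem _
  have Pd : ∀ x, x = P x + (x - P x) := fun x => by abel
  have PU : ∀ x, x - P x ∈ U := fun x => sub_proj_mem U x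
  have h1 : ∀ z, gB c e z (J z) = ENNReal.ofReal (‖Uᗮ.orthogonalProjectionOnto z‖ ^ 2) * q := by
    intro z
    have a1 : gB c e z (J z) = gB c e (P z) (J z) := by
      have := shU (P z) (J z) (z - P z) (PU z)
      rwa [← Pd z] at this
    have a2 : gB c e (P z) (J z) = gB c e (P z) (J (P z)) := by
      rw [gB_symm, gB_symm (P z)]
      have : J z = J (P z) + J (z - P z) := by rw [← map_add, ← Pd z]
      rw [this, shU _ _ _ (hJU _ (PU z))]
    rw [a1, a2, gB_unit hN U hU hq (PS z) (hJS _ (PS z)) (hJo _), hJn, ← pow_two]; rfl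
  have h2 : ∀ x, ∫⁻ y, gB c e x y ∂(stdGaussian E) = ENNReal.ofReal ‖Uᗮ.orthogonalProjectionOnto x‖ * (gM (e + 1) * q) := by
    intro x
    have a1 : ∀ y, gB c e x y = gB c e (P x) y := by
      intro y
      have := shU (P x) y (x - P x) (PU x)
      rwa [← Pd x] at this
    simp_rw [a1]
    by_cases x0 : P x = 0
    · have x1 : Uᗮ.orthogonalProjectionOnto x = 0 := Subtype.ext x0
      have z0 : ∀ y, gB c e 0 y = 0 := fun y => by
        have := gB_smul hN 0 y 0
        simpa using this
      simp [x0, x1, z0]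
    · set T : Submodule ℝ E := U ⊔ Submodule.span ℝ {P x} with hT
      have hTf : Module.finrank ℝ Tᗮ = e + 1 := by
        have b1 := T.finrank_add_finrank_orthogonal
        have b2 := Submodule.finrank_sup_add_finrank_inf_eq U (Submodule.span ℝ {P x})
        have b3 : U ⊓ Submodule.span ℝ {P x} = ⊥ := by
          rw [eq_bot_iff]
          have : Submodule.span ℝ {P x} ≤ Uᗮ := by
            rw [Submodule.span_singleton_le_iff_mem]; exact PS x
          exact (inf_le_inf_left U this).trans (Submodule.inf_orthogonal_eq_bot U).le
        rw [b3, finrank_bot, finrank_span_singleton x0, ← hT] at b2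
        omega
      have a2 : ∀ y, gB c e (P x) y = ENNReal.ofReal ‖Tᗮ.orthogonalProjectionOnto y‖ * (ENNReal.ofReal ‖Uᗮ.orthogonalProjectionOnto x‖ * q) := by
        intro y
        set y' : E := (Tᗮ.orthogonalProjectionOnto y : E) with hy'
        have c1 : gB c e (P x) y = gB c e (P x) y' := by
          rw [gB_symm, gB_symm (P x)]
          have := gB_shear (c := c) (e := e) hN (x := y') (y := P x) (w := y - y') (by
            have h := sub_proj_mem T y
            have : Submodule.span ℝ {a | a ∈ P x :: c} = T := by
              rw [hT, hU, ← Submodule.span_union]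
              congr 1; ext a
              rw [mem_union, mem_ofPred_eq, mem_ofPred_eq, List.mem_cons, mem_singleton_iff, or_comm]
            rw [this]; exact h)
          rwa [add_sub_cancel] at this
        have hy'T : y' ∈ Tᗮ := Submodule.coe_mem _
        have c2 : y' ∈ Uᗮ := Submodule.orthogonal_le le_sup_left hy'T
        have c3 : ⟪P x, y'⟫_ℝ = 0 := Submodule.inner_right_of_mem_orthogonal (Submodule.mem_sup_right (Submodule.mem_span_singleton_self _)) hy'T
        rw [c1, gB_unit hN U hU hq (PS x) c2 c3, mul_comm ‖P x‖, ENNReal.ofReal_mul (norm_nonneg _), mul_assoc]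
        rfl
      simp_rw [a2]
      rw [lintegral_mul_const _ (by fun_prop)]
      have := gauss_proj_lint Tᗮ 1
      simp only [pow_one] at this
      rw [this, gauss_one (by omega) hTf]
      ring
  simp_rw [h1, h2]
  rw [lintegral_mul_const _ (by fun_prop), lintegral_mul_const _ (by fun_prop)]
  have k1 := gauss_proj_lint Uᗮ 1
  simp only [pow_one] at k1
  rw [k1, gauss_proj_lint, gauss_sq (by omega), gauss_one (d := e + 2) (by omega) hS, hS, ← mul_assoc (gM (e+2)), gM_mul (d := e + 1) (by omega)]
  ring
end Ratio
end UV
end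

noncomputable section
namespace UV
open Filter Topology
open scoped InnerProductSpace
open ProbabilityTheory

section LintSucc
variable {E : Type*} [NormedAddCommGroup E] [InnerProductSpace ℝ E] [FiniteDimensional ℝ E] [MeasurableSpace E] [BorelSpace E]

theorem lint_succ' {i : ℕ} {f : (Fin (i+1) → E) → ℝ≥0∞} (hf : Measurable f) :
    ∫⁻ ω, f ω ∂(gP (Fin (i+1)) E) = ∫⁻ z, ∫⁻ u, f (Fin.cons z u) ∂(gP (Fin i) E) ∂(stdGaussian E) := by
  have h := (measurePreserving_piFinSuccAbove (fun _ : Fin (i+1) => stdGaussian E) 0).symm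
  rw [← h.lintegral_comp hf]
  exact (lintegral_prod _ (hf.comp h.measurable).aemeasurable).trans (by simp [gP, MeasurableEquiv.piFinSuccAbove]; rfl)

theorem lint_succ {i : ℕ} {f : (Fin (i+1) → E) → ℝ≥0∞} (hf : Measurable f) :
    ∫⁻ ω, f ω ∂(gP (Fin (i+1)) E) = ∫⁻ u, ∫⁻ z, f (Fin.cons z u) ∂(stdGaussian E) ∂(gP (Fin i) E) := by
  have h := (measurePreserving_piFinSuccAbove (fun _ : Fin (i+1) => stdGaussian E) 0).symm
  rw [← h.lintegral_comp hf]
  exact (lintegral_prod_symm _ (hf.comp h.measurable).aemeasurable).trans (by simp [gP, MeasurableEquiv.piFinSuccAbove]; rfl)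

theorem gP_pow_int {ι : Type*} [Fintype ι] (a : ℝ) (p : ℕ) : Integrable (fun ω : ι → E => (a + ∑ j, ‖ω j‖) ^ p) (gP ι E) := by
  have h1 : ∀ j : ι, MemLp (fun ω : ι → E => ‖ω j‖) (p : ℝ≥0∞) (gP ι E) := by
    intro j
    have h := (IsGaussian.memLp_id (stdGaussian E) (p : ℝ≥0∞) (by simp)).norm
    exact h.comp_measurePreserving (measurePreserving_eval (fun _ : ι => stdGaussian E) j)
  have h2 : MemLp (fun ω : ι → E => a + ∑ j, ‖ω j‖) (p : ℝ≥0∞) (gP ι E) :=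
    (memLp_const a).add (memLp_finset_sum _ fun j _ => h1 j)
  have h3 := h2.integrable_norm_pow'
  refine h3.mono' (by fun_prop : Continuous fun ω : ι → E => (a + ∑ j, ‖ω j‖) ^ p).aestronglyMeasurable (ae_of_all _ fun ω => ?_)
  simp
end LintSucc

attribute [local instance] InnerProductSpace.complexToReal

section CW
variable {W : Type*} [NormedAddCommGroup W] [InnerProductSpace ℂ W] [FiniteDimensional ℂ W] [MeasurableSpace W] [BorelSpace W]

theorem hd_cf_cont (i e : ℕ) : Continuous (fun p : (Fin i → W) × (Fin e → W) => hd (cf (List.ofFn p.1) (List.ofFn p.2))) := by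
  have := hd_cont (X := (Fin i → W) × (Fin e → W)) (List.ofFn (fun j p => p.1 j) ++ (List.ofFn (fun j p => Complex.I • p.1 j) ++ List.ofFn (fun j p => p.2 j))) (by
    intro f hf
    simp only [List.mem_append, List.mem_ofFn] at hf
    rcases hf with ⟨j, rfl⟩ | ⟨j, rfl⟩ | ⟨j, rfl⟩ <;> fun_prop)
  convert! this using 3 with p
  simp [cf, List.map_ofFn, Function.comp_def]

/-- the averages `W(i)` -/
def gW (W : Type*) [NormedAddCommGroup W] [InnerProductSpace ℂ W] [FiniteDimensional ℂ W] [MeasurableSpace W] [BorelSpace W] (i e : ℕ) : ℝ≥0∞ :=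
  ∫⁻ u : Fin i → W, ∫⁻ g : Fin e → W, ENNReal.ofReal (hd (cf (List.ofFn u) (List.ofFn g))) ∂(gP (Fin e) W) ∂(gP (Fin i) W)

theorem hd_cf_meas (i e : ℕ) : Measurable (fun p : (Fin i → W) × (Fin e → W) => ENNReal.ofReal (hd (cf (List.ofFn p.1) (List.ofFn p.2)))) :=
  (hd_cf_cont i e).measurable.ennreal_ofReal

theorem gW_left (i e : ℕ) : gW W (i + 1) e = ∫⁻ u : Fin i → W, ∫⁻ z, gB (cf (List.ofFn u) []) e z (Complex.I • z) ∂(stdGaussian W) ∂(gP (Fin i) W) := by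
  unfold gW
  rw [lint_succ ((hd_cf_meas (i+1) e).lintegral_prod_right')]
  congr 1; funext u; congr 1; funext z
  unfold gB
  congr 1; funext g; congr 1
  apply hd_perm
  rw [List.ofFn_cons]
  refine (cf_cons_left _ _ _).trans ?_
  simp [cf]

theorem gW_right (i e : ℕ) : gW W i (e + 2) = ∫⁻ u : Fin i → W, ∫⁻ x, ∫⁻ y, gB (cf (List.ofFn u) []) e x y ∂(stdGaussian W) ∂(stdGaussian W) ∂(gP (Fin i) W) := by
  unfold gW
  congr 1; funext u
  have hm : Measurable (fun g : Fin (e + 2) → W => ENNReal.ofReal (hd (cf (List.ofFn u) (List.ofFn g)))) :=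
    ((hd_cf_cont (W := W) i (e+2)).comp (Continuous.prodMk_right u)).measurable.ennreal_ofReal
  rw [lint_succ' hm]
  congr 1; funext x
  have hm2 : Measurable (fun g : Fin (e + 1) → W => ENNReal.ofReal (hd (cf (List.ofFn u) (List.ofFn (Fin.cons x g : Fin (e+2) → W))))) := by
    refine hm.comp (measurable_pi_lambda _ fun j => ?_)
    refine Fin.cases ?_ (fun j => ?_) j
    · exact measurable_const
    · exact measurable_pi_apply j
  rw [lint_succ' hm2]
  congr 1; funext y
  unfold gB
  congr 1; funext g; 
  show ENNReal.ofReal _ = _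
  congr 1
  apply hd_perm
  rw [List.ofFn_cons, List.ofFn_cons]
  refine (cf_cons_right _ _ _).trans ((cf_cons_right _ _ _).cons _ |>.trans ?_)
  simp [cf]

theorem gW_rec (i e : ℕ) (hN : e + 2 + 2 * i = Module.finrank ℝ W) : ((e + 1 : ℕ) : ℝ≥0∞) * gW W (i + 1) e = ((e + 2 : ℕ) : ℝ≥0∞) * gW W i (e + 2) := by
  rw [gW_left, gW_right, ← lintegral_const_mul' _ _ (by simp), ← lintegral_const_mul' _ _ (by simp)]
  congr 1; funext u
  set c := cf (List.ofFn u) [] with hc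
  have hcl : c.length = 2 * i := by rw [hc, cf_length]; simp
  by_cases hli : LinearIndependent ℝ c.get
  · have hr : {a | a ∈ c} = Set.range c.get := by rw [Set.range_list_get]
    have hf := linearIndependent_iff_card_eq_finrank_span.1 hli
    have hIc : ∀ a ∈ c, Complex.I • a ∈ Submodule.span ℝ {a | a ∈ c} := by
      intro a ha
      rw [hc, cf, List.append_nil, List.mem_append] at ha
      rcases ha with ha | ha
      · apply Submodule.subset_span
        rw [mem_ofPred_eq, hc, cf, List.append_nil, List.mem_append]
        exact Or.inr (List.mem_map.2 ⟨a, ha, rfl⟩)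
      · obtain ⟨b, hb, rfl⟩ := List.mem_map.1 ha
        rw [smul_smul, Complex.I_mul_I, neg_one_smul]
        apply Submodule.neg_mem
        apply Submodule.subset_span
        rw [mem_ofPred_eq, hc, cf, List.append_nil, List.mem_append]
        exact Or.inl hb
    have hIU : ∀ x ∈ Submodule.span ℝ {a | a ∈ c}, Complex.I • x ∈ Submodule.span ℝ {a | a ∈ c} := by
      intro x hx
      induction hx using Submodule.span_induction with
      | mem a ha => exact hIc a ha
      | zero => simp
      | add x y _ _ hx hy => rw [smul_add]; exact Submodule.add_mem _ hx hy
      | smul t x _ hx => rw [smul_comm]; exact Submodule.smul_mem _ _ hx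
    let J : W →ₗ[ℝ] W := { toFun := fun x => Complex.I • x, map_add' := smul_add _, map_smul' := fun t x => smul_comm _ _ _ }
    refine ratio (c := c) (e := e) (by omega) (Submodule.span ℝ {a | a ∈ c}) rfl ?_ J ?_ ?_ hIU ?_
    · rw [hr]; simpa [Set.finrank] using hf.symm
    · intro x; show ‖Complex.I • x‖ = _; rw [norm_smul]; simp
    · intro x
      show ⟪x, Complex.I • x⟫_ℝ = 0
      rw [real_inner_comm, rinner_I]; exact inner_self_im (𝕜 := ℂ) x
    · intro x hx
      show Complex.I • x ∈ _
      rw [Submodule.mem_orthogonal]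
      intro v hv
      have h1 := Submodule.inner_right_of_mem_orthogonal (hIU v hv) hx
      rw [rinner_I] at h1
      rw [rinner, inner_smul_right, Complex.mul_re, h1]; simp
  · have h0 : ∀ x y, gB c e x y = 0 := by
      intro x y
      unfold gB
      have : ∀ g : Fin e → W, hd (x :: y :: (c ++ List.ofFn g)) = 0 := by
        intro g
        apply hd_dep (by simp; omega)
        intro h
        apply hli
        have := h.comp (fun j : Fin c.length => (⟨j + 2, by simp; have := j.2; omega⟩ : Fin (x :: y :: (c ++ List.ofFn g)).length)) (by
          intro a b hab; simpa [Fin.ext_iff] using hab)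
        convert this using 1
        funext j
        simp
      simp [this]
    simp [h0]

theorem gW_zero (N : ℕ) : gW W 0 N = ∫⁻ g : Fin N → W, ENNReal.ofReal (hd (List.ofFn g)) ∂(gP (Fin N) W) := by
  unfold gW
  rw [show gP (Fin 0) W = Measure.dirac (fun a => isEmptyElim a) from Measure.pi_of_empty _ _]
  rw [lintegral_dirac]
  simp [cf]

theorem gW_pos : 0 < gW W 0 (Module.finrank ℝ W) := by
  rw [gW_zero, pos_iff_ne_zero]
  intro h
  have hc : Continuous (fun g : Fin (Module.finrank ℝ W) → W => hd (List.ofFn g)) := by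
    have := (hd_cf_cont (W := W) 0 (Module.finrank ℝ W)).comp (by fun_prop : Continuous (fun g : Fin (Module.finrank ℝ W) → W => ((fun a => isEmptyElim a : Fin 0 → W), g)))
    convert! this using 2
  rw [lintegral_eq_zero_iff hc.measurable.ennreal_ofReal] at h
  have h2 := (Continuous.ae_eq_iff_eq (gP (Fin (Module.finrank ℝ W)) W) (ENNReal.continuous_ofReal.comp hc) continuous_const).1 h
  have h3 := congrFun h2 (Module.finBasis ℝ W)
  have h4 : 0 < hd (List.ofFn (Module.finBasis ℝ W)) := by
    apply hd_pos (by simp)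
    have h5 := (Module.finBasis ℝ W).linearIndependent.comp (Fin.cast (List.length_ofFn (f := Module.finBasis ℝ W))) (Fin.cast_injective _)
    convert h5 using 1
    funext j; simp; rfl
  simp at h3
  linarith

theorem gW_fin (N : ℕ) : gW W 0 N ≠ ⊤ := by
  rw [gW_zero]
  have hi := (gP_pow_int (E := W) (ι := Fin N) 0 (Module.finrank ℝ W)).mul_const (vB W)
  refine ne_of_lt (lt_of_le_of_lt (lintegral_mono fun g => ENNReal.ofReal_le_ofReal (hd_bound _)) ?_)
  refine lt_of_le_of_lt (le_of_eq ?_) hi.lintegral_lt_top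
  congr 1; funext g
  simp [List.map_ofFn, List.sum_ofFn]

/-- `b_r` -/
def bb (r : ℕ) : ℝ := ∏ l ∈ Finset.range r, ((2 * l + 1 : ℝ) / (2 * l + 2))

theorem bb_pos (r : ℕ) : 0 < bb r := Finset.prod_pos fun l _ => by positivity

theorem gW_val (m : ℕ) (hm : Module.finrank ℝ W = 2 * m) : ∃ κ : ℝ, 0 < κ ∧ ∀ i, i ≤ m → (gW W i (2 * m - 2 * i)).toReal = κ * bb (m - i) := by
  have hp := gW_pos (W := W)
  have hf := gW_fin (W := W) (Module.finrank ℝ W)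
  rw [hm] at hp hf
  refine ⟨(gW W 0 (2 * m)).toReal / bb m, div_pos (ENNReal.toReal_pos hp.ne' hf) (bb_pos m), ?_⟩
  intro i
  induction i with
  | zero => intro _; have := bb_pos m; simp; field_simp
  | succ i ih =>
    intro hi
    have h := gW_rec (W := W) i (2 * m - 2 * (i + 1)) (by omega)
    have h2 := congrArg ENNReal.toReal h
    rw [ENNReal.toReal_mul, ENNReal.toReal_mul, show 2 * m - 2 * (i + 1) + 2 = 2 * m - 2 * i by omega, ih (by omega)] at h2
    obtain ⟨r, rfl⟩ : ∃ r, m = i + 1 + r := ⟨m - (i+1), by omega⟩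
    rw [show i + 1 + r - (i + 1) = r by omega]
    rw [show i + 1 + r - i = r + 1 by omega, show 2 * (i + 1 + r) - 2 * (i + 1) = 2 * r by omega, show 2 * (i + 1 + r) - 2 * i = 2 * r + 2 by omega] at h2
    rw [show 2 * (i + 1 + r) - 2 * (i + 1) = 2 * r by omega]
    rw [show bb (r + 1) = bb r * ((2 * r + 1 : ℝ) / (2 * r + 2)) from Finset.prod_range_succ _ _] at h2
    simp only [ENNReal.toReal_natCast] at h2
    push_cast at h2
    have h3 : (2 * (r:ℝ) + 1) ≠ 0 := by positivity
    apply mul_left_cancel₀ h3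
    rw [h2]
    field_simp
end CW
end UV
end

noncomputable section
namespace UV
open Filter Topology
open scoped InnerProductSpace ComplexConjugate
open ProbabilityTheory

section Tools
variable {V : Type*} [NormedAddCommGroup V] [NormedSpace ℝ V] {W : Type*} [NormedAddCommGroup W] [NormedSpace ℝ W]

theorem Dl_comp (f : V →L[ℝ] W) (μ : ConvexBody W → ℂ) (l : List V) (K : ConvexBody V) :
    Dl l (fun K => μ (cmap f K)) K = Dl (l.map f) μ (cmap f K) := by
  induction l generalizing K with
  | nil => rfl
  | cons v l ih =>
    rw [Dl_cons, List.map_cons, Dl_cons]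
    unfold Dv
    rw [ih, ih, cmap_add, cmap_seg]

theorem Dl_cont {X : Type*} [TopologicalSpace X] {μ : ConvexBody W → ℂ} (hμ : Continuous μ) (fs : List (X → W)) (h : ∀ f ∈ fs, Continuous f)
    {κ : X → ConvexBody W} (hκ : Continuous κ) : Continuous (fun x => Dl (fs.map (fun f => f x)) μ (κ x)) := by
  induction fs generalizing κ with
  | nil => exact hμ.comp hκ
  | cons f fs ih =>
    have ih' := fun {κ : X → ConvexBody W} (hκ : Continuous κ) => ih (fun g hg => h g (List.mem_cons_of_mem _ hg)) hκ
    exact (ih' (hκ.add (continuous_seg.comp (h f List.mem_cons_self)))).sub (ih' hκ)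

theorem Dl_int {Ω : Type*} [MeasurableSpace Ω] {P : Measure Ω} {F : Ω → ConvexBody V → ℂ} (hF : ∀ K, Integrable (fun ω => F ω K) P) (l : List V) (K : ConvexBody V) :
    Integrable (fun ω => Dl l (F ω) K) P ∧ Dl l (fun K => ∫ ω, F ω K ∂P) K = ∫ ω, Dl l (F ω) K ∂P := by
  induction l generalizing K with
  | nil => exact ⟨hF K, rfl⟩
  | cons v l ih =>
    refine ⟨(ih (K + seg v)).1.sub (ih K).1, ?_⟩
    rw [Dl_cons]
    unfold Dv
    rw [(ih (K + seg v)).2, (ih K).2, ← integral_sub (ih (K + seg v)).1 (ih K).1]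
    rfl
end Tools

section Bd
variable {E : Type*} [NormedAddCommGroup E] [InnerProductSpace ℝ E] [FiniteDimensional ℝ E] [MeasurableSpace E] [BorelSpace E]

theorem Dl_bound (l : List E) {R : ℝ} (hR : 0 ≤ R) (K : ConvexBody E) (h : ∀ x ∈ K, ‖x‖ ≤ R) :
    ‖Dl l vl K‖ ≤ 2 ^ l.length * ((R + (l.map (fun a => ‖a‖)).sum) ^ (Module.finrank ℝ E) * vB E) := by
  induction l generalizing K R with
  | nil =>
    have := vl_bound hR h
    rw [Dl_nil]
    unfold vl
    rw [Complex.norm_of_nonneg (vlr_nonneg K)]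
    simpa [vB] using this
  | cons v l ih =>
    rw [Dl_cons]
    unfold Dv
    have h1 := ih (R := R + ‖v‖) (by positivity) (K + seg v) (by
      intro x hx
      obtain ⟨y, hy, z, hz, rfl⟩ := mem_add.1 hx
      obtain ⟨t, ht, ht1, rfl⟩ := mem_seg.1 hz
      refine (norm_add_le _ _).trans (add_le_add (h y hy) ?_)
      rw [norm_smul, Real.norm_of_nonneg ht]
      exact mul_le_of_le_one_left (norm_nonneg _) ht1)
    have h2 := ih (R := R + ‖v‖) (by positivity) K (fun x hx => (h x hx).trans (by simp))
    refine (norm_sub_le _ _).trans ((add_le_add h1 h2).trans (le_of_eq ?_))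
    simp only [List.map_cons, List.sum_cons, List.length_cons, ← add_assoc]
    ring
end Bd

attribute [local instance] InnerProductSpace.complexToReal

section CW
variable {W : Type*} [NormedAddCommGroup W] [InnerProductSpace ℂ W] [FiniteDimensional ℂ W] [MeasurableSpace W] [BorelSpace W]
variable {n : ℕ}

/-- the real linear map `x ↦ ∑ x_j a_j` -/
def Am (a : Fin n → W) : Cn n →L[ℝ] W :=
  LinearMap.toContinuousLinearMap (LinearMap.restrictScalars ℝ (∑ j, (LinearMap.toSpanSingleton ℂ W (a j)) ∘ₗ (EuclideanSpace.projₗ j : Cn n →ₗ[ℂ] ℂ)))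

theorem Am_apply (a : Fin n → W) (x : Cn n) : Am a x = ∑ j, x j • a j := by
  simp [Am]

theorem Am_norm (a : Fin n → W) (x : Cn n) : ‖Am a x‖ ≤ ‖x‖ * ∑ j, ‖a j‖ := by
  rw [Am_apply, Finset.mul_sum]
  refine (norm_sum_le _ _).trans (Finset.sum_le_sum fun j _ => ?_)
  rw [norm_smul]
  exact mul_le_mul_of_nonneg_right (PiLp.norm_apply_le x j) (norm_nonneg _)

theorem cmap_Am_cont (K : ConvexBody (Cn n)) : Continuous (fun a : Fin n → W => cmap (Am a) K) := by
  obtain ⟨C, hC0, hC⟩ : ∃ C, 0 ≤ C ∧ ∀ x ∈ K, ‖x‖ ≤ C := by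
    obtain ⟨C, hC⟩ := K.isCompact.isBounded.exists_norm_le
    obtain ⟨x, hx⟩ := K.nonempty
    exact ⟨C, (norm_nonneg _).trans (hC x hx), hC⟩
  have key : ∀ a b : Fin n → W, ∀ x ∈ K, dist (Am a x) (Am b x) ≤ C * ∑ j, ‖a j - b j‖ := by
    intro a b x hx
    have : Am a x - Am b x = Am (a - b) x := by
      simp only [Am_apply, Pi.sub_apply, smul_sub, Finset.sum_sub_distrib]
    rw [dist_eq_norm, this]
    exact (Am_norm _ _).trans (mul_le_mul_of_nonneg_right (hC x hx) (by positivity))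
  rw [continuous_iff_continuousAt]
  intro b
  rw [ContinuousAt, tendsto_iff_dist_tendsto_zero]
  have hl : Tendsto (fun a : Fin n → W => C * ∑ j, ‖a j - b j‖) (𝓝 b) (𝓝 0) := by
    have : Continuous (fun a : Fin n → W => C * ∑ j, ‖a j - b j‖) := by fun_prop
    convert this.tendsto b using 2
    simp
  refine squeeze_zero (fun _ => dist_nonneg) (fun a => ?_) hl
  refine dist_le_of (by positivity) ?_ ?_
  · intro y hy
    obtain ⟨x, hx, rfl⟩ := mem_cmap.1 hy
    exact ⟨_, mem_cmap.2 ⟨x, hx, rfl⟩, key a b x hx⟩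
  · intro y hy
    obtain ⟨x, hx, rfl⟩ := mem_cmap.1 hy
    refine ⟨_, mem_cmap.2 ⟨x, hx, rfl⟩, ?_⟩
    rw [dist_comm]; exact key a b x hx

/-- unitary mixing preserves the Gaussian measure -/
theorem gP_unitary {ι : Type*} [Fintype ι] [DecidableEq ι] (M : Matrix ι ι ℂ) (hM : M ∈ Matrix.unitaryGroup ι ℂ) :
    (gP ι W).map (fun ω j => ∑ i, M i j • ω i) = gP ι W := by
  let T : (ι → W) →L[ℝ] (ι → W) := LinearMap.toContinuousLinearMap
    { toFun := fun ω j => ∑ i, M i j • ω i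
      map_add' := fun x y => by funext j; simp [smul_add, Finset.sum_add_distrib]
      map_smul' := fun t x => by funext j; simp [Finset.smul_sum, smul_comm (t : ℝ)] }
  have hT : (fun (ω : ι → W) j => ∑ i, M i j • ω i) = T := rfl
  rw [hT]
  apply Measure.ext_of_charFunDual
  ext L
  rw [charFunDual_map, charFunDual_pi, charFunDual_pi]
  simp only [charFunDual_stdGaussian]
  rw [← Complex.exp_sum, ← Complex.exp_sum]
  congr 1
  rw [← Finset.sum_div, ← Finset.sum_div, Finset.sum_neg_distrib, Finset.sum_neg_distrib]
  congr 2
  set a : ι → W := fun j => (InnerProductSpace.toDual ℝ W).symm (L.comp (ContinuousLinearMap.single ℝ (fun _ => W) j)) with ha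
  have hLa : ∀ j w, L (Pi.single j w) = ⟪a j, w⟫_ℝ := by
    intro j w
    rw [ha]; simp
  have h1 : ∀ i, ‖(L.comp T).comp (ContinuousLinearMap.single ℝ (fun _ => W) i)‖ = ‖∑ j, conj (M i j) • a j‖ := by
    intro i
    rw [← (InnerProductSpace.toDual ℝ W).norm_map]
    congr 1
    ext w
    have e : T (Pi.single i w) = ∑ j, Pi.single j (M i j • w) := by
      funext j
      show ∑ i', M i' j • (Pi.single i w : ι → W) i' = _
      rw [Finset.sum_apply, Finset.sum_eq_single i, Finset.sum_eq_single j] <;> simp +contextual [Pi.single_apply, eq_comm]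
    show L (T (Pi.single i w)) = ⟪_, w⟫_ℝ
    rw [e, map_sum, sum_inner]
    refine Finset.sum_congr rfl fun j _ => ?_
    rw [hLa, rinner, rinner, inner_smul_left, inner_smul_right]; simp
  have h2 : ∀ i, ‖L.comp (ContinuousLinearMap.single ℝ (fun _ => W) i)‖ = ‖a i‖ := by
    intro i; rw [ha]; simp
  simp only [h1, h2]
  have key : ∑ i, ((‖∑ j, conj (M i j) • a j‖ : ℂ)) ^ 2 = ∑ i, (‖a i‖ : ℂ) ^ 2 := by
    have e1 : ∀ x : W, (‖x‖ : ℂ) ^ 2 = ⟪x, x⟫_ℂ := fun x => (inner_self_eq_norm_sq_to_K x).symm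
    simp only [e1, sum_inner, inner_sum, inner_smul_left, inner_smul_right, Complex.conj_conj]
    rw [Finset.sum_comm]
    refine Finset.sum_congr rfl fun j _ => ?_
    simp only [Finset.mul_sum]
    rw [Finset.sum_comm]
    have hU : ∀ j', ∑ i, conj (M i j) * M i j' = if j = j' then 1 else 0 := by
      intro j'
      have := congrFun (congrFun (Matrix.mem_unitaryGroup_iff'.1 hM) j) j'
      simpa [Matrix.mul_apply, Matrix.star_apply, Matrix.one_apply] using this
    rw [Finset.sum_eq_single j]
    · have := hU j
      rw [if_pos rfl] at this
      calc _ = (∑ i, conj (M i j) * M i j) * ⟪a j, a j⟫_ℂ := by rw [Finset.sum_mul]; exact Finset.sum_congr rfl fun i _ => by ring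
        _ = _ := by rw [this, one_mul]
    · intro j' _ hj
      have := hU j'
      rw [if_neg (Ne.symm hj)] at this
      calc _ = (∑ i, conj (M i j) * M i j') * ⟪a j', a j⟫_ℂ := by rw [Finset.sum_mul]; exact Finset.sum_congr rfl fun i _ => by ring
        _ = _ := by rw [this, zero_mul]
    · simp
  exact key
end CW
end UV
end

noncomputable section
namespace UV
open Filter Topology
open scoped InnerProductSpace ComplexConjugate
open ProbabilityTheory
attribute [local instance] InnerProductSpace.complexToReal

section CW
variable {W : Type*} [NormedAddCommGroup W] [InnerProductSpace ℂ W] [FiniteDimensional ℂ W] [MeasurableSpace W] [BorelSpace W]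
variable {n r : ℕ}

/-- the random valuation -/
def muF (ω : Fin n ⊕ Fin r → W) (K : ConvexBody (Cn n)) : ℂ :=
  Dl (List.ofFn (fun j => ω (Sum.inr j))) vl (cmap (Am (fun j => ω (Sum.inl j))) K)

theorem muF_cont (K : ConvexBody (Cn n)) : Continuous (fun ω : Fin n ⊕ Fin r → W => muF ω K) := by
  have := Dl_cont (X := Fin n ⊕ Fin r → W) (μ := vl) (vl_isVal (E := W)).cont (List.ofFn (fun j ω => ω (Sum.inr j))) (by
    intro f hf
    obtain ⟨j, rfl⟩ := List.mem_ofFn.1 hf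
    fun_prop) (κ := fun ω => cmap (Am (fun j => ω (Sum.inl j))) K) ((cmap_Am_cont K).comp (by fun_prop : Continuous (fun (ω : Fin n ⊕ Fin r → W) j => ω (Sum.inl j))))
  convert! this using 3
  simp [muF, List.map_ofFn, Function.comp_def]

theorem muF_bound {K : ConvexBody (Cn n)} {R : ℝ} (hR : 0 ≤ R) (h : ∀ x ∈ K, ‖x‖ ≤ R) (ω : Fin n ⊕ Fin r → W) :
    ‖muF ω K‖ ≤ (0 + ∑ i, ‖ω i‖) ^ (Module.finrank ℝ W) * (2 ^ r * ((1 + R) ^ (Module.finrank ℝ W) * vB W)) := by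
  have h1 := Dl_bound (List.ofFn (fun j => ω (Sum.inr j))) (R := R * ∑ j, ‖ω (Sum.inl j)‖) (by positivity) (cmap (Am (fun j => ω (Sum.inl j))) K) (by
    intro y hy
    obtain ⟨x, hx, rfl⟩ := mem_cmap.1 hy
    exact (Am_norm _ _).trans (mul_le_mul_of_nonneg_right (h x hx) (by positivity)))
  refine h1.trans ?_
  rw [List.length_ofFn, List.map_ofFn, List.sum_ofFn]
  have h2 : (R * ∑ j, ‖ω (Sum.inl j)‖ + ∑ j, ((fun a => ‖a‖) ∘ fun j => ω (Sum.inr j)) j) ≤ (1 + R) * (0 + ∑ i, ‖ω i‖) := by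
    rw [Fintype.sum_sum_type]
    simp only [Function.comp]
    have a1 : 0 ≤ ∑ j, ‖ω (Sum.inl j)‖ := by positivity
    have a2 : 0 ≤ ∑ j, ‖ω (Sum.inr j)‖ := by positivity
    nlinarith [mul_nonneg hR a2]
  have h3 := pow_le_pow_left₀ (by simp only [Function.comp]; positivity) h2 (Module.finrank ℝ W)
  rw [mul_pow] at h3
  have h4 := mul_le_mul_of_nonneg_left (mul_le_mul_of_nonneg_right h3 (vB_nonneg (E := W))) (show (0:ℝ) ≤ 2 ^ r by positivity)
  refine h4.trans (le_of_eq (by ring))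

theorem muF_int (K : ConvexBody (Cn n)) : Integrable (fun ω : Fin n ⊕ Fin r → W => muF ω K) (gP (Fin n ⊕ Fin r) W) := by
  obtain ⟨R, hR, h⟩ : ∃ C, 0 ≤ C ∧ ∀ x ∈ K, ‖x‖ ≤ C := by
    obtain ⟨C, hC⟩ := K.isCompact.isBounded.exists_norm_le
    obtain ⟨x, hx⟩ := K.nonempty
    exact ⟨C, (norm_nonneg _).trans (hC x hx), hC⟩
  exact Integrable.mono' ((gP_pow_int (E := W) 0 _).mul_const _) (muF_cont K).aestronglyMeasurable (ae_of_all _ fun ω => muF_bound hR h ω)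

theorem muF_isVal (ω : Fin n ⊕ Fin r → W) : IsVal (muF ω) :=
  ((vl_isVal (E := W)).Dl (List.ofFn (fun j => ω (Sum.inr j)))).comp_cmap (Am (fun j => ω (Sum.inl j)))

/-- the averaged valuation -/
def mu (n r : ℕ) (W : Type*) [NormedAddCommGroup W] [InnerProductSpace ℂ W] [FiniteDimensional ℂ W] [MeasurableSpace W] [BorelSpace W] (K : ConvexBody (Cn n)) : ℂ :=
  ∫ ω : Fin n ⊕ Fin r → W, muF ω K ∂(gP (Fin n ⊕ Fin r) W)

theorem mu_isVal : IsVal (mu n r W) where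
  val := by
    intro K L M N hM hN
    unfold mu
    rw [← integral_add (muF_int M) (muF_int N), ← integral_add (muF_int K) (muF_int L)]
    congr 1; funext ω
    exact (muF_isVal ω).val K L M N hM hN
  trans := by
    intro x K
    unfold mu
    congr 1; funext ω
    exact (muF_isVal ω).trans x K
  cont := by
    rw [continuous_iff_continuousAt]
    intro K₀
    obtain ⟨R, hR, h⟩ : ∃ C, 0 ≤ C ∧ ∀ x ∈ K₀, ‖x‖ ≤ C := by
      obtain ⟨C, hC⟩ := K₀.isCompact.isBounded.exists_norm_le
      obtain ⟨x, hx⟩ := K₀.nonempty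
      exact ⟨C, (norm_nonneg _).trans (hC x hx), hC⟩
    refine continuousAt_of_dominated (F := fun K (ω : Fin n ⊕ Fin r → W) => muF ω K) (bound := fun ω => (0 + ∑ i, ‖ω i‖) ^ (Module.finrank ℝ W) * (2 ^ r * ((1 + (R + 1)) ^ (Module.finrank ℝ W) * vB W))) 
      (Eventually.of_forall fun K => (muF_cont K).aestronglyMeasurable) ?_ ((gP_pow_int (E := W) 0 _).mul_const _) (ae_of_all _ fun ω => (muF_isVal ω).cont.continuousAt)
    filter_upwards [Metric.ball_mem_nhds K₀ one_pos] with K hK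
    refine ae_of_all _ fun ω => muF_bound (by positivity) ?_ ω
    intro x hx
    obtain ⟨y, hy, hxy⟩ := exists_dist_le K K₀ hx
    have h1 : dist x y < 1 := lt_of_le_of_lt hxy (Metric.mem_ball.1 hK)
    rw [dist_eq_norm] at h1
    have h2 := norm_le_norm_add_norm_sub' x y
    have h3 := h y hy
    linarith

theorem mu_isHom {k : ℕ} (hk : k + r = Module.finrank ℝ W) : IsHom k (mu n r W) := by
  intro t ht K
  unfold mu
  rw [← integral_const_mul]
  congr 1; funext ω
  have h1 : IsHom k (Dl (List.ofFn (fun j => ω (Sum.inr j))) (vl (E := W))) := IsHom.Dl vl_isVal _ vl_isHom (by simpa using hk)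
  have h2 := h1.comp_cmap (Am (fun j => ω (Sum.inl j)))
  exact h2 t ht K

theorem mu_unitary (g : Matrix (Fin n) (Fin n) ℂ) (hg : g ∈ Matrix.unitaryGroup (Fin n) ℂ) (K L : ConvexBody (Cn n)) (hL : (L : Set (Cn n)) = (uAct g) '' (K : Set (Cn n))) :
    mu n r W L = mu n r W K := by
  let M : Matrix (Fin n ⊕ Fin r) (Fin n ⊕ Fin r) ℂ := Matrix.fromBlocks g 0 0 1
  have hM : M ∈ Matrix.unitaryGroup (Fin n ⊕ Fin r) ℂ := by
    rw [Matrix.mem_unitaryGroup_iff] at hg ⊢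
    rw [Matrix.star_eq_conjTranspose] at hg ⊢
    simp [M, Matrix.fromBlocks_conjTranspose, Matrix.fromBlocks_multiply, hg]
  unfold mu
  conv_rhs => rw [← gP_unitary M hM]
  have hcm : Continuous (fun (ω : Fin n ⊕ Fin r → W) j => ∑ i, M i j • ω i) :=
    continuous_pi fun j => continuous_finset_sum _ fun i _ => (continuous_apply i).const_smul (M i j)
  rw [integral_map hcm.aemeasurable (muF_cont K).aestronglyMeasurable]
  congr 1; funext ω
  unfold muF
  have e1 : (fun j : Fin r => ∑ i, M i (Sum.inr j) • ω i) = fun j => ω (Sum.inr j) := by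
    funext j
    rw [Fintype.sum_sum_type]
    simp [M, Matrix.one_apply]
  have e2 : cmap (Am (fun j : Fin n => ∑ i, M i (Sum.inl j) • ω i)) K = cmap (Am (fun j : Fin n => ω (Sum.inl j))) L := by
    apply ConvexBody.ext
    rw [coe_cmap, coe_cmap, hL, image_image]
    congr 1; funext x
    rw [Am_apply, Am_apply]
    simp only [Fintype.sum_sum_type]
    simp only [M, Matrix.fromBlocks_apply₁₁, Matrix.fromBlocks_apply₂₁, Matrix.zero_apply, zero_smul, Finset.sum_const_zero, add_zero, Finset.smul_sum, smul_smul]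
    rw [Finset.sum_comm]
    refine Finset.sum_congr rfl fun i _ => ?_
    rw [← Finset.sum_smul]
    congr 1
    simp [uAct, Matrix.toEuclideanLin, Matrix.toLpLin, Matrix.mulVec, dotProduct, mul_comm]
  rw [e1, e2]

theorem mu_mem {k : ℕ} (hk : k + r = Module.finrank ℝ W) : MemValUnk n k (mu n r W) :=
  ⟨mu_isVal.val, mu_isVal.cont, (isTranslationInvariantC_iff _).2 mu_isVal.trans, (isHomogeneousValC_iff _ _).2 (mu_isHom hk), mu_unitary⟩

theorem sel_inj {i e : ℕ} (σ : Fin i → Fin n) (τ : Fin e → Fin n) (hinj : Function.Injective (Sum.elim σ τ)) :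
    Function.Injective (Sum.elim (fun j => Sum.inl (σ j)) (Fin.append (fun j => Sum.inl (τ j)) Sum.inr) : Fin i ⊕ Fin (e + r) → Fin n ⊕ Fin r) := by
  have h1 : Function.Injective σ := fun x y h => Sum.inl_injective (hinj (a₁ := Sum.inl x) (a₂ := Sum.inl y) h)
  have h2 : Function.Injective τ := fun x y h => Sum.inr_injective (hinj (a₁ := Sum.inr x) (a₂ := Sum.inr y) h)
  have h3 : ∀ x y, σ x ≠ τ y := fun x y h => Sum.inl_ne_inr (hinj (a₁ := Sum.inl x) (a₂ := Sum.inr y) h)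
  rintro (x | x) (y | y)
  · intro h; rw [h1 (Sum.inl_injective h)]
  · refine Fin.addCases (fun y => ?_) (fun y => ?_) y <;> intro hxy <;> simp at hxy
    exact absurd hxy (h3 _ _)
  · refine Fin.addCases (fun x => ?_) (fun x => ?_) x <;> intro hxy <;> simp at hxy
    exact absurd hxy.symm (h3 _ _)
  · refine Fin.addCases (fun x => ?_) (fun x => ?_) x <;> refine Fin.addCases (fun y => ?_) (fun y => ?_) y <;> intro hxy <;> simp at hxy
    · rw [h2 hxy]
    · rw [hxy]

theorem hd_cf_cont2 (i e : ℕ) : Continuous (fun ω' : Fin i ⊕ Fin e → W => hd (cf (List.ofFn fun j => ω' (Sum.inl j)) (List.ofFn fun j => ω' (Sum.inr j)))) := by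
  have h0 : Continuous (fun ω' : Fin i ⊕ Fin e → W => fun j : Fin i => ω' (Sum.inl j)) := by fun_prop
  have h1 : Continuous (fun ω' : Fin i ⊕ Fin e → W => fun j : Fin e => ω' (Sum.inr j)) := by fun_prop
  have h2 := (hd_cf_cont (W := W) i e).comp (h0.prodMk h1)
  simp only [Function.comp_def] at h2
  exact h2

theorem gW_sum (i e : ℕ) : ∫ ω' : Fin i ⊕ Fin e → W, hd (cf (List.ofFn fun j => ω' (Sum.inl j)) (List.ofFn fun j => ω' (Sum.inr j))) ∂(gP (Fin i ⊕ Fin e) W) = (gW W i e).toReal := by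
  have hc : Continuous (fun ω' : Fin i ⊕ Fin e → W => hd (cf (List.ofFn fun j => ω' (Sum.inl j)) (List.ofFn fun j => ω' (Sum.inr j)))) := hd_cf_cont2 i e
  rw [integral_eq_lintegral_of_nonneg_ae (ae_of_all _ fun ω => hd_nonneg _) hc.aestronglyMeasurable]
  congr 1
  have hp := (measurePreserving_sumPiEquivProdPi (fun _ : Fin i ⊕ Fin e => stdGaussian W)).lintegral_comp (hd_cf_meas (W := W) i e)
  refine Eq.trans ?_ (hp.trans (lintegral_prod _ (hd_cf_meas (W := W) i e).aemeasurable))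
  rfl

theorem muF_eval {k i e : ℕ} (hk : k + r = Module.finrank ℝ W) (he : 2 * i + e = k) (σ : Fin i → Fin n) (τ : Fin e → Fin n) (ω : Fin n ⊕ Fin r → W) :
    Dl (cf (List.ofFn fun j => (EuclideanSpace.single (σ j) 1 : Cn n)) (List.ofFn fun j => (EuclideanSpace.single (τ j) 1 : Cn n))) (muF ω) 0 =
      (hd (cf (List.ofFn fun j => ω (Sum.inl (σ j))) (List.ofFn (Fin.append (fun j => ω (Sum.inl (τ j))) (fun j => ω (Sum.inr j))))) : ℂ) := by
  have hA : ∀ (a : Fin n → W) j, Am a (EuclideanSpace.single j 1) = a j := by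
    intro a j; rw [Am_apply, Finset.sum_eq_single j] <;> simp +contextual [Pi.single_apply]
  have hAI : ∀ (a : Fin n → W) j, Am a (Complex.I • EuclideanSpace.single j 1) = Complex.I • a j := by
    intro a j; rw [Am_apply, Finset.sum_eq_single j] <;> simp +contextual [Pi.single_apply]
  have e0 : muF ω = fun K => Dl (List.ofFn (fun j => ω (Sum.inr j))) vl (cmap (Am (fun j => ω (Sum.inl j))) K) := rfl
  rw [e0, Dl_comp, cmap_zero, ← Dl_append]
  have e1 : List.map (Am (fun j => ω (Sum.inl j))) (cf (List.ofFn fun j => (EuclideanSpace.single (σ j) 1 : Cn n)) (List.ofFn fun j => (EuclideanSpace.single (τ j) 1 : Cn n))) ++ (List.ofFn (fun j => ω (Sum.inr j)))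
      = cf (List.ofFn fun j => ω (Sum.inl (σ j))) (List.ofFn (Fin.append (fun j => ω (Sum.inl (τ j))) (fun j => ω (Sum.inr j)))) := by
    rw [List.ofFn_fin_append]
    simp only [cf, List.map_append, List.map_ofFn, Function.comp_def, hA, hAI, List.append_assoc]
  rw [e1, Dl_vl]
  rw [cf_length]; simp; omega

/-- evaluation on configurations -/
theorem mu_eval {k i e : ℕ} (hk : k + r = Module.finrank ℝ W) (he : 2 * i + e = k) (σ : Fin i → Fin n) (τ : Fin e → Fin n)
    (hinj : Function.Injective (Sum.elim σ τ)) :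
    Dl (cf (List.ofFn fun j => (EuclideanSpace.single (σ j) 1 : Cn n)) (List.ofFn fun j => (EuclideanSpace.single (τ j) 1 : Cn n))) (mu n r W) 0 =
      ((gW W i (e + r)).toReal : ℂ) := by
  rw [show mu n r W = fun K => ∫ ω : Fin n ⊕ Fin r → W, muF ω K ∂(gP (Fin n ⊕ Fin r) W) from rfl, (Dl_int muF_int _ _).2]
  simp only [muF_eval hk he]
  rw [integral_complex_ofReal, ← gW_sum, ← gP_sel _ (sel_inj (r := r) σ τ hinj)]
  congr 1
  have hc : Continuous (fun ω' : Fin i ⊕ Fin (e + r) → W => hd (cf (List.ofFn fun j => ω' (Sum.inl j)) (List.ofFn fun j => ω' (Sum.inr j)))) := hd_cf_cont2 i (e + r)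
  have hme : ∀ s : Fin i ⊕ Fin (e + r) → Fin n ⊕ Fin r, Measurable (fun ω : Fin n ⊕ Fin r → W => ω ∘ s) :=
    fun s => measurable_pi_lambda _ fun j => measurable_pi_apply _
  rw [integral_map (hme _).aemeasurable hc.aestronglyMeasurable]
  congr 1; funext ω; congr 3
  funext j
  refine Fin.addCases (fun j => ?_) (fun j => ?_) j <;> simp
end CW
end UV
end

noncomputable section
namespace UV
open Filter Topology
open scoped InnerProductSpace ComplexConjugate

section Exist
attribute [local instance] InnerProductSpace.complexToReal

theorem exists_phi' (n k m : ℕ) (W : Type*) [NormedAddCommGroup W] [InnerProductSpace ℂ W] [FiniteDimensional ℂ W] [MeasurableSpace W] [BorelSpace W]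
    (hk : k ≤ 2 * m) (hm : Module.finrank ℂ W = m) : ∃ φ : ConvexBody (Cn n) → ℂ, MemValUnk n k φ ∧ ∃ κ : ℝ, 0 < κ ∧ ∀ (i e : ℕ) (σ : Fin i → Fin n) (τ : Fin e → Fin n),
      2 * i + e = k → Function.Injective (Sum.elim σ τ) →
      Dl (cf (List.ofFn fun j => (EuclideanSpace.single (σ j) 1 : Cn n)) (List.ofFn fun j => (EuclideanSpace.single (τ j) 1 : Cn n))) φ 0 = ((κ * bb (m - i) : ℝ) : ℂ) := by
  have hW : Module.finrank ℝ W = 2 * m := by rw [← hm]; exact finrank_real_of_complex W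
  obtain ⟨κ, hκ, H⟩ := gW_val (W := W) m hW
  refine ⟨mu n (2 * m - k) W, mu_mem (by omega), κ, hκ, ?_⟩
  intro i e σ τ he hinj
  rw [mu_eval (by omega : k + (2 * m - k) = Module.finrank ℝ W) he σ τ hinj, show e + (2 * m - k) = 2 * m - 2 * i by omega, H i (by omega)]

theorem exists_phi (n k m : ℕ) (hk : k ≤ 2 * m) : ∃ φ : ConvexBody (Cn n) → ℂ, MemValUnk n k φ ∧ ∃ κ : ℝ, 0 < κ ∧ ∀ (i e : ℕ) (σ : Fin i → Fin n) (τ : Fin e → Fin n),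
      2 * i + e = k → Function.Injective (Sum.elim σ τ) →
      Dl (cf (List.ofFn fun j => (EuclideanSpace.single (σ j) 1 : Cn n)) (List.ofFn fun j => (EuclideanSpace.single (τ j) 1 : Cn n))) φ 0 = ((κ * bb (m - i) : ℝ) : ℂ) :=
  exists_phi' n k m (Cn m) hk (by simp)
end Exist

section Upper
variable {n k : ℕ}

theorem inv_isom {μ : ConvexBody (Cn n) → ℂ} (h : IsUnitaryInvariant μ) (g : Cn n ≃ₗᵢ[ℂ] Cn n) (K : ConvexBody (Cn n)) : μ (cmap (rl g) K) = μ K := by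
  let M : Matrix (Fin n) (Fin n) ℂ := Matrix.of fun i j => g (EuclideanSpace.single j 1) i
  have hM : M ∈ Matrix.unitaryGroup (Fin n) ℂ := by
    rw [Matrix.mem_unitaryGroup_iff']
    ext i j
    have h1 : ⟪g (EuclideanSpace.single i 1), g (EuclideanSpace.single j 1)⟫_ℂ = ⟪(EuclideanSpace.single i 1 : Cn n), EuclideanSpace.single j 1⟫_ℂ := g.inner_map_map _ _
    rw [PiLp.inner_apply] at h1
    rw [Matrix.mul_apply, Matrix.one_apply]
    simp only [Matrix.star_apply, M, Matrix.of_apply]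
    simp [EuclideanSpace.inner_single_left] at h1
    rw [← h1]
    exact Finset.sum_congr rfl fun l _ => mul_comm _ _
  have hact : uAct M = (g.toLinearEquiv : Cn n →ₗ[ℂ] Cn n) := by
    refine (EuclideanSpace.basisFun (Fin n) ℂ).toBasis.ext fun j => ?_
    ext i
    simp [uAct, Matrix.toEuclideanLin, Matrix.toLpLin, M]
  refine h M hM K _ ?_
  rw [coe_cmap, hact]
  rfl

/-- values on configurations only depend on the lengths -/
theorem T_zero {μ : ConvexBody (Cn n) → ℂ} (h : MemValUnk n k μ)
    (H : ∀ (i e : ℕ) (hie : i + e ≤ n), 2 * i + e = k →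
      Dl (cf (List.ofFn fun j : Fin i => (EuclideanSpace.single (⟨j, by omega⟩ : Fin n) 1 : Cn n)) (List.ofFn fun j : Fin e => (EuclideanSpace.single (⟨i + j, by omega⟩ : Fin n) 1 : Cn n))) μ 0 = 0)
    (K : ConvexBody (Cn n)) : μ K = 0 := by
  obtain ⟨h1, h2, h3, h4, h5⟩ := h
  have hv : IsVal μ := ⟨h1, h2, (isTranslationInvariantC_iff _).1 h3⟩
  refine upper hv ((isHomogeneousValC_iff _ _).1 h4) (inv_isom h5) ?_ K
  intro zs rs hon hlen
  set l := zs ++ rs with hl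
  have hll : l.length = zs.length + rs.length := by simp [hl]
  have horth : Orthonormal ℂ l.get := by
    refine ⟨fun j => hon.1 _ (List.get_mem l j), ?_⟩
    intro a b hab
    rcases lt_or_gt_of_ne hab with hlt | hlt
    · exact List.pairwise_iff_get.1 hon.2 a b hlt
    · rw [← inner_conj_symm]
      have := List.pairwise_iff_get.1 hon.2 b a hlt
      rw [this]; simp
  have hn : l.length ≤ n := by
    have := horth.linearIndependent.fintype_card_le_finrank
    simpa using this
  let v : Fin n → Cn n := fun j => if h : (j : ℕ) < l.length then l.get ⟨j, h⟩ else 0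
  let s : Set (Fin n) := {j | (j : ℕ) < l.length}
  have hvs : Orthonormal ℂ (s.domRestrict v) := by
    have e : s.domRestrict v = l.get ∘ (fun j : s => (⟨(j : Fin n), j.2⟩ : Fin l.length)) := by
      funext j
      have : ((j : Fin n) : ℕ) < l.length := j.2
      simp [v, this]
    rw [e]
    refine horth.comp _ ?_
    intro a b hab
    apply Subtype.ext; apply Fin.ext
    simpa using hab
  obtain ⟨B, hB⟩ := hvs.exists_orthonormalBasis_extension_of_card_eq (by simp)
  let g : Cn n ≃ₗᵢ[ℂ] Cn n := (EuclideanSpace.basisFun (Fin n) ℂ).equiv B (Equiv.refl _)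
  have hg : ∀ (j : ℕ) (hj : j < n) (hj' : j < l.length), g (EuclideanSpace.single (⟨j, hj⟩ : Fin n) 1) = l[j] := by
    intro j hj hj'
    have e1 : g (EuclideanSpace.basisFun (Fin n) ℂ ⟨j, hj⟩) = B ⟨j, hj⟩ := OrthonormalBasis.equiv_apply_basis _ _ _ _
    rw [EuclideanSpace.basisFun_apply] at e1
    rw [e1, hB ⟨j, hj⟩ hj']
    simp [v, hj']
  have hzs : zs = (List.ofFn fun j : Fin zs.length => (EuclideanSpace.single (⟨j, by omega⟩ : Fin n) 1 : Cn n)).map (rl g) := by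
    apply List.ext_get (by simp)
    intro j a b
    simp only [List.get_eq_getElem, List.getElem_map, List.getElem_ofFn, rl_apply]
    rw [hg j _ (by omega)]
    simp [hl, List.getElem_append_left a]
  have hrs : rs = (List.ofFn fun j : Fin rs.length => (EuclideanSpace.single (⟨zs.length + j, by omega⟩ : Fin n) 1 : Cn n)).map (rl g) := by
    apply List.ext_get (by simp)
    intro j a b
    simp only [List.get_eq_getElem, List.getElem_map, List.getElem_ofFn, rl_apply]
    rw [hg _ _ (by omega)]
    simp [hl]
  have hcf : cf zs rs = (cf (List.ofFn fun j : Fin zs.length => (EuclideanSpace.single (⟨j, by omega⟩ : Fin n) 1 : Cn n)) (List.ofFn fun j : Fin rs.length => (EuclideanSpace.single (⟨zs.length + j, by omega⟩ : Fin n) 1 : Cn n))).map (rl g) := by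
    have hmap : ∀ a b : List (Cn n), cf (a.map (rl g)) (b.map (rl g)) = (cf a b).map (rl g) := by
      intro a b
      simp only [cf, List.map_append, List.map_map, Function.comp_def, rl_apply, map_smul]
    exact (congrArg₂ cf hzs hrs).trans (hmap _ _)
  have hD := Dl_comp (rl g) μ (cf (List.ofFn fun j : Fin zs.length => (EuclideanSpace.single (⟨j, by omega⟩ : Fin n) 1 : Cn n)) (List.ofFn fun j : Fin rs.length => (EuclideanSpace.single (⟨zs.length + j, by omega⟩ : Fin n) 1 : Cn n))) 0
  rw [cmap_zero, ← hcf] at hD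
  rw [← hD, show (fun K => μ (cmap (rl g) K)) = μ from funext (inv_isom h5 g)]
  exact H zs.length rs.length (by omega) hlen
end Upper

section Hankel

theorem bb_int (r : ℕ) : ∫ x in (0:ℝ)..Real.pi, Real.sin x ^ (2 * r) = Real.pi * bb r := integral_sin_pow_even r

theorem hankel {p : ℕ} (δ : ℕ) (c : Fin p → ℝ) (h : ∀ s : Fin p, ∑ t : Fin p, bb (δ + t + s) * c t = 0) : c = 0 := by
  let f : ℝ → ℝ := fun x => Real.sin x ^ (2 * δ) * (∑ t : Fin p, c t * Real.sin x ^ (2 * (t : ℕ))) ^ 2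
  have hf : Continuous f := by fun_prop
  have hIntegr : ∫ x in (0:ℝ)..Real.pi, f x = 0 := by
    have e : f = fun x => ∑ s : Fin p, ∑ t : Fin p, c s * c t * Real.sin x ^ (2 * (δ + t + s)) := by
      funext x
      simp only [f]
      rw [sq, Finset.sum_mul_sum, Finset.mul_sum]
      refine Finset.sum_congr rfl fun s _ => ?_
      rw [Finset.mul_sum]
      refine Finset.sum_congr rfl fun t _ => ?_
      ring
    rw [e, intervalIntegral.integral_finset_sum]
    · apply Finset.sum_eq_zero
      intro s _
      rw [intervalIntegral.integral_finset_sum]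
      · simp only [intervalIntegral.integral_const_mul, bb_int]
        calc _ = Real.pi * c s * ∑ t : Fin p, bb (δ + t + s) * c t := by
              rw [Finset.mul_sum]; exact Finset.sum_congr rfl fun t _ => by ring
          _ = 0 := by rw [h s, mul_zero]
      · intro t _; exact (by fun_prop : Continuous fun x : ℝ => c s * c t * Real.sin x ^ (2 * (δ + t + s))).intervalIntegrable _ _
    · intro s _; exact (by fun_prop : Continuous fun x : ℝ => ∑ t : Fin p, c s * c t * Real.sin x ^ (2 * (δ + t + s))).intervalIntegrable _ _
  have hnn : ∀ x, 0 ≤ f x := fun x => by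
    simp only [f, pow_mul]; positivity
  have hz : ∀ x ∈ Ioo (0:ℝ) Real.pi, f x = 0 := by
    intro x hx
    by_contra hne
    have : 0 < ∫ x in (0:ℝ)..Real.pi, f x :=
      intervalIntegral.integral_pos Real.pi_pos hf.continuousOn (fun y _ => hnn y) ⟨x, ⟨hx.1.le, hx.2.le⟩, lt_of_le_of_ne (hnn x) (Ne.symm hne)⟩
    linarith
  let q : Polynomial ℝ := ∑ t : Fin p, Polynomial.monomial (t : ℕ) (c t)
  have hq : ∀ y ∈ Ioo (0:ℝ) 1, q.eval y = 0 := by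
    intro y hy
    have hs : Real.sin (Real.arcsin (Real.sqrt y)) = Real.sqrt y := Real.sin_arcsin (by linarith [Real.sqrt_nonneg y]) (Real.sqrt_le_one.2 hy.2.le)
    have h0 : 0 < Real.arcsin (Real.sqrt y) := Real.arcsin_pos.2 (Real.sqrt_pos.2 hy.1)
    have h1 := hz _ ⟨h0, by have := Real.arcsin_le_pi_div_two (Real.sqrt y); linarith [Real.pi_pos]⟩
    simp only [f, hs, pow_mul, Real.sq_sqrt hy.1.le] at h1
    have h2 : y ^ δ ≠ 0 := pow_ne_zero _ hy.1.ne'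
    have h3 := pow_eq_zero_iff (two_ne_zero) |>.1 ((mul_eq_zero.1 h1).resolve_left h2)
    simpa [q, Polynomial.eval_finset_sum, Polynomial.eval_monomial] using h3
  have hq0 : q = 0 := Polynomial.eq_zero_of_infinite_isRoot q ((Ioo_infinite (show (0:ℝ) < 1 by norm_num)).mono hq)
  funext t
  have := congrArg (fun q => Polynomial.coeff q (t : ℕ)) hq0
  simp only [q, Polynomial.finset_sum_coeff, Polynomial.coeff_monomial, Polynomial.coeff_zero] at this
  rw [Finset.sum_eq_single t] at this
  · simpa using this
  · intro b _ hb; rw [if_neg]; intro hh; exact hb (Fin.ext hh)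
  · simp
end Hankel
end UV
end

noncomputable section
namespace UV
open Filter Topology
section Final
variable {n k : ℕ}

theorem Dl_lin {V : Type*} [NormedAddCommGroup V] [NormedSpace ℝ V] {ι : Type*} (s : Finset ι) (μ : ConvexBody V → ℂ) (φ : ι → ConvexBody V → ℂ) (c : ι → ℂ)
    (l : List V) : ∀ K, Dl l (fun K => μ K - ∑ i ∈ s, c i * φ i K) K = Dl l μ K - ∑ i ∈ s, c i * Dl l (φ i) K := by
  induction l with
  | nil => intro K; rfl
  | cons v l ih =>
    intro K
    simp only [Dl_cons, Dv, ih, mul_sub, Finset.sum_sub_distrib]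
    ring

theorem mem_lin {ι : Type*} (s : Finset ι) {μ : ConvexBody (Cn n) → ℂ} {φ : ι → ConvexBody (Cn n) → ℂ} (c : ι → ℂ)
    (hμ : MemValUnk n k μ) (hφ : ∀ i, MemValUnk n k (φ i)) : MemValUnk n k (fun K => μ K - ∑ i ∈ s, c i * φ i K) := by
  refine ⟨?_, ?_, ?_, ?_, ?_⟩
  · intro K L M N h1 h2
    have a := hμ.1 K L M N h1 h2
    have b : ∑ i ∈ s, c i * φ i M + ∑ i ∈ s, c i * φ i N = ∑ i ∈ s, c i * φ i K + ∑ i ∈ s, c i * φ i L := by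
      rw [← Finset.sum_add_distrib, ← Finset.sum_add_distrib]
      refine Finset.sum_congr rfl fun i _ => ?_
      rw [← mul_add, ← mul_add, (hφ i).1 K L M N h1 h2]
    simp only
    linear_combination a - b
  · exact hμ.2.1.sub (continuous_finset_sum _ fun i _ => continuous_const.mul (hφ i).2.1)
  · intro x K L h
    simp only
    rw [hμ.2.2.1 x K L h]
    congr 1
    exact Finset.sum_congr rfl fun i _ => by rw [(hφ i).2.2.1 x K L h]
  · intro t ht K L h
    simp only
    rw [hμ.2.2.2.1 t ht K L h, mul_sub, Finset.mul_sum]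
    congr 1
    refine Finset.sum_congr rfl fun i _ => ?_
    rw [(hφ i).2.2.2.1 t ht K L h]; ring
  · intro g hg K L h
    simp only
    rw [hμ.2.2.2.2 g hg K L h]
    congr 1
    exact Finset.sum_congr rfl fun i _ => by rw [(hφ i).2.2.2.2 g hg K L h]

theorem hankelC {p : ℕ} (δ : ℕ) (κ : Fin p → ℝ) (hκ : ∀ t, 0 < κ t) (c : Fin p → ℂ)
    (h : ∀ s : Fin p, ∑ t : Fin p, ((κ t * bb (δ + t + s) : ℝ) : ℂ) * c t = 0) : c = 0 := by
  have hre := hankel δ (fun t => κ t * (c t).re) (fun s => by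
    have := congrArg Complex.re (h s)
    rw [Complex.re_sum] at this
    simp only [Complex.re_ofReal_mul, Complex.zero_re] at this
    rw [← this]
    exact Finset.sum_congr rfl fun t _ => by ring)
  have him := hankel δ (fun t => κ t * (c t).im) (fun s => by
    have := congrArg Complex.im (h s)
    rw [Complex.im_sum] at this
    simp only [Complex.im_ofReal_mul, Complex.zero_im] at this
    rw [← this]
    exact Finset.sum_congr rfl fun t _ => by ring)
  funext t
  have h1 := congrFun hre t
  have h2 := congrFun him t
  simp only [Pi.zero_apply, mul_eq_zero, (hκ t).ne', false_or] at h1 h2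
  exact Complex.ext h1 h2

theorem main (n k : ℕ) (hk : k ≤ 2 * n) :
    ∃ φ : Fin (min (k / 2) ((2 * n - k) / 2) + 1) → (ConvexBody (Cn n) → ℂ),
      (∀ i, MemValUnk n k (φ i)) ∧
      ∀ μ : ConvexBody (Cn n) → ℂ, MemValUnk n k μ →
        ∃! c : Fin (min (k / 2) ((2 * n - k) / 2) + 1) → ℂ,
          ∀ K : ConvexBody (Cn n), μ K = ∑ i, c i * φ i K := by
  set p := min (k / 2) ((2 * n - k) / 2) with hp
  choose φ hφ κ hκ hT using fun t : Fin (p + 1) => exists_phi n k (k - k / 2 + t) (by omega)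
  refine ⟨φ, hφ, ?_⟩
  let L : (i e : ℕ) → i + e ≤ n → List (Cn n) := fun i e hie =>
    cf (List.ofFn fun j : Fin i => (EuclideanSpace.single (⟨j, by omega⟩ : Fin n) 1 : Cn n)) (List.ofFn fun j : Fin e => (EuclideanSpace.single (⟨i + j, by omega⟩ : Fin n) 1 : Cn n))
  have hL : ∀ (i e : ℕ) (hie : i + e ≤ n), 2 * i + e = k → ∀ t, Dl (L i e hie) (φ t) 0 = ((κ t * bb (k - k / 2 + t - i) : ℝ) : ℂ) := by
    intro i e hie hik t
    refine hT t i e (fun j => ⟨j, by omega⟩) (fun j => ⟨i + j, by omega⟩) hik ?_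
    rintro (a | a) (b | b) hab
    all_goals
      simp only [Sum.elim_inl, Sum.elim_inr, Fin.mk.injEq] at hab
    · rw [Fin.ext hab]
    · omega
    · omega
    · rw [Fin.ext (by omega : (a : ℕ) = b)]
  have hs : ∀ s : Fin (p + 1), (k / 2 - s) + (k - 2 * (k / 2 - s)) ≤ n := fun s => by omega
  let T : (ConvexBody (Cn n) → ℂ) → Fin (p + 1) → ℂ := fun μ s => Dl (L _ _ (hs s)) μ 0
  let A : (Fin (p + 1) → ℂ) →ₗ[ℂ] (Fin (p + 1) → ℂ) :=
    (Matrix.of fun s t : Fin (p + 1) => ((κ t * bb (k - 2 * (k / 2) + t + s) : ℝ) : ℂ)).mulVecLin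
  have hA : ∀ c s, A c s = ∑ t, ((κ t * bb (k - 2 * (k / 2) + t + s) : ℝ) : ℂ) * c t := fun c s => rfl
  have hinj : Function.Injective A := by
    rw [← LinearMap.ker_eq_bot, LinearMap.ker_eq_bot']
    intro c hc
    refine hankelC (k - 2 * (k / 2)) κ hκ c fun s => ?_
    rw [← hA, hc]; rfl
  have hsurj : Function.Surjective A := LinearMap.injective_iff_surjective.1 hinj
  have hTs : ∀ s t, T (φ t) s = ((κ t * bb (k - 2 * (k / 2) + t + s) : ℝ) : ℂ) := by
    intro s t
    have := hL _ _ (hs s) (by omega) t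
    rw [show k - k / 2 + (t : ℕ) - (k / 2 - s) = k - 2 * (k / 2) + t + s by omega] at this
    exact this
  have hTlin : ∀ μ c s, T (fun K => μ K - ∑ i, c i * φ i K) s = T μ s - A c s := by
    intro μ c s
    simp only [T]
    rw [Dl_lin, hA]
    congr 1
    refine Finset.sum_congr rfl fun t _ => ?_
    rw [← hTs s t, mul_comm]
  intro μ hμ
  obtain ⟨c, hc⟩ := hsurj (T μ)
  refine ⟨c, ?_, ?_⟩
  · intro K
    have hmem := mem_lin Finset.univ c hμ hφ
    have := T_zero hmem (fun i e hie hik => by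
      have hsi : k / 2 - i < p + 1 := by omega
      have h0 := hTlin μ c ⟨k / 2 - i, hsi⟩
      rw [hc, sub_self] at h0
      simp only [T] at h0
      have key : ∀ (i' e' : ℕ) (h' : i' + e' ≤ n), i' = i → e' = e → L i' e' h' = L i e hie := by
        rintro i' e' h' rfl rfl; rfl
      rw [key (k / 2 - (k / 2 - i)) (k - 2 * (k / 2 - (k / 2 - i))) (by omega) (by omega) (by omega)] at h0
      exact h0) K
    exact sub_eq_zero.1 this
  · intro c' hc'
    apply hinj
    rw [hc]
    funext s
    have h0 := hTlin μ c' s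
    have hz' : T (fun K => μ K - ∑ i, c' i * φ i K) s = 0 := by
      have e : (fun K => μ K - ∑ i, c' i * φ i K) = fun K => μ K - ∑ i ∈ (Finset.univ : Finset (Fin 1)), (1 : ℂ) * μ K := by
        funext K; rw [← hc' K]; simp
      rw [e]
      simp only [T]
      rw [Dl_lin Finset.univ μ (fun _ => μ) (fun _ => 1)]
      simp
    rw [hz'] at h0
    exact (sub_eq_zero.1 h0.symm).symm
end Final
end UV
end

/-- `dim Val_k^{U(n)} = min(⌊k/2⌋, ⌊(2n-k)/2⌋) + 1`: there is a basis of this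
cardinality. -/
theorem statement16 (n k : ℕ) (hn : 1 ≤ n) (hk : k ≤ 2 * n) :
    ∃ φ : Fin (min (k / 2) ((2 * n - k) / 2) + 1) → (ConvexBody (Cn n) → ℂ),
      (∀ i, MemValUnk n k (φ i)) ∧
      ∀ μ : ConvexBody (Cn n) → ℂ, MemValUnk n k μ →
        ∃! c : Fin (min (k / 2) ((2 * n - k) / 2) + 1) → ℂ,
          ∀ K : ConvexBody (Cn n), μ K = ∑ i, c i * φ i K := by
  exact UV.main n k hk

end
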